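/- Let g ≥ 2 and n ≥ 3, and let a, b ∈ Γ_g be two elements with ab ≠ ba. Then there exists a representation ρ ∈ HIT_n such that the subgroup of SL_n(ℝ) generated by ρ(a) and ρ(b) is Zariski-dense in SL_n(ℝ). -/

import Mathlib

open Matrix MvPolynomial
open scoped commutatorElement

/-- `SL n K`: the special linear group of `n × n` matrices over `K`. -/
abbrev SL (n : ℕ) (K : Type) [CommRing K] := Matrix.SpecialLinearGroup (Fin n) K

/-- Topology on `SL n ℝ` induced from the space of matrices (the Euclidean topology). -/
instance (n : ℕ) (K : Type) [CommRing K] [TopologicalSpace K] :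
    TopologicalSpace (SL n K) :=
  TopologicalSpace.induced (fun A => (A : Matrix (Fin n) (Fin n) K)) inferInstance

/-- The relator `[a₁,b₁][a₂,b₂]⋯[a_g,b_g]` of the genus-`g` surface group;
`(i, false)` is the generator `aᵢ` and `(i, true)` is `bᵢ`. -/
def surfaceRelator (g : ℕ) : FreeGroup (Fin g × Bool) :=
  (List.ofFn fun i : Fin g =>
    ⁅FreeGroup.of (i, false), FreeGroup.of (i, true)⁆).prod

/-- The surface group `Γ_g` of genus `g`. -/
abbrev SurfaceGroup (g : ℕ) : Type :=
  PresentedGroup ({surfaceRelator g} : Set (FreeGroup (Fin g × Bool)))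

/-- The tuple `(ρ(a₁), ρ(b₁), …, ρ(a_g), ρ(b_g))` of matrices associated to a
representation `ρ : Γ_g → SL n ℝ`. -/
def repTuple {g n : ℕ} (ρ : SurfaceGroup g →* SL n ℝ) :
    (Fin g × Bool) → Matrix (Fin n) (Fin n) ℝ :=
  fun x => (ρ (PresentedGroup.of x) : Matrix (Fin n) (Fin n) ℝ)

/-- `Hom(Γ_g, SL_n(K))` as a subset of `K^{2g·n²}`: the `2g`-tuples of matrices of
determinant one whose product of commutators is the identity. -/
def RepVariety (g n : ℕ) (K : Type) [CommRing K] :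
    Set ((Fin g × Bool) → Matrix (Fin n) (Fin n) K) :=
  {A | (∀ x, (A x).det = 1) ∧
    (List.ofFn fun i : Fin g =>
      A (i, false) * A (i, true) * (A (i, false))⁻¹ * (A (i, true))⁻¹).prod = 1}

/-- `ρ₀ : Γ_g → SL₂(ℝ)` is discrete and faithful: injective with discrete image. -/
def IsDiscreteFaithful {g : ℕ} (ρ₀ : SurfaceGroup g →* SL 2 ℝ) : Prop :=
  Function.Injective ρ₀ ∧ DiscreteTopology (ρ₀.range : Subgroup (SL 2 ℝ))

/-- `j : SL₂(ℝ) → SL_n(ℝ)` is a continuous homomorphism acting irreducibly on `ℝⁿ`. -/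
def IsIrreducibleEmbedding (n : ℕ) (j : SL 2 ℝ →* SL n ℝ) : Prop :=
  Continuous j ∧
  ∀ W : Submodule ℝ (Fin n → ℝ),
    (∀ A : SL 2 ℝ, ∀ v ∈ W, (j A : Matrix (Fin n) (Fin n) ℝ).mulVec v ∈ W) →
    W = ⊥ ∨ W = ⊤

/-- A tuple in `ℝ^{2g·n²}` is a Teichmüller representation if it comes from `j ∘ ρ₀` with
`ρ₀` discrete and faithful and `j` continuous and irreducible. -/
def IsTeichmuller (g n : ℕ) (T : (Fin g × Bool) → Matrix (Fin n) (Fin n) ℝ) : Prop :=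
  ∃ (ρ₀ : SurfaceGroup g →* SL 2 ℝ) (j : SL 2 ℝ →* SL n ℝ),
    IsDiscreteFaithful ρ₀ ∧ IsIrreducibleEmbedding n j ∧
    T = repTuple (j.comp ρ₀)

/-- The Hitchin component: the connected component (Euclidean topology) of
`Hom(Γ_g, SL_n(ℝ))` containing the Teichmüller representation `T`. -/
def HIT (g n : ℕ) (T : (Fin g × Bool) → Matrix (Fin n) (Fin n) ℝ) :
    Set ((Fin g × Bool) → Matrix (Fin n) (Fin n) ℝ) :=
  connectedComponentIn (RepVariety g n ℝ) T

/-- A subgroup `H ≤ SL_n(ℝ)` is Zariski-dense in `SL_n(ℝ)`. -/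
def IsZariskiDense (n : ℕ) (H : Subgroup (SL n ℝ)) : Prop :=
  ∀ P : MvPolynomial (Fin n × Fin n) ℝ,
    (∀ h ∈ H, eval (fun p => (h : Matrix (Fin n) (Fin n) ℝ) p.1 p.2) P = 0) →
    ∀ A : SL n ℝ, eval (fun p => (A : Matrix (Fin n) (Fin n) ℝ) p.1 p.2) P = 0

/-- A subgroup `Γ ≤ SL_n(ℝ)` is strongly dense: every pair of noncommuting elements
generates a Zariski-dense subgroup. -/
def IsStronglyDense (n : ℕ) (Γ : Subgroup (SL n ℝ)) : Prop :=
  ∀ x ∈ Γ, ∀ y ∈ Γ, x * y ≠ y * x → IsZariskiDense n (Subgroup.closure {x, y})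

/-! ### A free subgroup of `SL₂(ℤ)` -/

def stdX : SL 2 ℤ := ⟨!![1, 1; 1, 2], by norm_num [Matrix.det_fin_two]⟩
def stdY : SL 2 ℤ := ⟨!![1, -1; -1, 2], by norm_num [Matrix.det_fin_two]⟩
def stdGen (b : Bool) : SL 2 ℤ := if b then stdY else stdX
def std : FreeGroup Bool →* SL 2 ℤ := FreeGroup.lift stdGen

abbrev NzVec := {p : Fin 2 → ℤ // p ≠ 0}

instance nzVecAction : MulAction (SL 2 ℤ) NzVec where
  smul A p := ⟨(A : Matrix (Fin 2) (Fin 2) ℤ) *ᵥ p.1, by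
    intro h
    apply p.2
    have := congrArg (fun v => ((A⁻¹ : SL 2 ℤ) : Matrix (Fin 2) (Fin 2) ℤ) *ᵥ v) h
    simp only [Matrix.mulVec_mulVec, ← Matrix.SpecialLinearGroup.coe_mul] at this
    rw [inv_mul_cancel, Matrix.SpecialLinearGroup.coe_one, Matrix.one_mulVec,
      Matrix.mulVec_zero] at this
    exact this⟩
  one_smul p := by
    apply Subtype.ext
    change ((1 : SL 2 ℤ) : Matrix (Fin 2) (Fin 2) ℤ) *ᵥ p.1 = p.1
    simp
  mul_smul A B p := by
    apply Subtype.ext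
    change ((A * B : SL 2 ℤ) : Matrix (Fin 2) (Fin 2) ℤ) *ᵥ p.1 = A.1 *ᵥ (B.1 *ᵥ p.1)
    rw [Matrix.mulVec_mulVec, Matrix.SpecialLinearGroup.coe_mul]

theorem nz_smul_val (A : SL 2 ℤ) (p : NzVec) : (A • p).1 = A.1 *ᵥ p.1 := rfl

def ppX (b : Bool) : Set NzVec :=
  if b then {p | p.1 0 * p.1 1 < 0 ∧ p.1 0 ^ 2 ≤ p.1 1 ^ 2}
  else {p | 0 ≤ p.1 0 * p.1 1 ∧ p.1 0 ^ 2 < p.1 1 ^ 2}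
def ppY (b : Bool) : Set NzVec :=
  if b then {p | 0 < p.1 0 * p.1 1 ∧ p.1 1 ^ 2 ≤ p.1 0 ^ 2}
  else {p | p.1 0 * p.1 1 ≤ 0 ∧ p.1 1 ^ 2 < p.1 0 ^ 2}

theorem nz_ne (p : NzVec) : p.1 0 ≠ 0 ∨ p.1 1 ≠ 0 := by
  by_contra h
  push Not at h
  apply p.2
  ext i; fin_cases i <;> simp [h]

theorem pp_aux0 (u v : ℤ) (hh : u ^ 2 ≤ v ^ 2) : -v ^ 2 ≤ u * v ∧ u * v ≤ v ^ 2 := by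
  constructor <;> nlinarith [sq_nonneg (u + v), sq_nonneg (u - v)]

theorem pp_aux0' (u v : ℤ) (hh : u ^ 2 < v ^ 2) : -v ^ 2 < u * v ∧ u * v < v ^ 2 := by
  constructor <;> nlinarith [sq_nonneg (u + v), sq_nonneg (u - v)]

theorem pp_aux00 (u v : ℤ) (h : u ≠ 0 ∨ v ≠ 0) (hh : u ^ 2 ≤ v ^ 2) : 0 < v ^ 2 := by
  have hv : v ≠ 0 := by
    rintro rfl
    have : u = 0 := by nlinarith
    simp_all
  positivity

theorem pp_pos (u v : ℤ) (h : u ≠ 0 ∨ v ≠ 0) : 0 < u ^ 2 + v ^ 2 := by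
  rcases h with h | h
  · have : 0 < u ^ 2 := by positivity
    nlinarith [sq_nonneg v]
  · have : 0 < v ^ 2 := by positivity
    nlinarith [sq_nonneg u]

theorem pp_prod (u v : ℤ) (hh : u ^ 2 ≤ v ^ 2) :
    0 ≤ (u + v) * (u + 2 * v) ∧ 0 ≤ (u - v) * (u - 2 * v) := by
  rcases abs_le.1 (sq_le_sq.1 hh) with ⟨h1, h2⟩
  rcases le_total 0 v with hv | hv
  · rw [abs_of_nonneg hv] at h1 h2
    constructor <;> nlinarith
  · rw [abs_of_nonpos hv] at h1 h2
    constructor <;> nlinarith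

theorem pp_prod' (u v : ℤ) (hh : u ^ 2 < v ^ 2) :
    0 < (u + v) * (u + 2 * v) ∧ 0 < (u - v) * (u - 2 * v) := by
  rcases abs_lt.1 (sq_lt_sq.1 hh) with ⟨h1, h2⟩
  rcases le_total 0 v with hv | hv
  · rw [abs_of_nonneg hv] at h1 h2
    constructor <;> nlinarith
  · rw [abs_of_nonpos hv] at h1 h2
    constructor <;> nlinarith

theorem pp_aux1 (u v : ℤ) (h : u ≠ 0 ∨ v ≠ 0) (hh : ¬ (u * v ≤ 0 ∧ v ^ 2 < u ^ 2)) :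
    0 ≤ (u + v) * (u + 2 * v) ∧ (u + v) ^ 2 < (u + 2 * v) ^ 2 := by
  have := pp_pos u v h
  rw [not_and_or, not_le, not_lt] at hh
  rcases hh with hh | hh
  · constructor <;> nlinarith [sq_nonneg u, sq_nonneg v]
  · exact ⟨(pp_prod u v hh).1, by nlinarith [pp_aux0 u v hh, pp_aux00 u v h hh]⟩

theorem pp_aux2 (u v : ℤ) (h : u ≠ 0 ∨ v ≠ 0) (hh : ¬ (0 < u * v ∧ v ^ 2 ≤ u ^ 2)) :
    (u - v) * (-u + 2 * v) < 0 ∧ (u - v) ^ 2 ≤ (-u + 2 * v) ^ 2 := by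
  have := pp_pos u v h
  rw [not_and_or, not_le, not_lt] at hh
  rcases hh with hh | hh
  · constructor <;> nlinarith [sq_nonneg u, sq_nonneg v]
  · exact ⟨by nlinarith [(pp_prod' u v hh).2], by nlinarith [pp_aux0' u v hh]⟩

theorem stdX_val : (stdX : Matrix (Fin 2) (Fin 2) ℤ) = !![1, 1; 1, 2] := rfl
theorem stdY_val : (stdY : Matrix (Fin 2) (Fin 2) ℤ) = !![1, -1; -1, 2] := rfl
theorem stdX_inv_val : ((stdX⁻¹ : SL 2 ℤ) : Matrix (Fin 2) (Fin 2) ℤ) = !![2, -1; -1, 1] := by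
  rw [Matrix.SpecialLinearGroup.coe_inv, stdX_val, Matrix.adjugate_fin_two]
  simp
theorem stdY_inv_val : ((stdY⁻¹ : SL 2 ℤ) : Matrix (Fin 2) (Fin 2) ℤ) = !![2, 1; 1, 1] := by
  rw [Matrix.SpecialLinearGroup.coe_inv, stdY_val, Matrix.adjugate_fin_two]
  simp

theorem std_injective : Function.Injective std := by
  refine FreeGroup.injective_lift_of_ping_pong (α := NzVec) stdGen ppX ppY ?_ ?_ ?_ ?_ ?_ ?_
  · intro b
    cases b
    · exact ⟨⟨![0, 1], fun h => by simpa using congrFun h 1⟩, by simp [ppX]⟩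
    · exact ⟨⟨![-1, 1], fun h => by simpa using congrFun h 1⟩, by simp [ppX]⟩
  · intro i j hij
    rw [Function.onFun, Set.disjoint_left]
    intro p
    cases i <;> cases j <;> simp [ppX] at hij ⊢ <;> intros <;> omega
  · intro i j hij
    rw [Function.onFun, Set.disjoint_left]
    intro p
    cases i <;> cases j <;> simp [ppY] at hij ⊢ <;> intros <;> omega
  · intro i j
    rw [Set.disjoint_left]
    intro p
    cases i <;> cases j <;> simp [ppX, ppY] <;> intros <;> omega
  · rintro b _ ⟨p, hp, rfl⟩
    have hz := nz_ne p
    cases b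
    · have := pp_aux1 (p.1 0) (p.1 1) hz (by simpa [ppY] using hp)
      change stdX • p ∈ ppX false
      simpa [ppX, nz_smul_val, stdX_val, Matrix.mulVec, dotProduct, Fin.sum_univ_two] using this
    · have := pp_aux2 (p.1 0) (p.1 1) hz (by simpa [ppY] using hp)
      change stdY • p ∈ ppX true
      simpa [ppX, nz_smul_val, stdY_val, Matrix.mulVec, dotProduct, Fin.sum_univ_two,
        ← sub_eq_add_neg] using this
  · rintro b _ ⟨p, hp, rfl⟩
    have hz := nz_ne p
    cases b
    · have := pp_aux1 (- p.1 1) (p.1 0) (by simpa [or_comm] using hz) (by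
        have : ¬ (0 ≤ p.1 0 * p.1 1 ∧ p.1 0 ^ 2 < p.1 1 ^ 2) := by simpa [ppX] using hp
        intro h
        apply this
        constructor <;> nlinarith [h.1, h.2])
      have h2 : (2 * p.1 0 + - p.1 1) * (- p.1 0 + p.1 1) ≤ 0 ∧
        (- p.1 0 + p.1 1) ^ 2 < (2 * p.1 0 + - p.1 1) ^ 2 := by
        constructor <;> nlinarith [this.1, this.2]
      change stdX⁻¹ • p ∈ ppY false
      have e := nz_smul_val stdX⁻¹ p
      rw [stdX_inv_val] at e
      have e0 := congrFun e 0
      have e1 := congrFun e 1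
      simp [Matrix.mulVec, dotProduct, Fin.sum_univ_two] at e0 e1
      simp only [ppY, Bool.false_eq_true, if_true, if_false, Set.mem_setOf_eq]
      rw [e0, e1]
      exact h2
    · have := pp_aux2 (- p.1 1) (p.1 0) (by simpa [or_comm] using hz) (by
        have : ¬ (p.1 0 * p.1 1 < 0 ∧ p.1 0 ^ 2 ≤ p.1 1 ^ 2) := by simpa [ppX] using hp
        intro h
        apply this
        constructor <;> nlinarith [h.1, h.2])
      have h2 : 0 < (2 * p.1 0 + p.1 1) * (p.1 0 + p.1 1) ∧
        (p.1 0 + p.1 1) ^ 2 ≤ (2 * p.1 0 + p.1 1) ^ 2 := by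
        constructor <;> nlinarith [this.1, this.2]
      change stdY⁻¹ • p ∈ ppY true
      have e := nz_smul_val stdY⁻¹ p
      rw [stdY_inv_val] at e
      have e0 := congrFun e 0
      have e1 := congrFun e 1
      simp [Matrix.mulVec, dotProduct, Fin.sum_univ_two] at e0 e1
      simp only [ppY, Bool.false_eq_true, if_true, if_false, Set.mem_setOf_eq]
      rw [e0, e1]
      exact h2

/-! ### A twisted (cyclic) algebra and Borel's theorem for `GL_n` -/

abbrev R2 := Polynomial (Polynomial ℂ)

noncomputable def tau (ω : ℂ) : Polynomial ℂ →+* Polynomial ℂ :=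
  Polynomial.compRingHom (Polynomial.C ω * Polynomial.X)
noncomputable def sig (ω : ℂ) : R2 →+* R2 := Polynomial.mapRingHom (tau ω)

theorem tau_inj {ω : ℂ} (hω : ω ≠ 0) (p : Polynomial ℂ) (h : tau ω p = 0) : p = 0 := by
  have : p.comp (Polynomial.C ω * Polynomial.X) = 0 := h
  rwa [Polynomial.comp_C_mul_X_eq_zero_iff (mem_nonZeroDivisors_of_ne_zero hω)] at this

theorem sig_X (ω : ℂ) : sig ω Polynomial.X = Polynomial.X := by simp [sig]

theorem sig_eval_zero (ω : ℂ) (p : R2) :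
    (sig ω p).eval 0 = tau ω (p.eval 0) := by
  simp [sig, Polynomial.eval_map, Polynomial.hom_eval₂, ← Polynomial.coeff_zero_eq_eval_zero]

section tw
variable {k : ℕ}

noncomputable def twc (i : Fin (k + 1)) : R2 := if i + 1 = 0 then Polynomial.X else 1

noncomputable def twU (k : ℕ) : Matrix (Fin (k + 1)) (Fin (k + 1)) R2 :=
  fun i j => if j = i + 1 then twc i else 0

def Tw (ω : ℂ) (M : Matrix (Fin (k + 1)) (Fin (k + 1)) R2) : Prop :=
  twU k * M = M.map (sig ω) * twU k

theorem twU_mul (M : Matrix (Fin (k + 1)) (Fin (k + 1)) R2) (i j) :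
    (twU k * M) i j = twc i * M (i + 1) j := by
  simp [Matrix.mul_apply, twU]

theorem mul_twU (M : Matrix (Fin (k + 1)) (Fin (k + 1)) R2) (i j) :
    (M * twU k) i (j + 1) = M i j * twc j := by
  simp [Matrix.mul_apply, twU]

theorem twc_ne (i : Fin (k + 1)) : twc i ≠ 0 := by
  unfold twc; split_ifs <;> simp [Polynomial.X_ne_zero]

theorem tw_iff {ω : ℂ} {M : Matrix (Fin (k + 1)) (Fin (k + 1)) R2} :
    Tw ω M ↔ ∀ i j, twc i * M (i + 1) (j + 1) = sig ω (M i j) * twc j := by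
  constructor
  · intro h i j
    have := congrFun (congrFun h i) (j + 1)
    rwa [twU_mul, mul_twU] at this
  · intro h
    ext1 i j
    obtain ⟨j, rfl⟩ : ∃ j', j = j' + 1 := ⟨j - 1, by simp⟩
    rw [twU_mul, mul_twU, h i j]; rfl

theorem det_twU : (twU k).det ≠ 0 := by
  have : twU k = Matrix.diagonal twc * (Equiv.addRight (1 : Fin (k + 1))).permMatrix R2 := by
    ext1 i j
    simp [twU, Matrix.diagonal_mul, Equiv.Perm.permMatrix, PEquiv.toMatrix_apply, eq_comm]
  rw [this, Matrix.det_mul, Matrix.det_diagonal, Matrix.det_permutation]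
  refine mul_ne_zero (Finset.prod_ne_zero_iff.2 fun i _ => twc_ne i) ?_
  rcases Int.units_eq_one_or (Equiv.Perm.sign (Equiv.addRight (1 : Fin (k + 1)))) with h | h <;>
    simp [h]

theorem mul_twU_cancel {A B : Matrix (Fin (k + 1)) (Fin (k + 1)) R2}
    (h : A * twU k = B * twU k) : A = B := by
  ext1 i j
  have := congrFun (congrFun h i) (j + 1)
  rw [mul_twU, mul_twU] at this
  exact mul_right_cancel₀ (twc_ne j) this

theorem Tw.one {ω : ℂ} : Tw ω (1 : Matrix (Fin (k + 1)) (Fin (k + 1)) R2) := by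
  simp [Tw]

theorem Tw.mul {ω : ℂ} {M N : Matrix (Fin (k + 1)) (Fin (k + 1)) R2} (hM : Tw ω M)
    (hN : Tw ω N) : Tw ω (M * N) := by
  unfold Tw at *
  rw [← mul_assoc, hM, Matrix.map_mul, mul_assoc, hN, mul_assoc]

theorem Tw.sub {ω : ℂ} {M N : Matrix (Fin (k + 1)) (Fin (k + 1)) R2} (hM : Tw ω M)
    (hN : Tw ω N) : Tw ω (M - N) := by
  unfold Tw at *
  rw [mul_sub, hM, hN, Matrix.map_sub _ (by simp), sub_mul]

theorem Tw.det {ω : ℂ} {M : Matrix (Fin (k + 1)) (Fin (k + 1)) R2} (hM : Tw ω M) :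
    sig ω M.det = M.det := by
  have := congrArg Matrix.det hM
  rw [Matrix.det_mul, Matrix.det_mul, mul_comm] at this
  rw [RingHom.map_det]
  exact (mul_right_cancel₀ det_twU this).symm

theorem Tw.smul {ω : ℂ} {M : Matrix (Fin (k + 1)) (Fin (k + 1)) R2} (hM : Tw ω M)
    {d : R2} (hd : sig ω d = d) : Tw ω (d • M) := by
  rw [tw_iff] at *
  intro i j
  simp only [Matrix.smul_apply, smul_eq_mul, map_mul, hd, mul_assoc, ← hM i j]
  ring

theorem Tw.adj {ω : ℂ} {M : Matrix (Fin (k + 1)) (Fin (k + 1)) R2} (hM : Tw ω M)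
    (hd : M.det ≠ 0) : Tw ω M.adjugate := by
  have h1 : M.map (sig ω) * (twU k * M.adjugate - M.adjugate.map (sig ω) * twU k) = 0 := by
    have e2 : M.map (sig ω) * M.adjugate.map (sig ω) = M.det • 1 := by
      rw [← Matrix.map_mul, Matrix.mul_adjugate]
      ext1 i j
      simp [Matrix.one_apply, hM.det]
      split_ifs <;> simp [hM.det]
    rw [mul_sub, ← mul_assoc, ← mul_assoc, ← hM, e2, mul_assoc, Matrix.mul_adjugate]
    simp
  have h2 := congrArg (fun N => (M.map (sig ω)).adjugate * N) h1
  simp only [← mul_assoc, Matrix.adjugate_mul, mul_zero] at h2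
  have h3 : (M.map (sig ω)).det ≠ 0 := by
    have := hM.det
    rw [RingHom.map_det] at this
    rw [← this] at hd
    exact hd
  rw [Matrix.smul_mul, one_mul, smul_eq_zero] at h2
  exact sub_eq_zero.1 (h2.resolve_left h3)

theorem twc_castSucc (i : Fin k) : twc i.castSucc = 1 := by
  simp [twc, Fin.coeSucc_eq_succ, Fin.succ_ne_zero]
theorem twc_last : twc (Fin.last k) = Polynomial.X := by
  simp [twc]

theorem bad_col0 {ω : ℂ} (hω : ω ≠ 0) {M : Matrix (Fin (k + 1)) (Fin (k + 1)) R2} (hM : Tw ω M)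
    (hd : M.det = 0) (i) : Polynomial.X ∣ M i 0 := by
  rw [tw_iff] at hM
  have hsucc : ∀ i : Fin k, Polynomial.X ∣ M i.succ 0 := by
    intro i
    have := hM i.castSucc (Fin.last k)
    rw [twc_castSucc, twc_last, Fin.coeSucc_eq_succ, Fin.last_add_one, one_mul] at this
    exact ⟨_, this.trans (mul_comm _ _)⟩
  have hss : ∀ i j : Fin k, M i.succ j.succ = sig ω (M i.castSucc j.castSucc) := by
    intro i j
    have := hM i.castSucc j.castSucc
    rwa [twc_castSucc, twc_castSucc, Fin.coeSucc_eq_succ, Fin.coeSucc_eq_succ, one_mul,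
      mul_one] at this
  have hlow : ∀ j i : Fin (k + 1), j < i → (M i j).eval 0 = 0 := by
    intro j
    induction j using Fin.induction with
    | zero =>
      intro i hi
      obtain ⟨i, rfl⟩ := Fin.exists_succ_eq.2 hi.ne'
      obtain ⟨q, hq⟩ := hsucc i
      simp [hq]
    | succ j ih =>
      intro i hi
      obtain ⟨i, rfl⟩ := Fin.exists_succ_eq.2 (Fin.ne_of_gt (lt_of_le_of_lt (Fin.zero_le _) hi))
      rw [hss, sig_eval_zero, ih _ (Fin.castSucc_lt_castSucc_iff.2 (Fin.succ_lt_succ_iff.1 hi)), map_zero]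
  have hdiag : ∀ i, (M i i).eval 0 = 0 → (M 0 0).eval 0 = 0 := by
    intro i
    induction i using Fin.induction with
    | zero => exact id
    | succ i ih =>
      intro h
      rw [hss, sig_eval_zero] at h
      exact ih (tau_inj hω _ h)
  have hdet : (M.map (Polynomial.evalRingHom (0 : Polynomial ℂ))).det = 0 := by
    rw [← RingHom.mapMatrix_apply, ← RingHom.map_det, hd, map_zero]
  rw [Matrix.det_of_upperTriangular (by
    intro i j hij
    exact hlow j i hij), Finset.prod_eq_zero_iff] at hdet
  obtain ⟨i0, -, hi0⟩ := hdet
  have h00 := hdiag i0 hi0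
  rcases Fin.eq_zero_or_eq_succ i with rfl | ⟨i, rfl⟩
  · rw [Polynomial.X_dvd_iff, Polynomial.coeff_zero_eq_eval_zero, h00]
  · exact hsucc i

theorem bad_factor {ω : ℂ} (hω : ω ≠ 0) {M : Matrix (Fin (k + 1)) (Fin (k + 1)) R2} (hM : Tw ω M)
    (hd : M.det = 0) : ∃ M', Tw ω M' ∧ M'.det = 0 ∧ M = M' * twU k := by
  have : ∀ i j, ∃ q, M i (j + 1) = q * twc j := by
    intro i j
    by_cases h : j + 1 = 0
    · obtain ⟨q, hq⟩ := bad_col0 hω hM hd i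
      refine ⟨q, ?_⟩
      simp only [twc, h, if_true]
      rw [hq, mul_comm]
    · exact ⟨M i (j + 1), by simp [twc, h]⟩
  obtain ⟨M', hM'⟩ : ∃ M' : Matrix (Fin (k + 1)) (Fin (k + 1)) R2,
      ∀ i j, M i (j + 1) = M' i j * twc j := by
    choose M' hM' using this
    exact ⟨Matrix.of M', hM'⟩
  have e : M = M' * twU k := by
    ext1 i j
    obtain ⟨j, rfl⟩ : ∃ j', j = j' + 1 := ⟨j - 1, by simp⟩
    rw [mul_twU]
    exact hM' i j
  refine ⟨M', ?_, ?_, e⟩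
  · unfold Tw at hM
    rw [e, ← mul_assoc, Matrix.map_mul] at hM
    have hU : (twU k).map (sig ω) = twU k := by
      ext1 i j
      simp only [twU, Matrix.map_apply, twc]
      split_ifs <;> simp [sig_X]
    rw [hU] at hM
    exact mul_twU_cancel hM
  · rw [e, Matrix.det_mul] at hd
    exact (mul_eq_zero.1 hd).resolve_right det_twU

theorem bad_dvd {ω : ℂ} (hω : ω ≠ 0) (j : Fin (k + 1)) :
    ∀ {M : Matrix (Fin (k + 1)) (Fin (k + 1)) R2}, Tw ω M → M.det = 0 →
      ∀ i, Polynomial.X ∣ M i j := by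
  induction j using Fin.induction with
  | zero => intro M hM hd i; exact bad_col0 hω hM hd i
  | succ j ih =>
    intro M hM hd i
    obtain ⟨M', h1, h2, rfl⟩ := bad_factor hω hM hd
    rw [← Fin.coeSucc_eq_succ, mul_twU]
    exact Dvd.dvd.mul_right (ih h1 h2 i) _

theorem bad_zero {ω : ℂ} (hω : ω ≠ 0) {M : Matrix (Fin (k + 1)) (Fin (k + 1)) R2} (hM : Tw ω M)
    (hd : M.det = 0) : M = 0 := by
  have key : ∀ r : ℕ, ∀ M : Matrix (Fin (k + 1)) (Fin (k + 1)) R2, Tw ω M → M.det = 0 →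
      ∀ i j, Polynomial.X ^ r ∣ M i j := by
    intro r
    induction r with
    | zero => intro M _ _ i j; simp
    | succ r ih =>
      intro M hM hd
      obtain ⟨N, hN⟩ : ∃ N : Matrix (Fin (k + 1)) (Fin (k + 1)) R2,
          ∀ i j, M i j = Polynomial.X * N i j := by
        choose N hN using fun i j => bad_dvd hω j hM hd i
        exact ⟨Matrix.of N, hN⟩
      have e : M = (Polynomial.X : R2) • N := by
        ext1 i j; exact hN i j
      have hT : Tw ω N := by
        rw [tw_iff] at hM ⊢
        intro i j
        have := hM i j
        rw [hN, hN, map_mul, sig_X] at this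
        refine mul_left_cancel₀ (Polynomial.X_ne_zero (R := Polynomial ℂ)) ?_
        linear_combination this
      have hD : N.det = 0 := by
        rw [e, Matrix.det_smul] at hd
        exact (mul_eq_zero.1 hd).resolve_left (pow_ne_zero _ Polynomial.X_ne_zero)
      intro i j
      rw [hN, pow_succ']
      exact mul_dvd_mul_left _ (ih _ hT hD i j)
  ext1 i j
  by_contra h
  have h1 := key ((M i j).natDegree + 1) M hM hd i j
  have := Polynomial.natDegree_le_of_dvd h1 h
  simp at this

end tw

theorem tau_comp (ω c : ℂ) (p : Polynomial ℂ) :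
    tau ω (p.comp (Polynomial.C c * Polynomial.X)) =
      p.comp (Polynomial.C (c * ω) * Polynomial.X) := by
  simp [tau, Polynomial.comp_assoc, mul_assoc]

theorem tw_lift {k : ℕ} {ω : ℂ} (hω : IsPrimitiveRoot ω (k + 1))
    (A : Matrix (Fin (k + 1)) (Fin (k + 1)) ℂ) :
    ∃ M : Matrix (Fin (k + 1)) (Fin (k + 1)) R2, Tw ω M ∧
      M.map (Polynomial.evalEvalRingHom 1 1) = A := by
  have hinj : Set.InjOn (fun i : Fin (k + 1) => ω ^ (i : ℕ))
      (Finset.univ : Finset (Fin (k + 1))) := by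
    intro i _ j _ h
    exact Fin.ext (hω.pow_inj i.2 j.2 h)
  let m : Fin (k + 1) → Polynomial ℂ := fun d =>
    Lagrange.interpolate Finset.univ (fun i : Fin (k + 1) => ω ^ (i : ℕ)) (fun i => A i (i + d))
  have hm : ∀ (d i : Fin (k + 1)), (m d).eval (ω ^ (i : ℕ)) = A i (i + d) := by
    intro d i
    exact Lagrange.eval_interpolate_at_node (fun i => A i (i + d)) hinj (Finset.mem_univ i)
  let e : Fin (k + 1) → Fin (k + 1) → R2 := fun i j => if j < i then Polynomial.X else 1
  refine ⟨Matrix.of fun i j => Polynomial.C ((m (j - i)).comp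
    (Polynomial.C (ω ^ (i : ℕ)) * Polynomial.X)) * e i j, ?_, ?_⟩
  · rw [tw_iff]
    intro i j
    have h1 : twc i * e (i + 1) (j + 1) = e i j * twc j := by
      rcases Fin.eq_castSucc_or_eq_last i with ⟨i, rfl⟩ | rfl <;>
      rcases Fin.eq_castSucc_or_eq_last j with ⟨j, rfl⟩ | rfl <;>
      simp only [twc_castSucc, twc_last, e, Fin.coeSucc_eq_succ, Fin.last_add_one]
      · simp
      · rw [if_pos (Fin.succ_pos i), if_neg (not_lt.2 (Fin.le_last _))]
      · rw [if_pos (Fin.castSucc_lt_last j), if_neg (not_lt.2 (Fin.zero_le _)), mul_comm]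
      · simp
    have h2 : sig ω (e i j) = e i j := by
      simp only [e]; split_ifs <;> simp [sig_X]
    have h3 : ω ^ ((i + 1 : Fin (k + 1)) : ℕ) = ω ^ (i : ℕ) * ω := by
      rcases Fin.eq_castSucc_or_eq_last i with ⟨i, rfl⟩ | rfl
      · rw [Fin.coeSucc_eq_succ]; simp [pow_succ]
      · rw [Fin.last_add_one]; simp [← pow_succ, hω.pow_eq_one]
    have h4 : ∀ p : Polynomial ℂ, sig ω (Polynomial.C p) = Polynomial.C (tau ω p) := by
      intro p; simp [sig]
    simp only [Matrix.of_apply, map_mul (sig ω), h2, h3, h4, tau_comp, add_sub_add_right_eq_sub]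
    linear_combination Polynomial.C ((m (j - i)).comp
      (Polynomial.C (ω ^ (i : ℕ) * ω) * Polynomial.X)) * h1
  · ext1 i j
    have h1 : Polynomial.evalEvalRingHom (1 : ℂ) 1 (e i j) = 1 := by
      simp only [e]; split_ifs <;> simp
    rw [Matrix.map_apply, Matrix.of_apply, map_mul, h1, mul_one]
    simp [Polynomial.eval_comp, hm]

theorem tw_word {k : ℕ} {ω : ℂ} (Xs : Bool → Matrix (Fin (k + 1)) (Fin (k + 1)) R2)
    (hX : ∀ b, Tw ω (Xs b)) (hd : ∀ b, (Xs b).det ≠ 0) (w : FreeGroup Bool) :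
    ∃ (W : Matrix (Fin (k + 1)) (Fin (k + 1)) R2) (δ : R2), Tw ω W ∧ sig ω δ = δ ∧
      ∀ (s t : ℂ) (u : Bool → GL (Fin (k + 1)) ℂ),
        (∀ b, (u b : Matrix (Fin (k + 1)) (Fin (k + 1)) ℂ) = (Xs b).map (Polynomial.evalEvalRingHom s t)) →
        Polynomial.evalEvalRingHom s t δ ≠ 0 ∧
        W.map (Polynomial.evalEvalRingHom s t) = Polynomial.evalEvalRingHom s t δ •
          ((FreeGroup.lift u w : GL (Fin (k + 1)) ℂ) : Matrix (Fin (k + 1)) (Fin (k + 1)) ℂ) := by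
  induction w using FreeGroup.induction_on with
  | C1 =>
    refine ⟨1, 1, Tw.one, by simp, fun s t u _ => ⟨by simp, ?_⟩⟩
    rw [Matrix.map_one _ (map_zero _) (map_one _)]; simp
  | of b =>
    refine ⟨Xs b, 1, hX b, by simp, fun s t u hu => ⟨by simp, ?_⟩⟩
    rw [← hu b]; simp
  | inv_of b _ =>
    refine ⟨(Xs b).adjugate, (Xs b).det, (hX b).adj (hd b), (hX b).det, fun s t u hu => ?_⟩
    have e1 : Polynomial.evalEvalRingHom s t (Xs b).det = (u b : Matrix (Fin (k + 1)) (Fin (k + 1)) ℂ).det := by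
      rw [hu b, RingHom.map_det]; rfl
    have hne : (u b : Matrix (Fin (k + 1)) (Fin (k + 1)) ℂ).det ≠ 0 := by
      have := (Matrix.isUnits_det_units (u b)).ne_zero
      exact this
    rw [e1]
    refine ⟨hne, ?_⟩
    have := RingHom.map_adjugate (Polynomial.evalEvalRingHom s t) (Xs b)
    rw [RingHom.mapMatrix_apply, RingHom.mapMatrix_apply, ← hu b] at this
    rw [this, map_inv, FreeGroup.lift_apply_of, Matrix.coe_units_inv, Matrix.inv_def,
      smul_smul, Ring.inverse_eq_inv', mul_inv_cancel₀ hne, one_smul]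
  | mul x y hx hy =>
    obtain ⟨W, d, h1, h2, h3⟩ := hx
    obtain ⟨W', d', h1', h2', h3'⟩ := hy
    refine ⟨W * W', d * d', h1.mul h1', by rw [map_mul, h2, h2'], fun s t u hu => ?_⟩
    obtain ⟨a1, a2⟩ := h3 s t u hu
    obtain ⟨b1, b2⟩ := h3' s t u hu
    refine ⟨by rw [map_mul]; exact mul_ne_zero a1 b1, ?_⟩
    rw [Matrix.map_mul, a2, b2, map_mul, map_mul, Units.val_mul, Matrix.smul_mul,
      Matrix.mul_smul, smul_smul]

theorem evalEval_ext {p : R2} (h : ∀ s t : ℂ, Polynomial.evalEvalRingHom s t p = 0) : p = 0 := by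
  ext1 n
  rw [Polynomial.coeff_zero]
  apply Polynomial.funext
  intro s
  have h2 : p.map (Polynomial.evalRingHom s) = 0 := by
    apply Polynomial.funext
    intro t
    have := h s t
    rw [Polynomial.evalEvalRingHom_eq] at this
    simpa [Polynomial.eval_map] using this
  have := congrArg (fun q => q.coeff n) h2
  simpa using this

/-- a faithful representation of the free group -/
theorem exists_lift_ne_one {k : ℕ} (hk : 1 ≤ k) {w : FreeGroup Bool} (hw : w ≠ 1) :
    ∃ u : Bool → GL (Fin (k + 1)) ℂ, FreeGroup.lift u w ≠ 1 := by
  obtain ⟨l, rfl⟩ : ∃ l, k = 1 + l := ⟨k - 1, by omega⟩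
  let e : Fin 2 ⊕ Fin l ≃ Fin (1 + l + 1) := finSumFinEquiv.trans (finCongr (by omega))
  let f : Matrix (Fin 2) (Fin 2) ℤ →* Matrix (Fin (1 + l + 1)) (Fin (1 + l + 1)) ℂ :=
    { toFun := fun A => Matrix.reindex e e
        (Matrix.fromBlocks (A.map (Int.castRingHom ℂ)) 0 0 1)
      map_one' := by
        rw [Matrix.map_one _ (map_zero _) (map_one _)]; simp
      map_mul' := by
        intro A B
        rw [Matrix.map_mul]
        simp [Matrix.fromBlocks_multiply, Matrix.submatrix_mul_equiv] }
  have hf : Function.Injective f := by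
    intro A B h
    have h1 := (Matrix.reindex e e).injective h
    have h2 := (Matrix.fromBlocks_inj.1 h1).1
    ext i j
    have := congrFun (congrFun h2 i) j
    simpa using this
  let F : SL 2 ℤ →* GL (Fin (1 + l + 1)) ℂ :=
    (Units.map f).comp (Matrix.SpecialLinearGroup.toGL)
  refine ⟨fun b => F (stdGen b), ?_⟩
  have h1 : FreeGroup.lift (fun b => F (stdGen b)) = F.comp std := by
    ext b; simp [std]
  rw [h1]
  intro h
  apply hw
  apply std_injective
  have h2 := congrArg Units.val h
  have h3 : f (std w : Matrix (Fin 2) (Fin 2) ℤ) = 1 := h2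
  rw [← map_one f] at h3
  rw [map_one]
  exact Subtype.ext (hf h3)

theorem borel_E {k : ℕ} (hk : 1 ≤ k) {w : FreeGroup Bool} (hw : w ≠ 1) :
    ∃ u : Bool → GL (Fin (k + 1)) ℂ,
      (((FreeGroup.lift u w : GL (Fin (k + 1)) ℂ) : Matrix (Fin (k + 1)) (Fin (k + 1)) ℂ) - 1).det ≠ 0 := by
  by_contra! hcon
  obtain ⟨u, hu⟩ := exists_lift_ne_one hk hw
  have hω := Complex.isPrimitiveRoot_exp (k + 1) (by omega)
  set ω := Complex.exp (2 * Real.pi * Complex.I / ((k + 1 : ℕ) : ℂ))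
  choose Xs hX1 hX2 using fun b => tw_lift hω (u b : Matrix (Fin (k + 1)) (Fin (k + 1)) ℂ)
  have hdet : ∀ (s t : ℂ) (b : Bool), Polynomial.evalEvalRingHom s t (Xs b).det =
      ((Xs b).map (Polynomial.evalEvalRingHom s t)).det := by
    intro s t b; rw [RingHom.map_det]; rfl
  have hd : ∀ b, (Xs b).det ≠ 0 := by
    intro b h0
    have := hdet 1 1 b
    rw [h0, map_zero, hX2] at this
    exact (Matrix.isUnits_det_units (u b)).ne_zero this.symm
  obtain ⟨W, δ, h1, h2, h3⟩ := tw_word Xs hX1 hd w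
  have hω0 : ω ≠ 0 := hω.ne_zero (by omega)
  have hz : (W - δ • 1).det * ((Xs false).det * (Xs true).det) = 0 := by
    apply evalEval_ext
    intro s t
    by_cases hh : ∀ b, ((Xs b).map (Polynomial.evalEvalRingHom s t)).det ≠ 0
    · let v : Bool → GL (Fin (k + 1)) ℂ := fun b => Matrix.GeneralLinearGroup.mkOfDetNeZero _ (hh b)
      obtain ⟨g1, g2⟩ := h3 s t v (fun b => rfl)
      rw [map_mul, RingHom.map_det, RingHom.mapMatrix_apply, Matrix.map_sub _ (by simp), g2]
      have : (δ • (1 : Matrix (Fin (k + 1)) (Fin (k + 1)) R2)).map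
          (Polynomial.evalEvalRingHom s t) = Polynomial.evalEvalRingHom s t δ • 1 := by
        ext1 i j
        by_cases hij : i = j <;> simp [hij]
      rw [this, ← smul_sub, Matrix.det_smul, hcon v, mul_zero, zero_mul]
    · push Not at hh
      obtain ⟨b, hb⟩ := hh
      rw [map_mul, map_mul, hdet, hdet]
      cases b
      · rw [hb, zero_mul, mul_zero]
      · rw [hb, mul_zero, mul_zero]
  have hz2 := (mul_eq_zero.1 hz).resolve_right (mul_ne_zero (hd _) (hd _))
  have hW := bad_zero hω0 (h1.sub (Tw.one.smul h2)) hz2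
  rw [sub_eq_zero] at hW
  obtain ⟨g1, g2⟩ := h3 1 1 u (fun b => (hX2 b).symm)
  have : W.map (Polynomial.evalEvalRingHom 1 1) = Polynomial.evalEvalRingHom 1 1 δ • 1 := by
    rw [hW]
    ext1 i j
    by_cases hij : i = j <;> simp [hij]
  rw [this] at g2
  apply hu
  have h5 := smul_right_injective _ g1 g2
  exact Units.ext h5.symm

/-! ### Holomorphic functions of tuples of matrices -/

attribute [local instance] Matrix.normedAddCommGroup Matrix.normedSpace

abbrev Mat (n : ℕ) := Matrix (Fin n) (Fin n) ℂ
abbrev Tup (ι : Type) (n : ℕ) := ι → Mat n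

def InvT (ι : Type) (n : ℕ) : Set (Tup ι n) := {A | ∀ x, (A x).det ≠ 0}

open Classical in
noncomputable def glOf {n : ℕ} (M : Mat n) : GL (Fin n) ℂ :=
  if h : M.det ≠ 0 then Matrix.GeneralLinearGroup.mkOfDetNeZero M h else 1

theorem glOf_val {n : ℕ} {M : Mat n} (h : M.det ≠ 0) : (glOf M : Mat n) = M := by
  simp [glOf, h, Matrix.GeneralLinearGroup.mkOfDetNeZero]

theorem gl_det_ne {n : ℕ} (u : GL (Fin n) ℂ) : (u : Mat n).det ≠ 0 :=
  (Matrix.isUnits_det_units u).ne_zero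

theorem glOf_coe {n : ℕ} (u : GL (Fin n) ℂ) : glOf (u : Mat n) = u :=
  Units.ext (glOf_val (gl_det_ne u))

noncomputable def wgl {ι : Type} {n : ℕ} (w : FreeGroup ι) (A : Tup ι n) : GL (Fin n) ℂ :=
  FreeGroup.lift (fun x => glOf (A x)) w
noncomputable def wev {ι : Type} {n : ℕ} (w : FreeGroup ι) (A : Tup ι n) : Mat n := (wgl w A : Mat n)

theorem wgl_coe {ι : Type} {n : ℕ} (w : FreeGroup ι) (u : ι → GL (Fin n) ℂ) :
    wgl w (fun x => (u x : Mat n)) = FreeGroup.lift u w := by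
  simp [wgl, glOf_coe]

theorem wev_mul {ι : Type} {n : ℕ} (v w : FreeGroup ι) (A : Tup ι n) :
    wev (v * w) A = wev v A * wev w A := by simp [wev, wgl]
theorem wev_one {ι : Type} {n : ℕ} (A : Tup ι n) :
    wev (1 : FreeGroup ι) A = 1 := by simp [wev, wgl]
theorem wev_inv {ι : Type} {n : ℕ} (w : FreeGroup ι) (A : Tup ι n) :
    wev w⁻¹ A = (wev w A)⁻¹ := by simp [wev, wgl]
theorem wev_of {ι : Type} {n : ℕ} {A : Tup ι n} (hA : A ∈ InvT ι n) (x : ι) :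
    wev (FreeGroup.of x) A = A x := by simp [wev, wgl, glOf_val (hA x)]
theorem wev_det_ne {ι : Type} {n : ℕ} (w : FreeGroup ι) (A : Tup ι n) : (wev w A).det ≠ 0 :=
  gl_det_ne _

section diff
variable {E : Type*} [NormedAddCommGroup E] [NormedSpace ℂ E] {S : Set E}

theorem diffOn_mat {a b : Type} [Fintype a] [Fintype b] {f : E → Matrix a b ℂ} :
    DifferentiableOn ℂ f S ↔ ∀ i j, DifferentiableOn ℂ (fun x => f x i j) S := by
  constructor
  · intro h i j
    exact (differentiableOn_pi.1 ((differentiableOn_pi (F' := fun _ => b → ℂ)).1 h i)) j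
  · intro h
    exact (differentiableOn_pi (F' := fun _ => b → ℂ)).2 fun i => differentiableOn_pi.2 (h i)

theorem diffOn_mul {a b c : Type} [Fintype a] [Fintype b] [Fintype c]
    {f : E → Matrix a b ℂ} {g : E → Matrix b c ℂ} (hf : DifferentiableOn ℂ f S)
    (hg : DifferentiableOn ℂ g S) : DifferentiableOn ℂ (fun x => f x * g x) S := by
  rw [diffOn_mat] at *
  intro i j
  simp only [Matrix.mul_apply]
  exact DifferentiableOn.fun_sum fun k _ => (hf i k).mul (hg k j)

theorem diffOn_fprod {κ : Type*} (s : Finset κ) {f : κ → E → ℂ}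
    (hf : ∀ i, DifferentiableOn ℂ (f i) S) : DifferentiableOn ℂ (fun x => ∏ i ∈ s, f i x) S := by
  classical
  induction s using Finset.induction_on with
  | empty => simpa using differentiableOn_const (1 : ℂ)
  | insert a s ha ih =>
    simp only [Finset.prod_insert ha]
    exact DifferentiableOn.mul (hf a) ih

theorem diffOn_det {a : Type} [Fintype a] [DecidableEq a] {f : E → Matrix a a ℂ}
    (hf : DifferentiableOn ℂ f S) : DifferentiableOn ℂ (fun x => (f x).det) S := by
  rw [diffOn_mat] at *
  simp only [Matrix.det_apply]
  refine DifferentiableOn.fun_sum fun σ _ => ?_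
  refine DifferentiableOn.const_smul ?_ _
  exact diffOn_fprod _ fun i => hf _ _

theorem diffOn_adj {a : Type} [Fintype a] [DecidableEq a] {f : E → Matrix a a ℂ}
    (hf : DifferentiableOn ℂ f S) : DifferentiableOn ℂ (fun x => (f x).adjugate) S := by
  rw [diffOn_mat]
  intro i j
  simp only [Matrix.adjugate_apply]
  refine diffOn_det (diffOn_mat.2 fun k l => ?_)
  rw [diffOn_mat] at hf
  by_cases h : k = j
  · subst h; simp
  · simpa [Matrix.updateRow_ne h] using hf k l

theorem diffOn_inv {a : Type} [Fintype a] [DecidableEq a] {f : E → Matrix a a ℂ}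
    (hf : DifferentiableOn ℂ f S) (h0 : ∀ x ∈ S, (f x).det ≠ 0) :
    DifferentiableOn ℂ (fun x => (f x)⁻¹) S := by
  simp only [Matrix.inv_def, Ring.inverse_eq_inv']
  rw [diffOn_mat]
  intro i j
  simp only [Matrix.smul_apply, smul_eq_mul]
  exact ((diffOn_det hf).inv h0).mul (diffOn_mat.1 (diffOn_adj hf) i j)

theorem diffOn_mvp {σ : Type*} {f : E → σ → ℂ} (hf : ∀ i, DifferentiableOn ℂ (fun x => f x i) S)
    (p : MvPolynomial σ ℂ) : DifferentiableOn ℂ (fun x => MvPolynomial.eval (f x) p) S := by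
  induction p using MvPolynomial.induction_on with
  | C a => simp
  | add p q hp hq => simp only [map_add]; exact DifferentiableOn.add hp hq
  | mul_X p i hp => simp only [map_mul, eval_X]; exact DifferentiableOn.mul hp (hf i)

theorem diffOn_wev {ι : Type} {n : ℕ} (w : FreeGroup ι) {f : E → Tup ι n}
    (hf : ∀ x, DifferentiableOn ℂ (fun e => f e x) S) (h0 : ∀ e ∈ S, f e ∈ InvT ι n) :
    DifferentiableOn ℂ (fun e => wev w (f e)) S := by
  induction w using FreeGroup.induction_on with
  | C1 => simp [wev_one]
  | of x => exact (hf x).congr fun e he => wev_of (h0 e he) x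
  | inv_of x h =>
    simp only [wev_inv]
    exact diffOn_inv h fun e _ => wev_det_ne _ _
  | mul v w hv hw =>
    simp only [wev_mul]
    exact diffOn_mul hv hw

theorem diffOn_charpoly {n : ℕ} {f : E → Mat n} (hf : DifferentiableOn ℂ f S) (i : ℕ) :
    DifferentiableOn ℂ (fun e => (f e).charpoly.coeff i) S := by
  have : ∀ e, (f e).charpoly.coeff i = MvPolynomial.eval (fun p : Fin n × Fin n => f e p.1 p.2)
      ((Matrix.charpoly.univ ℂ (Fin n)).coeff i) := by
    intro e
    exact (Matrix.charpoly.univ_coeff_eval₂Hom (Fin n) (RingHom.id ℂ)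
      (fun p : Fin n × Fin n => f e p.1 p.2) i).symm
  simp only [this]
  generalize (Matrix.charpoly.univ ℂ (Fin n)).coeff i = q
  exact diffOn_mvp (f := fun e (p : Fin n × Fin n) => f e p.1 p.2)
    (fun p => diffOn_mat.1 hf p.1 p.2) q

end diff

theorem isPreconnected_poly_ne {q : Polynomial ℂ} (hq : q ≠ 0) :
    IsPreconnected {t : ℂ | q.eval t ≠ 0} := by
  have hc : {t : ℂ | q.eval t = 0}.Countable := by
    have : {t : ℂ | q.eval t = 0} ⊆ (q.roots.toFinset : Set ℂ) := by
      intro t ht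
      simp only [Finset.mem_coe, Multiset.mem_toFinset, Polynomial.mem_roots hq]
      exact ht
    exact (Set.Finite.subset (Finset.finite_toSet _) this).countable
  have := (hc.isPathConnected_compl_of_one_lt_rank (by
    rw [Complex.rank_real_complex]; exact Cardinal.one_lt_two)).isConnected.isPreconnected
  exact this

theorem isOpen_poly_ne (q : Polynomial ℂ) : IsOpen {t : ℂ | q.eval t ≠ 0} :=
  isOpen_ne_fun q.continuous continuous_const

/-- identity theorem -/
theorem ident_zero {S : Set ℂ} (hS : IsOpen S) (hc : IsPreconnected S) {f : ℂ → ℂ}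
    (hf : DifferentiableOn ℂ f S) {t₀ : ℂ} (h0 : t₀ ∈ S) (hz : ∀ᶠ t in nhds t₀, f t = 0)
    {t : ℂ} (ht : t ∈ S) : f t = 0 :=
  (hf.analyticOnNhd hS).eqOn_zero_of_preconnected_of_eventuallyEq_zero hc h0 hz ht

section line
variable {ι : Type} [Fintype ι] {n : ℕ}

/-- the line through two tuples -/
noncomputable def lineT (A B : Tup ι n) (t : ℂ) : Tup ι n := fun x => A x + t • (B x - A x)

theorem lineT_zero (A B : Tup ι n) : lineT A B 0 = A := by ext1 x; simp [lineT]
theorem lineT_one (A B : Tup ι n) : lineT A B 1 = B := by ext1 x; simp [lineT]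

theorem lineT_diff (A B : Tup ι n) (x : ι) : Differentiable ℂ (fun t => lineT A B t x) := by
  unfold lineT; fun_prop

theorem lineT_diff' (A B : Tup ι n) : Differentiable ℂ (lineT A B) := by
  exact differentiable_pi.2 (lineT_diff A B)

theorem lineT_poly {A : Tup ι n} (hA : A ∈ InvT ι n) (B : Tup ι n) :
    ∃ q : Polynomial ℂ, q ≠ 0 ∧ ∀ t, q.eval t ≠ 0 ↔ lineT A B t ∈ InvT ι n := by
  let P : ι → Matrix (Fin n) (Fin n) (Polynomial ℂ) := fun x => Matrix.of fun i j =>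
    Polynomial.C (A x i j) + Polynomial.X * Polynomial.C (B x i j - A x i j)
  have hP : ∀ t x, ((P x).det).eval t = (lineT A B t x).det := by
    intro t x
    rw [← Polynomial.coe_evalRingHom, RingHom.map_det]
    congr 1
    ext i j
    simp [P, lineT]
  have key : ∀ t, (∏ x, (P x).det).eval t ≠ 0 ↔ lineT A B t ∈ InvT ι n := by
    intro t
    rw [Polynomial.eval_prod, Finset.prod_ne_zero_iff]
    simp [hP, InvT]
  refine ⟨_, ?_, key⟩
  intro h
  have := (key 0).2 (by rwa [lineT_zero])
  rw [h] at this
  simp at this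

theorem line_set {A : Tup ι n} (hA : A ∈ InvT ι n) (B : Tup ι n) :
    IsOpen {t | lineT A B t ∈ InvT ι n} ∧ IsPreconnected {t | lineT A B t ∈ InvT ι n} := by
  obtain ⟨q, hq, h⟩ := lineT_poly hA B
  have : {t | lineT A B t ∈ InvT ι n} = {t | q.eval t ≠ 0} := by ext t; exact (h t).symm
  rw [this]
  exact ⟨isOpen_poly_ne q, isPreconnected_poly_ne hq⟩

/-- holomorphic functions on invertible tuples -/
def HolT (f : Tup ι n → ℂ) : Prop := DifferentiableOn ℂ f (InvT ι n)

theorem HolT.line {f : Tup ι n → ℂ} (hf : HolT f) (A B : Tup ι n) :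
    DifferentiableOn ℂ (fun t => f (lineT A B t)) {t | lineT A B t ∈ InvT ι n} :=
  DifferentiableOn.comp hf (lineT_diff' A B).differentiableOn (fun _ h => h)

/-- a holomorphic function on invertible tuples vanishing near a point vanishes identically -/
theorem HolT.zero {f : Tup ι n → ℂ} (hf : HolT f) {A : Tup ι n} (hA : A ∈ InvT ι n)
    (hz : ∀ᶠ B in nhds A, f B = 0) {B : Tup ι n} (hB : B ∈ InvT ι n) : f B = 0 := by
  obtain ⟨h1, h2⟩ := line_set hA B
  have := ident_zero h1 h2 (hf.line A B) (t₀ := 0) (by simpa [lineT_zero] using hA)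
    (by
      have hc : Filter.Tendsto (lineT A B) (nhds 0) (nhds A) := by
        have := (lineT_diff' A B).continuous.tendsto 0
        rwa [lineT_zero] at this
      exact hc.eventually hz) (t := 1) (by simpa [lineT_one] using hB)
  simpa [lineT_one] using this

theorem isOpen_InvT : IsOpen (InvT ι n) := by
  have : InvT ι n = ⋂ x, {A : Tup ι n | (A x).det ≠ 0} := by ext; simp [InvT]
  rw [this]
  refine isOpen_iInter_of_finite fun x => isOpen_ne_fun ?_ continuous_const
  exact (continuous_apply x).matrix_det

theorem HolT.mul {f g : Tup ι n → ℂ} (hf : HolT f) (hg : HolT g) : HolT (fun A => f A * g A) :=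
  DifferentiableOn.mul hf hg

theorem HolT.mul_ne {f g : Tup ι n → ℂ} (hf : HolT f) (hg : HolT g)
    (h1 : ∃ A ∈ InvT ι n, f A ≠ 0) (h2 : ∃ A ∈ InvT ι n, g A ≠ 0) :
    ∃ A ∈ InvT ι n, f A * g A ≠ 0 := by
  obtain ⟨A, hA, hfA⟩ := h1
  obtain ⟨B, hB, hgB⟩ := h2
  by_contra! hcon
  apply hgB
  refine hg.zero hA ?_ hB
  have hcont : ContinuousAt f A := (hf.differentiableAt (isOpen_InvT.mem_nhds hA)).continuousAt
  filter_upwards [hcont.eventually_ne hfA, isOpen_InvT.mem_nhds hA] with C hC hC2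
  exact (mul_eq_zero.1 (hcon C hC2)).resolve_left hC

theorem HolT.prod_ne {κ : Type*} (s : Finset κ) {f : κ → Tup ι n → ℂ} (hf : ∀ i, HolT (f i))
    (h1 : ∀ i, ∃ A ∈ InvT ι n, f i A ≠ 0) :
    ∃ A ∈ InvT ι n, ∀ i ∈ s, f i A ≠ 0 := by
  classical
  have : HolT (fun A => ∏ i ∈ s, f i A) ∧ ∃ A ∈ InvT ι n, ∏ i ∈ s, f i A ≠ 0 := by
    induction s using Finset.induction_on with
    | empty => exact ⟨by simp [HolT], fun _ => 1, by simp [InvT], by simp⟩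
    | insert a s ha ih =>
      simp only [Finset.prod_insert ha]
      exact ⟨(hf a).mul ih.1, (hf a).mul_ne ih.1 (h1 a) ih.2⟩
  obtain ⟨A, hA, h⟩ := this.2
  exact ⟨A, hA, Finset.prod_ne_zero_iff.1 h⟩

theorem HolT.wev (w : FreeGroup ι) :
    DifferentiableOn ℂ (fun A : Tup ι n => wev w A) (InvT ι n) :=
  diffOn_wev w (f := fun A => A) (fun x => (differentiable_apply x).differentiableOn)
    (fun _ h => h)

end line

/-! ### Resonances -/

attribute [local instance] Matrix.normedAddCommGroup Matrix.normedSpace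

noncomputable def resP {n : ℕ} (m : Fin n → ℕ) : MvPolynomial (Fin n) ℂ :=
  ∏ σ : Equiv.Perm (Fin n), (∏ k, X (σ k) ^ m k - 1)

theorem resP_symm {n : ℕ} (m : Fin n → ℕ) : (resP m).IsSymmetric := by
  intro τ
  simp only [resP, map_prod, map_sub, map_pow, rename_X, map_one]
  exact Fintype.prod_equiv (Equiv.mulLeft τ) _ _ (fun σ => by simp)

noncomputable def resQ {n : ℕ} (m : Fin n → ℕ) : MvPolynomial (Fin n) ℂ :=
  (esymmAlgEquiv (Fin n) ℂ (Fintype.card_fin n)).symm ⟨resP m, resP_symm m⟩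

theorem resQ_spec {n : ℕ} (m : Fin n → ℕ) :
    aeval (fun i : Fin n => esymm (Fin n) ℂ (i + 1)) (resQ m) = resP m := by
  have h := (esymmAlgEquiv (Fin n) ℂ (Fintype.card_fin n)).apply_symm_apply ⟨resP m, resP_symm m⟩
  have h2 := congrArg Subtype.val h
  rw [esymmAlgEquiv_apply, esymmAlgHom_apply] at h2
  exact h2

/-- resonance function -/
noncomputable def resD {n : ℕ} (m : Fin n → ℕ) (A : Mat n) : ℂ :=
  eval (fun i : Fin n => (-1) ^ ((i : ℕ) + 1) * A.charpoly.coeff (n - (i + 1))) (resQ m)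

theorem resD_eq {n : ℕ} (m : Fin n → ℕ) (A : Mat n) (l : Fin n → ℂ)
    (h : A.charpoly = ∏ i, (Polynomial.X - Polynomial.C (l i))) :
    resD m A = ∏ σ : Equiv.Perm (Fin n), (∏ k, l (σ k) ^ m k - 1) := by
  have h1 : eval l (resP m) = ∏ σ : Equiv.Perm (Fin n), (∏ k, l (σ k) ^ m k - 1) := by
    simp [resP]
  rw [← h1, ← resQ_spec, resD]
  have h2 : eval l (aeval (fun i : Fin n => esymm (Fin n) ℂ (i + 1)) (resQ m)) =
      eval (fun i : Fin n => eval l (esymm (Fin n) ℂ (i + 1))) (resQ m) := by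
    generalize resQ m = q
    induction q using MvPolynomial.induction_on with
    | C a => simp
    | add p q hp hq => simp only [map_add, hp, hq]
    | mul_X p i hp => simp only [map_mul, hp, aeval_X, eval_X]
  rw [h2]
  congr 2
  ext i
  have hc : Multiset.card (Finset.univ.val.map l) = n := by simp
  have h3 : A.charpoly = ((Finset.univ.val.map l).map
      fun t => Polynomial.X - Polynomial.C t).prod := by
    rw [h, Multiset.map_map]; rfl
  rw [h3, Multiset.prod_X_sub_C_coeff _ (by rw [hc]; omega), hc]
  have h4 : n - (n - ((i : ℕ) + 1)) = i + 1 := by have := i.2; omega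
  rw [h4, ← mul_assoc, ← mul_pow]
  have := aeval_esymm_eq_multiset_esymm (Fin n) ℂ (S := ℂ) (i + 1) l
  rw [← this]
  simp [aeval_eq_eval]

theorem exists_eig {n : ℕ} (A : Mat n) :
    ∃ l : Fin n → ℂ, A.charpoly = ∏ i, (Polynomial.X - Polynomial.C (l i)) := by
  have hs := IsAlgClosed.splits A.charpoly
  have h1 := hs.eq_prod_roots_of_monic A.charpoly_monic
  have hc : A.charpoly.roots.toList.length = n := by
    rw [Multiset.length_toList, ← hs.natDegree_eq_card_roots, Matrix.charpoly_natDegree_eq_dim,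
      Fintype.card_fin]
  refine ⟨fun i => A.charpoly.roots.toList.get (i.cast hc.symm), ?_⟩
  conv_lhs => rw [h1]
  have : (∏ i : Fin n, (Polynomial.X - Polynomial.C
      (A.charpoly.roots.toList.get (i.cast hc.symm)))) = ∏ i : Fin A.charpoly.roots.toList.length,
        (Polynomial.X - Polynomial.C (A.charpoly.roots.toList.get i)) :=
    Fintype.prod_equiv (finCongr hc.symm) _ _ (fun i => rfl)
  rw [this, ← List.prod_ofFn]
  have h5 : List.ofFn (fun i => Polynomial.X - Polynomial.C (A.charpoly.roots.toList.get i)) =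
      A.charpoly.roots.toList.map (fun t => Polynomial.X - Polynomial.C t) := by
    conv_rhs => rw [← List.ofFn_get A.charpoly.roots.toList]
    rw [List.map_ofFn]; rfl
  rw [h5, ← Multiset.prod_coe, ← Multiset.map_coe, Multiset.coe_toList]

theorem eig_det {n : ℕ} {A : Mat n} {l : Fin n → ℂ}
    (h : A.charpoly = ∏ i, (Polynomial.X - Polynomial.C (l i))) : A.det = ∏ i, l i := by
  rw [Matrix.det_eq_sign_charpoly_coeff, h, Polynomial.coeff_zero_eq_eval_zero,
    Polynomial.eval_prod, Fintype.card_fin]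
  simp [Finset.prod_neg, ← mul_assoc, ← mul_pow]

theorem eig_pow_det {n : ℕ} {A : Mat n} {l : Fin n → ℂ}
    (h : A.charpoly = ∏ i, (Polynomial.X - Polynomial.C (l i))) (i : Fin n) (q : ℕ)
    (hq : l i ^ q = 1) : (A ^ q - 1).det = 0 := by
  have h1 : A.charpoly.eval (l i) = 0 := by
    rw [h, Polynomial.eval_prod]
    exact Finset.prod_eq_zero (Finset.mem_univ i) (by simp)
  rw [Matrix.eval_charpoly] at h1
  obtain ⟨v, hv, hv2⟩ := Matrix.exists_mulVec_eq_zero_iff.2 h1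
  refine Matrix.exists_mulVec_eq_zero_iff.1 ⟨v, hv, ?_⟩
  have h3 : A *ᵥ v = l i • v := by
    rw [Matrix.sub_mulVec, sub_eq_zero, Matrix.scalar_apply] at hv2
    rw [← hv2]; ext j; simp [Matrix.mulVec_diagonal]
  have h4 : ∀ r : ℕ, A ^ r *ᵥ v = l i ^ r • v := by
    intro r
    induction r with
    | zero => simp
    | succ r ih => rw [pow_succ', ← Matrix.mulVec_mulVec, ih, Matrix.mulVec_smul, h3, smul_smul,
        pow_succ]
  rw [Matrix.sub_mulVec, h4, hq]; simp

theorem resD_hol {n : ℕ} (m : Fin n → ℕ) {E : Type*} [NormedAddCommGroup E] [NormedSpace ℂ E]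
    {S : Set E} {f : E → Mat n} (hf : DifferentiableOn ℂ f S) :
    DifferentiableOn ℂ (fun e => resD m (f e)) S := by
  unfold resD
  generalize resQ m = q
  exact diffOn_mvp (f := fun e (i : Fin n) => (-1) ^ ((i : ℕ) + 1) *
    (f e).charpoly.coeff (n - (i + 1))) (fun i => (diffOn_charpoly hf _).const_mul _) q

theorem std_pow_ne {w : FreeGroup Bool} (hw : w ≠ 1) {q : ℕ} (hq : q ≠ 0) : w ^ q ≠ 1 := by
  intro h
  exact hw ((pow_eq_one_iff_left hq).1 h)

theorem resD_exists {w : FreeGroup Bool} (hw : w ≠ 1)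
    (hdet : ∀ (n : ℕ) (A : Tup Bool n), (wev w A).det = 1) :
    ∀ (n : ℕ) (m : Fin n → ℕ), (¬ ∀ i j, m i = m j) →
      ∃ A ∈ InvT Bool n, resD m (wev w A) ≠ 0 := by
  intro n
  induction n with
  | zero => intro m hm; exact absurd (fun i => i.elim0) hm
  | succ n ih =>
    intro m hm
    have hn : 1 ≤ n := by
      by_contra h0
      obtain rfl : n = 0 := by omega
      exact hm fun i j => by rw [show i = j from Fin.ext (by omega)]
    by_cases hk : ∃ (k0 : Fin (n + 1)) (c : ℕ), ∀ k, k ≠ k0 → m k = c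
    · obtain ⟨k0, c, hc⟩ := hk
      have hne : m k0 ≠ c := by
        intro h
        have : ∀ k, m k = c := fun k => by
          by_cases hh : k = k0
          · rw [hh, h]
          · exact hc k hh
        exact hm fun i j => by rw [this, this]
      let q := (m k0 - c) + (c - m k0)
      have hq : q ≠ 0 := by omega
      obtain ⟨u, hu⟩ := borel_E hn (std_pow_ne hw hq)
      refine ⟨fun b => (u b : Mat (n + 1)), fun b => gl_det_ne _, ?_⟩
      obtain ⟨l, hl⟩ := exists_eig (wev w (fun b => (u b : Mat (n + 1))))
      rw [resD_eq m _ l hl, Finset.prod_ne_zero_iff]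
      intro σ _ h0
      have hprod : ∏ k, l (σ k) = 1 := by
        rw [Equiv.prod_comp σ l, ← eig_det hl, hdet]
      have hpow : wev w (fun b => (u b : Mat (n + 1))) ^ q =
          ((FreeGroup.lift u (w ^ q) : GL (Fin (n + 1)) ℂ) : Mat (n + 1)) := by
        rw [wev, wgl_coe, map_pow]; rfl
      apply hu
      rw [← hpow]
      refine eig_pow_det hl (σ k0) q ?_
      have e1 : ∏ k, l (σ k) ^ m k = 1 := sub_eq_zero.1 h0
      rw [← Finset.mul_prod_erase _ _ (Finset.mem_univ k0)] at e1 hprod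
      have e2 : ∏ k ∈ Finset.univ.erase k0, l (σ k) ^ m k =
          (∏ k ∈ Finset.univ.erase k0, l (σ k)) ^ c := by
        rw [← Finset.prod_pow]
        exact Finset.prod_congr rfl fun k hk => by rw [hc k (Finset.ne_of_mem_erase hk)]
      rw [e2] at e1
      have e3 : l (σ k0) ^ m k0 = l (σ k0) ^ c := by
        have := congrArg (fun z => z ^ c) hprod
        simp only [mul_pow, one_pow] at this
        calc l (σ k0) ^ m k0 = l (σ k0) ^ m k0 * (l (σ k0) ^ c *
              (∏ k ∈ Finset.univ.erase k0, l (σ k)) ^ c) := by rw [this, mul_one]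
          _ = l (σ k0) ^ c * (l (σ k0) ^ m k0 *
              (∏ k ∈ Finset.univ.erase k0, l (σ k)) ^ c) := by ring
          _ = _ := by rw [e1, mul_one]
      have hl0 : l (σ k0) ≠ 0 := left_ne_zero_of_mul_eq_one hprod
      rcases lt_or_gt_of_ne hne with hlt | hlt
      · have hq2 : c = m k0 + q := by omega
        rw [hq2, pow_add] at e3
        exact (mul_left_cancel₀ (pow_ne_zero _ hl0) (e3.symm.trans (mul_one _).symm))
      · have hq2 : m k0 = c + q := by omega
        rw [hq2, pow_add] at e3
        exact (mul_left_cancel₀ (pow_ne_zero _ hl0) (e3.trans (mul_one _).symm))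
    · push Not at hk
      have hsub : ∀ k0 : Fin (n + 1), ¬ ∀ i j : Fin n, m (k0.succAbove i) = m (k0.succAbove j) := by
        intro k0 h
        obtain ⟨k, hk1, hk2⟩ := hk k0 (m (k0.succAbove ⟨0, hn⟩))
        obtain ⟨i, rfl⟩ := Fin.exists_succAbove_eq hk1
        exact hk2 (h _ _)
      obtain ⟨A, hA, hA2⟩ := HolT.prod_ne (ι := Bool) (n := n) (Finset.univ : Finset (Fin (n + 1)))
        (f := fun k0 A => resD (fun i => m (k0.succAbove i)) (wev w A))
        (fun k0 => resD_hol _ (HolT.wev w)) (fun k0 => ih _ (hsub k0))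
      let e : Fin 1 ⊕ Fin n ≃ Fin (n + 1) := finSumFinEquiv.trans (finCongr (by omega))
      let f : Mat n →* Mat (n + 1) :=
        { toFun := fun A => Matrix.reindex e e (Matrix.fromBlocks 1 0 0 A)
          map_one' := by simp
          map_mul' := by
            intro A B
            simp [Matrix.fromBlocks_multiply, Matrix.submatrix_mul_equiv] }
      let u : Bool → GL (Fin (n + 1)) ℂ := fun b => Units.map f (glOf (A b))
      refine ⟨fun b => (u b : Mat (n + 1)), fun b => gl_det_ne _, ?_⟩
      have hW : wev w (fun b => (u b : Mat (n + 1))) = f (wev w A) := by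
        rw [wev, wgl_coe, wev, wgl]
        have : FreeGroup.lift u = (Units.map f).comp (FreeGroup.lift fun b => glOf (A b)) := by
          ext b; simp [u]
        rw [this]; rfl
      rw [hW]
      obtain ⟨l, hl⟩ := exists_eig (wev w A)
      have hchar : (f (wev w A)).charpoly =
          ∏ i, (Polynomial.X - Polynomial.C ((Fin.cons 1 l : Fin (n + 1) → ℂ) i)) := by
        have : (f (wev w A)).charpoly = (Matrix.fromBlocks 1 0 0 (wev w A) :
          Matrix (Fin 1 ⊕ Fin n) (Fin 1 ⊕ Fin n) ℂ).charpoly := Matrix.charpoly_reindex _ _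
        rw [this, Matrix.charpoly_fromBlocks_zero₁₂, hl, Fin.prod_univ_succ]
        have h1 : (1 : Matrix (Fin 1) (Fin 1) ℂ).charpoly = Polynomial.X - 1 := by
          simp [Matrix.charpoly, Matrix.det_fin_one, Matrix.charmatrix]
        simp [h1]
      rw [resD_eq m _ _ hchar, Finset.prod_ne_zero_iff]
      intro σ _ h0
      let k0 := σ.symm 0
      have hA3 := hA2 k0 (Finset.mem_univ _)
      rw [resD_eq _ _ l hl, Finset.prod_ne_zero_iff] at hA3
      have hσ : ∀ i, σ (k0.succAbove i) ≠ 0 := by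
        intro i h
        have : k0.succAbove i = k0 := by simp only [k0]; rw [Equiv.eq_symm_apply]; exact h
        exact Fin.succAbove_ne _ _ this
      let s : Fin n → Fin n := fun i => (σ (k0.succAbove i)).pred (hσ i)
      have hs : Function.Injective s := by
        intro i j hij
        have := Fin.pred_inj.1 hij
        exact Fin.succAbove_right_injective (σ.injective this)
      have hb : Function.Bijective s := Finite.injective_iff_bijective.1 hs
      refine hA3 (Equiv.ofBijective s hb) (Finset.mem_univ _) ?_
      rw [← h0]
      congr 1
      rw [Fin.prod_univ_succAbove _ k0]
      have h6 : σ k0 = 0 := by simp [k0]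
      rw [h6]
      simp only [Fin.cons_zero, one_pow, one_mul]
      refine Finset.prod_congr rfl fun i _ => ?_
      have : σ (k0.succAbove i) = (s i).succ := by simp [s]
      rw [this, Fin.cons_succ]; rfl

/-! ### Residual freeness of surface groups -/

/-- the commutator of the two free generators -/
def kk : FreeGroup Bool := ⁅FreeGroup.of false, FreeGroup.of true⁆

theorem std_of_false : std (FreeGroup.of false) = stdX := by simp [std, stdGen]
theorem std_of_true : std (FreeGroup.of true) = stdY := by simp [std, stdGen]

theorem std_kk : (std kk : Matrix (Fin 2) (Fin 2) ℤ) = !![-1, 0; -6, -1] := by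
  rw [kk, map_commutatorElement, std_of_false, std_of_true, commutatorElement_def]
  simp only [Matrix.SpecialLinearGroup.coe_mul, stdX_val, stdY_val, stdX_inv_val, stdY_inv_val]
  ext i j; fin_cases i <;> fin_cases j <;> simp [Matrix.mul_apply, Fin.sum_univ_two]

theorem std_kk_inv : ((std kk)⁻¹ : SL 2 ℤ).1 = !![-1, 0; 6, -1] := by
  rw [Matrix.SpecialLinearGroup.coe_inv, std_kk]
  ext i j; fin_cases i <;> fin_cases j <;> simp [Matrix.adjugate_fin_two]

theorem std_kk_two (q : ℤ) : (std (kk ^ (2 * q)) : Matrix (Fin 2) (Fin 2) ℤ) =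
    !![1, 0; 12 * q, 1] := by
  induction q using Int.induction_on with
  | zero => simp; exact Matrix.one_fin_two
  | succ i ih =>
    rw [show (2 * ((i : ℤ) + 1)) = 2 * i + 1 + 1 by ring, _root_.zpow_add_one, _root_.zpow_add_one, map_mul,
      map_mul, Matrix.SpecialLinearGroup.coe_mul, Matrix.SpecialLinearGroup.coe_mul, ih, std_kk]
    ext a b; fin_cases a <;> fin_cases b <;> simp [Matrix.mul_apply, Fin.sum_univ_two]; ring
  | pred i ih =>
    rw [show (2 * (-(i : ℤ) - 1)) = 2 * -i - 1 - 1 by ring, _root_.zpow_sub_one, _root_.zpow_sub_one, map_mul,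
      map_mul, Matrix.SpecialLinearGroup.coe_mul, Matrix.SpecialLinearGroup.coe_mul, ih, map_inv,
      std_kk_inv]
    ext a b; fin_cases a <;> fin_cases b <;> simp [Matrix.mul_apply, Fin.sum_univ_two]; ring

theorem std_kk_odd (q : ℤ) : (std (kk ^ (2 * q + 1)) : Matrix (Fin 2) (Fin 2) ℤ) =
    !![-1, 0; -12 * q - 6, -1] := by
  rw [_root_.zpow_add_one, map_mul, Matrix.SpecialLinearGroup.coe_mul, std_kk_two, std_kk]
  ext a b; fin_cases a <;> fin_cases b <;> simp [Matrix.mul_apply, Fin.sum_univ_two]; ring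

/-- four entries reduced mod `p` -/
def redT (p : ℕ) (A : SL 2 ℤ) : ZMod p × ZMod p × ZMod p × ZMod p :=
  ((A.1 0 0 : ZMod p), (A.1 0 1 : ZMod p), (A.1 1 0 : ZMod p), (A.1 1 1 : ZMod p))

def mulT {p : ℕ} (a b : ZMod p × ZMod p × ZMod p × ZMod p) : ZMod p × ZMod p × ZMod p × ZMod p :=
  (a.1 * b.1 + a.2.1 * b.2.2.1, a.1 * b.2.1 + a.2.1 * b.2.2.2,
    a.2.2.1 * b.1 + a.2.2.2 * b.2.2.1, a.2.2.1 * b.2.1 + a.2.2.2 * b.2.2.2)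

theorem redT_mul (p : ℕ) (A B : SL 2 ℤ) : redT p (A * B) = mulT (redT p A) (redT p B) := by
  simp [redT, mulT, Matrix.mul_apply, Fin.sum_univ_two]

def l3 : List (ZMod 3 × ZMod 3 × ZMod 3 × ZMod 3) :=
  [(0, 1, 2, 0), (0, 2, 1, 0), (1, 0, 0, 1), (1, 1, 1, 2), (1, 2, 2, 2), (2, 0, 0, 2),
    (2, 1, 1, 1), (2, 2, 2, 1)]
def l4 : List (ZMod 4 × ZMod 4 × ZMod 4 × ZMod 4) :=
  [(0, 1, 3, 3), (0, 3, 1, 3), (1, 0, 0, 1), (1, 1, 1, 2), (1, 2, 2, 1), (1, 3, 3, 2),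
    (2, 1, 1, 1), (2, 3, 3, 1), (3, 0, 2, 3), (3, 1, 3, 0), (3, 2, 0, 3), (3, 3, 1, 0)]

theorem redT_mem (p : ℕ) (l : List (ZMod p × ZMod p × ZMod p × ZMod p))
    (h1 : redT p 1 ∈ l) (hX : redT p stdX ∈ l) (hY : redT p stdY ∈ l)
    (hX' : redT p stdX⁻¹ ∈ l) (hY' : redT p stdY⁻¹ ∈ l)
    (hm : ∀ a ∈ l, ∀ b ∈ l, mulT a b ∈ l) (w : FreeGroup Bool) : redT p (std w) ∈ l := by
  induction w using FreeGroup.induction_on with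
  | C1 => rw [map_one]; exact h1
  | of b => cases b
            · rw [std_of_false]; exact hX
            · rw [std_of_true]; exact hY
  | inv_of b _ => cases b
                  · rw [map_inv, std_of_false]; exact hX'
                  · rw [map_inv, std_of_true]; exact hY'
  | mul x y hx hy => rw [map_mul, redT_mul]; exact hm _ hx _ hy

set_option maxRecDepth 10000 in
theorem redT_3 (w : FreeGroup Bool) : redT 3 (std w) ∈ l3 := by
  refine redT_mem 3 l3 ?_ ?_ ?_ ?_ ?_ (by decide) w
  · simp [redT, l3]
  · rw [redT, stdX_val]; decide
  · rw [redT, stdY_val]; decide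
  · rw [redT, stdX_inv_val]; decide
  · rw [redT, stdY_inv_val]; decide

set_option maxRecDepth 10000 in
theorem redT_4 (w : FreeGroup Bool) : redT 4 (std w) ∈ l4 := by
  refine redT_mem 4 l4 ?_ ?_ ?_ ?_ ?_ (by decide) w
  · simp [redT, l4]
  · rw [redT, stdX_val]; decide
  · rw [redT, stdY_val]; decide
  · rw [redT, stdX_inv_val]; decide
  · rw [redT, stdY_inv_val]; decide

set_option maxRecDepth 10000 in
theorem l3_spec : ∀ a ∈ l3, a.2.1 = 0 → a.2.2.1 = 0 := by decide
set_option maxRecDepth 10000 in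
theorem l4_spec : ∀ a ∈ l4, a.2.1 = 0 → (a.1 = 1 ∧ a.2.2.1 = 0) ∨ (a.1 = 3 ∧ a.2.2.1 = 2) := by
  decide

theorem mem_kk_of_zero (w : FreeGroup Bool) (h : (std w).1 0 1 = 0) :
    ∃ n : ℤ, w = kk ^ n := by
  have h3 := l3_spec _ (redT_3 w) (by simp [redT, h])
  have h4 := l4_spec _ (redT_4 w) (by simp [redT, h])
  simp only [redT] at h3 h4
  have hd := (std w).2
  rw [Matrix.det_fin_two, h, zero_mul, sub_zero] at hd
  have h3' : (3 : ℤ) ∣ (std w).1 1 0 := by exact_mod_cast (ZMod.intCast_zmod_eq_zero_iff_dvd _ 3).1 h3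
  rcases Int.eq_one_or_neg_one_of_mul_eq_one' hd with ⟨e1, e2⟩ | ⟨e1, e2⟩
  · rcases h4 with h4 | h4
    · have h4' : (4 : ℤ) ∣ (std w).1 1 0 := by
        exact_mod_cast (ZMod.intCast_zmod_eq_zero_iff_dvd _ 4).1 h4.2
      obtain ⟨q, hq⟩ : (12 : ℤ) ∣ (std w).1 1 0 := by omega
      refine ⟨2 * q, std_injective (Subtype.ext ?_)⟩
      rw [std_kk_two]
      ext a b; fin_cases a <;> fin_cases b <;> simp [e1, e2, h, hq]
    · rw [e1] at h4; exact absurd h4.1 (by decide)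
  · rcases h4 with h4 | h4
    · rw [e1] at h4; exact absurd h4.1 (by decide)
    · have h4' : (4 : ℤ) ∣ (std w).1 1 0 - 2 := by
        refine (ZMod.intCast_zmod_eq_zero_iff_dvd _ 4).1 ?_
        push_cast; rw [h4.2]; decide
      obtain ⟨q, hq⟩ : (12 : ℤ) ∣ (std w).1 1 0 + 6 := by omega
      refine ⟨2 * (-q) + 1, std_injective (Subtype.ext ?_)⟩
      rw [std_kk_odd]
      ext a b; fin_cases a <;> fin_cases b <;> simp [e1, e2, h]
      omega

/-! genus two -/

/-- row vectors of polynomials along a list of matrices; `b = true` means conjugated side. -/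
theorem row_step (u v : Polynomial ℤ) (d : ℕ) (hu : u.natDegree ≤ d + 1) (hv : v.natDegree ≤ d)
    (huc : u.coeff (d + 1) ≠ 0) (W : SL 2 ℤ) (hW : W.1 0 1 ≠ 0) :
    (u * Polynomial.C (W.1 0 0) + v * Polynomial.C (W.1 1 0)).natDegree ≤ d + 1 ∧
    (u * Polynomial.C (W.1 0 1) + v * Polynomial.C (W.1 1 1)).natDegree ≤ d + 1 ∧
    (u * Polynomial.C (W.1 0 1) + v * Polynomial.C (W.1 1 1)).coeff (d + 1) ≠ 0 := by
  have key : ∀ a b : ℤ, (u * Polynomial.C a + v * Polynomial.C b).natDegree ≤ d + 1 := by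
    intro a b
    refine (Polynomial.natDegree_add_le _ _).trans (max_le ?_ ?_)
    · exact (Polynomial.natDegree_mul_C_le _ _).trans hu
    · exact (Polynomial.natDegree_mul_C_le _ _).trans (hv.trans (Nat.le_succ d))
  refine ⟨key _ _, key _ _, ?_⟩
  rw [Polynomial.coeff_add, Polynomial.coeff_mul_C, Polynomial.coeff_mul_C,
    Polynomial.coeff_eq_zero_of_natDegree_lt (p := v) (by omega)]
  simpa using ⟨huc, hW⟩

def Dm (τ : ℤ) : SL 2 ℤ := ⟨!![1, 0; τ, 1], by simp [Matrix.det_fin_two]⟩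

theorem Dm_val (τ : ℤ) : (Dm τ).1 = !![1, 0; τ, 1] := rfl
theorem Dm_inv (τ : ℤ) : ((Dm τ)⁻¹ : SL 2 ℤ).1 = !![1, 0; -τ, 1] := by
  rw [Matrix.SpecialLinearGroup.coe_inv, Dm_val]
  ext i j; fin_cases i <;> fin_cases j <;> simp [Matrix.adjugate_fin_two]

def letM (τ : ℤ) (x : Bool × SL 2 ℤ) : SL 2 ℤ := if x.1 then Dm τ * x.2 * (Dm τ)⁻¹ else x.2

def bz (b : Bool) : ℤ := if b then 1 else 0

theorem letM_row (τ : ℤ) (b : Bool) (W : SL 2 ℤ) (U v : ℤ) :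
    (![U, v] ᵥ* (letM τ (b, W)).1) =
      ![((U + bz b * τ * v) * W.1 0 0 + v * W.1 1 0) -
          bz b * τ * ((U + bz b * τ * v) * W.1 0 1 + v * W.1 1 1),
        (U + bz b * τ * v) * W.1 0 1 + v * W.1 1 1] := by
  cases b
  · ext i; fin_cases i <;> simp [letM, bz, Matrix.vecMul, dotProduct, Fin.sum_univ_two]
  · simp only [letM, bz, if_true, Matrix.SpecialLinearGroup.coe_mul, Dm_val, Dm_inv]
    ext i; fin_cases i <;> simp [Matrix.vecMul, dotProduct, Fin.sum_univ_two, Matrix.mul_apply]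
      <;> ring

theorem chain_poly : ∀ (L : List (Bool × SL 2 ℤ)) (x : Bool × SL 2 ℤ) (u v : Polynomial ℤ) (d : ℕ),
    (x :: L).IsChain (fun x y => x.1 ≠ y.1) → (∀ y ∈ L, y.2.1 0 1 ≠ 0) →
    u.natDegree ≤ d → v.natDegree ≤ d → v.coeff d ≠ 0 →
    ∃ V : Polynomial ℤ, V ≠ 0 ∧ ∀ τ : ℤ,
      (![u.eval τ - bz x.1 * τ * v.eval τ, v.eval τ] ᵥ* (L.map (letM τ)).prod.1) 1 = V.eval τ := by
  intro L
  induction L with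
  | nil =>
    intro x u v d _ _ _ _ hv
    refine ⟨v, fun h => hv (by simp [h]), fun τ => by simp⟩
  | cons y L ih =>
    intro x u v d hc hq hu hv hvc
    rw [List.isChain_cons_cons] at hc
    obtain ⟨hxy, hc⟩ := hc
    set ε : ℤ := bz y.1 - bz x.1 with hε
    have hε0 : ε ≠ 0 := by
      rcases x with ⟨_ | _, _⟩ <;> rcases y with ⟨_ | _, _⟩ <;> simp_all [bz]
    set u1 : Polynomial ℤ := u + Polynomial.C ε * (Polynomial.X * v) with hu1
    have h1 : u1.natDegree ≤ d + 1 := by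
      refine (Polynomial.natDegree_add_le _ _).trans (max_le (by omega) ?_)
      refine (Polynomial.natDegree_C_mul_le _ _).trans ?_
      refine (Polynomial.natDegree_mul_le).trans ?_
      rw [Polynomial.natDegree_X]; omega
    have h2 : u1.coeff (d + 1) ≠ 0 := by
      rw [hu1, Polynomial.coeff_add, Polynomial.coeff_eq_zero_of_natDegree_lt (p := u) (by omega),
        Polynomial.coeff_C_mul, Polynomial.coeff_X_mul]
      simpa using ⟨hε0, hvc⟩
    obtain ⟨k1, k2, k3⟩ := row_step u1 v d h1 hv h2 y.2 (hq y (by simp))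
    obtain ⟨V, hV, hV2⟩ := ih y _ _ (d + 1) hc (fun z hz => hq z (by simp [hz])) k1 k2 k3
    refine ⟨V, hV, fun τ => ?_⟩
    rw [← hV2 τ, List.map_cons, List.prod_cons, Matrix.SpecialLinearGroup.coe_mul,
      ← Matrix.vecMul_vecMul]
    congr 2
    rw [show y = (y.1, y.2) from rfl, letM_row]
    congr 1
    · simp only [hu1, hε, Polynomial.eval_add, Polynomial.eval_mul, Polynomial.eval_C,
        Polynomial.eval_X]; ring
    · congr 1
      simp only [hu1, hε, Polynomial.eval_add, Polynomial.eval_mul, Polynomial.eval_C,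
        Polynomial.eval_X]; ring

theorem chain_poly' (L : List (Bool × SL 2 ℤ)) (hL : L ≠ []) (hc : L.IsChain (fun x y => x.1 ≠ y.1))
    (hq : ∀ y ∈ L, y.2.1 0 1 ≠ 0) :
    ∃ V : Polynomial ℤ, V ≠ 0 ∧ ∀ τ : ℤ, (L.map (letM τ)).prod.1 0 1 = V.eval τ := by
  obtain ⟨x, L, rfl⟩ := List.exists_cons_of_ne_nil hL
  obtain ⟨V, hV, hV2⟩ := chain_poly L x (Polynomial.C (x.2.1 0 0)) (Polynomial.C (x.2.1 0 1)) 0 hc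
    (fun z hz => hq z (by simp [hz])) (by simp) (by simp) (by simpa using hq x (by simp))
  refine ⟨V, hV, fun τ => ?_⟩
  rw [← hV2 τ, List.map_cons, List.prod_cons, Matrix.SpecialLinearGroup.coe_mul]
  have : ∀ M : Matrix (Fin 2) (Fin 2) ℤ, M 0 1 = (![1, 0] ᵥ* M) 1 := by
    intro M; simp [Matrix.vecMul, dotProduct, Fin.sum_univ_two]
  refine (this _).trans ?_
  rw [← Matrix.vecMul_vecMul]
  congr 2
  rw [show x = (x.1, x.2) from rfl, letM_row]
  congr 1
  · simp
  · simp

/-! normal forms in the genus two group -/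

theorem kk_zero (n : ℤ) : (std (kk ^ n)).1 0 1 = 0 := by
  obtain ⟨q, rfl | rfl⟩ := Int.even_or_odd' n
  · rw [std_kk_two]; simp
  · rw [std_kk_odd]; simp

def Nz (w : FreeGroup Bool) : Prop := (std w).1 0 1 ≠ 0

theorem not_Nz {w : FreeGroup Bool} : ¬ Nz w ↔ ∃ n : ℤ, w = kk ^ n := by
  constructor
  · intro h; exact mem_kk_of_zero w (not_not.1 h)
  · rintro ⟨n, rfl⟩; exact not_not.2 (kk_zero n)

theorem Nz_kmul {w : FreeGroup Bool} (h : Nz w) (n : ℤ) : Nz (kk ^ n * w) := by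
  by_contra h1
  obtain ⟨m, hm⟩ := not_Nz.1 h1
  refine (not_Nz.2 ⟨-n + m, ?_⟩) h
  rw [_root_.zpow_add, ← hm]; group

def GoodL (L : List (Bool × FreeGroup Bool)) : Prop :=
  (∃ x, L = [x]) ∨ (L.IsChain (fun x y => x.1 ≠ y.1) ∧ ∀ x ∈ L, Nz x.2)

theorem GoodL.kmerge {x : Bool × FreeGroup Bool} {L : List (Bool × FreeGroup Bool)}
    (h : GoodL (x :: L)) (n : ℤ) : GoodL ((x.1, kk ^ n * x.2) :: L) := by
  rcases h with ⟨y, hy⟩ | ⟨hc, hz⟩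
  · left; simp at hy; simp [hy]
  · right
    refine ⟨?_, ?_⟩
    · cases L with
      | nil => simp
      | cons z L =>
        rw [List.isChain_cons_cons] at hc ⊢
        exact hc
    · intro y hy
      rcases List.mem_cons.1 hy with rfl | hy
      · exact Nz_kmul (hz x (by simp)) n
      · exact hz y (by simp [hy])

section
variable {G : Type*} [Group G] (ia : Bool → FreeGroup Bool →* G) (hk : ia false kk = ia true kk)

def evL (L : List (Bool × FreeGroup Bool)) : G := (L.map fun x => ia x.1 x.2).prod

theorem ia_switch (hk : ia false kk = ia true kk) (b c : Bool) (n : ℤ) :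
    ia b (kk ^ n) = ia c (kk ^ n) := by
  cases b <;> cases c <;> simp [map_zpow, hk]

theorem good_cons (hk : ia false kk = ia true kk) (x : Bool × FreeGroup Bool)
    (L : List (Bool × FreeGroup Bool)) (hL : GoodL L) :
    ∃ L', GoodL L' ∧ evL ia L' = ia x.1 x.2 * evL ia L := by
  cases L with
  | nil => exact ⟨[x], Or.inl ⟨x, rfl⟩, by simp [evL]⟩
  | cons y L =>
    by_cases hx : Nz x.2
    swap
    · obtain ⟨n, hn⟩ := not_Nz.1 hx
      refine ⟨_, hL.kmerge n, ?_⟩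
      simp only [evL, List.map_cons, List.prod_cons, map_mul]
      rw [hn, ia_switch ia hk x.1 y.1, mul_assoc]
    · by_cases hxy : x.1 = y.1
      · have hm : ia x.1 x.2 * evL ia (y :: L) = evL ia ((y.1, x.2 * y.2) :: L) := by
          simp [evL, hxy, mul_assoc]
        rw [hm]
        cases L with
        | nil => exact ⟨_, Or.inl ⟨_, rfl⟩, rfl⟩
        | cons z L =>
          have hL' : (y :: z :: L).IsChain (fun x y => x.1 ≠ y.1) ∧
              ∀ x ∈ (y :: z :: L), Nz x.2 := by
            rcases hL with ⟨w, hw⟩ | h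
            · simp at hw
            · exact h
          have hL2 : GoodL (z :: L) := Or.inr ⟨(List.isChain_cons_cons.1 hL'.1).2,
            fun w hw => hL'.2 w (List.mem_cons_of_mem _ hw)⟩
          by_cases hxy2 : Nz (x.2 * y.2)
          · refine ⟨_, Or.inr ⟨?_, ?_⟩, rfl⟩
            · exact List.isChain_cons_cons.2 (List.isChain_cons_cons.1 hL'.1)
            · intro w hw
              rcases List.mem_cons.1 hw with rfl | hw
              · exact hxy2
              · exact hL'.2 w (List.mem_cons_of_mem _ hw)
          · obtain ⟨n, hn⟩ := not_Nz.1 hxy2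
            refine ⟨_, hL2.kmerge n, ?_⟩
            simp only [evL, List.map_cons, List.prod_cons, map_mul]
            rw [← map_mul (ia y.1), hn, ia_switch ia hk z.1 y.1, mul_assoc]
      · by_cases hy : Nz y.2
        · refine ⟨x :: y :: L, Or.inr ⟨?_, ?_⟩, by simp [evL]⟩
          · rcases hL with ⟨w, hw⟩ | h
            · simp at hw
              rw [hw.2]; simpa using hxy
            · exact List.isChain_cons_cons.2 ⟨hxy, h.1⟩
          · intro w hw
            rcases List.mem_cons.1 hw with rfl | hw
            · exact hx
            · rcases hL with ⟨w', hw'⟩ | h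
              · simp at hw'
                rw [hw'.2] at hw; simp at hw; rw [hw]; exact hy
              · exact h.2 w hw
        · obtain ⟨n, hn⟩ := not_Nz.1 hy
          have : L = [] := by
            rcases hL with ⟨w', hw'⟩ | h
            · simp at hw'; exact hw'.2
            · exact absurd (h.2 y (by simp)) hy
          subst this
          refine ⟨[(x.1, x.2 * y.2)], Or.inl ⟨_, rfl⟩, ?_⟩
          simp only [evL, List.map_cons, List.prod_cons, map_mul, List.map_nil, List.prod_nil,
            mul_one]
          rw [hn, ia_switch ia hk x.1 y.1]

theorem good_exists (hk : ia false kk = ia true kk) (L : List (Bool × FreeGroup Bool)) :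
    ∃ L', GoodL L' ∧ evL ia L' = evL ia L := by
  induction L with
  | nil => exact ⟨[], Or.inr ⟨by simp, by simp⟩, rfl⟩
  | cons x L ih =>
    obtain ⟨L1, h1, h2⟩ := ih
    obtain ⟨L2, h3, h4⟩ := good_cons ia hk x L1 h1
    exact ⟨L2, h3, by rw [h4, h2]; simp [evL]⟩

end

abbrev sgen {g : ℕ} (i : Fin g) (b : Bool) : SurfaceGroup g := PresentedGroup.of (i, b)

theorem sg_rel (g : ℕ) : (List.ofFn fun i : Fin g => ⁅sgen i false, sgen i true⁆).prod = 1 := by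
  have h : PresentedGroup.mk ({surfaceRelator g} : Set (FreeGroup (Fin g × Bool)))
      (surfaceRelator g) = 1 := PresentedGroup.one_of_mem rfl
  have h2 : PresentedGroup.mk ({surfaceRelator g} : Set (FreeGroup (Fin g × Bool)))
      (surfaceRelator g) = (List.ofFn fun i : Fin g => ⁅sgen i false, sgen i true⁆).prod := by
    refine (congrArg (PresentedGroup.mk _) (show surfaceRelator g = (List.ofFn fun i : Fin g =>
      ⁅FreeGroup.of (i, false), FreeGroup.of (i, true)⁆).prod from rfl)).trans ?_
    rw [map_list_prod, List.map_ofFn]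
    rfl
  rw [← h2, h]

/-- homs out of the surface group -/
def sgLift {g : ℕ} {G : Type*} [Group G] (f : Fin g → Bool → G)
    (hf : (List.ofFn fun i : Fin g => ⁅f i false, f i true⁆).prod = 1) : SurfaceGroup g →* G :=
  PresentedGroup.toGroup (f := fun x : Fin g × Bool => f x.1 x.2) (by
    intro r hr
    rw [Set.mem_singleton_iff.1 hr, surfaceRelator, map_list_prod, List.map_ofFn, ← hf]
    congr 2
    funext i
    simp [map_commutatorElement])

@[simp] theorem sgLift_gen {g : ℕ} {G : Type*} [Group G] (f : Fin g → Bool → G)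
    (hf : (List.ofFn fun i : Fin g => ⁅f i false, f i true⁆).prod = 1) (i : Fin g) (b : Bool) :
    sgLift f hf (sgen i b) = f i b := PresentedGroup.toGroup.of _

theorem sg_hom_ext {g : ℕ} {G : Type*} [Group G] {f h : SurfaceGroup g →* G}
    (e : ∀ i b, f (sgen i b) = h (sgen i b)) : f = h :=
  PresentedGroup.ext fun x => e x.1 x.2

def ia2 (b : Bool) : FreeGroup Bool →* SurfaceGroup 2 :=
  if b then FreeGroup.lift (fun c => sgen 0 (!c)) else FreeGroup.lift (fun c => sgen 1 c)

theorem ia2_kk : ia2 false kk = ia2 true kk := by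
  have h := sg_rel 2
  simp only [List.ofFn_succ, List.ofFn_zero, List.prod_cons, List.prod_nil, mul_one] at h
  simp only [ia2, kk, map_commutatorElement]
  simp only [Bool.false_eq_true, if_false, if_true, FreeGroup.lift_apply_of, Bool.not_false,
    Bool.not_true]
  rw [← commutatorElement_inv (sgen 0 false)]
  exact eq_inv_of_mul_eq_one_right h

theorem evL_surj (δ : SurfaceGroup 2) : ∃ L, evL ia2 L = δ := by
  let H : Subgroup (SurfaceGroup 2) := (ia2 false).range ⊔ (ia2 true).range
  obtain ⟨w, rfl⟩ := PresentedGroup.mk_surjective _ δ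
  have h1 : ∀ (b : Bool) (u : FreeGroup Bool), ∃ L, evL ia2 L = ia2 b u :=
    fun b u => ⟨[(b, u)], by simp [evL]⟩
  have h2 : ∀ x y : SurfaceGroup 2, (∃ L, evL ia2 L = x) → (∃ L, evL ia2 L = y) →
      ∃ L, evL ia2 L = x * y := by
    rintro x y ⟨L, rfl⟩ ⟨M, rfl⟩
    exact ⟨L ++ M, by simp [evL]⟩
  have h3 : ∀ (i : Fin 2) (c : Bool), ∃ b u, ia2 b u = sgen i c ∧ ia2 b u⁻¹ = (sgen i c)⁻¹ := by
    intro i c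
    fin_cases i
    · refine ⟨true, FreeGroup.of (!c), ?_, ?_⟩ <;> simp [ia2]
    · refine ⟨false, FreeGroup.of c, ?_, ?_⟩ <;> simp [ia2]
  induction w using FreeGroup.induction_on with
  | C1 => exact ⟨[], by simp [evL]⟩
  | of x => obtain ⟨b, u, e, -⟩ := h3 x.1 x.2
            obtain ⟨L, hL⟩ := h1 b u
            exact ⟨L, hL.trans e⟩
  | inv_of x _ => obtain ⟨b, u, -, e⟩ := h3 x.1 x.2
                  obtain ⟨L, hL⟩ := h1 b u⁻¹
                  exact ⟨L, hL.trans (e.trans (map_inv _ _).symm)⟩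
  | mul x y hx hy => rw [map_mul]; exact h2 _ _ hx hy

/-- the folding homs `Γ₂ → F₂` -/
def fold2 (q : ℕ) : SurfaceGroup 2 →* FreeGroup Bool :=
  sgLift (fun i c => if i = 0 then kk ^ (2 * (q : ℤ)) * FreeGroup.of (!c) * (kk ^ (2 * (q : ℤ)))⁻¹
    else FreeGroup.of c) (by
    simp only [List.ofFn_succ, List.ofFn_zero, List.prod_cons, List.prod_nil, mul_one]
    simp only [Fin.succ_zero_eq_one, if_true, one_ne_zero, if_false, Bool.not_false, Bool.not_true]
    have : ∀ a b c : FreeGroup Bool, ⁅c * a * c⁻¹, c * b * c⁻¹⁆ = c * ⁅a, b⁆ * c⁻¹ := by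
      intro a b c; simp only [commutatorElement_def]; group
    rw [this, ← commutatorElement_inv, ← kk]; group)

theorem fold2_ia (q : ℕ) (b : Bool) (w : FreeGroup Bool) :
    fold2 q (ia2 b w) = if b then kk ^ (2 * (q : ℤ)) * w * (kk ^ (2 * (q : ℤ)))⁻¹ else w := by
  cases b
  · have : (fold2 q).comp (ia2 false) = MonoidHom.id _ := by
      ext c; simp [ia2, fold2]
    exact DFunLike.congr_fun this w
  · have : (fold2 q).comp (ia2 true) = (MulAut.conj (kk ^ (2 * (q : ℤ)))).toMonoidHom := by
      ext c
      simp only [ia2, fold2, if_true, MonoidHom.comp_apply, FreeGroup.lift_apply_of, sgLift_gen,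
        Bool.not_not, MulEquiv.toMonoidHom_eq_coe, MonoidHom.coe_coe, MulAut.conj_apply]
    exact DFunLike.congr_fun this w

theorem std_fold2 (q : ℕ) (x : Bool × FreeGroup Bool) :
    std (fold2 q (ia2 x.1 x.2)) = letM (12 * q) (x.1, std x.2) := by
  rw [fold2_ia, letM]
  have : std (kk ^ (2 * (q : ℤ))) = Dm (12 * q) := Subtype.ext (by rw [std_kk_two, Dm_val])
  split_ifs with h
  · rw [map_mul, map_mul, map_inv, this]
  · rfl

theorem resfree2 (δ : SurfaceGroup 2) (hδ : δ ≠ 1) : ∀ᶠ q in Filter.atTop, fold2 q δ ≠ 1 := by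
  obtain ⟨L0, rfl⟩ := evL_surj δ
  obtain ⟨L, hL, e⟩ := good_exists ia2 ia2_kk L0
  rw [← e] at hδ ⊢
  rcases hL with ⟨x, rfl⟩ | ⟨hc, hz⟩
  · simp only [evL, List.map_cons, List.map_nil, List.prod_cons, List.prod_nil, mul_one] at hδ ⊢
    refine Filter.Eventually.of_forall fun q h => hδ ?_
    rw [fold2_ia] at h
    have : x.2 = 1 := by
      split_ifs at h
      · rwa [mul_inv_eq_one, mul_eq_left] at h
      · exact h
    rw [this, map_one]
  · have hne : L ≠ [] := by rintro rfl; exact hδ (by simp [evL])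
    have hcm : (L.map fun x => (x.1, std x.2)).IsChain (fun x y => x.1 ≠ y.1) := by
      rw [List.isChain_map]; exact hc
    obtain ⟨V, hV, hV2⟩ := chain_poly' (L.map fun x => (x.1, std x.2)) (by simpa using hne) hcm
      (by
        intro y hy
        obtain ⟨x, hx, rfl⟩ := List.mem_map.1 hy
        exact hz x hx)
    have hfin : {q : ℕ | V.eval (12 * (q : ℤ)) = 0}.Finite := by
      have : {t : ℤ | V.eval t = 0}.Finite := by
        refine (V.roots.toFinset.finite_toSet).subset fun t ht => ?_
        simpa [hV] using ht
      exact this.preimage (fun a _ b _ h => by simpa using h)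
    have := hfin.eventually_cofinite_notMem
    rw [Nat.cofinite_eq_atTop] at this
    filter_upwards [this] with q hq h1
    apply hq
    change V.eval (12 * (q : ℤ)) = 0
    rw [← hV2, List.map_map]
    have e2 : (L.map (letM (12 * (q : ℤ)) ∘ fun x => (x.1, std x.2))).prod =
        std (fold2 q (evL ia2 L)) := by
      rw [evL, map_list_prod, map_list_prod, List.map_map, List.map_map]
      congr 1
      refine List.map_congr_left fun x _ => ?_
      exact (std_fold2 q x).symm
    rw [e2, h1, map_one]
    simp

/-! ### all genera embed in genus two -/

abbrev NF : Type := FreeGroup (Option (ℤ × Bool))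
abbrev nx (k : ℤ) (c : Bool) : NF := FreeGroup.of (some (k, c))
abbrev nb : NF := FreeGroup.of none

def thF : NF →* NF := FreeGroup.lift fun o => match o with
  | none => ⁅nx 0 false, nx 0 true⁆⁻¹ * nb
  | some (k, c) => nx (k + 1) c

def thB : NF →* NF := FreeGroup.lift fun o => match o with
  | none => ⁅nx (-1) false, nx (-1) true⁆ * nb
  | some (k, c) => nx (k - 1) c

theorem thF_x (k : ℤ) (c : Bool) : thF (nx k c) = nx (k + 1) c := by simp [thF]
theorem thF_b : thF nb = ⁅nx 0 false, nx 0 true⁆⁻¹ * nb := by simp [thF]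
theorem thB_x (k : ℤ) (c : Bool) : thB (nx k c) = nx (k - 1) c := by simp [thB]
theorem thB_b : thB nb = ⁅nx (-1) false, nx (-1) true⁆ * nb := by simp [thB]

def theta : MulAut NF :=
  MonoidHom.toMulEquiv thF thB
    (by
      apply FreeGroup.ext_hom
      rintro (_ | ⟨k, c⟩)
      · change thB (thF nb) = nb
        rw [thF_b, map_mul, map_inv, map_commutatorElement, thB_x, thB_x, thB_b]
        simp only [zero_sub, inv_mul_cancel_left]
      · change thB (thF (nx k c)) = nx k c
        rw [thF_x, thB_x]; simp)
    (by
      apply FreeGroup.ext_hom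
      rintro (_ | ⟨k, c⟩)
      · change thF (thB nb) = nb
        rw [thB_b, map_mul, map_commutatorElement, thF_x, thF_x, thF_b]
        simp only [neg_add_cancel, mul_inv_cancel_left]
      · change thF (thB (nx k c)) = nx k c
        rw [thB_x, thF_x]; simp)

theorem theta_x (k : ℤ) (c : Bool) : theta (nx k c) = nx (k + 1) c := thF_x k c
theorem theta_b : theta nb = ⁅nx 0 false, nx 0 true⁆⁻¹ * nb := thF_b

theorem theta_pow_x (m : ℕ) (k : ℤ) (c : Bool) : (theta ^ m) (nx k c) = nx (k + m) c := by
  induction m generalizing k with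
  | zero => simp
  | succ m ih => rw [pow_succ, MulAut.mul_apply, theta_x, ih, show k + 1 + (m : ℤ) = k + ((m + 1 : ℕ) : ℤ) by push_cast; ring]

def relN (m : ℕ) : NF := (List.ofFn fun i : Fin m => ⁅nx (i : ℕ) false, nx (i : ℕ) true⁆).prod

theorem relN_succ (m : ℕ) : relN (m + 1) = relN m * ⁅nx m false, nx m true⁆ := by
  rw [relN, List.ofFn_succ', List.concat_eq_append, List.prod_append]
  simp [relN]

theorem theta_pow_b (m : ℕ) : (theta ^ m) nb = (relN m)⁻¹ * nb := by
  induction m with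
  | zero => simp [relN]
  | succ m ih =>
    rw [pow_succ, MulAut.mul_apply, theta_b, map_mul, map_inv, map_commutatorElement, theta_pow_x,
      theta_pow_x, ih, relN_succ, _root_.mul_inv_rev, zero_add, mul_assoc]

def PhiM (m : ℕ) : Multiplicative ℤ →* MulAut NF :=
  (zpowersHom (MulAut NF) theta).comp (powMonoidHom m)

theorem PhiM_apply (m : ℕ) (k : Multiplicative ℤ) :
    PhiM m k = (theta ^ m) ^ (Multiplicative.toAdd k) := by
  simp only [PhiM, MonoidHom.comp_apply, powMonoidHom_apply, zpowersHom_apply]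
  rw [toAdd_pow, ← _root_.zpow_natCast theta, ← _root_.zpow_mul]; simp

abbrev PP (m : ℕ) : Type := NF ⋊[PhiM m] Multiplicative ℤ

def tt : Multiplicative ℤ := Multiplicative.ofAdd 1

theorem prod_ofFn_succ {G : Type*} [Group G] (m : ℕ) (f : Fin (m + 1) → G) :
    (List.ofFn f).prod = (List.ofFn fun i : Fin m => f i.castSucc).prod * f (Fin.last m) := by
  rw [List.ofFn_succ', List.concat_eq_append, List.prod_append]; simp

/-- assemble a handle function -/
def hcase {G : Type*} {m : ℕ} (f : Fin m → Bool → G) (l : Bool → G) (i : Fin (m + 1)) : Bool → G :=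
  Fin.lastCases (motive := fun _ => Bool → G) l f i

@[simp] theorem hcase_castSucc {G : Type*} {m : ℕ} (f : Fin m → Bool → G) (l : Bool → G) (i : Fin m) :
    hcase f l i.castSucc = f i := Fin.lastCases_castSucc ..
@[simp] theorem hcase_last {G : Type*} {m : ℕ} (f : Fin m → Bool → G) (l : Bool → G) :
    hcase f l (Fin.last m) = l := Fin.lastCases_last ..

def etaM (m : ℕ) : SurfaceGroup (m + 1) →* PP m :=
  sgLift (hcase (fun i c => SemidirectProduct.inl (nx (i : ℕ) c))
    (fun c => if c then SemidirectProduct.inl nb else SemidirectProduct.inr tt)) (by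
    rw [prod_ofFn_succ]
    simp only [hcase_castSucc, hcase_last]
    have h1 : (List.ofFn fun i : Fin m => ⁅(SemidirectProduct.inl (nx (i : ℕ) false) : PP m),
        (SemidirectProduct.inl (nx (i : ℕ) true) : PP m)⁆).prod =
        (SemidirectProduct.inl (relN m) : PP m) := by
      rw [relN, map_list_prod, List.map_ofFn]
      congr 2
    rw [h1]
    simp only [Bool.false_eq_true, if_false, if_true, commutatorElement_def]
    rw [← map_inv (SemidirectProduct.inr (N := NF) (φ := PhiM m)), ← SemidirectProduct.inl_aut, PhiM_apply]
    have : Multiplicative.toAdd tt = 1 := rfl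
    rw [this, zpow_one, theta_pow_b, ← map_inv, ← map_mul, ← map_mul]
    simp)

theorem conj_zpow_fn {N H : Type*} [Group N] [Group H] (Th : MulAut N) (fn : N →* H) (t : H)
    (h : ∀ n, fn (Th n) = t * fn n * t⁻¹) (k : ℤ) :
    ∀ n, fn ((Th ^ k) n) = t ^ k * fn n * (t ^ k)⁻¹ := by
  induction k using Int.induction_on with
  | zero => simp
  | succ i ih =>
    intro n
    rw [_root_.zpow_add_one, MulAut.mul_apply, ih, h, _root_.zpow_add_one]; group
  | pred i ih =>
    intro n
    rw [_root_.zpow_sub_one, MulAut.mul_apply, ih, _root_.zpow_sub_one]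
    have : fn (Th⁻¹ n) = t⁻¹ * fn n * t := by
      have := h (Th⁻¹ n)
      rw [MulAut.apply_inv_self] at this
      rw [this]; group
    rw [this]; group

def psiN (m : ℕ) (hm : 0 < m) : NF →* SurfaceGroup (m + 1) :=
  FreeGroup.lift fun o => match o with
  | none => sgen (Fin.last m) true
  | some (k, c) => sgen (Fin.last m) false ^ (k / m) *
      sgen (Fin.castSucc ⟨(k % m).toNat, by
        have := Int.emod_lt_of_pos k (b := m) (by omega)
        have := Int.emod_nonneg k (b := m) (by omega); omega⟩) c *
      (sgen (Fin.last m) false ^ (k / m))⁻¹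

theorem psiN_b (m : ℕ) (hm : 0 < m) : psiN m hm nb = sgen (Fin.last m) true := by simp [psiN]

theorem psiN_x (m : ℕ) (hm : 0 < m) (i : Fin m) (k : ℤ) (c : Bool) :
    psiN m hm (nx (i + m * k) c) = sgen (Fin.last m) false ^ k * sgen i.castSucc c *
      (sgen (Fin.last m) false ^ k)⁻¹ := by
  have hi := i.2
  have h1 : ((i : ℤ) + m * k) / m = k := by
    rw [Int.add_mul_ediv_left _ _ (by omega), Int.ediv_eq_zero_of_lt (by omega) (by omega), zero_add]
  have h2 : ((i : ℤ) + m * k) % m = i := by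
    rw [Int.add_mul_emod_self_left, Int.emod_eq_of_lt (by omega) (by omega)]
  simp only [psiN, FreeGroup.lift_apply_of, h1, h2]
  simp

theorem psiN_x0 (m : ℕ) (hm : 0 < m) (i : Fin m) (c : Bool) :
    psiN m hm (nx (i : ℕ) c) = sgen i.castSucc c := by
  have := psiN_x m hm i 0 c
  simpa using this

theorem sg_rel_last (m : ℕ) : (List.ofFn fun i : Fin m =>
    ⁅sgen (g := m + 1) i.castSucc false, sgen i.castSucc true⁆).prod *
      ⁅sgen (Fin.last m) false, sgen (Fin.last m) true⁆ = 1 := by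
  rw [← prod_ofFn_succ m (fun i => ⁅sgen i false, sgen i true⁆)]; exact sg_rel (m + 1)

theorem psiN_theta (m : ℕ) (hm : 0 < m) (n : NF) :
    psiN m hm ((theta ^ m) n) = sgen (Fin.last m) false * psiN m hm n *
      (sgen (Fin.last m) false)⁻¹ := by
  have : (psiN m hm).comp (theta ^ m).toMonoidHom =
      (MulAut.conj (sgen (Fin.last m) false)).toMonoidHom.comp (psiN m hm) := by
    apply FreeGroup.ext_hom
    rintro (_ | ⟨k, c⟩)
    · change psiN m hm ((theta ^ m) nb) = sgen (Fin.last m) false * psiN m hm nb *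
        (sgen (Fin.last m) false)⁻¹
      rw [theta_pow_b, map_mul, map_inv, psiN_b, relN, map_list_prod, List.map_ofFn]
      have h := sg_rel_last m
      have e : (psiN m hm ∘ fun i : Fin m => ⁅nx (i : ℕ) false, nx (i : ℕ) true⁆) =
          fun i => ⁅sgen i.castSucc false, sgen i.castSucc true⁆ := by
        funext i
        simp only [Function.comp, map_commutatorElement, psiN_x0]
      rw [e, inv_eq_of_mul_eq_one_right h, commutatorElement_def]
      group
    · change psiN m hm ((theta ^ m) (nx k c)) = sgen (Fin.last m) false * psiN m hm (nx k c) *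
        (sgen (Fin.last m) false)⁻¹
      have hk := Int.emod_add_mul_ediv k m
      have h1 := Int.emod_lt_of_pos k (b := m) (by omega)
      have h2 := Int.emod_nonneg k (b := m) (by omega)
      obtain ⟨i, hi⟩ : ∃ i : Fin m, ((i : ℕ) : ℤ) = k % m := ⟨⟨(k % m).toNat, by omega⟩, by
        simp [h2]⟩
      rw [theta_pow_x, ← hk, ← hi, psiN_x, show ((i : ℕ) : ℤ) + m * (k / m) + m =
        (i : ℕ) + m * (k / m + 1) by ring, psiN_x, add_comm (k / m) 1, _root_.zpow_add]
      group
  exact DFunLike.congr_fun this n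

def psiM (m : ℕ) (hm : 0 < m) : PP m →* SurfaceGroup (m + 1) :=
  SemidirectProduct.lift (psiN m hm) (zpowersHom _ (sgen (Fin.last m) false)) (by
    intro k
    ext n
    change psiN m hm (PhiM m k (FreeGroup.of n)) = _
    rw [PhiM_apply, conj_zpow_fn _ _ _ (psiN_theta m hm)]
    rfl)

theorem psi_eta (m : ℕ) (hm : 0 < m) (δ : SurfaceGroup (m + 1)) : psiM m hm (etaM m δ) = δ := by
  have : (psiM m hm).comp (etaM m) = MonoidHom.id _ := by
    apply sg_hom_ext
    intro i c
    induction i using Fin.lastCases with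
    | last =>
      cases c
      · simp [etaM, psiM, tt]
      · simp [etaM, psiM, psiN_b]
    | cast i =>
      simp only [etaM, psiM, MonoidHom.comp_apply, sgLift_gen, hcase_castSucc,
        SemidirectProduct.lift_inl, MonoidHom.id_apply]
      exact psiN_x0 m hm i c
  exact DFunLike.congr_fun this δ

def incM (m : ℕ) : PP m →* PP 1 :=
  SemidirectProduct.map (MonoidHom.id _) (powMonoidHom m) (by
    intro k
    ext n
    simp [PhiM])

theorem incM_inj (m : ℕ) (hm : 0 < m) : Function.Injective (incM m) := by
  intro x y h
  have h1 := congrArg SemidirectProduct.left h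
  have h2 := congrArg SemidirectProduct.right h
  simp only [incM, SemidirectProduct.map_left, SemidirectProduct.map_right, MonoidHom.id_apply,
    powMonoidHom_apply] at h1 h2
  refine SemidirectProduct.ext h1 ?_
  have := congrArg Multiplicative.toAdd h2
  simp only [toAdd_pow] at this
  have h3 : (m : ℤ) * Multiplicative.toAdd x.right = m * Multiplicative.toAdd y.right := by
    simpa using this
  exact Multiplicative.toAdd.injective (mul_left_cancel₀ (by omega) h3)

def iotaM (m : ℕ) : SurfaceGroup (m + 1) →* SurfaceGroup 2 :=
  sgLift (hcase (fun i c => sgen 1 false ^ (i : ℕ) * sgen 0 c * (sgen 1 false ^ (i : ℕ))⁻¹)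
    (fun c => if c then sgen 1 true else sgen 1 false ^ m)) (by
    rw [prod_ofFn_succ]
    simp only [hcase_castSucc, hcase_last, Bool.false_eq_true, if_false, if_true]
    have h := sg_rel 2
    simp only [List.ofFn_succ, List.ofFn_zero, List.prod_cons, List.prod_nil, mul_one] at h
    simp only [Fin.succ_zero_eq_one] at h
    generalize sgen (1 : Fin 2) false = a at *
    generalize sgen (1 : Fin 2) true = b at *
    have hc : ∀ i : ℕ, ⁅a ^ i * sgen 0 false * (a ^ i)⁻¹, a ^ i * sgen 0 true * (a ^ i)⁻¹⁆ =
        a ^ i * ⁅b, a⁆ * (a ^ i)⁻¹ := by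
      intro i
      rw [← commutatorElement_inv a b, ← eq_inv_of_mul_eq_one_left h]
      simp only [commutatorElement_def]; group
    simp only [hc]
    have key : ∀ m : ℕ, (List.ofFn fun i : Fin m => a ^ (i : ℕ) * ⁅b, a⁆ * (a ^ (i : ℕ))⁻¹).prod =
        b * a ^ m * b⁻¹ * (a ^ m)⁻¹ := by
      intro m
      induction m with
      | zero => simp
      | succ m ih =>
        rw [prod_ofFn_succ]
        simp only [Fin.val_castSucc, Fin.val_last]
        rw [ih, commutatorElement_def, pow_succ']
        group
    rw [key, commutatorElement_def]; group)

theorem inc_eta (m : ℕ) (δ : SurfaceGroup (m + 1)) :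
    incM m (etaM m δ) = etaM 1 (iotaM m δ) := by
  have e0 : ∀ c, etaM 1 (sgen (0 : Fin 2) c) = SemidirectProduct.inl (nx 0 c) := by
    intro c
    have : (0 : Fin 2) = Fin.castSucc (0 : Fin 1) := rfl
    rw [this, etaM, sgLift_gen, hcase_castSucc]; rfl
  have e1 : ∀ c, etaM 1 (sgen (1 : Fin 2) c) =
      if c then SemidirectProduct.inl nb else SemidirectProduct.inr tt := by
    intro c
    have : (1 : Fin 2) = Fin.last 1 := rfl
    rw [this, etaM, sgLift_gen, hcase_last]
  have : (incM m).comp (etaM m) = (etaM 1).comp (iotaM m) := by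
    apply sg_hom_ext
    intro i c
    induction i using Fin.lastCases with
    | last =>
      simp only [MonoidHom.comp_apply, iotaM, etaM, sgLift_gen, hcase_last]
      rw [← etaM]
      cases c
      · simp only [Bool.false_eq_true, if_false, map_pow, e1]
        simp [incM]
      · simp only [if_true, e1]
        simp [incM]
    | cast i =>
      simp only [MonoidHom.comp_apply, iotaM, etaM, sgLift_gen, hcase_castSucc]
      rw [← etaM]
      simp only [map_mul, map_inv, map_pow, e0, e1, Bool.false_eq_true, if_false]
      rw [← map_pow, ← map_inv, ← SemidirectProduct.inl_aut, PhiM_apply]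
      have : Multiplicative.toAdd (tt ^ (i : ℕ)) = (i : ℕ) := by simp [tt]
      rw [this, pow_one, zpow_natCast, theta_pow_x]
      simp [incM]
  exact DFunLike.congr_fun this δ

theorem iotaM_inj (m : ℕ) (hm : 0 < m) : Function.Injective (iotaM m) := by
  intro x y h
  have h2 : incM m (etaM m x) = incM m (etaM m y) := by rw [inc_eta, inc_eta, h]
  have h3 := incM_inj m hm h2
  rw [← psi_eta m hm x, h3, psi_eta]

theorem resfree (g : ℕ) (hg : 2 ≤ g) : ∃ φ : ℕ → SurfaceGroup g →* FreeGroup Bool,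
    ∀ δ, δ ≠ 1 → ∀ᶠ s in Filter.atTop, φ s δ ≠ 1 := by
  obtain ⟨m, rfl⟩ : ∃ m, g = m + 1 := ⟨g - 1, by omega⟩
  refine ⟨fun s => (fold2 s).comp (iotaM m), fun δ hδ => ?_⟩
  exact resfree2 (iotaM m δ) (fun h => hδ (iotaM_inj m (by omega) (by rw [h, map_one])))

/-! ### Zariski closures of sets of complex matrices -/

noncomputable def pev {n : ℕ} (P : MvPolynomial (Fin n × Fin n) ℂ) (A : Mat n) : ℂ :=
  eval (fun p => A p.1 p.2) P

def Zc {n : ℕ} (H : Set (Mat n)) : Set (Mat n) :=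
  {A | ∀ P : MvPolynomial (Fin n × Fin n) ℂ, (∀ h ∈ H, pev P h = 0) → pev P A = 0}

theorem Zc_of_mem {n : ℕ} {H : Set (Mat n)} {A : Mat n} (h : A ∈ H) : A ∈ Zc H :=
  fun _ hP => hP A h

theorem pev_subst {n : ℕ} {σ : Type} (P : MvPolynomial (Fin n × Fin n) ℂ)
    (Q : Fin n × Fin n → MvPolynomial σ ℂ) (v : σ → ℂ) :
    eval v (bind₁ Q P) = pev P (Matrix.of fun i j => eval v (Q (i, j))) := by
  rw [pev, ← MvPolynomial.coe_aeval_eq_eval, ← MvPolynomial.coe_aeval_eq_eval]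
  simp only [RingHom.coe_coe]
  rw [aeval_bind₁]
  rfl

/-- left and right multiplication by constants -/
theorem pev_mul {n : ℕ} (P : MvPolynomial (Fin n × Fin n) ℂ) (B C : Mat n) :
    ∃ Q : MvPolynomial (Fin n × Fin n) ℂ, ∀ A, pev Q A = pev P (B * A * C) := by
  refine ⟨bind₁ (fun p => ∑ k, (∑ l, MvPolynomial.C (B p.1 l) * X (l, k)) *
    MvPolynomial.C (C k p.2)) P, fun A => ?_⟩
  rw [pev, pev_subst]
  congr 1
  ext i j
  simp [Matrix.mul_apply]

theorem Zc_mul {n : ℕ} {H : Set (Mat n)} (hH : ∀ a ∈ H, ∀ b ∈ H, a * b ∈ H) {A B : Mat n}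
    (hA : A ∈ Zc H) (hB : B ∈ Zc H) : A * B ∈ Zc H := by
  have h1 : ∀ b ∈ H, A * b ∈ Zc H := by
    intro b hb P hP
    obtain ⟨Q, hQ⟩ := pev_mul P 1 b
    simp only [one_mul] at hQ
    rw [← hQ]
    exact hA Q fun h hh => by rw [hQ]; exact hP _ (hH _ hh _ hb)
  intro P hP
  obtain ⟨Q, hQ⟩ := pev_mul P A 1
  simp only [mul_one] at hQ
  rw [← hQ]
  exact hB Q fun h hh => by rw [hQ]; exact h1 h hh P hP

theorem Zc_closed {n : ℕ} (H : Set (Mat n)) : IsClosed (Zc H) := by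
  have : Zc H = ⋂ P : MvPolynomial (Fin n × Fin n) ℂ, ⋂ _ : (∀ h ∈ H, pev P h = 0),
      {A | pev P A = 0} := by
    ext A; simp [Zc]
  rw [this]
  refine isClosed_iInter fun P => isClosed_iInter fun _ => ?_
  refine isClosed_eq ?_ continuous_const
  exact (MvPolynomial.continuous_eval P).comp (by fun_prop)

/-- independence of characters: the torus lies in the closure of the powers. -/
theorem torus_mem {n : ℕ} (q : MvPolynomial (Fin n) ℂ) (l d : Fin n → ℂ)
    (hl : ∏ i, l i = 1) (hd : ∏ i, d i = 1)
    (hres : ∀ m : Fin n → ℕ, ∏ i, l i ^ m i = 1 → ∀ i j, m i = m j)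
    (hq : ∀ k : ℕ, eval (fun i => l i ^ k) q = 0) : eval d q = 0 := by
  classical
  have hl0 : ∀ i, l i ≠ 0 := fun i h => by
    rw [Finset.prod_eq_zero (Finset.mem_univ i) h] at hl; exact zero_ne_one hl
  have hev : ∀ v : Fin n → ℂ, eval v q = ∑ m ∈ q.support, coeff m q * ∏ i, v i ^ m i :=
    fun v => MvPolynomial.eval_eq' v q
  have hwd : ∀ m m' : Fin n →₀ ℕ, ∏ i, l i ^ m i = ∏ i, l i ^ m' i →
      ∏ i, d i ^ m i = ∏ i, d i ^ m' i := by
    intro m m' h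
    obtain ⟨N, hN⟩ : ∃ N, ∀ i, m' i ≤ N := ⟨∑ i, m' i, fun i =>
      Finset.single_le_sum (f := fun i => m' i) (fun _ _ => Nat.zero_le _) (Finset.mem_univ i)⟩
    have e1 : ∀ v : Fin n → ℂ, ∏ i, v i = 1 →
        (∏ i, v i ^ (m i + (N - m' i))) * ∏ i, v i ^ m' i = ∏ i, v i ^ m i := by
      intro v hv
      rw [← Finset.prod_mul_distrib]
      calc _ = ∏ i, v i ^ m i * v i ^ N := by
            refine Finset.prod_congr rfl fun i _ => ?_
            rw [← pow_add, ← pow_add]; congr 1; have := hN i; omega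
        _ = _ := by rw [Finset.prod_mul_distrib, Finset.prod_pow, hv, one_pow, mul_one]
    have h0 : ∏ i, l i ^ m' i ≠ 0 := Finset.prod_ne_zero_iff.2 fun i _ => pow_ne_zero _ (hl0 i)
    have e2 : ∏ i, l i ^ (m i + (N - m' i)) = 1 := by
      have := e1 l hl
      rw [h] at this
      exact mul_right_cancel₀ h0 (this.trans (one_mul _).symm)
    have e3 := hres _ e2
    have e4 : ∏ i, d i ^ (m i + (N - m' i)) = 1 := by
      rcases isEmpty_or_nonempty (Fin n) with hE | ⟨⟨i0⟩⟩
      · simp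
      · calc _ = ∏ i, d i ^ (m i0 + (N - m' i0)) :=
              Finset.prod_congr rfl fun i _ => by rw [e3 i i0]
          _ = 1 := by rw [Finset.prod_pow, hd, one_pow]
    rw [← e1 d hd, e4, one_mul]
  have hQ : ∀ Q : Polynomial ℂ,
      ∑ m ∈ q.support, coeff m q * Q.eval (∏ i, l i ^ m i) = 0 := by
    intro Q
    simp only [Polynomial.eval_eq_sum_range, Finset.mul_sum]
    rw [Finset.sum_comm]
    refine Finset.sum_eq_zero fun k _ => ?_
    have := hq k
    rw [hev] at this
    calc _ = Q.coeff k * ∑ m ∈ q.support, coeff m q * ∏ i, (l i ^ k) ^ m i := by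
          rw [Finset.mul_sum]
          refine Finset.sum_congr rfl fun m _ => ?_
          rw [← Finset.prod_pow]
          rw [show ∏ i, (l i ^ m i) ^ k = ∏ i, (l i ^ k) ^ m i from
            Finset.prod_congr rfl fun i _ => by rw [← pow_mul, ← pow_mul, mul_comm]]
          ring
      _ = 0 := by rw [this, mul_zero]
  let r : ℂ → ℂ := fun v => if h : ∃ m : Fin n →₀ ℕ, ∏ i, l i ^ m i = v then
    ∏ i, d i ^ (h.choose i) else 0
  have hr : ∀ m : Fin n →₀ ℕ, r (∏ i, l i ^ m i) = ∏ i, d i ^ m i := by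
    intro m
    have h : ∃ m' : Fin n →₀ ℕ, ∏ i, l i ^ m' i = ∏ i, l i ^ m i := ⟨m, rfl⟩
    simp only [r, dif_pos h]
    exact hwd _ _ h.choose_spec
  let s : Finset ℂ := q.support.image fun m => ∏ i, l i ^ m i
  have := hQ (Lagrange.interpolate s id r)
  rw [hev, ← this]
  refine Finset.sum_congr rfl fun m hm => ?_
  rw [← hr]
  have : ∏ i, l i ^ m i ∈ s := Finset.mem_image_of_mem _ hm
  congr 1
  exact (Lagrange.eval_interpolate_at_node (v := id) r Function.injective_id.injOn this).symm

/-! weights -/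

def wt {n : ℕ} (i j a : Fin n) : ℤ := (if a = i then 1 else 0) - (if a = j then 1 else 0)

theorem prod_wt {n : ℕ} (i j : Fin n) {z : ℂ} (hz : z ≠ 0) : ∏ a, z ^ wt i j a = 1 := by
  simp only [wt, zpow_sub₀ hz, Finset.prod_div_distrib]
  simp [apply_ite (fun k : ℤ => z ^ k), Finset.prod_ite_eq', hz]

theorem torus_sum {n : ℕ} (x y : Mat n) (hxy : x * y = 1) {k l : Fin n} (hkl : k ≠ l) (z : ℂ)
    (a b : Fin n) :
    (x * Matrix.diagonal (fun c => z ^ wt k l c) * y) a b =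
      (1 : Mat n) a b + (z - 1) * (x a k * y k b) + (z⁻¹ - 1) * (x a l * y l b) := by
  have h1 : ∀ c, z ^ wt k l c = 1 + (if c = k then z - 1 else 0) + (if c = l then z⁻¹ - 1 else 0) := by
    intro c
    by_cases hk : c = k
    · subst hk; simp [wt, hkl]
    · by_cases hc : c = l
      · subst hc; simp [wt, hk]
      · simp [wt, hk, hc]
  rw [Matrix.mul_apply]
  simp only [Matrix.mul_diagonal, h1, mul_add, add_mul, mul_one, Finset.sum_add_distrib]
  rw [← Matrix.mul_apply, hxy]
  congr 1
  · congr 1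
    rw [Finset.sum_eq_single k]
    · simp; ring
    · intro c _ hc; simp [hc]
    · simp
  · rw [Finset.sum_eq_single l]
    · simp; ring
    · intro c _ hc; simp [hc]
    · simp

/-- the limit argument producing transvections -/
theorem transv_limit {n : ℕ} (Z : Set (Mat n)) (hZc : IsClosed Z)
    (hZm : ∀ a ∈ Z, ∀ b ∈ Z, a * b ∈ Z)
    (hT : ∀ d : Fin n → ℂ, ∏ i, d i = 1 → Matrix.diagonal d ∈ Z)
    (x y : Mat n) (hx : x ∈ Z) (hy : y ∈ Z) (hxy : x * y = 1)
    (i j k l : Fin n) (hij : i ≠ j) (hkl : k ≠ l) (s : ℂ) :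
    1 + Matrix.single i j (s * (x i k * y k j - x i l * y l j)) ∈ Z := by
  let e : Fin n → Fin n → ℕ := fun a b => (2 - wt i j a + wt i j b).toNat
  let M : ℂ → Mat n := fun u => Matrix.of fun a b => (1 : Mat n) a b +
    s * (u ^ e a b * (x a k * y k b - x a l * y l b * (1 + s * u ^ 2)⁻¹))
  have hM0 : M 0 = 1 + Matrix.single i j (s * (x i k * y k j - x i l * y l j)) := by
    ext a b
    have he : e a b = 0 ↔ (a = i ∧ b = j) := by
      simp only [e, wt]
      constructor
      · intro h
        split_ifs at h with h1 h2 h3 h4 h5 h6 h7 h8 <;> simp_all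
      · rintro ⟨rfl, rfl⟩; simp [hij, hij.symm]
    simp only [M, Matrix.of_apply, Matrix.add_apply, Matrix.single_apply]
    by_cases h : a = i ∧ b = j
    · rw [he.2 h, if_pos ⟨h.1.symm, h.2.symm⟩, h.1, h.2]; simp
    · rw [if_neg (fun h' => h ⟨h'.1.symm, h'.2.symm⟩), zero_pow (fun h' => h (he.1 h'))]; simp
  have hcont : ContinuousAt M 0 := by
    refine continuousAt_pi.2 fun a => continuousAt_pi.2 fun b => ?_
    simp only [M, Matrix.of_apply]
    have h1 : ContinuousAt (fun u : ℂ => (1 + s * u ^ 2)⁻¹) 0 :=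
      ContinuousAt.inv₀ (by fun_prop) (by simp)
    fun_prop
  rw [← hM0]
  refine hZc.mem_of_tendsto (hcont.tendsto.mono_left (nhdsWithin_le_nhds (s := {0}ᶜ))) ?_
  have hev : ∀ᶠ u : ℂ in nhds 0, 1 + s * u ^ 2 ≠ 0 := by
    have : ContinuousAt (fun u : ℂ => 1 + s * u ^ 2) 0 := by fun_prop
    exact this.eventually_ne (by simp)
  filter_upwards [self_mem_nhdsWithin, nhdsWithin_le_nhds hev] with u hu hz
  have hu0 : u ≠ 0 := hu
  have key : M u = Matrix.diagonal (fun a => u ^ (wt j i a)) *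
      (x * Matrix.diagonal (fun c => (1 + s * u ^ 2) ^ wt k l c) * y) *
      Matrix.diagonal (fun a => u ^ (wt i j a)) := by
    ext a b
    rw [Matrix.mul_diagonal, Matrix.diagonal_mul, torus_sum x y hxy hkl]
    have hw : ∀ a : Fin n, wt j i a = - wt i j a := fun a => by simp [wt]
    have h1 : (1 : Mat n) a b = u ^ wt j i a * (1 : Mat n) a b * u ^ wt i j b := by
      by_cases hab : a = b
      · subst hab; rw [hw, _root_.zpow_neg]
        simp only [Matrix.one_apply_eq, mul_one]
        exact (inv_mul_cancel₀ (zpow_ne_zero _ hu0)).symm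
      · simp [hab]
    have h2 : u ^ e a b = u ^ (wt j i a) * u ^ (wt i j b) * u ^ 2 := by
      have : (0 : ℤ) ≤ 2 - wt i j a + wt i j b := by
        simp only [wt]; split_ifs <;> simp_all
      rw [hw, ← zpow_natCast u (e a b), ← zpow_natCast u 2, ← zpow_add₀ hu0, ← zpow_add₀ hu0]
      congr 1
      simp only [e]
      rw [Int.toNat_of_nonneg this]
      push_cast; ring
    simp only [M, Matrix.of_apply]
    rw [h2]
    conv_lhs => rw [h1]
    field_simp
    ring
  rw [key]
  exact hZm _ (hZm _ (hT _ (prod_wt j i hu0)) _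
    (hZm _ (hZm _ hx _ (hT _ (prod_wt k l hz))) _ hy)) _ (hT _ (prod_wt i j hu0))

theorem dense_diag {n : ℕ} (Z : Set (Mat n)) (hZc : IsClosed Z)
    (hZm : ∀ a ∈ Z, ∀ b ∈ Z, a * b ∈ Z)
    (hT : ∀ d : Fin n → ℂ, ∏ i, d i = 1 → Matrix.diagonal d ∈ Z)
    (x y : Mat n) (hx : x ∈ Z) (hy : y ∈ Z) (hxy : x * y = 1)
    (hx0 : ∀ i j, x i j ≠ 0) (hy0 : ∀ i j, y i j ≠ 0) (A : Mat n) (hA : A.det = 1) : A ∈ Z := by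
  have htr : ∀ i j : Fin n, i ≠ j → ∀ c, Matrix.transvection i j c ∈ Z := by
    intro i j hij c
    obtain ⟨k, l, hkl⟩ : ∃ k l, x i k * y k j ≠ x i l * y l j := by
      by_contra h
      push Not at h
      have h1 : ∑ k, x i k * y k j = 0 := by
        rw [← Matrix.mul_apply, hxy, Matrix.one_apply_ne hij]
      rw [Finset.sum_congr rfl fun k _ => h k i] at h1
      simp only [Finset.sum_const, Finset.card_univ, Fintype.card_fin, nsmul_eq_mul] at h1
      have : n ≠ 0 := by rintro rfl; exact i.elim0
      rcases mul_eq_zero.1 h1 with h2 | h2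
      · exact this (by exact_mod_cast h2)
      · exact (mul_ne_zero (hx0 _ _) (hy0 _ _)) h2
    have hne : k ≠ l := by rintro rfl; exact hkl rfl
    have := transv_limit Z hZc hZm hT x y hx hy hxy i j k l hij hne
      (c / (x i k * y k j - x i l * y l j))
    rwa [div_mul_cancel₀ _ (sub_ne_zero.2 hkl)] at this
  have h1 : (1 : Mat n) ∈ Z := by
    have := hT (fun _ => 1) (by simp)
    simpa using this
  have hlist : ∀ L : List (Matrix.TransvectionStruct (Fin n) ℂ),
      (L.map Matrix.TransvectionStruct.toMatrix).prod ∈ Z := by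
    intro L
    induction L with
    | nil => simpa using h1
    | cons t L ih =>
      rw [List.map_cons, List.prod_cons]
      exact hZm _ (htr _ _ t.hij _) _ ih
  obtain ⟨L, L', D, hD⟩ := Matrix.Pivot.exists_list_transvec_mul_diagonal_mul_list_transvec A
  have hdet : ∏ i, D i = 1 := by
    have := congrArg Matrix.det hD
    rw [hA, Matrix.det_mul, Matrix.det_mul, Matrix.TransvectionStruct.det_toMatrix_prod,
      Matrix.TransvectionStruct.det_toMatrix_prod, Matrix.det_diagonal, one_mul, mul_one] at this
    exact this.symm
  rw [hD]
  exact hZm _ (hZm _ (hlist L) _ (hT D hdet)) _ (hlist L')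

/-- the density criterion, in an eigenbasis -/
theorem dense_crit {n : ℕ} (H : Set (Mat n)) (hH : ∀ a ∈ H, ∀ b ∈ H, a * b ∈ H) (h1 : 1 ∈ H)
    (g x y B B' : Mat n) (hg : g ∈ H) (hx : x ∈ H) (hy : y ∈ H) (hxy : x * y = 1)
    (hB : B * B' = 1) (l : Fin n → ℂ) (hgl : g = B * Matrix.diagonal l * B')
    (hl : ∏ i, l i = 1) (hres : ∀ m : Fin n → ℕ, ∏ i, l i ^ m i = 1 → ∀ i j, m i = m j)
    (hx0 : ∀ i j, (B' * x * B) i j ≠ 0) (hy0 : ∀ i j, (B' * y * B) i j ≠ 0)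
    (A : Mat n) (hA : A.det = 1) : A ∈ Zc H := by
  have hB' : B' * B = 1 := mul_eq_one_comm.1 hB
  let Z : Set (Mat n) := {A | B * A * B' ∈ Zc H}
  have hpow : ∀ k : ℕ, g ^ k ∈ H := by
    intro k
    induction k with
    | zero => simpa using h1
    | succ k ih => rw [pow_succ]; exact hH _ ih _ hg
  have hcan : ∀ A : Mat n, B * (B' * A * B) * B' = A := by
    intro A
    calc B * (B' * A * B) * B' = (B * B') * A * (B * B') := by simp only [mul_assoc]
      _ = A := by rw [hB]; simp
  have : B' * A * B ∈ Z := by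
    refine dense_diag Z ?_ ?_ ?_ (B' * x * B) (B' * y * B) ?_ ?_ ?_ hx0 hy0 _ ?_
    · exact (Zc_closed H).preimage (by fun_prop)
    · intro a ha b hb
      have := Zc_mul hH ha hb
      have e : B * a * B' * (B * b * B') = B * (a * b) * B' := by
        calc _ = B * a * (B' * B) * b * B' := by simp only [mul_assoc]
          _ = _ := by rw [hB']; simp only [mul_assoc, one_mul]
      rw [e] at this
      exact this
    · intro d hd P hP
      let Q : Fin n × Fin n → MvPolynomial (Fin n) ℂ := fun p =>
        ∑ k, MvPolynomial.C (B p.1 k) * X k * MvPolynomial.C (B' k p.2)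
      have hQ : ∀ v, eval v (bind₁ Q P) = pev P (B * Matrix.diagonal v * B') := by
        intro v
        rw [pev_subst]
        congr 1
        ext i j
        rw [Matrix.mul_apply]
        simp [Q, Matrix.mul_diagonal]
      rw [← hQ]
      refine torus_mem _ l d hl hd hres fun k => ?_
      rw [hQ]
      apply hP
      have e : B * Matrix.diagonal (fun i => l i ^ k) * B' = g ^ k := by
        rw [show (fun i => l i ^ k) = l ^ k from rfl, ← Matrix.diagonal_pow, hgl]
        induction k with
        | zero => simp [hB]
        | succ k ih =>
          rw [pow_succ, pow_succ, ← ih]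
          calc _ = B * Matrix.diagonal l ^ k * 1 * (Matrix.diagonal l * B') := by
                simp only [mul_assoc, one_mul]
            _ = _ := by rw [← hB']; simp only [mul_assoc]
      rw [e]
      exact hpow k
    · change B * (B' * x * B) * B' ∈ Zc H
      rw [hcan]; exact Zc_of_mem hx
    · change B * (B' * y * B) * B' ∈ Zc H
      rw [hcan]; exact Zc_of_mem hy
    · calc B' * x * B * (B' * y * B) = B' * x * (B * B') * y * B := by simp only [mul_assoc]
        _ = B' * (x * y) * B := by rw [hB]; simp only [mul_assoc, one_mul]
        _ = 1 := by rw [hxy, mul_one, hB']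
    · rw [Matrix.det_mul, Matrix.det_mul, hA, mul_one, ← Matrix.det_mul, hB', Matrix.det_one]
  have h2 : B * (B' * A * B) * B' ∈ Zc H := this
  rwa [hcan] at h2

attribute [local instance] Matrix.normedAddCommGroup Matrix.normedSpace

/-- the matrix of all `g^k x g^l` -/
noncomputable def ffM {n : ℕ} (g x : Mat n) : Matrix (Fin n × Fin n) (Fin n × Fin n) ℂ :=
  Matrix.of fun p q => (g ^ (p.1 : ℕ) * x * g ^ (p.2 : ℕ)) q.1 q.2

noncomputable def ff {n : ℕ} (g x : Mat n) : ℂ := (ffM g x).det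

theorem mul3_apply {n : ℕ} (P M P' : Mat n) (i j : Fin n) :
    (P * M * P') i j = ∑ a, ∑ b, P i a * M a b * P' b j := by
  rw [Matrix.mul_apply, Finset.sum_comm]
  refine Finset.sum_congr rfl fun b _ => ?_
  rw [Matrix.mul_apply, Finset.sum_mul]

theorem ff_conj {n : ℕ} {g x P P' : Mat n} (hP : P * P' = 1) (h : ff g x ≠ 0) :
    ff (P * g * P') (P * x * P') ≠ 0 := by
  have hP' : P' * P = 1 := mul_eq_one_comm.1 hP
  have hpow : ∀ k : ℕ, (P * g * P') ^ k = P * g ^ k * P' := by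
    intro k
    induction k with
    | zero => simp [hP]
    | succ k ih =>
      rw [pow_succ, ih, pow_succ]
      calc _ = P * g ^ k * (P' * P) * g * P' := by simp only [mul_assoc]
        _ = _ := by rw [hP']; simp only [mul_assoc, one_mul]
  have hd : P.det * P'.det = 1 := by rw [← Matrix.det_mul, hP, Matrix.det_one]
  have hM : ffM (P * g * P') (P * x * P') = ffM g x * Matrix.kroneckerMap (· * ·) Pᵀ P' := by
    ext p q
    simp only [ffM, Matrix.of_apply, hpow]
    have e : P * g ^ (p.1 : ℕ) * P' * (P * x * P') * (P * g ^ (p.2 : ℕ) * P') =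
        P * (g ^ (p.1 : ℕ) * x * g ^ (p.2 : ℕ)) * P' := by
      calc _ = P * g ^ (p.1 : ℕ) * (P' * P) * x * (P' * P) * g ^ (p.2 : ℕ) * P' := by
            simp only [mul_assoc]
        _ = _ := by rw [hP']; simp only [mul_assoc, one_mul]
    rw [e, mul3_apply, Matrix.mul_apply, Fintype.sum_prod_type]
    simp only [Matrix.of_apply, Matrix.kroneckerMap_apply, Matrix.transpose_apply]
    refine Finset.sum_congr rfl fun a _ => Finset.sum_congr rfl fun b _ => by ring
  rw [ff, hM, Matrix.det_mul]
  refine mul_ne_zero h ?_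
  rw [Matrix.det_kronecker, Matrix.det_transpose]
  exact mul_ne_zero (pow_ne_zero _ (left_ne_zero_of_mul_eq_one hd))
    (pow_ne_zero _ (right_ne_zero_of_mul_eq_one hd))

theorem ff_diag {n : ℕ} {l : Fin n → ℂ} (hl : Function.Injective l) {x : Mat n}
    (hx : ∀ i j, x i j ≠ 0) : ff (Matrix.diagonal l) x ≠ 0 := by
  have hM : ffM (Matrix.diagonal l) x = Matrix.kroneckerMap (· * ·) (Matrix.vandermonde l)ᵀ
      (Matrix.vandermonde l)ᵀ * Matrix.diagonal (fun q => x q.1 q.2) := by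
    ext p q
    rw [Matrix.mul_diagonal]
    simp only [ffM, Matrix.of_apply, Matrix.kroneckerMap_apply,
      Matrix.transpose_apply, Matrix.vandermonde_apply, Matrix.diagonal_pow, Matrix.mul_diagonal,
      Matrix.diagonal_mul, Pi.pow_apply]
    ring
  rw [ff, hM, Matrix.det_mul, Matrix.det_kronecker, Matrix.det_transpose, Matrix.det_diagonal]
  have := Matrix.det_vandermonde_ne_zero_iff.2 hl
  exact mul_ne_zero (mul_ne_zero (pow_ne_zero _ this) (pow_ne_zero _ this))
    (Finset.prod_ne_zero_iff.2 fun q _ => hx _ _)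

theorem ff_entries {n : ℕ} {g x B B' : Mat n} {l : Fin n → ℂ} (hB : B * B' = 1)
    (hg : g = B * Matrix.diagonal l * B') (h : ff g x ≠ 0) (i j : Fin n) :
    (B' * x * B) i j ≠ 0 := by
  have hB' : B' * B = 1 := mul_eq_one_comm.1 hB
  intro h0
  apply h
  rw [ff, ← Matrix.exists_mulVec_eq_zero_iff]
  have hpow : ∀ k : ℕ, g ^ k = B * Matrix.diagonal (l ^ k) * B' := by
    intro k
    rw [← Matrix.diagonal_pow]
    induction k with
    | zero => simp [hB]
    | succ k ih =>
      rw [pow_succ, ih, pow_succ, hg]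
      calc _ = B * Matrix.diagonal l ^ k * (B' * B) * Matrix.diagonal l * B' := by
            simp only [mul_assoc]
        _ = _ := by rw [hB']; simp only [mul_assoc, one_mul]
  refine ⟨fun q => B' i q.1 * B q.2 j, ?_, ?_⟩
  · intro hv
    have h1 : (B' * B) i i = 1 := by rw [hB']; simp
    have h2 : (B' * B) j j = 1 := by rw [hB']; simp
    have h3 : (B' * B) i i * (B' * B) j j = 0 := by
      rw [Matrix.mul_apply, Matrix.mul_apply, Finset.sum_mul_sum]
      refine Finset.sum_eq_zero fun a _ => Finset.sum_eq_zero fun b _ => ?_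
      have : B' i a * B b j = 0 := congrFun hv (a, b)
      calc _ = (B' i a * B b j) * (B a i * B' j b) := by ring
        _ = 0 := by rw [this, zero_mul]
    rw [h1, h2] at h3
    simp at h3
  · ext p
    have e : (ffM g x *ᵥ fun q => B' i q.1 * B q.2 j) p =
        (B' * (g ^ (p.1 : ℕ) * x * g ^ (p.2 : ℕ)) * B) i j := by
      rw [mul3_apply]
      simp only [Matrix.mulVec, dotProduct, Fintype.sum_prod_type, ffM, Matrix.of_apply]
      refine Finset.sum_congr rfl fun a _ => Finset.sum_congr rfl fun b _ => by ring
    have e2 : B' * (g ^ (p.1 : ℕ) * x * g ^ (p.2 : ℕ)) * B =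
        Matrix.diagonal (l ^ (p.1 : ℕ)) * (B' * x * B) * Matrix.diagonal (l ^ (p.2 : ℕ)) := by
      rw [hpow, hpow]
      calc _ = (B' * B) * Matrix.diagonal (l ^ (p.1 : ℕ)) * B' * x * B *
            Matrix.diagonal (l ^ (p.2 : ℕ)) * (B' * B) := by simp only [mul_assoc]
        _ = _ := by rw [hB']; simp only [mul_assoc, one_mul, mul_one]
    rw [e, e2, Matrix.mul_diagonal, Matrix.diagonal_mul, h0]
    simp

/-- diagonalisation of a matrix with distinct eigenvalues -/
theorem diag_of_distinct {n : ℕ} {g : Mat n} {l : Fin n → ℂ}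
    (h : g.charpoly = ∏ i, (Polynomial.X - Polynomial.C (l i))) (hl : Function.Injective l) :
    ∃ B B' : Mat n, B * B' = 1 ∧ g = B * Matrix.diagonal l * B' := by
  have hev : ∀ i, ∃ v : Fin n → ℂ, v ≠ 0 ∧ g *ᵥ v = l i • v := by
    intro i
    have h0 : (Matrix.scalar (Fin n) (l i) - g).det = 0 := by
      rw [← Matrix.eval_charpoly, h, Polynomial.eval_prod]
      exact Finset.prod_eq_zero (Finset.mem_univ i) (by simp)
    obtain ⟨v, hv, hv0⟩ := Matrix.exists_mulVec_eq_zero_iff.2 h0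
    refine ⟨v, hv, ?_⟩
    rw [Matrix.sub_mulVec, sub_eq_zero] at hv0
    rw [← hv0]
    ext a
    simp [Matrix.scalar_apply, Matrix.mulVec_diagonal]
  choose v hv0 hv using hev
  have hli : LinearIndependent ℂ v := by
    refine Module.End.eigenvectors_linearIndependent' (Matrix.toLin' g) l hl v fun i => ?_
    rw [Module.End.hasEigenvector_iff, Module.End.mem_eigenspace_iff]
    exact ⟨by simpa using hv i, hv0 i⟩
  let B : Mat n := Matrix.of fun a i => v i a
  have hBu : IsUnit B := by
    rw [← Matrix.linearIndependent_cols_iff_isUnit]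
    exact hli
  have hBd : IsUnit B.det := (Matrix.isUnit_iff_isUnit_det B).1 hBu
  have hc : g * B = B * Matrix.diagonal l := by
    ext a i
    rw [Matrix.mul_diagonal]
    have := congrFun (hv i) a
    simp only [Pi.smul_apply, smul_eq_mul] at this
    rw [mul_comm]
    exact this
  refine ⟨B, B⁻¹, Matrix.mul_nonsing_inv B hBd, ?_⟩
  rw [← hc, mul_assoc, Matrix.mul_nonsing_inv B hBd, mul_one]

theorem dense_of_fun {n : ℕ} (H : Set (Mat n)) (hH : ∀ a ∈ H, ∀ b ∈ H, a * b ∈ H) (h1 : 1 ∈ H)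
    (g x y : Mat n) (hg : g ∈ H) (hx : x ∈ H) (hy : y ∈ H) (hxy : x * y = 1) (hgd : g.det = 1)
    (hres : ∀ m : Fin n → ℕ, (¬ ∀ i j, m i = m j) → resD m g ≠ 0)
    (hfx : ff g x ≠ 0) (hfy : ff g y ≠ 0) (A : Mat n) (hA : A.det = 1) : A ∈ Zc H := by
  obtain ⟨l, hl⟩ := exists_eig g
  have hprod : ∏ i, l i = 1 := by rw [eig_det hl] at hgd; exact hgd
  have hres' : ∀ m : Fin n → ℕ, ∏ i, l i ^ m i = 1 → ∀ i j, m i = m j := by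
    intro m hm
    by_contra hc
    apply hres m hc
    rw [resD_eq m g l hl]
    exact Finset.prod_eq_zero (Finset.mem_univ 1) (by simp [hm])
  have hinj : Function.Injective l := by
    intro i j hij
    by_contra hne
    have := hres' (fun k => if k = i then 2 else if k = j then 0 else 1) ?_ i j
    · simp [Ne.symm hne] at this
    · have hfin : ∏ k, l k ^ (if k = i then 2 else if k = j then 0 else 1) = ∏ k, l k := by
        rw [← Finset.mul_prod_erase _ _ (Finset.mem_univ i),
          ← Finset.mul_prod_erase _ _ (show j ∈ Finset.univ.erase i by simp [Ne.symm hne]),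
          ← Finset.mul_prod_erase _ (fun k => l k) (Finset.mem_univ i),
          ← Finset.mul_prod_erase _ (fun k => l k) (show j ∈ Finset.univ.erase i by simp [Ne.symm hne])]
        rw [Finset.prod_congr rfl (g := fun k => l k)]
        · simp only [if_true, Ne.symm hne, if_false, hij]; ring
        · intro k hk
          simp only [Finset.mem_erase, Finset.mem_univ, and_true] at hk
          simp [hk.1, hk.2]
      rw [hfin, hprod]
  obtain ⟨B, B', hB, hgB⟩ := diag_of_distinct hl hinj
  exact dense_crit H hH h1 g x y B B' hg hx hy hxy hB l hgB hprod hres'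
    (ff_entries hB hgB hfx) (ff_entries hB hgB hfy) A hA

/-- complexification of a real matrix -/
noncomputable abbrev cx {n : ℕ} (A : Matrix (Fin n) (Fin n) ℝ) : Mat n := A.map Complex.ofRealHom

theorem cx_mul {n : ℕ} (A B : Matrix (Fin n) (Fin n) ℝ) : cx (A * B) = cx A * cx B :=
  Matrix.map_mul
theorem cx_one {n : ℕ} : cx (1 : Matrix (Fin n) (Fin n) ℝ) = 1 := by
  ext i j; by_cases h : i = j <;> simp [cx, h, Matrix.one_apply]
theorem cx_det {n : ℕ} (A : Matrix (Fin n) (Fin n) ℝ) : (cx A).det = (A.det : ℂ) :=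
  (RingHom.map_det Complex.ofRealHom A).symm
theorem cx_inj {n : ℕ} {A B : Matrix (Fin n) (Fin n) ℝ} (h : cx A = cx B) : A = B := by
  ext i j
  have := congrFun (congrFun h i) j
  simpa [cx] using this

theorem zdense_of_fun {n : ℕ} (H : Subgroup (SL n ℝ)) (g x : SL n ℝ) (hg : g ∈ H) (hx : x ∈ H)
    (hres : ∀ m : Fin n → ℕ, (¬ ∀ i j, m i = m j) → resD m (cx g.1) ≠ 0)
    (hfx : ff (cx g.1) (cx x.1) ≠ 0) (hfy : ff (cx g.1) (cx (x⁻¹).1) ≠ 0) :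
    IsZariskiDense n H := by
  intro P hP A
  let HS : Set (Mat n) := {M | ∃ h ∈ H, M = cx h.1}
  have hev : ∀ M : Matrix (Fin n) (Fin n) ℝ, pev (MvPolynomial.map Complex.ofRealHom P) (cx M) =
      ((eval (fun p => M p.1 p.2) P : ℝ) : ℂ) := by
    intro M
    rw [pev, MvPolynomial.eval_map]
    exact (MvPolynomial.eval₂_comp Complex.ofRealHom (fun p : Fin n × Fin n => M p.1 p.2) P).symm
  have key : cx A.1 ∈ Zc HS := by
    refine dense_of_fun HS ?_ ⟨1, H.one_mem, by simpa using cx_one.symm⟩ (cx g.1) (cx x.1) (cx (x⁻¹).1) ⟨g, hg, rfl⟩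
      ⟨x, hx, rfl⟩ ⟨x⁻¹, H.inv_mem hx, rfl⟩ ?_ ?_ hres hfx hfy _ ?_
    · rintro _ ⟨a, ha, rfl⟩ _ ⟨b, hb, rfl⟩
      exact ⟨a * b, H.mul_mem ha hb, by rw [Matrix.SpecialLinearGroup.coe_mul, cx_mul]⟩
    · rw [← cx_mul, ← Matrix.SpecialLinearGroup.coe_mul, mul_inv_cancel,
        Matrix.SpecialLinearGroup.coe_one, cx_one]
    · rw [cx_det, g.2]; simp
    · rw [cx_det, A.2]; simp
  have := key (MvPolynomial.map Complex.ofRealHom P) (by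
    rintro _ ⟨h, hh, rfl⟩
    rw [hev, hP h hh]; simp)
  rw [hev] at this
  exact_mod_cast this

attribute [local instance] Matrix.normedAddCommGroup Matrix.normedSpace

/-! ### Zariski density in SL2 -/

/-- the set of matrices underlying a subgroup -/
def sset {n : ℕ} (H : Subgroup (SL n ℂ)) : Set (Mat n) := {M | ∃ h ∈ H, M = h.1}

def NoEig (H : Subgroup (SL 2 ℂ)) : Prop :=
  ∀ x y : ℂ, (x ≠ 0 ∨ y ≠ 0) → ∃ h ∈ H, (h.1 0 0 * x + h.1 0 1 * y) * y ≠ (h.1 1 0 * x + h.1 1 1 * y) * x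

theorem det2 (h : SL 2 ℂ) : h.1 0 0 * h.1 1 1 - h.1 0 1 * h.1 1 0 = 1 := by
  have := h.2; rwa [Matrix.det_fin_two] at this

theorem ext2 {A B : Mat 2} (h00 : A 0 0 = B 0 0) (h01 : A 0 1 = B 0 1) (h10 : A 1 0 = B 1 0)
    (h11 : A 1 1 = B 1 1) : A = B := by
  ext i j; fin_cases i <;> fin_cases j <;> assumption

theorem mat2_ext {a b c d a' b' c' d' : ℂ} (h1 : a = a') (h2 : b = b') (h3 : c = c')
    (h4 : d = d') : (!![a, b; c, d] : Mat 2) = !![a', b'; c', d'] := by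
  rw [h1, h2, h3, h4]

theorem par_pow {a b c d : ℂ} (hd : a * d - b * c = 1) (htr : (a + d) ^ 2 = 4) (k : ℕ) :
    (!![a, b; c, d] : Mat 2) ^ (2 * k) = !![1 + k * ((a + d) * a - 2), k * ((a + d) * b);
      k * ((a + d) * c), 1 + k * ((a + d) * d - 2)] := by
  have h2 : (!![a, b; c, d] : Mat 2) ^ 2 = !![(a + d) * a - 1, (a + d) * b; (a + d) * c, (a + d) * d - 1] := by
    rw [pow_two, Matrix.mul_fin_two]
    exact mat2_ext (by linear_combination -hd) (by ring) (by ring) (by linear_combination -hd)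
  induction k with
  | zero => simp [Matrix.one_fin_two]
  | succ k ih =>
    rw [Nat.mul_succ, pow_add, h2, ih, Matrix.mul_fin_two]
    push_cast
    refine mat2_ext ?_ ?_ ?_ ?_
    · linear_combination (k : ℂ) * ((a + d) * a - 1) * htr - (k : ℂ) * (a + d) ^ 2 * hd
    · linear_combination (k : ℂ) * ((a + d) * b) * htr
    · linear_combination (k : ℂ) * ((a + d) * c) * htr
    · linear_combination (k : ℂ) * ((a + d) * d - 1) * htr - (k : ℂ) * (a + d) ^ 2 * hd

theorem exists_hyp (H : Subgroup (SL 2 ℂ)) (hne : NoEig H) :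
    ∃ g ∈ H, (g.1 0 0 + g.1 1 1) ^ 2 ≠ 4 := by
  by_contra hcon
  push Not at hcon
  obtain ⟨g, hg, hgn⟩ := hne 1 0 (by simp)
  have hc : g.1 1 0 ≠ 0 := by intro h; apply hgn; simp [h]
  have hd := det2 g
  have htr := hcon g hg
  have hge := Matrix.eta_fin_two g.1
  obtain ⟨h, hh, hhn⟩ := hne (g.1 0 0 - g.1 1 1) (2 * g.1 1 0) (Or.inr (by simpa using hc))
  have hhe := Matrix.eta_fin_two h.1
  have htr2 : ∀ k : ℕ, ((!![g.1 0 0, g.1 0 1; g.1 1 0, g.1 1 1] ^ (2 * k) *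
      !![h.1 0 0, h.1 0 1; h.1 1 0, h.1 1 1] : Mat 2).trace) ^ 2 = 4 := by
    intro k
    have := hcon _ (H.mul_mem (H.pow_mem hg (2 * k)) hh)
    rw [← hge, ← hhe, Matrix.trace_fin_two]
    simpa using this
  generalize g.1 0 0 = a at *
  generalize g.1 0 1 = b at *
  generalize g.1 1 0 = c at *
  generalize g.1 1 1 = d at *
  generalize h.1 0 0 = p at *
  generalize h.1 0 1 = q at *
  generalize h.1 1 0 = r at *
  generalize h.1 1 1 = s at *
  have htrk : ∀ k : ℕ, ((p + s) + k * ((a + d) * (a * p + b * r + c * q + d * s) - 2 * (p + s))) ^ 2 = 4 := by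
    intro k
    have := htr2 k
    rw [par_pow hd htr, Matrix.mul_fin_two, Matrix.trace_fin_two] at this
    simp at this
    rw [← this]
    ring
  have h0 := htrk 0
  have h1 := htrk 1
  have h2 := htrk 2
  push_cast at h0 h1 h2
  have hw : (a + d) * (a * p + b * r + c * q + d * s) - 2 * (p + s) = 0 := by
    generalize (a + d) * (a * p + b * r + c * q + d * s) - 2 * (p + s) = w at *
    have : w ^ 2 = 0 := by linear_combination (h0 + h2 - 2 * h1) / 2
    exact pow_eq_zero_iff (two_ne_zero) |>.1 this
  have hT0 : a + d ≠ 0 := by intro h; rw [h] at htr; norm_num at htr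
  apply hhn
  have : (a + d) * ((p * (a - d) + q * (2 * c)) * (2 * c) - (r * (a - d) + s * (2 * c)) * (a - d)) = 0 := by
    linear_combination 4 * c * hw - 2 * c * (p + s) * htr - (a + d) * r * (htr - 4 * hd)
  exact sub_eq_zero.1 ((mul_eq_zero.1 this).resolve_left hT0)

/-- torsion-free irreducible subgroups of SL2 are Zariski dense -/
theorem dense2 (H : Subgroup (SL 2 ℂ)) (hne : NoEig H)
    (htf : ∀ h ∈ H, ∀ k : ℕ, k ≠ 0 → h ^ k = 1 → h = 1) (A : Mat 2) (hA : A.det = 1) :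
    A ∈ Zc (sset H) := by
  obtain ⟨g, hg, hgt⟩ := exists_hyp H hne
  obtain ⟨l, hl⟩ := exists_eig g.1
  have hprod : l 0 * l 1 = 1 := by
    have := eig_det hl
    rw [g.2, Fin.prod_univ_two] at this
    exact this.symm
  have hsum : g.1 0 0 + g.1 1 1 = l 0 + l 1 := by
    have h0 := Matrix.charpoly_fin_two g.1
    rw [hl, Fin.prod_univ_two, Matrix.trace_fin_two] at h0
    have h1 := congrArg (Polynomial.eval 1) h0
    have h2 := congrArg (Polynomial.eval 0) h0
    simp at h1 h2
    linear_combination h1 - h2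
  have hl01 : l 0 ≠ l 1 := by
    intro h
    apply hgt
    rw [hsum, ← h]
    rw [← h] at hprod
    linear_combination 4 * hprod
  have hinj : Function.Injective l := by
    intro i j hij
    fin_cases i <;> fin_cases j <;> simp_all
  obtain ⟨B, B', hB, hgB⟩ := diag_of_distinct hl hinj
  have hB' : B' * B = 1 := mul_eq_one_comm.1 hB
  have hpow : ∀ k : ℕ, g.1 ^ k = B * Matrix.diagonal (l ^ k) * B' := by
    intro k
    rw [← Matrix.diagonal_pow]
    induction k with
    | zero => simp [hB]
    | succ k ih =>
      rw [pow_succ, ih, pow_succ]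
      conv_lhs => rw [hgB]
      calc _ = B * Matrix.diagonal l ^ k * (B' * B) * Matrix.diagonal l * B' := by
            simp only [mul_assoc]
        _ = _ := by rw [hB']; simp only [mul_assoc, one_mul]
  have hl0 : l 0 ≠ 0 := left_ne_zero_of_mul_eq_one hprod
  have hl1 : l 1 = (l 0)⁻¹ := by field_simp; linear_combination hprod
  have hroot : ∀ k : ℕ, k ≠ 0 → l 0 ^ k ≠ 1 := by
    intro k hk h
    have h1 : l ^ k = 1 := by
      ext i
      fin_cases i
      · simpa using h
      · simp [hl1, h]
    have h2 : g ^ k = 1 := by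
      apply Subtype.ext
      rw [Matrix.SpecialLinearGroup.coe_pow, hpow, h1]
      simp [hB]
    have h3 := htf g hg k hk h2
    apply hgt
    rw [h3]; norm_num
  have hres : ∀ m : Fin 2 → ℕ, ∏ i, l i ^ m i = 1 → ∀ i j, m i = m j := by
    intro m hm
    rw [Fin.prod_univ_two] at hm
    have h01 : m 0 = m 1 := by
      rcases lt_trichotomy (m 0) (m 1) with h | h | h
      · exfalso
        obtain ⟨c, hc⟩ := Nat.exists_eq_add_of_lt h
        apply hroot (c + 1) (by omega)
        rw [hc, hl1, inv_pow, pow_add, pow_add] at hm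
        have := pow_ne_zero (m 0) hl0
        field_simp at hm
        rw [pow_succ]; linear_combination -hm
      · exact h
      · exfalso
        obtain ⟨c, hc⟩ := Nat.exists_eq_add_of_lt h
        apply hroot (c + 1) (by omega)
        rw [hc, hl1, inv_pow, pow_add, pow_add] at hm
        have := pow_ne_zero (m 1) hl0
        field_simp at hm
        rw [pow_succ]; linear_combination hm
    intro i j
    fin_cases i <;> fin_cases j <;> simp_all
  -- conjugated elements
  let K : SL 2 ℂ → Mat 2 := fun h => B' * h.1 * B
  have hK : ∀ h, K h = B' * h.1 * B := fun _ => rfl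
  have hKm : ∀ h h', K (h * h') = K h * K h' := by
    intro h h'
    simp only [hK, Matrix.SpecialLinearGroup.coe_mul]
    calc _ = B' * h.1 * 1 * h'.1 * B := by simp only [mul_assoc, one_mul]
      _ = _ := by rw [← hB]; simp only [mul_assoc]
  have hK1 : ∀ h, B * K h * B' = h.1 := by
    intro h
    calc _ = (B * B') * h.1 * (B * B') := by simp only [hK, mul_assoc]
      _ = _ := by rw [hB]; simp
  have hKd : ∀ h, K h 0 0 * K h 1 1 - K h 0 1 * K h 1 0 = 1 := by
    intro h
    rw [← Matrix.det_fin_two, hK, Matrix.det_mul, Matrix.det_mul, h.2, mul_one, ← Matrix.det_mul,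
      hB', Matrix.det_one]
  have hKg : K g = Matrix.diagonal l := by
    rw [hK, hgB]
    calc _ = (B' * B) * Matrix.diagonal l * (B' * B) := by simp only [mul_assoc]
      _ = _ := by rw [hB']; simp
  have hBdet : B 0 0 * B 1 1 - B 0 1 * B 1 0 ≠ 0 := by
    rw [← Matrix.det_fin_two]
    intro h
    have := congrArg Matrix.det hB
    rw [Matrix.det_mul, h] at this
    simp at this
  have hrow : ∀ h, h.1 * B = B * K h := by
    intro h
    calc _ = 1 * h.1 * B := by rw [one_mul]
      _ = _ := by rw [← hB]; simp only [hK, mul_assoc]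
  obtain ⟨h1, hh1, hr1⟩ : ∃ h ∈ H, K h 1 0 ≠ 0 := by
    obtain ⟨h, hh, hhn⟩ := hne (B 0 0) (B 1 0) (by
      by_contra hc; push Not at hc; apply hBdet; rw [hc.1, hc.2]; ring)
    refine ⟨h, hh, fun h0 => hhn ?_⟩
    have e0 := congrFun (congrFun (hrow h) 0) 0
    have e1 := congrFun (congrFun (hrow h) 1) 0
    rw [Matrix.mul_apply, Matrix.mul_apply, Fin.sum_univ_two, Fin.sum_univ_two, h0] at e0 e1
    rw [e0, e1]; ring
  obtain ⟨h2, hh2, hq2⟩ : ∃ h ∈ H, K h 0 1 ≠ 0 := by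
    obtain ⟨h, hh, hhn⟩ := hne (B 0 1) (B 1 1) (by
      by_contra hc; push Not at hc; apply hBdet; rw [hc.1, hc.2]; ring)
    refine ⟨h, hh, fun h0 => hhn ?_⟩
    have e0 := congrFun (congrFun (hrow h) 0) 1
    have e1 := congrFun (congrFun (hrow h) 1) 1
    rw [Matrix.mul_apply, Matrix.mul_apply, Fin.sum_univ_two, Fin.sum_univ_two, h0] at e0 e1
    rw [e0, e1]; ring
  have hmul : ∀ (M N : Mat 2) i j, (M * N) i j = M i 0 * N 0 j + M i 1 * N 1 j := by
    intro M N i j; rw [Matrix.mul_apply, Fin.sum_univ_two]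
  obtain ⟨h, hh, hq, hr⟩ : ∃ h ∈ H, K h 0 1 ≠ 0 ∧ K h 1 0 ≠ 0 := by
    by_cases hq1 : K h1 0 1 = 0
    · by_cases hr2 : K h2 1 0 = 0
      · refine ⟨h1 * h2, H.mul_mem hh1 hh2, ?_, ?_⟩
        · rw [hKm, hmul, hq1, zero_mul, add_zero]
          refine mul_ne_zero (fun h0 => ?_) hq2
          have := hKd h1; rw [h0, hq1] at this; simp at this
        · rw [hKm, hmul, hr2, mul_zero, add_zero]
          refine mul_ne_zero hr1 (fun h0 => ?_)
          have := hKd h2; rw [h0, hr2] at this; simp at this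
      · exact ⟨h2, hh2, hq2, hr2⟩
    · exact ⟨h1, hh1, hq1, hr1⟩
  obtain ⟨x, hx, hx0⟩ : ∃ x ∈ H, ∀ i j, K x i j ≠ 0 := by
    have mk : ∀ x ∈ H, K x 0 0 ≠ 0 → K x 0 1 ≠ 0 → K x 1 0 ≠ 0 → K x 1 1 ≠ 0 →
        ∃ x ∈ H, ∀ i j, K x i j ≠ 0 := by
      intro x hx a b c d
      refine ⟨x, hx, fun i j => ?_⟩
      fin_cases i <;> fin_cases j <;> assumption
    have hg2 : ∀ i j, K (h * g * h) i j = K h i 0 * l 0 * K h 0 j + K h i 1 * l 1 * K h 1 j := by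
      intro i j
      rw [hKm, hKm, hKg, hmul, Matrix.mul_diagonal, Matrix.mul_diagonal]
    have hg1 : ∀ i j, K (h * h) i j = K h i 0 * K h 0 j + K h i 1 * K h 1 j := by
      intro i j
      rw [hKm, hmul]
    have hl10 : l 1 ≠ 0 := right_ne_zero_of_mul_eq_one hprod
    have hm1 : h * h ∈ H := H.mul_mem hh hh
    have hm2 : h * g * h ∈ H := H.mul_mem (H.mul_mem hh hg) hh
    by_cases hp : K h 0 0 = 0
    · by_cases hs : K h 1 1 = 0
      · exfalso
        have hdd := hKd h
        rw [hp, hs] at hdd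
        have e : K (h * h) = -1 := by
          refine ext2 ?_ ?_ ?_ ?_ <;> rw [hg1] <;> simp [hp, hs] <;> linear_combination -hdd
        have e4 : K ((h * h) * (h * h)) = 1 := by rw [hKm, e]; simp
        have e5 : h ^ 4 = 1 := by
          apply Subtype.ext
          rw [← hK1 (h ^ 4), show h ^ 4 = (h * h) * (h * h) by simp only [pow_succ, pow_zero, one_mul, mul_assoc], e4]
          simp [hB]
        have := htf h hh 4 (by norm_num) e5
        apply hq
        rw [this, hK]
        simp [hB']
      · by_cases hc : K (h * h) 1 1 = 0
        · refine mk _ hm2 ?_ ?_ ?_ ?_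
          · rw [hg2, hp]; simp [hq, hr, hl10]
          · rw [hg2, hp]; simp [hq, hs, hl10]
          · rw [hg2, hp]; simp [hr, hs, hl10]
          · rw [hg1] at hc
            rw [hg2]
            intro h0
            have : (l 1 - l 0) * (K h 1 1 * K h 1 1) = 0 := by linear_combination h0 - l 0 * hc
            exact mul_ne_zero (sub_ne_zero.2 hl01.symm) (mul_ne_zero hs hs) this
        · refine mk _ hm1 ?_ ?_ ?_ hc
          · rw [hg1, hp]; simp [hq, hr]
          · rw [hg1, hp]; simp [hq, hs]
          · rw [hg1, hp]; simp [hr, hs]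
    · by_cases hs : K h 1 1 = 0
      · by_cases hc : K (h * h) 0 0 = 0
        · refine mk _ hm2 ?_ ?_ ?_ ?_
          · rw [hg1] at hc
            rw [hg2]
            intro h0
            have : (l 0 - l 1) * (K h 0 0 * K h 0 0) = 0 := by linear_combination h0 - l 1 * hc
            exact mul_ne_zero (sub_ne_zero.2 hl01) (mul_ne_zero hp hp) this
          · rw [hg2, hs]; simp [hq, hp, hl0]
          · rw [hg2, hs]; simp [hr, hp, hl0]
          · rw [hg2, hs]; simp [hq, hr, hl0]
        · refine mk _ hm1 hc ?_ ?_ ?_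
          · rw [hg1, hs]; simp [hq, hp]
          · rw [hg1, hs]; simp [hr, hp]
          · rw [hg1, hs]; simp [hq, hr]
      · exact mk _ hh hp hq hr hs
  refine dense_crit (sset H) ?_ ⟨1, H.one_mem, by simp⟩ g.1 x.1 (x⁻¹).1 B B' ⟨g, hg, rfl⟩ ⟨x, hx, rfl⟩
    ⟨x⁻¹, H.inv_mem hx, rfl⟩ ?_ hB l hgB (by rw [Fin.prod_univ_two, hprod]) hres hx0 ?_ A hA
  · rintro _ ⟨a, ha, rfl⟩ _ ⟨b, hb, rfl⟩
    exact ⟨a * b, H.mul_mem ha hb, by simp⟩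
  · rw [← Matrix.SpecialLinearGroup.coe_mul, mul_inv_cancel, Matrix.SpecialLinearGroup.coe_one]
  · have e : K x⁻¹ = !![K x 1 1, -K x 0 1; -K x 1 0, K x 0 0] := by
      have e1 : K x * K x⁻¹ = 1 := by rw [← hKm, mul_inv_cancel, hK]; simp [hB']
      have e2 : !![K x 1 1, -K x 0 1; -K x 1 0, K x 0 0] * K x = 1 := by
        have := Matrix.adjugate_mul (K x)
        rw [Matrix.det_fin_two, hKd, one_smul, Matrix.adjugate_fin_two] at this
        exact this
      calc K x⁻¹ = 1 * K x⁻¹ := (one_mul _).symm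
        _ = _ := by rw [← e2, mul_assoc, e1, mul_one]
    intro i j
    change K x⁻¹ i j ≠ 0
    rw [e]
    fin_cases i <;> fin_cases j <;> simp [hx0]

attribute [local instance] Matrix.normedAddCommGroup Matrix.normedSpace

/-- not metabelian, in an elementary form -/
def NonMet {G : Type*} [Group G] (L : Subgroup G) : Prop :=
  ∃ p ∈ L, ∃ q ∈ L, ∃ r ∈ L, ∃ s ∈ L, ⁅p, q⁆ * ⁅r, s⁆ ≠ ⁅r, s⁆ * ⁅p, q⁆

theorem NonMet.of_map {G G' : Type*} [Group G] [Group G'] (f : G →* G') {L : Subgroup G}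
    (h : NonMet (L.map f)) : NonMet L := by
  obtain ⟨_, ⟨p, hp, rfl⟩, _, ⟨q, hq, rfl⟩, _, ⟨r, hr, rfl⟩, _, ⟨s, hs, rfl⟩, hn⟩ := h
  refine ⟨p, hp, q, hq, r, hr, s, hs, fun e => hn ?_⟩
  have := congrArg f e
  simpa [map_mul, map_commutatorElement] using this

theorem NonMet.map {G G' : Type*} [Group G] [Group G'] (f : G →* G') (hf : Function.Injective f)
    {L : Subgroup G} (h : NonMet L) : NonMet (L.map f) := by
  obtain ⟨p, hp, q, hq, r, hr, s, hs, hn⟩ := h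
  refine ⟨f p, ⟨p, hp, rfl⟩, f q, ⟨q, hq, rfl⟩, f r, ⟨r, hr, rfl⟩, f s, ⟨s, hs, rfl⟩, fun e => hn ?_⟩
  apply hf
  simpa [map_mul, map_commutatorElement] using e

set_option maxRecDepth 10000 in
theorem free_nonmet {u v : FreeGroup Bool} (h : u * v ≠ v * u) :
    NonMet (Subgroup.closure {u, v}) := by
  set L := Subgroup.closure {u, v} with hL
  have hu : u ∈ L := Subgroup.subset_closure (by simp)
  have hv : v ∈ L := Subgroup.subset_closure (by simp)
  let e := IsFreeGroup.toFreeGroup L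
  have hns : ∃ x y : IsFreeGroup.Generators L, x ≠ y := by
    by_contra hc
    push Not at hc
    have hsub : Subsingleton (IsFreeGroup.Generators L) := ⟨hc⟩
    apply h
    have hcomm : ∀ p q : FreeGroup (IsFreeGroup.Generators L), p * q = q * p := by
      have h1 : ∀ (x : IsFreeGroup.Generators L) (q : FreeGroup (IsFreeGroup.Generators L)),
          Commute (FreeGroup.of x) q := by
        intro x q
        induction q using FreeGroup.induction_on with
        | C1 => exact Commute.one_right _
        | of y => rw [hc x y]
        | inv_of y hy => exact hy.inv_right
        | mul p q hp hq => exact hp.mul_right hq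
      intro p q
      change Commute p q
      induction p using FreeGroup.induction_on with
      | C1 => exact Commute.one_left _
      | of y => exact h1 y q
      | inv_of y hy => exact hy.inv_left
      | mul p q hp hq => exact hp.mul_left hq
    have h2 : (⟨u, hu⟩ : L) * ⟨v, hv⟩ = ⟨v, hv⟩ * ⟨u, hu⟩ := by
      apply e.injective
      rw [map_mul, map_mul, hcomm]
    exact congrArg Subtype.val h2
  obtain ⟨x, y, hxy⟩ := hns
  classical
  let ψ : FreeGroup (IsFreeGroup.Generators L) →* FreeGroup Bool :=
    FreeGroup.lift fun z => if z = x then FreeGroup.of false else FreeGroup.of true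
  have hx : ψ (FreeGroup.of x) = FreeGroup.of false := by simp [ψ]
  have hy : ψ (FreeGroup.of y) = FreeGroup.of true := by simp [ψ, hxy.symm]
  have key : NonMet (⊤ : Subgroup L) := by
    refine NonMet.of_map (ψ.comp e.toMonoidHom) ?_
    refine ⟨FreeGroup.of false, ⟨e.symm (FreeGroup.of x), trivial, by simp [hx]⟩,
      FreeGroup.of true, ⟨e.symm (FreeGroup.of y), trivial, by simp [hy]⟩,
      FreeGroup.of false * FreeGroup.of false, ⟨e.symm (FreeGroup.of x * FreeGroup.of x), trivial, by simp [hx]⟩,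
      FreeGroup.of true, ⟨e.symm (FreeGroup.of y), trivial, by simp [hy]⟩, ?_⟩
    simp only [commutatorElement_def]
    decide
  have := key.map L.subtype L.subtype_injective
  rwa [← MonoidHom.range_eq_map, Subgroup.range_subtype] at this

theorem sl2_fix_commute {C D : Mat 2} (hC : C.det = 1) (hD : D.det = 1) {v : Fin 2 → ℂ}
    (hv : v ≠ 0) (hCv : C *ᵥ v = v) (hDv : D *ᵥ v = v) : C * D = D * C := by
  rw [Matrix.det_fin_two] at hC hD
  have c0 := congrFun hCv 0
  have c1 := congrFun hCv 1
  have d0 := congrFun hDv 0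
  have d1 := congrFun hDv 1
  simp only [Matrix.mulVec, dotProduct, Fin.sum_univ_two] at c0 c1 d0 d1
  have hv' : v 0 ≠ 0 ∨ v 1 ≠ 0 := by
    by_contra hc
    push Not at hc
    apply hv
    ext i; fin_cases i
    · exact hc.1
    · exact hc.2
  rw [Matrix.eta_fin_two C, Matrix.eta_fin_two D, Matrix.mul_fin_two, Matrix.mul_fin_two]
  generalize v 0 = x at *
  generalize v 1 = y at *
  generalize C 0 0 = a at *
  generalize C 0 1 = b at *
  generalize C 1 0 = c at *
  generalize C 1 1 = d at *
  generalize D 0 0 = a' at *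
  generalize D 0 1 = b' at *
  generalize D 1 0 = c' at *
  generalize D 1 1 = d' at *
  have hdet0 : (a - 1) * (d - 1) - b * c = 0 := by
    rcases hv' with h | h
    · have : x * ((a - 1) * (d - 1) - b * c) = 0 := by linear_combination (d - 1) * c0 - b * c1
      exact (mul_eq_zero.1 this).resolve_left h
    · have : y * ((a - 1) * (d - 1) - b * c) = 0 := by linear_combination (a - 1) * c1 - c * c0
      exact (mul_eq_zero.1 this).resolve_left h
  have hdet0' : (a' - 1) * (d' - 1) - b' * c' = 0 := by
    rcases hv' with h | h
    · have : x * ((a' - 1) * (d' - 1) - b' * c') = 0 := by linear_combination (d' - 1) * d0 - b' * d1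
      exact (mul_eq_zero.1 this).resolve_left h
    · have : y * ((a' - 1) * (d' - 1) - b' * c') = 0 := by linear_combination (a' - 1) * d1 - c' * d0
      exact (mul_eq_zero.1 this).resolve_left h
  have hd : d = 2 - a := by linear_combination hC - hdet0
  have hd' : d' = 2 - a' := by linear_combination hD - hdet0'
  subst hd hd'
  have key : b * c' = b' * c ∧ (a - 1) * b' = (a' - 1) * b ∧ (a - 1) * c' = (a' - 1) * c := by
    rcases hv' with h | h
    · have f1 : a = 1 - b * (y / x) := by field_simp; linear_combination c0
      have f2 : c = -b * (y / x) ^ 2 := by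
        have : c = (a - 1) * (y / x) := by field_simp; linear_combination c1
        rw [this, f1]; ring
      have f1' : a' = 1 - b' * (y / x) := by field_simp; linear_combination d0
      have f2' : c' = -b' * (y / x) ^ 2 := by
        have : c' = (a' - 1) * (y / x) := by field_simp; linear_combination d1
        rw [this, f1']; ring
      rw [f1, f2, f1', f2']
      refine ⟨?_, ?_, ?_⟩ <;> ring
    · have f1 : a = 1 + c * (x / y) := by field_simp; linear_combination -c1
      have f2 : b = -c * (x / y) ^ 2 := by
        have : b = -(a - 1) * (x / y) := by field_simp; linear_combination c0
        rw [this, f1]; ring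
      have f1' : a' = 1 + c' * (x / y) := by field_simp; linear_combination -d1
      have f2' : b' = -c' * (x / y) ^ 2 := by
        have : b' = -(a' - 1) * (x / y) := by field_simp; linear_combination d0
        rw [this, f1']; ring
      rw [f1, f2, f1', f2']
      refine ⟨?_, ?_, ?_⟩ <;> ring
  obtain ⟨e1, e2, e3⟩ := key
  exact mat2_ext (by linear_combination e1) (by linear_combination 2 * e2) (by linear_combination -2 * e3)
    (by linear_combination -e1)

theorem NonMet.noEig {L : Subgroup (SL 2 ℂ)} (h : NonMet L) : NoEig L := by
  intro x y hxy
  by_contra hc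
  push Not at hc
  obtain ⟨p, hp, q, hq, r, hr, s, hs, hn⟩ := h
  let v : Fin 2 → ℂ := ![x, y]
  have hv : v ≠ 0 := by
    intro h
    have h0 := congrFun h 0
    have h1 := congrFun h 1
    simp [v] at h0 h1
    rcases hxy with h | h
    · exact h h0
    · exact h h1
  have hev : ∀ h ∈ L, ∃ χ : ℂ, χ ≠ 0 ∧ h.1 *ᵥ v = χ • v := by
    intro h hh
    have h1 := hc h hh
    have : ∃ χ : ℂ, h.1 *ᵥ v = χ • v := by
      rcases hxy with hx | hy
      · refine ⟨(h.1 0 0 * x + h.1 0 1 * y) / x, ?_⟩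
        ext i
        fin_cases i
        · simp [v, Matrix.mulVec, dotProduct, Fin.sum_univ_two]; field_simp
        · simp [v, Matrix.mulVec, dotProduct, Fin.sum_univ_two]; field_simp; linear_combination -h1
      · refine ⟨(h.1 1 0 * x + h.1 1 1 * y) / y, ?_⟩
        ext i
        fin_cases i
        · simp [v, Matrix.mulVec, dotProduct, Fin.sum_univ_two]; field_simp; linear_combination h1
        · simp [v, Matrix.mulVec, dotProduct, Fin.sum_univ_two]; field_simp
    obtain ⟨χ, hχ⟩ := this
    refine ⟨χ, fun h0 => hv ?_, hχ⟩
    rw [h0, zero_smul] at hχ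
    have := congrArg (fun w => (h⁻¹).1 *ᵥ w) hχ
    simp only [Matrix.mulVec_mulVec, ← Matrix.SpecialLinearGroup.coe_mul, inv_mul_cancel] at this
    simpa using this
  have hfix : ∀ p ∈ L, ∀ q ∈ L, (⁅p, q⁆).1 *ᵥ v = v := by
    intro p hp q hq
    obtain ⟨α, hα, ha⟩ := hev p hp
    obtain ⟨β, hβ, hb⟩ := hev q hq
    have e : ⁅p, q⁆ * (q * p) = p * q := by rw [commutatorElement_def]; group
    have e' : (⁅p, q⁆).1 *ᵥ ((q * p).1 *ᵥ v) = (p * q).1 *ᵥ v := by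
      rw [Matrix.mulVec_mulVec, ← Matrix.SpecialLinearGroup.coe_mul, e]
    rw [Matrix.SpecialLinearGroup.coe_mul, Matrix.SpecialLinearGroup.coe_mul,
      ← Matrix.mulVec_mulVec, ← Matrix.mulVec_mulVec, ha, hb, Matrix.mulVec_smul, Matrix.mulVec_smul,
      hb, Matrix.mulVec_smul, Matrix.mulVec_smul, ha, smul_smul, smul_smul, mul_comm] at e'
    exact smul_right_injective _ (mul_ne_zero hβ hα) e'
  apply hn
  apply Subtype.ext
  rw [Matrix.SpecialLinearGroup.coe_mul, Matrix.SpecialLinearGroup.coe_mul]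
  exact sl2_fix_commute (⁅p, q⁆).2 (⁅r, s⁆).2 hv (hfix p hp q hq) (hfix r hr s hs)

theorem dense_hom {G : Type*} [Group G] (r : G →* SL 2 ℂ) (hr : Function.Injective r)
    (htf : ∀ h : G, ∀ k : ℕ, k ≠ 0 → h ^ k = 1 → h = 1) (L : Subgroup G) (hL : NonMet L)
    (A : Mat 2) (hA : A.det = 1) : A ∈ Zc (sset (L.map r)) := by
  refine dense2 _ (hL.map r hr).noEig ?_ A hA
  rintro _ ⟨h, hh, rfl⟩ k hk e
  rw [← map_pow] at e
  have : h ^ k = 1 := hr (by rw [e, map_one])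
  rw [htf h k hk this, map_one]

theorem free_tf (h : FreeGroup Bool) (k : ℕ) (hk : k ≠ 0) (e : h ^ k = 1) : h = 1 := by
  by_contra hc
  exact std_pow_ne hc hk e

theorem surf_tf {g : ℕ} (hg : 2 ≤ g) (h : SurfaceGroup g) (k : ℕ) (hk : k ≠ 0) (e : h ^ k = 1) :
    h = 1 := by
  by_contra hc
  obtain ⟨φ, hφ⟩ := resfree g hg
  obtain ⟨s, hs⟩ := (hφ h hc).exists
  exact std_pow_ne hs hk (by rw [← map_pow, e, map_one])

theorem surf_nonmet {g : ℕ} (hg : 2 ≤ g) {u v : SurfaceGroup g} (h : u * v ≠ v * u) :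
    NonMet (Subgroup.closure {u, v}) := by
  obtain ⟨φ, hφ⟩ := resfree g hg
  obtain ⟨s, hs⟩ := (hφ ⁅u, v⁆ (fun e => h (commutatorElement_eq_one_iff_mul_comm.1 e))).exists
  refine NonMet.of_map (φ s) ?_
  rw [MonoidHom.map_closure, Set.image_pair]
  refine free_nonmet fun e => hs ?_
  rw [map_commutatorElement]
  exact commutatorElement_eq_one_iff_mul_comm.2 e

attribute [local instance] Matrix.normedAddCommGroup Matrix.normedSpace

/-! ### Symmetric powers -/

noncomputable def symq {R : Type*} [CommRing R] (m : ℕ) (g : Matrix (Fin 2) (Fin 2) R) (i : ℕ) : Polynomial R :=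
  (Polynomial.C (g 0 0) * Polynomial.X + Polynomial.C (g 1 0)) ^ i *
    (Polynomial.C (g 0 1) * Polynomial.X + Polynomial.C (g 1 1)) ^ (m - i)

noncomputable def symP {R : Type*} [CommRing R] (m : ℕ) (g : Matrix (Fin 2) (Fin 2) R) :
    Matrix (Fin (m + 1)) (Fin (m + 1)) R :=
  Matrix.of fun k i => (symq m g i).coeff k

theorem symq_hom {R A : Type*} [CommRing R] [CommRing A] [Algebra R A] (m : ℕ)
    (g : Matrix (Fin 2) (Fin 2) R) (i : ℕ) (hi : i ≤ m) (x y : A) :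
    ∑ k ∈ Finset.range (m + 1), algebraMap R A ((symq m g i).coeff k) * (x ^ k * y ^ (m - k)) =
    (algebraMap R A (g 0 0) * x + algebraMap R A (g 1 0) * y) ^ i *
      (algebraMap R A (g 0 1) * x + algebraMap R A (g 1 1) * y) ^ (m - i) := by
  have h := Polynomial.homogenize_eq_of_isHomogeneous (p := symq m g i) (n := m)
    (q := (MvPolynomial.C (g 0 0) * X 0 + MvPolynomial.C (g 1 0) * X 1) ^ i *
      (MvPolynomial.C (g 0 1) * X 0 + MvPolynomial.C (g 1 1) * X 1) ^ (m - i)) ?_ ?_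
  · have h2 := congrArg (MvPolynomial.aeval ![x, y]) h
    rw [Polynomial.homogenize, map_sum, Finset.Nat.sum_antidiagonal_eq_sum_range_succ_mk] at h2
    simp only [map_mul, map_pow, map_add, MvPolynomial.aeval_C, MvPolynomial.aeval_X] at h2
    refine Eq.trans ?_ h2
    refine Finset.sum_congr rfl fun k _ => ?_
    rw [MvPolynomial.aeval_monomial]
    congr 1
    rw [Finsupp.prod_fintype _ _ (by simp)]
    simp [Fin.prod_univ_two, Finsupp.update_apply]
  · have h1 : ∀ a b : R, (MvPolynomial.C a * X 0 + MvPolynomial.C b * X 1 :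
        MvPolynomial (Fin 2) R).IsHomogeneous 1 := by
      intro a b
      exact (MvPolynomial.isHomogeneous_C_mul_X _ _).add (MvPolynomial.isHomogeneous_C_mul_X _ _)
    have := ((h1 (g 0 0) (g 1 0)).pow i).mul ((h1 (g 0 1) (g 1 1)).pow (m - i))
    rwa [one_mul, one_mul, Nat.add_sub_cancel' hi] at this
  · simp [symq, Polynomial.C_eq_algebraMap]

theorem symP_mul {R : Type*} [CommRing R] (m : ℕ) (g h : Matrix (Fin 2) (Fin 2) R) :
    symP m (g * h) = symP m g * symP m h := by
  ext l i
  have hi : (i : ℕ) ≤ m := by have := i.2; omega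
  have key := symq_hom (A := Polynomial R) m h i hi
    (Polynomial.C (g 0 0) * Polynomial.X + Polynomial.C (g 1 0))
    (Polynomial.C (g 0 1) * Polynomial.X + Polynomial.C (g 1 1))
  have e : symq m (g * h) i = ∑ k ∈ Finset.range (m + 1), Polynomial.C ((symq m h i).coeff k) * symq m g k := by
    rw [show (∑ k ∈ Finset.range (m + 1), Polynomial.C ((symq m h i).coeff k) * symq m g k) = _ from key]
    rw [symq]
    simp only [Matrix.mul_apply, Fin.sum_univ_two, Polynomial.algebraMap_eq, map_add, map_mul]
    congr 2 <;> ring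
  simp only [symP, Matrix.of_apply, Matrix.mul_apply]
  rw [e, Polynomial.finset_sum_coeff, Finset.sum_range]
  refine Finset.sum_congr rfl fun k _ => ?_
  rw [Polynomial.coeff_C_mul, mul_comm]

theorem symP_one {R : Type*} [CommRing R] (m : ℕ) : symP m (1 : Matrix (Fin 2) (Fin 2) R) = 1 := by
  ext k i
  simp [symP, symq, Polynomial.coeff_X_pow, Matrix.one_apply, Fin.ext_iff]

theorem symP_map {R S : Type*} [CommRing R] [CommRing S] (f : R →+* S) (m : ℕ)
    (g : Matrix (Fin 2) (Fin 2) R) : symP m (g.map f) = (symP m g).map f := by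
  ext k i
  simp only [symP, Matrix.of_apply, Matrix.map_apply]
  rw [← Polynomial.coeff_map]
  simp [symq]

theorem symP_diag {R : Type*} [CommRing R] (m : ℕ) (a d : R) :
    symP m (!![a, 0; 0, d]) = Matrix.diagonal fun i : Fin (m + 1) => a ^ (i : ℕ) * d ^ (m - (i : ℕ)) := by
  ext k i
  simp only [symP, symq, Matrix.of_apply]
  simp only [Matrix.cons_val', Matrix.cons_val_zero, Matrix.cons_val_one, Matrix.cons_val_fin_one,
    map_zero, add_zero, zero_mul, zero_add, mul_pow]
  rw [← Polynomial.C_pow, ← Polynomial.C_pow, mul_assoc, Polynomial.coeff_C_mul, Polynomial.coeff_mul_C,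
    Polynomial.coeff_X_pow, Matrix.diagonal_apply]
  by_cases h : k = i
  · simp [h]
  · simp [h, Fin.ext_iff.not.1 h]

/-- the linear entries expand with positive coefficients -/
theorem symP_entry {R : Type*} [CommRing R] (m : ℕ) (g : Matrix (Fin 2) (Fin 2) R)
    (k i : Fin (m + 1)) :
    symP m g k i = ∑ p ∈ Finset.HasAntidiagonal.antidiagonal (k : ℕ),
      (g 0 0 ^ p.1 * g 1 0 ^ ((i : ℕ) - p.1) * ((i : ℕ).choose p.1 : R)) *
      (g 0 1 ^ p.2 * g 1 1 ^ (m - i - p.2) * ((m - i : ℕ).choose p.2 : R)) := by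
  have h1 : ∀ (a b : R) (n k : ℕ), ((Polynomial.C a * Polynomial.X + Polynomial.C b) ^ n).coeff k =
      a ^ k * b ^ (n - k) * (n.choose k : R) := by
    intro a b n k
    have e : (Polynomial.C a * Polynomial.X + Polynomial.C b) ^ n =
        ∑ l ∈ Finset.range (n + 1), Polynomial.C (a ^ l * b ^ (n - l) * (n.choose l : R)) *
          Polynomial.X ^ l := by
      rw [add_pow]
      refine Finset.sum_congr rfl fun l _ => ?_
      simp only [map_mul, map_pow, map_natCast, mul_pow]
      ring
    rw [e, Polynomial.finset_sum_coeff]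
    simp only [Polynomial.coeff_C_mul, Polynomial.coeff_X_pow, mul_ite, mul_one, mul_zero]
    rw [Finset.sum_ite_eq]
    split_ifs with h
    · rfl
    · rw [Nat.choose_eq_zero_of_lt (by simpa using h)]; simp
  simp only [symP, symq, Matrix.of_apply, Polynomial.coeff_mul, h1]

attribute [local instance] Matrix.normedAddCommGroup Matrix.normedSpace

/-! ### One-parameter groups of matrices -/

/-- entrywise derivative of a matrix-valued function -/
def HasDM {ι κ : Type*} (f : ℝ → Matrix ι κ ℝ) (f' : Matrix ι κ ℝ) (x : ℝ) : Prop :=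
  ∀ i j, HasDerivAt (fun t => f t i j) (f' i j) x

theorem HasDM.mul {ι κ μ : Type*} [Fintype κ] {f : ℝ → Matrix ι κ ℝ} {f' : Matrix ι κ ℝ}
    {g : ℝ → Matrix κ μ ℝ} {g' : Matrix κ μ ℝ} {x : ℝ} (hf : HasDM f f' x) (hg : HasDM g g' x) :
    HasDM (fun t => f t * g t) (f' * g x + f x * g') x := by
  intro i j
  have := HasDerivAt.fun_sum (u := Finset.univ) fun k _ => (hf i k).fun_mul (hg k j)
  simpa [Matrix.mul_apply, Finset.sum_add_distrib] using this

theorem HasDM.const {ι κ : Type*} (A : Matrix ι κ ℝ) (x : ℝ) : HasDM (fun _ => A) 0 x :=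
  fun i j => hasDerivAt_const x (A i j)

theorem HasDM.comp {ι κ : Type*} {f : ℝ → Matrix ι κ ℝ} {f' : Matrix ι κ ℝ} {φ : ℝ → ℝ} {c x y : ℝ}
    (hf : HasDM f f' y) (hφ : HasDerivAt φ c x) (hy : φ x = y) :
    HasDM (fun t => f (φ t)) (c • f') x := by
  intro i j
  subst hy
  have := (hf i j).comp x hφ
  simpa [Function.comp_def, mul_comm] using this

theorem HasDM.unique {ι κ : Type*} {f : ℝ → Matrix ι κ ℝ} {f' f'' : Matrix ι κ ℝ} {x : ℝ}
    (h : HasDM f f' x) (h' : HasDM f f'' x) : f' = f'' := by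
  ext i j
  exact (h i j).unique (h' i j)

theorem HasDM.congr {ι κ : Type*} {f g : ℝ → Matrix ι κ ℝ} {f' : Matrix ι κ ℝ} {x : ℝ}
    (h : HasDM f f' x) (hfg : ∀ᶠ t in nhds x, g t = f t) : HasDM g f' x := by
  intro i j
  refine (h i j).congr_of_eventuallyEq ?_
  filter_upwards [hfg] with t ht
  rw [ht]

structure OneP {ι : Type*} [Fintype ι] [DecidableEq ι] (f : ℝ → Matrix ι ι ℝ) (N : Matrix ι ι ℝ) : Prop where
  zero : f 0 = 1
  add : ∀ x y, f (x + y) = f x * f y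
  der : HasDM f N 0

theorem OneP.neg {ι : Type*} [Fintype ι] [DecidableEq ι] {f : ℝ → Matrix ι ι ℝ} {N : Matrix ι ι ℝ}
    (h : OneP f N) (x : ℝ) : f x * f (-x) = 1 := by
  rw [← h.add, add_neg_cancel, h.zero]

theorem OneP.derl {ι : Type*} [Fintype ι] [DecidableEq ι] {f : ℝ → Matrix ι ι ℝ} {N : Matrix ι ι ℝ}
    (h : OneP f N) (x : ℝ) : HasDM f (f x * N) x := by
  have h1 : HasDM (fun t => f (t - x)) N x := by
    have := h.der.comp (φ := fun t => t - x) (x := x) ((hasDerivAt_id x).sub_const x) (by simp)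
    simpa using this
  have h2 := (HasDM.const (f x) x).mul h1
  simp only [zero_mul, zero_add] at h2
  refine h2.congr (Filter.Eventually.of_forall fun t => ?_)
  rw [← h.add]; congr 1; ring

theorem OneP.derr {ι : Type*} [Fintype ι] [DecidableEq ι] {f : ℝ → Matrix ι ι ℝ} {N : Matrix ι ι ℝ}
    (h : OneP f N) (x : ℝ) : HasDM f (N * f x) x := by
  have h1 : HasDM (fun t => f (t - x)) N x := by
    have := h.der.comp (φ := fun t => t - x) (x := x) ((hasDerivAt_id x).sub_const x) (by simp)
    simpa using this
  have h2 := h1.mul (HasDM.const (f x) x)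
  simp only [mul_zero, add_zero] at h2
  refine h2.congr (Filter.Eventually.of_forall fun t => ?_)
  rw [← h.add]; congr 1; ring

/-- intertwining -/
theorem OneP.intertwine {ι κ : Type*} [Fintype ι] [DecidableEq ι] [Fintype κ] [DecidableEq κ]
    {f : ℝ → Matrix ι ι ℝ} {N : Matrix ι ι ℝ} {f2 : ℝ → Matrix κ κ ℝ} {N2 : Matrix κ κ ℝ}
    (h : OneP f N) (h2 : OneP f2 N2) (P : Matrix ι κ ℝ) (hP : N * P = P * N2) (x : ℝ) :
    f x * P = P * f2 x := by
  have hd : ∀ x, HasDM (fun t => f (-t) * P * f2 t) 0 x := by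
    intro x
    have a := (h.derl (-x)).comp (φ := fun t => -t) (x := x) (hasDerivAt_neg x) rfl
    have b := (a.mul (HasDM.const P x)).mul (h2.derr x)
    convert b using 1
    rw [Matrix.mul_zero, add_zero, neg_smul, one_smul, Matrix.neg_mul, Matrix.mul_assoc (f (-x)) N P, hP]
    simp only [Matrix.neg_mul, Matrix.mul_assoc]
    simp
  have hc : f (-x) * P * f2 x = P := by
    ext i j
    have := is_const_of_deriv_eq_zero (f := fun t => (f (-t) * P * f2 t) i j)
      (fun t => (hd t i j).differentiableAt) (fun t => (hd t i j).deriv) x 0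
    simpa [h.zero, h2.zero] using this
  calc f x * P = f x * (f (-x) * P * f2 x) := by rw [hc]
    _ = P * f2 x := by
      rw [← Matrix.mul_assoc, ← Matrix.mul_assoc, h.neg, Matrix.one_mul]

theorem oneP_of_cont {ι : Type*} [Fintype ι] [DecidableEq ι] (f : ℝ → Matrix ι ι ℝ)
    (h0 : f 0 = 1) (ha : ∀ x y, f (x + y) = f x * f y) (hc : ∀ i j, Continuous fun t => f t i j) :
    ∃ N, OneP f N := by
  let F : ℝ → Matrix ι ι ℝ := fun h => Matrix.of fun i j => ∫ t in (0:ℝ)..h, f t i j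
  have hF : HasDM F 1 0 := by
    intro i j
    have := intervalIntegral.integral_hasDerivAt_right (f := fun t => f t i j) (a := 0) (b := 0)
      ((hc i j).intervalIntegrable _ _) ((hc i j).stronglyMeasurableAtFilter _ _) (hc i j).continuousAt
    simp only [h0] at this
    exact this
  have hdet : ∃ h : ℝ, (F h).det ≠ 0 := by
    have h1 : Filter.Tendsto (fun t => t⁻¹ • F t) (nhdsWithin 0 {0}ᶜ) (nhds 1) := by
      refine tendsto_pi_nhds.2 fun i => tendsto_pi_nhds.2 fun j => ?_
      have := hasDerivAt_iff_tendsto_slope_zero.1 (hF i j)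
      refine this.congr fun t => ?_
      simp [F]
    have h2 := (Continuous.matrix_det continuous_id).continuousAt.tendsto.comp h1
    have h3 := h2.eventually (isOpen_ne.mem_nhds (show Matrix.det (id (1 : Matrix ι ι ℝ)) ≠ 0 by simp))
    obtain ⟨t, ht⟩ := h3.exists
    refine ⟨t, fun h => ht ?_⟩
    simp [Matrix.det_smul, h]
  obtain ⟨h, hdet⟩ := hdet
  let G : ℝ → Matrix ι ι ℝ := fun x => Matrix.of fun i j => (∫ t in (0:ℝ)..(x + h), f t i j) -
    ∫ t in (0:ℝ)..x, f t i j
  have hG : ∀ x, f x * F h = G x := by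
    intro x
    ext i j
    simp only [Matrix.mul_apply, F, G, Matrix.of_apply]
    rw [intervalIntegral.integral_interval_sub_left ((hc i j).intervalIntegrable _ _)
      ((hc i j).intervalIntegrable _ _)]
    have e : ∫ t in x..(x + h), f t i j = ∫ t in (0:ℝ)..h, f (x + t) i j := by
      rw [intervalIntegral.integral_comp_add_left (fun t => f t i j)]
      simp
    rw [e]
    simp only [ha, Matrix.mul_apply]
    rw [intervalIntegral.integral_finset_sum]
    · simp
    · intro k _
      exact ((continuous_const.mul (hc k j))).intervalIntegrable _ _
  have hGd : HasDM G (f h - f 0) 0 := by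
    intro i j
    have key : ∀ x, HasDerivAt (fun x => ∫ t in (0:ℝ)..x, f t i j) (f x i j) x := fun x =>
      intervalIntegral.integral_hasDerivAt_right (f := fun t => f t i j) (a := 0) (b := x)
        ((hc i j).intervalIntegrable _ _) ((hc i j).stronglyMeasurableAtFilter _ _) (hc i j).continuousAt
    have k1 := (key (0 + h)).comp_add_const 0 h
    have := k1.fun_sub (key 0)
    simp only [zero_add] at this
    exact this
  refine ⟨(f h - f 0) * (F h)⁻¹, h0, ha, ?_⟩
  have := hGd.mul (HasDM.const (F h)⁻¹ 0)
  simp only [mul_zero, add_zero] at this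
  refine this.congr (Filter.Eventually.of_forall fun t => ?_)
  rw [← hG, Matrix.mul_assoc, Matrix.mul_nonsing_inv _ (isUnit_iff_ne_zero.2 hdet), Matrix.mul_one]

attribute [local instance] Matrix.normedAddCommGroup Matrix.normedSpace

/-! ### The Lie algebra of a continuous representation of SL₂(ℝ) -/

theorem mat2_extR {R : Type*} {a b c d a' b' c' d' : R} (h1 : a = a') (h2 : b = b') (h3 : c = c') (h4 : d = d') :
    !![a, b; c, d] = !![a', b'; c', d'] := by rw [h1, h2, h3, h4]

def uS (x : ℝ) : SL 2 ℝ := ⟨!![1, x; 0, 1], by simp [Matrix.det_fin_two]⟩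
def vS (x : ℝ) : SL 2 ℝ := ⟨!![1, 0; x, 1], by simp [Matrix.det_fin_two]⟩
noncomputable def dS (s : ℝ) : SL 2 ℝ := ⟨!![Real.exp s, 0; 0, Real.exp (-s)], by
  simp [Matrix.det_fin_two, ← Real.exp_add]⟩

theorem uS_val (x : ℝ) : (uS x).1 = !![1, x; 0, 1] := rfl
theorem vS_val (x : ℝ) : (vS x).1 = !![1, 0; x, 1] := rfl
theorem dS_val (x : ℝ) : (dS x).1 = !![Real.exp x, 0; 0, Real.exp (-x)] := rfl

theorem sl2_ext {h k : SL 2 ℝ} (e : h.1 = k.1) : h = k := Subtype.ext e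

theorem uS_add (x y : ℝ) : uS (x + y) = uS x * uS y := by
  apply sl2_ext
  rw [Matrix.SpecialLinearGroup.coe_mul, uS_val, uS_val, uS_val]
  simp [Matrix.mul_fin_two, add_comm]

theorem vS_add (x y : ℝ) : vS (x + y) = vS x * vS y := by
  apply sl2_ext
  rw [Matrix.SpecialLinearGroup.coe_mul, vS_val, vS_val, vS_val]
  simp [Matrix.mul_fin_two]

theorem dS_add (x y : ℝ) : dS (x + y) = dS x * dS y := by
  apply sl2_ext
  rw [Matrix.SpecialLinearGroup.coe_mul, dS_val, dS_val, dS_val]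
  simp [Matrix.mul_fin_two, Real.exp_add, mul_comm]

theorem uS_zero : uS 0 = 1 := by
  apply sl2_ext; rw [uS_val, Matrix.SpecialLinearGroup.coe_one, Matrix.one_fin_two]

theorem vS_zero : vS 0 = 1 := by
  apply sl2_ext; rw [vS_val, Matrix.SpecialLinearGroup.coe_one, Matrix.one_fin_two]

theorem dS_zero : dS 0 = 1 := by
  apply sl2_ext; rw [dS_val, Matrix.SpecialLinearGroup.coe_one, Matrix.one_fin_two]; simp

theorem dS_uS (s x : ℝ) : dS s * uS x = uS (Real.exp (2 * s) * x) * dS s := by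
  apply sl2_ext
  have h : Real.exp (2 * s) * Real.exp (-s) = Real.exp s := by rw [← Real.exp_add]; congr 1; ring
  rw [Matrix.SpecialLinearGroup.coe_mul, Matrix.SpecialLinearGroup.coe_mul, dS_val, uS_val, uS_val,
    Matrix.mul_fin_two, Matrix.mul_fin_two, ← h]
  apply mat2_extR <;> simp <;> ring

theorem dS_vS (s x : ℝ) : dS s * vS x = vS (Real.exp (-2 * s) * x) * dS s := by
  apply sl2_ext
  have h : Real.exp (-2 * s) * Real.exp s = Real.exp (-s) := by rw [← Real.exp_add]; congr 1; ring
  rw [Matrix.SpecialLinearGroup.coe_mul, Matrix.SpecialLinearGroup.coe_mul, dS_val, vS_val, vS_val,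
    Matrix.mul_fin_two, Matrix.mul_fin_two, ← h]
  apply mat2_extR <;> simp <;> ring

theorem uS_vS (x y : ℝ) (h : 0 < 1 + x * y) :
    uS x * vS y * uS (-x) =
      vS (y / (1 + x * y)) * dS (Real.log (1 + x * y)) * uS (-x ^ 2 * y / (1 + x * y)) := by
  apply sl2_ext
  simp only [Matrix.SpecialLinearGroup.coe_mul, dS_val, vS_val, uS_val, Matrix.mul_fin_two,
    Real.exp_neg, Real.exp_log h]
  have := h.ne'
  obtain ⟨q, hq⟩ : ∃ q, q = 1 + x * y := ⟨_, rfl⟩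
  rw [← hq] at this ⊢
  apply mat2_extR
  · rw [hq]; ring
  · field_simp; rw [hq]; ring
  · field_simp; ring
  · field_simp; rw [hq]; ring

/-- generation of SL₂(ℝ) by unipotents -/
theorem sl2_gen (K : Subgroup (SL 2 ℝ)) (hu : ∀ x, uS x ∈ K) (hv : ∀ x, vS x ∈ K) (h : SL 2 ℝ) :
    h ∈ K := by
  have key : ∀ h : SL 2 ℝ, h.1 1 0 ≠ 0 → h ∈ K := by
    intro h hc
    have e : h = uS ((h.1 0 0 - 1) / h.1 1 0) * vS (h.1 1 0) * uS ((h.1 1 1 - 1) / h.1 1 0) := by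
      apply sl2_ext
      have hd := h.2
      rw [Matrix.det_fin_two] at hd
      rw [Matrix.SpecialLinearGroup.coe_mul, Matrix.SpecialLinearGroup.coe_mul, uS_val, vS_val, uS_val]
      conv_lhs => rw [Matrix.eta_fin_two h.1]
      generalize h.1 0 0 = a at *
      generalize h.1 0 1 = b at *
      generalize h.1 1 0 = c at *
      generalize h.1 1 1 = d at *
      rw [Matrix.mul_fin_two, Matrix.mul_fin_two]
      apply mat2_extR
      · field_simp; ring
      · field_simp; linear_combination (-1 : ℝ) * hd
      · ring
      · field_simp; ring
    rw [e]
    exact K.mul_mem (K.mul_mem (hu _) (hv _)) (hu _)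
  by_cases hc : h.1 1 0 = 0
  · have h1 : vS 1 * h ∈ K := by
      apply key
      rw [Matrix.SpecialLinearGroup.coe_mul, vS_val, Matrix.mul_apply]
      have hd := h.2
      rw [Matrix.det_fin_two, hc] at hd
      simp [Fin.sum_univ_two, hc]
      rintro e
      rw [e] at hd; simp at hd
    exact (K.mul_mem_cancel_left (hv 1)).1 h1
  · exact key h hc

theorem cont_S (n : ℕ) (j : SL 2 ℝ →* SL n ℝ) (hj : Continuous j) (f : ℝ → SL 2 ℝ)
    (hf : Continuous fun t => (f t).1) (i k : Fin n) : Continuous fun t => (j (f t)).1 i k := by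
  have h1 : Continuous f := continuous_induced_rng.2 hf
  have h2 : Continuous fun t => (j (f t)).1 := continuous_induced_dom.comp (hj.comp h1)
  exact h2.matrix_elem i k

theorem cont_oneP (n : ℕ) (j : SL 2 ℝ →* SL n ℝ) (hj : Continuous j) (f : ℝ → SL 2 ℝ)
    (h0 : f 0 = 1) (ha : ∀ x y, f (x + y) = f x * f y)
    (hf : Continuous fun t => (f t).1) : ∃ N, OneP (fun t => (j (f t)).1) N := by
  apply oneP_of_cont
  · simp [h0]
  · intro x y; simp [ha]
  · exact cont_S n j hj f hf

theorem exists_lie (n : ℕ) (j : SL 2 ℝ →* SL n ℝ) (hj : Continuous j) :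
    ∃ N M H : Matrix (Fin n) (Fin n) ℝ, OneP (fun t => (j (uS t)).1) N ∧
      OneP (fun t => (j (vS t)).1) M ∧ OneP (fun t => (j (dS t)).1) H ∧
      H * N - N * H = (2 : ℝ) • N ∧ H * M - M * H = (-2 : ℝ) • M ∧ N * M - M * N = H := by
  obtain ⟨N, hN⟩ := cont_oneP n j hj uS uS_zero uS_add (by
    refine continuous_matrix fun i k => ?_
    fin_cases i <;> fin_cases k <;> simp [uS_val] <;> fun_prop)
  obtain ⟨M, hM⟩ := cont_oneP n j hj vS vS_zero vS_add (by
    refine continuous_matrix fun i k => ?_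
    fin_cases i <;> fin_cases k <;> simp [vS_val] <;> fun_prop)
  obtain ⟨H, hH⟩ := cont_oneP n j hj dS dS_zero dS_add (by
    refine continuous_matrix fun i k => ?_
    fin_cases i <;> fin_cases k <;> simp [dS_val] <;> fun_prop)
  have conj : ∀ (f : ℝ → SL 2 ℝ) (N : Matrix (Fin n) (Fin n) ℝ) (c : ℝ)
      (hN : OneP (fun t => (j (f t)).1) N) (hr : ∀ s x, dS s * f x = f (Real.exp (c * s) * x) * dS s),
      H * N - N * H = c • N := by
    intro f N c hN hr
    have h1 : ∀ s, (j (dS s)).1 * N = Real.exp (c * s) • N * (j (dS s)).1 := by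
      intro s
      have a := (HasDM.const (j (dS s)).1 0).mul hN.der
      have b := (hN.der.comp (φ := fun x => Real.exp (c * s) * x) (x := 0) (by
        simpa using (hasDerivAt_id (0:ℝ)).const_mul (Real.exp (c * s))) (by simp)).mul
        (HasDM.const (j (dS s)).1 0)
      have e := a.unique (b.congr (Filter.Eventually.of_forall fun t => ?_))
      · simpa using e
      · rw [← Matrix.SpecialLinearGroup.coe_mul, ← Matrix.SpecialLinearGroup.coe_mul, ← map_mul, ← map_mul, hr]
    have a := hH.der.mul (HasDM.const N 0)
    have b0 : HasDM (fun s => Real.exp (c * s) • N) (c • N) 0 := by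
      intro i k
      have := (((hasDerivAt_id (0:ℝ)).const_mul c).exp).mul_const (N i k)
      simpa using this
    have b := b0.mul hH.der
    have e := a.unique (b.congr (Filter.Eventually.of_forall fun t => h1 t))
    simp only [hH.zero, mul_zero, Real.exp_zero, one_smul, mul_one, add_zero] at e
    rw [e]; abel
  have hN2 := conj uS N 2 hN dS_uS
  have hM2 := conj vS M (-2) hM dS_vS
  refine ⟨N, M, H, hN, hM, hH, hN2, hM2, ?_⟩
  have h1 : ∀ x, (j (uS x)).1 * M * (j (uS (-x))).1 = M + x • H - x ^ 2 • N := by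
    intro x
    have a := ((HasDM.const (j (uS x)).1 0).mul hM.der).mul (HasDM.const (j (uS (-x))).1 0)
    have hq : HasDerivAt (fun y : ℝ => 1 + x * y) x 0 := by
      simpa using ((hasDerivAt_id (0:ℝ)).const_mul x).const_add 1
    have b1 := hM.der.comp (φ := fun y => y / (1 + x * y)) (x := 0) (c := 1) (by
      simpa using (hasDerivAt_id (0:ℝ)).fun_div hq (by simp)) (by simp)
    have b2 := hH.der.comp (φ := fun y => Real.log (1 + x * y)) (x := 0) (c := x) (by
      simpa using hq.log (by simp)) (by simp)
    have b3 := hN.der.comp (φ := fun y => -x ^ 2 * y / (1 + x * y)) (x := 0) (c := -x ^ 2) (by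
      simpa using ((hasDerivAt_id (0:ℝ)).const_mul (-x ^ 2)).fun_div hq (by simp)) (by simp)
    have e := a.unique (((b1.mul b2).mul b3).congr ?_)
    · simp only [mul_zero, add_zero, zero_add, zero_mul, zero_div, Real.log_one, hM.zero, hH.zero, hN.zero,
        one_smul, mul_one, one_mul, neg_smul] at e
      rw [e]; abel
    · have : ∀ᶠ y in nhds (0:ℝ), 0 < 1 + x * y := by
        have hc : Continuous fun y : ℝ => 1 + x * y := by fun_prop
        exact hc.continuousAt.eventually (lt_mem_nhds (by simp))
      filter_upwards [this] with y hy
      simp only [← Matrix.SpecialLinearGroup.coe_mul, ← map_mul]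
      rw [uS_vS x y hy]
  have a := (hN.der.mul (HasDM.const M 0)).mul (hN.der.comp (φ := fun x => -x) (x := 0) (hasDerivAt_neg 0) (by simp))
  have b : HasDM (fun x : ℝ => M + x • H - x ^ 2 • N) H 0 := by
    intro i k
    have := (((hasDerivAt_id (0:ℝ)).mul_const (H i k)).const_add (M i k)).fun_sub
      ((hasDerivAt_pow 2 (0:ℝ)).mul_const (N i k))
    simpa using this
  have e := a.unique (b.congr (Filter.Eventually.of_forall fun t => h1 t))
  simp only [hN.zero, mul_zero, add_zero, neg_zero, mul_one, one_mul, neg_smul, one_smul, mul_neg] at e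
  rw [← e]; abel

attribute [local instance] Matrix.normedAddCommGroup Matrix.normedSpace

/-! ### Classification of irreducible representations -/

theorem eig_chain {K : Type*} [Field K] [CharZero K] {n : ℕ} (H : Matrix (Fin n) (Fin n) K)
    (u : ℕ → Fin n → K) (a c : K) (hc : c ≠ 0) (hu : ∀ i, H *ᵥ u i = (a + i * c) • u i) :
    ∃ i, u i = 0 := by
  by_contra! hne
  have := Module.End.eigenvectors_linearIndependent' (Matrix.toLin' H)
    (fun i : Fin (n + 1) => a + ((i : ℕ) : K) * c) (by
      intro i k h
      simp only [add_right_inj, mul_eq_mul_right_iff, hc, or_false, Nat.cast_inj] at h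
      exact Fin.ext h) (fun i => u i) (fun i => ⟨by
        rw [Module.End.mem_eigenspace_iff, Matrix.toLin'_apply]; exact hu i, hne i⟩)
  have h2 := this.fintype_card_le_finrank
  simp at h2

theorem sl2_H {K : Type*} [Field K] [CharZero K] {n : ℕ} {N H : Matrix (Fin n) (Fin n) K} (c : K)
    (hN : H * N - N * H = c • N) (v : Fin n → K) (a : K) (hv : H *ᵥ v = a • v) (i : ℕ) :
    H *ᵥ ((N ^ i) *ᵥ v) = (a + i * c) • ((N ^ i) *ᵥ v) := by
  induction i with
  | zero => simp [hv]
  | succ i ih =>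
    rw [pow_succ', ← Matrix.mulVec_mulVec]
    generalize (N ^ i) *ᵥ v = w at *
    have : H * N = N * H + c • N := by rw [← hN]; abel
    rw [Matrix.mulVec_mulVec, this, Matrix.add_mulVec, ← Matrix.mulVec_mulVec, ih, Matrix.mulVec_smul,
      Matrix.smul_mulVec, ← add_smul]
    congr 1
    push_cast; ring

theorem sl2_M {K : Type*} [Field K] [CharZero K] {n : ℕ} {N M H : Matrix (Fin n) (Fin n) K}
    (hN : H * N - N * H = (2 : K) • N) (hH : N * M - M * N = H)
    (v : Fin n → K) (μ : K) (hv : H *ᵥ v = (-μ) • v) (hM : M *ᵥ v = 0) (i : ℕ) :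
    M *ᵥ ((N ^ (i + 1)) *ᵥ v) = ((i + 1) * (μ - i)) • ((N ^ i) *ᵥ v) := by
  have hs : M * N = N * M - H := by rw [← hH]; abel
  induction i with
  | zero =>
    rw [pow_succ', ← Matrix.mulVec_mulVec, Matrix.mulVec_mulVec _ M, hs, Matrix.sub_mulVec, pow_zero, Matrix.one_mulVec,
      ← Matrix.mulVec_mulVec, hM, hv]
    simp
  | succ i ih =>
    rw [pow_succ', ← Matrix.mulVec_mulVec, Matrix.mulVec_mulVec _ M, hs, Matrix.sub_mulVec,
      ← Matrix.mulVec_mulVec, ih, sl2_H 2 hN v (-μ) hv, Matrix.mulVec_smul, Matrix.mulVec_mulVec, ← pow_succ',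
      ← sub_smul]
    congr 1
    push_cast; ring

theorem sl2_nat {K : Type*} [Field K] [CharZero K] {n : ℕ} {N M H : Matrix (Fin n) (Fin n) K}
    (hN : H * N - N * H = (2 : K) • N) (hH : N * M - M * N = H)
    (v : Fin n → K) (μ : K) (hv0 : v ≠ 0) (hv : H *ᵥ v = (-μ) • v) (hM : M *ᵥ v = 0) :
    ∃ k : ℕ, μ = k ∧ (N ^ (k + 1)) *ᵥ v = 0 := by
  have h := eig_chain H (fun i => (N ^ i) *ᵥ v) (-μ) 2 two_ne_zero (sl2_H 2 hN v (-μ) hv)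
  obtain ⟨k, hk, hk1⟩ := Nat.exists_not_and_succ_of_not_zero_of_exists (p := fun i => (N ^ i) *ᵥ v = 0)
    (by simpa using hv0) h
  refine ⟨k, ?_, hk1⟩
  have := sl2_M hN hH v μ hv hM k
  rw [hk1, Matrix.mulVec_zero, eq_comm, smul_eq_zero] at this
  rcases this with h | h
  · rcases mul_eq_zero.1 h with h | h
    · exact absurd h (Nat.cast_add_one_ne_zero k)
    · exact sub_eq_zero.1 h
  · exact absurd h hk

theorem sl2_prim {n : ℕ} (hn : 0 < n) {N M H : Matrix (Fin n) (Fin n) ℝ}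
    (hN : H * N - N * H = (2 : ℝ) • N) (hM : H * M - M * H = (-2 : ℝ) • M) (hH : N * M - M * N = H) :
    ∃ (m : ℕ) (v : Fin n → ℝ), v ≠ 0 ∧ H *ᵥ v = (-(m : ℝ)) • v ∧ M *ᵥ v = 0 := by
  have hNc : cx H * cx N - cx N * cx H = (2 : ℂ) • cx N := by
    have := congrArg cx hN
    rw [show cx (H * N - N * H) = cx (H * N) - cx (N * H) from Matrix.map_sub _ (by simp) _ _] at this
    rw [← cx_mul, ← cx_mul, this]
    ext i k; simp
  have hMc : cx H * cx M - cx M * cx H = (-2 : ℂ) • cx M := by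
    have := congrArg cx hM
    rw [show cx (H * M - M * H) = cx (H * M) - cx (M * H) from Matrix.map_sub _ (by simp) _ _] at this
    rw [← cx_mul, ← cx_mul, this]
    ext i k; simp
  have hHc : cx N * cx M - cx M * cx N = cx H := by
    have := congrArg cx hH
    rw [show cx (N * M - M * N) = cx (N * M) - cx (M * N) from Matrix.map_sub _ (by simp) _ _] at this
    rw [← cx_mul, ← cx_mul, this]
  haveI : Nonempty (Fin n) := ⟨⟨0, hn⟩⟩
  obtain ⟨a, ha⟩ := Module.End.exists_eigenvalue (Matrix.toLin' (cx H))
  obtain ⟨v, hv⟩ := ha.exists_hasEigenvector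
  have hv1 : cx H *ᵥ v = a • v := by
    have := hv.apply_eq_smul
    rwa [Matrix.toLin'_apply] at this
  have hch := sl2_H (-2) hMc v a hv1
  obtain ⟨k, hk, hk1⟩ := Nat.exists_not_and_succ_of_not_zero_of_exists (p := fun i => (cx M ^ i) *ᵥ v = 0)
    (by simpa using hv.2) (eig_chain (cx H) _ a (-2) (by norm_num) hch)
  have hw := hch k
  generalize hwd : (cx M ^ k) *ᵥ v = w at *
  have hMw : cx M *ᵥ w = 0 := by rw [← hwd, Matrix.mulVec_mulVec, ← pow_succ', hk1]
  generalize a + (k : ℂ) * (-2) = b at *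
  obtain ⟨m, hm, -⟩ := sl2_nat hNc hHc w (-b) hk (by simpa using hw) hMw
  have hb : b = -(m : ℂ) := by rw [← hm]; simp
  have hre : ∀ (A : Matrix (Fin n) (Fin n) ℝ) (w : Fin n → ℂ) i, ((cx A *ᵥ w) i).re = (A *ᵥ fun r => (w r).re) i := by
    intro A w i
    simp [Matrix.mulVec, dotProduct]
  have him : ∀ (A : Matrix (Fin n) (Fin n) ℝ) (w : Fin n → ℂ) i, ((cx A *ᵥ w) i).im = (A *ᵥ fun r => (w r).im) i := by
    intro A w i
    simp [Matrix.mulVec, dotProduct]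
  refine ⟨m, ?_⟩
  by_cases h0 : (fun r => (w r).re) = 0
  · refine ⟨fun r => (w r).im, ?_, ?_, ?_⟩
    · intro h1
      refine hk (funext fun r => Complex.ext ?_ ?_)
      · exact congrFun h0 r
      · exact congrFun h1 r
    · ext i
      rw [← him, hw, hb]; simp
    · ext i
      rw [← him, hMw]; simp
  · refine ⟨fun r => (w r).re, h0, ?_, ?_⟩
    · ext i
      rw [← hre, hw, hb]; simp
    · ext i
      rw [← hre, hMw]; simp

theorem dpow (p : ℕ) (c : ℝ) : HasDerivAt (fun x : ℝ => x ^ p * c) (if p = 1 then c else 0) 0 := by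
  have := (hasDerivAt_pow p (0:ℝ)).mul_const c
  have e : (if p = 1 then c else 0) = (p : ℝ) * 0 ^ (p - 1) * c := by
    rcases p with _ | _ | p <;> simp
  rw [e]
  exact this

theorem coeff_lin_pow {R : Type*} [CommRing R] (a b : R) (n k : ℕ) :
    ((Polynomial.C a * Polynomial.X + Polynomial.C b) ^ n).coeff k =
      a ^ k * b ^ (n - k) * (n.choose k : R) := by
  have e : (Polynomial.C a * Polynomial.X + Polynomial.C b) ^ n =
      ∑ l ∈ Finset.range (n + 1), Polynomial.C (a ^ l * b ^ (n - l) * (n.choose l : R)) *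
        Polynomial.X ^ l := by
    rw [add_pow]
    refine Finset.sum_congr rfl fun l _ => ?_
    simp only [map_mul, map_pow, map_natCast, mul_pow]
    ring
  rw [e, Polynomial.finset_sum_coeff]
  simp only [Polynomial.coeff_C_mul, Polynomial.coeff_X_pow, mul_ite, mul_one, mul_zero]
  rw [Finset.sum_ite_eq]
  split_ifs with h
  · rfl
  · rw [Nat.choose_eq_zero_of_lt (by simpa using h)]; simp

theorem symP_oneP_u (m : ℕ) : OneP (fun x => symP m (uS x).1)
    (Matrix.of fun k i : Fin (m + 1) => if (k : ℕ) = i + 1 then ((m : ℝ) - (i : ℕ)) else 0) := by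
  refine ⟨?_, ?_, ?_⟩
  · simp only [uS_zero, Matrix.SpecialLinearGroup.coe_one, symP_one]
  · intro x y
    simp only [uS_add, Matrix.SpecialLinearGroup.coe_mul, symP_mul]
  · intro k i
    have hi : (i : ℕ) ≤ m := by have := i.2; omega
    have e : ∀ x : ℝ, symP m (uS x).1 k i = if (i : ℕ) ≤ k then x ^ ((k : ℕ) - i) * ((m - i).choose (k - i) : ℝ) else 0 := by
      intro x
      simp only [symP, symq, uS_val, Matrix.of_apply]
      have := coeff_lin_pow x 1 (m - i) (k - i)
      simp only [one_pow, mul_one] at this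
      simp only [Matrix.cons_val', Matrix.cons_val_zero, Matrix.cons_val_one, Matrix.cons_val_fin_one,
        map_zero, add_zero, map_one, one_mul]
      rw [Polynomial.coeff_X_pow_mul']
      rw [← this]; simp
    simp only [e, Matrix.of_apply]
    by_cases h : (i : ℕ) ≤ k
    · simp only [h, if_true]
      convert dpow ((k : ℕ) - i) ((m - i).choose (k - i) : ℝ) using 1
      by_cases h1 : (k : ℕ) = i + 1
      · have : (k : ℕ) - i = 1 := by omega
        simp [h1, Nat.cast_sub hi]
      · have : (k : ℕ) - i ≠ 1 := by omega
        simp [h1, this]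
    · have h1 : (k : ℕ) ≠ i + 1 := by omega
      simp only [h, h1, if_false]
      exact hasDerivAt_const _ _

theorem symP_oneP_v (m : ℕ) : OneP (fun x => symP m (vS x).1)
    (Matrix.of fun k i : Fin (m + 1) => if (i : ℕ) = k + 1 then ((i : ℕ) : ℝ) else 0) := by
  refine ⟨?_, ?_, ?_⟩
  · simp only [vS_zero, Matrix.SpecialLinearGroup.coe_one, symP_one]
  · intro x y
    simp only [vS_add, Matrix.SpecialLinearGroup.coe_mul, symP_mul]
  · intro k i
    have e : ∀ x : ℝ, symP m (vS x).1 k i = x ^ ((i : ℕ) - k) * ((i : ℕ).choose k : ℝ) := by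
      intro x
      simp only [symP, symq, vS_val, Matrix.of_apply]
      have := coeff_lin_pow 1 x i k
      simp only [one_pow, one_mul] at this
      rw [← this]; simp
    simp only [e, Matrix.of_apply]
    convert dpow ((i : ℕ) - k) ((i : ℕ).choose k : ℝ) using 1
    by_cases h1 : (i : ℕ) = k + 1
    · simp [h1]
    · have : (i : ℕ) - k ≠ 1 := by omega
      simp [h1, this]

theorem irr_form {n : ℕ} (hn : 0 < n) (j : SL 2 ℝ →* SL n ℝ) (hj : IsIrreducibleEmbedding n j) :
    ∃ m : ℕ, n = m + 1 ∧ ∃ (P : Matrix (Fin n) (Fin (m + 1)) ℝ) (P' : Matrix (Fin (m + 1)) (Fin n) ℝ),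
      P * P' = 1 ∧ P' * P = 1 ∧ ∀ h : SL 2 ℝ, (j h).1 = P * symP m h.1 * P' := by
  obtain ⟨N, M, H, hN, hM, hH, hHN, hHM, hNM⟩ := exists_lie n j hj.1
  obtain ⟨m, v, hv0, hv, hMv⟩ := sl2_prim hn hHN hHM hNM
  have hwm : (N ^ (m + 1)) *ᵥ v = 0 := by
    obtain ⟨k, hk, h⟩ := sl2_nat hHN hNM v m hv0 hv hMv
    rw [Nat.cast_inj.1 hk]; exact h
  have hwM := sl2_M hHN hNM v m hv hMv
  have hwH := sl2_H 2 hHN v (-m) hv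
  have hw0 : (N ^ 0) *ᵥ v = v := by simp
  have hwN : ∀ i, N *ᵥ ((N ^ i) *ᵥ v) = (N ^ (i + 1)) *ᵥ v := fun i => by
    rw [Matrix.mulVec_mulVec, pow_succ']
  generalize hwd : (fun i => (N ^ i) *ᵥ v) = w at *
  have hwd' : ∀ i, (N ^ i) *ᵥ v = w i := fun i => congrFun hwd i
  simp only [hwd'] at hwm hwM hwH hw0 hwN
  have hwne : ∀ i, i ≤ m → w i ≠ 0 := by
    intro i
    induction i with
    | zero => intro _; rw [hw0]; exact hv0
    | succ i ih =>
      intro hi h0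
      have := hwM i
      rw [h0, Matrix.mulVec_zero, eq_comm, smul_eq_zero] at this
      have h1 : ((i : ℝ) + 1) * (m - i) ≠ 0 := by
        apply mul_ne_zero
        · positivity
        · rw [sub_ne_zero]; exact_mod_cast (by omega : m ≠ i)
      exact this.elim h1 (ih (by omega))
  let c : ℕ → ℝ := fun i => ((m - i).factorial : ℝ)
  have hc0 : ∀ i, c i ≠ 0 := fun i => Nat.cast_ne_zero.2 (Nat.factorial_ne_zero _)
  have hc : ∀ i, i < m → c i = (m - i) * c (i + 1) := by
    intro i hi
    simp only [c]
    obtain ⟨k, rfl⟩ := Nat.exists_eq_add_of_lt hi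
    rw [show i + k + 1 - i = k + 1 by omega, show i + k + 1 - (i + 1) = k by omega, Nat.factorial_succ]
    push_cast; ring
  let P : Matrix (Fin n) (Fin (m + 1)) ℝ := Matrix.of fun r i => c i * w i r
  have hPcol : ∀ (A : Matrix (Fin n) (Fin n) ℝ) r i, (A * P) r i = c i * (A *ᵥ w i) r := by
    intro A r i
    simp only [Matrix.mul_apply, Matrix.mulVec, dotProduct, P, Matrix.of_apply, Finset.mul_sum]
    exact Finset.sum_congr rfl fun k _ => by ring
  have hPN : N * P = P * Matrix.of fun k i : Fin (m + 1) => if (k : ℕ) = i + 1 then ((m : ℝ) - (i : ℕ)) else 0 := by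
    ext r i
    rw [hPcol, hwN, Matrix.mul_apply]
    simp only [P, Matrix.of_apply, mul_ite, mul_zero]
    by_cases hi : (i : ℕ) < m
    · rw [Finset.sum_eq_single (⟨i + 1, by omega⟩ : Fin (m + 1))]
      · simp only [if_true]; rw [hc i hi]; ring
      · intro k _ hk
        rw [if_neg]; intro h; exact hk (Fin.ext h)
      · simp
    · have : (i : ℕ) = m := by have := i.2; omega
      rw [this, hwm, Finset.sum_eq_zero]
      · simp
      · intro k _; rw [if_neg]; have := k.2; omega
  have hPM : M * P = P * Matrix.of fun k i : Fin (m + 1) => if (i : ℕ) = k + 1 then ((i : ℕ) : ℝ) else 0 := by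
    ext r i
    rw [hPcol, Matrix.mul_apply]
    simp only [P, Matrix.of_apply, mul_ite, mul_zero]
    obtain ⟨i, hi⟩ := i
    rcases i with _ | i
    · simp only [hw0, hMv]
      rw [Finset.sum_eq_zero]
      · simp
      · intro k _; rw [if_neg]; omega
    · rw [Finset.sum_eq_single (⟨i, by omega⟩ : Fin (m + 1))]
      · simp only [if_true]
        rw [hwM i, hc i (by omega)]; simp; ring
      · intro k _ hk
        rw [if_neg]; intro h; exact hk (Fin.ext (by simp at h; simp [h]))
      · simp
  have hjint : ∀ h : SL 2 ℝ, (j h).1 * P = P * symP m h.1 := by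
    let K : Subgroup (SL 2 ℝ) :=
      { carrier := {h | (j h).1 * P = P * symP m h.1}
        one_mem' := by simp [symP_one]
        mul_mem' := by
          intro a b (ha : _ = _) (hb : _ = _)
          change _ = _
          rw [map_mul, Matrix.SpecialLinearGroup.coe_mul, Matrix.SpecialLinearGroup.coe_mul, symP_mul,
            Matrix.mul_assoc, hb, ← Matrix.mul_assoc, ha, Matrix.mul_assoc]
        inv_mem' := by
          intro a (ha : _ = _)
          change _ = _
          have h1 : (j a⁻¹).1 * (j a).1 = 1 := by
            rw [← Matrix.SpecialLinearGroup.coe_mul, ← map_mul]; simp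
          have h2 : symP m a.1 * symP m (a⁻¹).1 = 1 := by
            rw [← symP_mul, ← Matrix.SpecialLinearGroup.coe_mul]; simp [symP_one]
          calc (j a⁻¹).1 * P = (j a⁻¹).1 * (P * (symP m a.1 * symP m (a⁻¹).1)) := by rw [h2, Matrix.mul_one]
            _ = (j a⁻¹).1 * ((j a).1 * P) * symP m (a⁻¹).1 := by
              rw [ha]; simp only [Matrix.mul_assoc]
            _ = P * symP m (a⁻¹).1 := by rw [← Matrix.mul_assoc, h1, Matrix.one_mul] }
    intro h
    exact sl2_gen K (fun x => hN.intertwine (symP_oneP_u m) P hPN x)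
      (fun x => hM.intertwine (symP_oneP_v m) P hPM x) h
  have hinj : Function.Injective P.mulVecLin := by
    have h1 := Module.End.eigenvectors_linearIndependent' (Matrix.toLin' H)
      (fun i : Fin (m + 1) => -(m : ℝ) + ((i : ℕ) : ℝ) * 2) (by
        intro i k h
        simp only [add_right_inj, mul_eq_mul_right_iff, OfNat.ofNat_ne_zero, or_false, Nat.cast_inj] at h
        exact Fin.ext h) (fun i => c i • w i) (fun i => ⟨by
          rw [Module.End.mem_eigenspace_iff, Matrix.toLin'_apply, Matrix.mulVec_smul, hwH, smul_comm],
            smul_ne_zero (hc0 _) (hwne i (by have := i.2; omega))⟩)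
    have h2 : LinearIndependent ℝ P.col := by
      have e : P.col = fun i : Fin (m + 1) => c i • w i := by
        ext i r; simp [P, Matrix.col]
      rw [e]; exact h1
    exact Matrix.mulVec_injective_iff.2 h2
  have hsurj : Function.Surjective P.mulVecLin := by
    rw [← LinearMap.range_eq_top]
    have hW := hj.2 (LinearMap.range P.mulVecLin) ?_
    · rcases hW with h | h
      swap
      · exact h
      exfalso
      have h3 : P.mulVecLin (Pi.single 0 1) ∈ LinearMap.range P.mulVecLin := ⟨_, rfl⟩
      rw [h, Submodule.mem_bot] at h3
      have := hinj (h3.trans (map_zero _).symm)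
      simpa using congrFun this 0
    · rintro A _ ⟨x, rfl⟩
      refine ⟨symP m A.1 *ᵥ x, ?_⟩
      simp only [Matrix.mulVecLin_apply, Matrix.mulVec_mulVec]
      rw [hjint]
  let e := LinearEquiv.ofBijective P.mulVecLin ⟨hinj, hsurj⟩
  have hPe : LinearMap.toMatrix' (e : (Fin (m + 1) → ℝ) →ₗ[ℝ] (Fin n → ℝ)) = P := by
    skip
    apply LinearMap.toMatrix'.symm.injective
    rw [LinearEquiv.symm_apply_apply]
    rfl
  have hPP : P * LinearMap.toMatrix' (e.symm : (Fin n → ℝ) →ₗ[ℝ] (Fin (m + 1) → ℝ)) = 1 := by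
    conv_lhs => rw [← hPe]
    rw [← LinearMap.toMatrix'_comp]
    simp
  have hPP2 : LinearMap.toMatrix' (e.symm : (Fin n → ℝ) →ₗ[ℝ] (Fin (m + 1) → ℝ)) * P = 1 := by
    conv_lhs => rw [← hPe]
    rw [← LinearMap.toMatrix'_comp]
    simp
  refine ⟨m, ?_, P, _, hPP, hPP2, fun h => ?_⟩
  · have := e.finrank_eq
    simpa using this.symm
  · rw [← hjint, Matrix.mul_assoc, hPP, Matrix.mul_one]

attribute [local instance] Matrix.normedAddCommGroup Matrix.normedSpace

/-! ### Polynomial matrix functions -/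

def MPF {α ι κ : Type*} (S : Subalgebra ℂ (α → ℂ)) (M : α → Matrix ι κ ℂ) : Prop :=
  ∀ i j, (fun a => M a i j) ∈ S

section MPF
variable {α ι κ μ : Type*} {S : Subalgebra ℂ (α → ℂ)}

theorem pf_const (c : ℂ) : (fun _ => c : α → ℂ) ∈ S := S.algebraMap_mem c

theorem pf_mul {f g : α → ℂ} (hf : f ∈ S) (hg : g ∈ S) : (fun a => f a * g a) ∈ S := S.mul_mem hf hg
theorem pf_add {f g : α → ℂ} (hf : f ∈ S) (hg : g ∈ S) : (fun a => f a + g a) ∈ S := S.add_mem hf hg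
theorem pf_sub {f g : α → ℂ} (hf : f ∈ S) (hg : g ∈ S) : (fun a => f a - g a) ∈ S := S.sub_mem hf hg
theorem pf_neg {f : α → ℂ} (hf : f ∈ S) : (fun a => - f a) ∈ S := S.neg_mem hf
theorem pf_pow {f : α → ℂ} (hf : f ∈ S) (k : ℕ) : (fun a => f a ^ k) ∈ S := S.pow_mem hf k

theorem pf_sum {β : Type*} (s : Finset β) {f : β → α → ℂ} (hf : ∀ b ∈ s, f b ∈ S) :
    (fun a => ∑ b ∈ s, f b a) ∈ S := by
  have := S.sum_mem hf
  convert this using 1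
  ext a; simp

theorem pf_prod {β : Type*} (s : Finset β) {f : β → α → ℂ} (hf : ∀ b ∈ s, f b ∈ S) :
    (fun a => ∏ b ∈ s, f b a) ∈ S := by
  have := S.prod_mem hf
  convert this using 1
  ext a; simp

theorem MPF.const (A : Matrix ι κ ℂ) : MPF S (fun _ => A) := fun _ _ => pf_const _

theorem MPF.mul [Fintype κ] {M : α → Matrix ι κ ℂ} {N : α → Matrix κ μ ℂ} (hM : MPF S M) (hN : MPF S N) :
    MPF S (fun a => M a * N a) := by
  intro i j
  simp only [Matrix.mul_apply]
  exact pf_sum _ fun k _ => pf_mul (hM i k) (hN k j)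

theorem MPF.add {M N : α → Matrix ι κ ℂ} (hM : MPF S M) (hN : MPF S N) :
    MPF S (fun a => M a + N a) := fun i j => pf_add (hM i j) (hN i j)

theorem MPF.sub {M N : α → Matrix ι κ ℂ} (hM : MPF S M) (hN : MPF S N) :
    MPF S (fun a => M a - N a) := fun i j => pf_sub (hM i j) (hN i j)

theorem MPF.smul {f : α → ℂ} {M : α → Matrix ι κ ℂ} (hf : f ∈ S) (hM : MPF S M) :
    MPF S (fun a => f a • M a) := fun i j => pf_mul hf (hM i j)

theorem MPF.pow [Fintype ι] [DecidableEq ι] {M : α → Matrix ι ι ℂ} (hM : MPF S M) (k : ℕ) :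
    MPF S (fun a => M a ^ k) := by
  induction k with
  | zero => simpa using MPF.const 1
  | succ k ih => simp only [pow_succ]; exact ih.mul hM

theorem MPF.det [Fintype ι] [DecidableEq ι] {M : α → Matrix ι ι ℂ} (hM : MPF S M) :
    (fun a => (M a).det) ∈ S := by
  simp only [Matrix.det_apply]
  refine pf_sum _ fun σ _ => ?_
  have h := pf_mul (pf_const (S := S) (((Equiv.Perm.sign σ : ℤˣ) : ℤ) : ℂ)) (pf_prod Finset.univ fun i _ => hM (σ i) i)
  convert h using 1
  ext a
  rw [Units.smul_def, zsmul_eq_mul]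

theorem MPF.trace [Fintype ι] {M : α → Matrix ι ι ℂ} (hM : MPF S M) :
    (fun a => (M a).trace) ∈ S := by
  simp only [Matrix.trace, Matrix.diag]
  exact pf_sum _ fun i _ => hM i i

theorem MPF.adj {M : α → Mat 2} (hM : MPF S M) : MPF S (fun a => (M a).adjugate) := by
  intro i j
  simp only [Matrix.adjugate_fin_two]
  fin_cases i <;> fin_cases j <;> simp
  · exact hM 1 1
  · exact pf_neg (hM 0 1)
  · exact pf_neg (hM 1 0)
  · exact hM 0 0

theorem MPF.symP {M : α → Mat 2} (m : ℕ) (hM : MPF S M) : MPF S (fun a => symP m (M a)) := by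
  intro k i
  simp only [symP_entry]
  exact pf_sum _ fun p _ => pf_mul (pf_mul (pf_mul (pf_pow (hM 0 0) _) (pf_pow (hM 1 0) _)) (pf_const _))
    (pf_mul (pf_mul (pf_pow (hM 0 1) _) (pf_pow (hM 1 1) _)) (pf_const _))

theorem MPF.ff {n : ℕ} {M N : α → Mat n} (hM : MPF S M) (hN : MPF S N) :
    (fun a => ff (M a) (N a)) ∈ S := by
  apply MPF.det (M := fun a => ffM (M a) (N a))
  intro p q
  exact ((hM.pow p.1).mul hN).mul (hM.pow p.2) q.1 q.2

theorem MPF.listprod [Fintype ι] [DecidableEq ι] {β : Type*} (l : List β) {M : β → α → Matrix ι ι ℂ}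
    (hM : ∀ b, MPF S (M b)) : MPF S (fun a => (l.map fun b => M b a).prod) := by
  induction l with
  | nil => simpa using MPF.const 1
  | cons b l ih => simp only [List.map_cons, List.prod_cons]; exact (hM b).mul ih

end MPF

/-! ### The polynomial representation -/

noncomputable def Jm {m : ℕ} (P P' : Mat (m + 1)) (g : Mat 2) : Mat (m + 1) := P * symP m g * P'

theorem Jm_mul {m : ℕ} {P P' : Mat (m + 1)} (hP : P * P' = 1) (g h : Mat 2) :
    Jm P P' (g * h) = Jm P P' g * Jm P P' h := by
  have hP' : P' * P = 1 := mul_eq_one_comm.1 hP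
  calc P * symP m (g * h) * P' = P * symP m g * (1 * (symP m h * P')) := by
        rw [symP_mul, one_mul]; simp only [Matrix.mul_assoc]
    _ = _ := by rw [← hP']; simp only [Jm, Matrix.mul_assoc]

theorem Jm_one {m : ℕ} {P P' : Mat (m + 1)} (hP : P * P' = 1) : Jm P P' 1 = 1 := by
  rw [Jm, symP_one, mul_one, hP]

theorem symP_scalar {m : ℕ} (c : ℂ) : symP m (c • (1 : Mat 2)) = c ^ m • 1 := by
  have : c • (1 : Mat 2) = !![c, 0; 0, c] := by rw [Matrix.one_fin_two]; simp
  rw [this, symP_diag, Matrix.smul_one_eq_diagonal]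
  congr 1; ext i
  rw [← pow_add]; congr 1; have := i.2; omega

theorem Jm_scalar {m : ℕ} {P P' : Mat (m + 1)} (hP : P * P' = 1) (c : ℂ) :
    Jm P P' (c • (1 : Mat 2)) = c ^ m • 1 := by
  rw [Jm, symP_scalar, Matrix.mul_smul, Matrix.smul_mul, mul_one, hP]

theorem MPF.Jm {α : Type*} {S : Subalgebra ℂ (α → ℂ)} {M : α → Mat 2} {m : ℕ} (P P' : Mat (m + 1))
    (hM : MPF S M) : MPF S (fun a => Jm P P' (M a)) :=
  ((MPF.const P).mul (hM.symP m)).mul (MPF.const P')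

theorem symP_pos_ne {m : ℕ} (a b c d : ℝ) (ha : 0 < a) (hb : 0 < b) (hc : 0 < c) (hd : 0 < d)
    (k i : Fin (m + 1)) : 0 < symP m !![a, b; c, d] k i := by
  rw [symP_entry]
  simp only [Matrix.cons_val', Matrix.cons_val_zero, Matrix.cons_val_one, Matrix.cons_val_fin_one, Matrix.of_apply]
  apply Finset.sum_pos'
  · intro p _; positivity
  · have hk := k.2
    have hi := i.2
    refine ⟨((min k i : ℕ), (k : ℕ) - min (k : ℕ) i), ?_, ?_⟩
    · rw [Finset.HasAntidiagonal.mem_antidiagonal]; simp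
    · have h1 : 0 < (i : ℕ).choose (min (k : ℕ) i) := Nat.choose_pos (by omega)
      have h2 : 0 < (m - i : ℕ).choose ((k : ℕ) - min (k : ℕ) i) := Nat.choose_pos (by omega)
      positivity

theorem symP_cx (m : ℕ) (g : Matrix (Fin 2) (Fin 2) ℝ) :
    symP m (g.map Complex.ofRealHom) = (symP m g).map Complex.ofRealHom := symP_map _ _ _

theorem ff_std {m : ℕ} {P P' : Mat (m + 1)} (hP : P * P' = 1) :
    ff (Jm P P' !![4, 0; 0, 1 / 4]) (Jm P P' !![1, 1; 1, 2]) ≠ 0 ∧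
    ff (Jm P P' !![4, 0; 0, 1 / 4]) (Jm P P' !![2, -1; -1, 1]) ≠ 0 := by
  have hdiag : symP m (!![4, 0; 0, 1 / 4] : Mat 2) = Matrix.diagonal
      fun i : Fin (m + 1) => (4 : ℂ) ^ (i : ℕ) * (1 / 4) ^ (m - (i : ℕ)) := symP_diag m _ _
  have hinj : Function.Injective fun i : Fin (m + 1) => (4 : ℂ) ^ (i : ℕ) * (1 / 4) ^ (m - (i : ℕ)) := by
    intro i k h
    have e : ∀ i : Fin (m + 1), (4 : ℂ) ^ (i : ℕ) * (1 / 4) ^ (m - (i : ℕ)) = 16 ^ (i : ℕ) * (1 / 4) ^ m := by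
      intro i
      have h2 : ∀ i : ℕ, (16 : ℂ) ^ i * (1 / 4) ^ i = 4 ^ i := fun i => by rw [← mul_pow]; norm_num
      have h5 : ∀ (i m : ℕ), i ≤ m → (4 : ℂ) ^ i * (1 / 4) ^ (m - i) = 16 ^ i * (1 / 4) ^ m := by
        intro i m him
        obtain ⟨q, rfl⟩ := Nat.exists_eq_add_of_le him
        rw [Nat.add_sub_cancel_left, pow_add, ← mul_assoc, h2]
      exact h5 i m (by have := i.2; omega)
    simp only [e] at h
    have h3 := mul_right_cancel₀ (pow_ne_zero m (by norm_num : (1 / 4 : ℂ) ≠ 0)) h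
    have h4 : (16 : ℕ) ^ (i : ℕ) = 16 ^ (k : ℕ) := by exact_mod_cast h3
    exact Fin.ext (Nat.pow_right_injective (le_refl 2 |>.trans (by norm_num)) h4)
  have hx1 : ∀ k i, symP m (!![1, 1; 1, 2] : Mat 2) k i ≠ 0 := by
    intro k i
    have h1 := symP_pos_ne (m := m) 1 1 1 2 one_pos one_pos one_pos two_pos k i
    have h2 : (!![1, 1; 1, 2] : Mat 2) = (!![1, 1; 1, 2] : Matrix (Fin 2) (Fin 2) ℝ).map Complex.ofRealHom := by
      ext i j; fin_cases i <;> fin_cases j <;> simp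
    rw [h2, symP_cx, Matrix.map_apply]
    simpa using h1.ne'
  have hx2 : ∀ k i, symP m (!![2, -1; -1, 1] : Mat 2) k i ≠ 0 := by
    intro k i
    have h1 := symP_pos_ne (m := m) 2 1 1 1 two_pos one_pos one_pos one_pos k i
    have h2 : (!![2, -1; -1, 1] : Mat 2) = !![1, 0; 0, -1] * (!![2, 1; 1, 1] : Matrix (Fin 2) (Fin 2) ℝ).map Complex.ofRealHom
        * !![1, 0; 0, -1] := by
      have h3 : (!![2, 1; 1, 1] : Matrix (Fin 2) (Fin 2) ℝ).map Complex.ofRealHom = (!![2, 1; 1, 1] : Mat 2) := by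
        ext i j; fin_cases i <;> fin_cases j <;> simp
      rw [h3, Matrix.mul_fin_two, Matrix.mul_fin_two]
      norm_num
    rw [h2, symP_mul, symP_mul, symP_diag, symP_cx, Matrix.mul_diagonal, Matrix.diagonal_mul, Matrix.map_apply]
    have h3 : ((symP m !![2, 1; 1, 1] k i : ℝ) : ℂ) ≠ 0 := by exact_mod_cast h1.ne'
    refine mul_ne_zero (mul_ne_zero ?_ h3) ?_ <;> simp
  constructor
  · exact ff_conj hP (by rw [hdiag]; exact ff_diag hinj hx1)
  · exact ff_conj hP (by rw [hdiag]; exact ff_diag hinj hx2)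

/-- polynomial functions on 2×2 matrices -/
noncomputable def PM : Subalgebra ℂ (Mat 2 → ℂ) :=
  (MvPolynomial.aeval (fun (p : Fin 2 × Fin 2) (A : Mat 2) => A p.1 p.2)).range

theorem PM_id : MPF PM (fun A => A) := by
  intro i j
  exact ⟨X (i, j), by simp⟩

theorem PM_dense {f : Mat 2 → ℂ} (hf : f ∈ PM) {K : Set (Mat 2)} {A : Mat 2} (hA : A ∈ Zc K)
    (h : f A ≠ 0) : ∃ B ∈ K, f B ≠ 0 := by
  obtain ⟨P, rfl⟩ := hf
  have e : ∀ A : Mat 2, (MvPolynomial.aeval (fun (p : Fin 2 × Fin 2) (A : Mat 2) => A p.1 p.2)) P A = pev P A := by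
    intro A
    have h1 := MvPolynomial.map_aeval (fun (p : Fin 2 × Fin 2) (A : Mat 2) => A p.1 p.2)
      (Pi.evalRingHom (fun _ : Mat 2 => ℂ) A) P
    exact h1.trans rfl
  by_contra! hB
  exact h ((e A).trans (hA P fun B hBK => (e B).symm.trans (hB B hBK)))

attribute [local instance] Matrix.normedAddCommGroup Matrix.normedSpace

/-! ### Words with adjugates, absolute irreducibility -/

noncomputable def wadj (l : List (Bool × Bool)) (p : Bool → Mat 2) : Mat 2 :=
  (l.map fun x => if x.2 then p x.1 else (p x.1).adjugate).prod

theorem wadj_lift (l : List (Bool × Bool)) (f : Bool → SL 2 ℂ) :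
    (FreeGroup.lift f (FreeGroup.mk l)).1 = wadj l (fun b => (f b).1) := by
  rw [FreeGroup.lift_mk]
  induction l with
  | nil => simp [wadj]
  | cons x l ih =>
    obtain ⟨x, s⟩ := x
    simp only [List.map_cons, List.prod_cons, wadj]
    rw [Matrix.SpecialLinearGroup.coe_mul, ih]
    cases s <;> simp [wadj, Matrix.SpecialLinearGroup.coe_inv]

theorem MPF.wadj {α : Type*} {S : Subalgebra ℂ (α → ℂ)} (l : List (Bool × Bool)) {p : α → Bool → Mat 2}
    (hp : ∀ b, MPF S (fun a => p a b)) : MPF S (fun a => wadj l (p a)) := by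
  refine MPF.listprod l fun x => ?_
  by_cases h : x.2
  · simp only [h, if_true]; exact hp _
  · simp only [h]; exact (hp _).adj

theorem closure_pair_word {G : Type*} [Group G] {u v w : G} (hw : w ∈ Subgroup.closure {u, v}) :
    ∃ W : FreeGroup Bool, w = FreeGroup.lift (fun b => if b then v else u) W := by
  have : Subgroup.closure {u, v} ≤ (FreeGroup.lift (fun b : Bool => if b then v else u)).range := by
    rw [Subgroup.closure_le]
    rintro x (rfl | rfl)
    · exact ⟨FreeGroup.of false, by simp⟩
    · exact ⟨FreeGroup.of true, by simp⟩
  obtain ⟨W, hW⟩ := this hw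
  exact ⟨W, hW.symm⟩

theorem closure_pair_wadj {u v w : SL 2 ℂ} (hw : w ∈ Subgroup.closure {u, v}) :
    ∃ l, w.1 = wadj l (fun b => if b then v.1 else u.1) := by
  obtain ⟨W, rfl⟩ := closure_pair_word hw
  refine ⟨W.toWord, ?_⟩
  have := wadj_lift W.toWord (fun b => if b then v else u)
  rw [FreeGroup.mk_toWord] at this
  rw [this]
  congr 1; ext1 b; cases b <;> rfl

def AbsP {n : ℕ} (A B : Mat n) : Prop := ∀ C : Mat n, C * A = A * C → C * B = B * C → ∃ c : ℂ, C = c • 1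

theorem ff_scalar {n : ℕ} {g x C : Mat n} (h : ff g x ≠ 0) (hg : C * g = g * C) (hx : C * x = x * C) :
    ∃ c : ℂ, C = c • 1 := by
  have hM : IsUnit (ffM g x) := (Matrix.isUnit_iff_isUnit_det _).2 (isUnit_iff_ne_zero.2 h)
  have hall : ∀ M : Mat n, C * M = M * C := by
    intro M
    obtain ⟨v, hv⟩ := (Matrix.vecMul_surjective_iff_isUnit.2 hM) (fun q => M q.1 q.2)
    have hMs : M = ∑ p : Fin n × Fin n, v p • (g ^ (p.1 : ℕ) * x * g ^ (p.2 : ℕ)) := by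
      ext i j
      have := congrFun hv (i, j)
      simp only [Matrix.vecMul, dotProduct, ffM, Matrix.of_apply] at this
      rw [← this, Matrix.sum_apply]
      simp
    rw [hMs, Finset.mul_sum, Finset.sum_mul]
    refine Finset.sum_congr rfl fun p _ => ?_
    rw [Matrix.mul_smul, Matrix.smul_mul]
    congr 1
    have h1 : ∀ k : ℕ, Commute C (g ^ k) := fun k => Commute.pow_right hg k
    exact ((h1 _).mul_right hx).mul_right (h1 _)
  obtain ⟨c, hc⟩ := Matrix.mem_range_scalar_of_commute_single (M := C) (fun i j _ => (hall _).symm)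
  refine ⟨c, ?_⟩
  rw [← hc, Matrix.scalar_apply, Matrix.smul_one_eq_diagonal]

theorem abs_of_wadj {m : ℕ} {P P' : Mat (m + 1)} (hP : P * P' = 1) {p : Bool → Mat 2}
    (hp : ∀ b, (p b).det ≠ 0) {l1 l2 : List (Bool × Bool)}
    (h : ff (Jm P P' (wadj l1 p)) (Jm P P' (wadj l2 p)) ≠ 0) :
    AbsP (Jm P P' (p false)) (Jm P P' (p true)) := by
  intro C h1 h2
  have hb : ∀ b, C * Jm P P' (p b) = Jm P P' (p b) * C := by intro b; cases b; exacts [h1, h2]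
  have hadj : ∀ b, C * Jm P P' (p b).adjugate = Jm P P' (p b).adjugate * C := by
    intro b
    have e1 : Jm P P' (p b) * Jm P P' (p b).adjugate = (p b).det ^ m • 1 := by
      rw [← Jm_mul hP, Matrix.mul_adjugate, Jm_scalar hP]
    have e2 : Jm P P' (p b).adjugate * Jm P P' (p b) = (p b).det ^ m • 1 := by
      rw [← Jm_mul hP, Matrix.adjugate_mul, Jm_scalar hP]
    have e3 : (p b).det ^ m • (C * Jm P P' (p b).adjugate) = (p b).det ^ m • (Jm P P' (p b).adjugate * C) := by
      calc (p b).det ^ m • (C * Jm P P' (p b).adjugate)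
          = ((p b).det ^ m • 1) * (C * Jm P P' (p b).adjugate) := by rw [Matrix.smul_mul, one_mul]
        _ = Jm P P' (p b).adjugate * (Jm P P' (p b) * C) * Jm P P' (p b).adjugate := by
            rw [← e2]; simp only [mul_assoc]
        _ = Jm P P' (p b).adjugate * C * (Jm P P' (p b) * Jm P P' (p b).adjugate) := by
            rw [← hb]; simp only [mul_assoc]
        _ = _ := by rw [e1, Matrix.mul_smul, mul_one]
    exact smul_right_injective _ (pow_ne_zero m (hp b)) e3
  have hw : ∀ l, C * Jm P P' (wadj l p) = Jm P P' (wadj l p) * C := by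
    intro l
    induction l with
    | nil => simp [wadj, Jm_one hP]
    | cons x l ih =>
      have : wadj (x :: l) p = (if x.2 then p x.1 else (p x.1).adjugate) * wadj l p := by simp [wadj]
      have key : C * Jm P P' (if x.2 then p x.1 else (p x.1).adjugate) =
          Jm P P' (if x.2 then p x.1 else (p x.1).adjugate) * C := by
        by_cases hx : x.2 = true
        · rw [if_pos hx]; exact hb x.1
        · rw [if_neg hx]; exact hadj x.1
      rw [this, Jm_mul hP, ← mul_assoc, key, mul_assoc, ih, mul_assoc]
  exact ff_scalar h (hw l1) (hw l2)

/-! ### Density -/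

theorem dens1 {G : Type*} [Group G] (r : G →* SL 2 ℂ) (hr : Function.Injective r)
    (htf : ∀ h : G, ∀ k : ℕ, k ≠ 0 → h ^ k = 1 → h = 1) (L : Subgroup G) (hL : NonMet L) {f : Mat 2 → ℂ} (hf : f ∈ PM) {A : Mat 2} (hA : A.det = 1) (h : f A ≠ 0) :
    ∃ u ∈ L, f (r u).1 ≠ 0 := by
  obtain ⟨_, ⟨_, ⟨u, hu, rfl⟩, rfl⟩, hB⟩ := PM_dense hf (dense_hom r hr htf L hL A hA) h
  exact ⟨u, hu, hB⟩

theorem dens2 {G : Type*} [Group G] (r : G →* SL 2 ℂ) (hr : Function.Injective r)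
    (htf : ∀ h : G, ∀ k : ℕ, k ≠ 0 → h ^ k = 1 → h = 1) (L : Subgroup G) (hL : NonMet L) {m : ℕ} {P P' : Mat (m + 1)} (hP : P * P' = 1) :
    ∃ u ∈ L, ∃ v ∈ L, ff (Jm P P' (r u).1) (Jm P P' (r v).1) ≠ 0 := by
  obtain ⟨u, hu, h1⟩ := dens1 r hr htf L hL (f := fun A => ff (Jm P P' A) (Jm P P' !![1, 1; 1, 2]))
    ((PM_id.Jm P P').ff (MPF.const _)) (A := !![4, 0; 0, 1 / 4]) (by norm_num [Matrix.det_fin_two])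
    (ff_std hP).1
  obtain ⟨v, hv, h2⟩ := dens1 r hr htf L hL (f := fun A => ff (Jm P P' (r u).1) (Jm P P' A))
    ((MPF.const _).ff (PM_id.Jm P P')) (A := !![1, 1; 1, 2]) (by norm_num [Matrix.det_fin_two]) h1
  exact ⟨u, hu, v, hv, h2⟩

theorem dens4 {G : Type*} [Group G] (r : G →* SL 2 ℂ) (hr : Function.Injective r)
    (htf : ∀ h : G, ∀ k : ℕ, k ≠ 0 → h ^ k = 1 → h = 1) (L : Subgroup G) (hL : NonMet L) {m : ℕ} {P P' : Mat (m + 1)} (hP : P * P' = 1) :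
    ∃ p ∈ L, ∃ q ∈ L, ∃ u ∈ L, ∃ v ∈ L, ff (Jm P P' (r ⁅p, q⁆).1) (Jm P P' (r ⁅u, v⁆).1) ≠ 0 ∧
      ff (Jm P P' (r ⁅p, q⁆).1) (Jm P P' (r ⁅u, v⁆⁻¹).1) ≠ 0 := by
  let c : Mat 2 → Mat 2 → Mat 2 := fun A B => A * B * A.adjugate * B.adjugate
  have hc : ∀ p q, (r ⁅p, q⁆).1 = c (r p).1 (r q).1 := by
    intro p q
    simp [c, commutatorElement_def, Matrix.SpecialLinearGroup.coe_inv]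
  have hc' : ∀ p q, (r ⁅p, q⁆⁻¹).1 = c (r q).1 (r p).1 := by
    intro p q
    rw [commutatorElement_inv, hc]
  have hcP : ∀ {S : Subalgebra ℂ (Mat 2 → ℂ)} {M N : Mat 2 → Mat 2}, MPF S M → MPF S N →
      MPF S (fun a => c (M a) (N a)) := fun hM hN => ((hM.mul hN).mul hM.adj).mul hN.adj
  let F : Mat 2 → Mat 2 → Mat 2 → Mat 2 → ℂ := fun A B U V =>
    ff (Jm P P' (c A B)) (Jm P P' (c U V)) * ff (Jm P P' (c A B)) (Jm P P' (c V U))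
  have hF : ∀ {M1 M2 M3 M4 : Mat 2 → Mat 2}, MPF PM M1 → MPF PM M2 → MPF PM M3 → MPF PM M4 →
      (fun a => F (M1 a) (M2 a) (M3 a) (M4 a)) ∈ PM := fun h1 h2 h3 h4 =>
    pf_mul (((hcP h1 h2).Jm P P').ff ((hcP h3 h4).Jm P P')) (((hcP h1 h2).Jm P P').ff ((hcP h4 h3).Jm P P'))
  have hF0 : F !![0, 1; -1, 0] !![1 / 2, 0; 0, 2] !![1, 1; 0, 1] !![1, 0; -1, 1] ≠ 0 := by
    have e1 : c !![0, 1; -1, 0] !![1 / 2, 0; 0, 2] = !![4, 0; 0, 1 / 4] := by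
      simp only [c, Matrix.adjugate_fin_two_of, Matrix.mul_fin_two]; norm_num
    have e2 : c !![1, 1; 0, 1] !![1, 0; -1, 1] = !![1, 1; 1, 2] := by
      simp only [c, Matrix.adjugate_fin_two_of, Matrix.mul_fin_two]; norm_num
    have e3 : c !![1, 0; -1, 1] !![1, 1; 0, 1] = !![2, -1; -1, 1] := by
      simp only [c, Matrix.adjugate_fin_two_of, Matrix.mul_fin_two]; norm_num
    simp only [F, e1, e2, e3]
    exact mul_ne_zero (ff_std hP).1 (ff_std hP).2
  obtain ⟨p, hp, h1⟩ := dens1 r hr htf L hL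
    (hF PM_id (MPF.const _) (MPF.const _) (MPF.const _)) (by norm_num [Matrix.det_fin_two]) hF0
  obtain ⟨q, hq, h2⟩ := dens1 r hr htf L hL
    (hF (MPF.const _) PM_id (MPF.const _) (MPF.const _)) (by norm_num [Matrix.det_fin_two]) h1
  obtain ⟨u, hu, h3⟩ := dens1 r hr htf L hL
    (hF (MPF.const _) (MPF.const _) PM_id (MPF.const _)) (by norm_num [Matrix.det_fin_two]) h2
  obtain ⟨v, hv, h4⟩ := dens1 r hr htf L hL
    (hF (MPF.const _) (MPF.const _) (MPF.const _) PM_id) (by norm_num [Matrix.det_fin_two]) h3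
  refine ⟨p, hp, q, hq, u, hu, v, hv, ?_, ?_⟩
  · rw [hc, hc]; exact left_ne_zero_of_mul h4
  · rw [hc', hc]; exact right_ne_zero_of_mul h4

theorem ff_one {n : ℕ} (hn : 2 ≤ n) (x : Mat n) : ff 1 x = 0 := by
  refine Matrix.det_zero_of_row_eq (i := ((⟨0, by omega⟩ : Fin n), (⟨0, by omega⟩ : Fin n)))
    (j := ((⟨1, by omega⟩ : Fin n), (⟨0, by omega⟩ : Fin n))) ?_ ?_
  · simp
  · ext q; simp [ffM]

attribute [local instance] Matrix.normedAddCommGroup Matrix.normedSpace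

/-! ### Algebraic paths in the representation variety of `SL₂` -/

/-- polynomial functions of one variable -/
noncomputable def PC : Subalgebra ℂ (ℂ → ℂ) := (Polynomial.aeval (fun t : ℂ => t)).range

theorem PC_id : (fun t : ℂ => t) ∈ PC := ⟨Polynomial.X, by simp⟩

theorem PC_poly {f : ℂ → ℂ} (hf : f ∈ PC) : ∃ q : Polynomial ℂ, ∀ t, f t = q.eval t := by
  obtain ⟨q, rfl⟩ := hf
  refine ⟨q, fun t => ?_⟩
  induction q using Polynomial.induction_on' with
  | add p q hp hq => simp only [Polynomial.eval_add, map_add, ← hp, ← hq]; rfl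
  | monomial n a =>
    change (Polynomial.aeval (fun t : ℂ => t)) (Polynomial.monomial n a) t = _
    rw [Polynomial.aeval_monomial, Polynomial.eval_monomial]
    rfl

theorem PC_line (x y : ℂ) : (fun t : ℂ => (1 - t) * x + t * y) ∈ PC :=
  pf_add (pf_mul (pf_sub (pf_const 1) PC_id) (pf_const x)) (pf_mul PC_id (pf_const y))

theorem PC_mline {ι κ : Type*} (X Y : Matrix ι κ ℂ) : MPF PC (fun t : ℂ => (1 - t) • X + t • Y) :=
  (MPF.smul (pf_sub (pf_const 1) PC_id) (MPF.const X)).add (MPF.smul PC_id (MPF.const Y))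

noncomputable def Ka {k : ℕ} (H : Fin k × Bool → Mat 2) : Mat 2 :=
  (List.ofFn fun i : Fin k => H (i, false) * H (i, true) * (H (i, false)).adjugate * (H (i, true)).adjugate).prod

noncomputable def Da {k : ℕ} (H : Fin k × Bool → Mat 2) : ℂ :=
  (List.ofFn fun i : Fin k => (H (i, false)).det * (H (i, true)).det).prod

theorem MPF.Ka {α : Type*} {S : Subalgebra ℂ (α → ℂ)} {k : ℕ} {H : α → Fin k × Bool → Mat 2}
    (hH : ∀ x, MPF S (fun a => H a x)) : MPF S (fun a => Ka (H a)) := by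
  simp only [_root_.Ka, List.ofFn_eq_map]
  exact MPF.listprod _ fun i => (((hH _).mul (hH _)).mul (hH _).adj).mul (hH _).adj

theorem MPF.Da {α : Type*} {S : Subalgebra ℂ (α → ℂ)} {k : ℕ} {H : α → Fin k × Bool → Mat 2}
    (hH : ∀ x, MPF S (fun a => H a x)) : (fun a => Da (H a)) ∈ S := by
  simp only [_root_.Da, List.prod_ofFn]
  exact pf_prod _ fun i _ => pf_mul (hH _).det (hH _).det

theorem Ka_det {k : ℕ} (H : Fin k × Bool → Mat 2) : (Ka H).det = Da H ^ 2 := by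
  have : ∀ l : List (Fin k), ((l.map fun i => H (i, false) * H (i, true) * (H (i, false)).adjugate *
      (H (i, true)).adjugate).prod).det = ((l.map fun i => (H (i, false)).det * (H (i, true)).det).prod) ^ 2 := by
    intro l
    induction l with
    | nil => simp
    | cons i l ih =>
      simp only [List.map_cons, List.prod_cons, Matrix.det_mul, ih, Matrix.det_adjugate, Fintype.card_fin]
      ring
  rw [Ka, Da, List.ofFn_eq_map, List.ofFn_eq_map]
  exact this _

theorem Da_one {k : ℕ} {H : Fin k × Bool → Mat 2} (h : ∀ x, (H x).det = 1) : Da H = 1 := by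
  simp [Da, List.prod_ofFn, h]

theorem cay2 (M : Mat 2) : M * M = M.trace • M - M.det • 1 := by
  generalize ha : M 0 0 = a; generalize hb : M 0 1 = b
  generalize hc : M 1 0 = c; generalize hd : M 1 1 = d
  have : M = !![a, b; c, d] := by rw [Matrix.eta_fin_two M, ha, hb, hc, hd]
  subst this
  rw [Matrix.mul_fin_two, Matrix.trace_fin_two, Matrix.det_fin_two, Matrix.one_fin_two]
  ext i j; fin_cases i <;> fin_cases j <;> simp <;> ring

theorem anti2 (A X : Mat 2) (hX : X.trace = 0) :
    A * X + X * A = A.trace • X + (A * X).trace • 1 := by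
  generalize ha : A 0 0 = a; generalize hb : A 0 1 = b
  generalize hc : A 1 0 = c; generalize hd : A 1 1 = d
  generalize ha' : X 0 0 = x; generalize hb' : X 0 1 = y
  generalize hc' : X 1 0 = z; generalize hd' : X 1 1 = w
  have e1 : A = !![a, b; c, d] := by rw [Matrix.eta_fin_two A, ha, hb, hc, hd]
  have e2 : X = !![x, y; z, w] := by rw [Matrix.eta_fin_two X, ha', hb', hc', hd']
  rw [Matrix.trace_fin_two, ha', hd'] at hX
  have : w = -x := by linear_combination hX
  subst this
  rw [e1, e2, Matrix.mul_fin_two, Matrix.mul_fin_two, Matrix.trace_fin_two, Matrix.trace_fin_two, Matrix.one_fin_two]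
  ext i j; fin_cases i <;> fin_cases j <;> simp <;> ring

theorem handle_solve (K A C : Mat 2) (D : ℂ) (hK : K.det = D ^ 2) (hA : (K * A).trace = D * A.trace) :
    K * A * (K * A * C + D • (C * A - A.trace • C)) = D • ((K * A * C + D • (C * A - A.trace • C)) * A) := by
  have h1 : (K * A) * (K * A) * C = (D * A.trace) • (K * A * C) - (D ^ 2 * A.det) • C := by
    rw [cay2, hA, Matrix.det_mul, hK, Matrix.sub_mul, Matrix.smul_mul, Matrix.smul_mul, one_mul]
  have h2 : C * A * A = A.trace • (C * A) - A.det • C := by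
    rw [mul_assoc, cay2, Matrix.mul_sub, Matrix.mul_smul, Matrix.mul_smul, mul_one]
  calc K * A * (K * A * C + D • (C * A - A.trace • C))
      = (K * A) * (K * A) * C + D • (K * A * (C * A)) - (D * A.trace) • (K * A * C) := by
        rw [Matrix.mul_add, Matrix.mul_smul, Matrix.mul_sub, Matrix.mul_smul, smul_sub, smul_smul, mul_assoc (K * A)]
        abel
    _ = D • (K * A * C * A) - (D ^ 2 * A.det) • C := by
        rw [h1, mul_assoc (K * A) C A]; abel
    _ = _ := by
        rw [Matrix.add_mul, Matrix.smul_mul, Matrix.sub_mul, Matrix.smul_mul, h2, smul_add]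
        rw [sub_right_comm, sub_self, zero_sub, smul_neg, smul_neg, smul_smul, smul_smul]
        rw [sub_eq_add_neg, show D ^ 2 * A.det = D * D * A.det by ring]

theorem exists_traceless {A : Mat 2} (hA : ∀ c : ℂ, A ≠ c • 1) : ∃ X : Mat 2, X.trace = 0 ∧ (A * X).trace = 1 := by
  by_cases h01 : A 0 1 = 0
  · by_cases h10 : A 1 0 = 0
    · have hd : A 0 0 - A 1 1 ≠ 0 := by
        intro h
        apply hA (A 0 0)
        have : A 1 1 = A 0 0 := by linear_combination -h
        rw [Matrix.eta_fin_two A, h01, h10, this, Matrix.one_fin_two]; simp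
      refine ⟨!![(A 0 0 - A 1 1)⁻¹, 0; 0, -(A 0 0 - A 1 1)⁻¹], by simp [Matrix.trace_fin_two], ?_⟩
      rw [Matrix.trace_fin_two, Matrix.mul_apply, Matrix.mul_apply, Fin.sum_univ_two, Fin.sum_univ_two]
      simp
      field_simp
      ring
    · refine ⟨!![0, (A 1 0)⁻¹; 0, 0], by simp [Matrix.trace_fin_two], ?_⟩
      rw [Matrix.trace_fin_two, Matrix.mul_apply, Matrix.mul_apply, Fin.sum_univ_two, Fin.sum_univ_two]
      simp [h10]
  · refine ⟨!![0, 0; (A 0 1)⁻¹, 0], by simp [Matrix.trace_fin_two], ?_⟩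
    rw [Matrix.trace_fin_two, Matrix.mul_apply, Matrix.mul_apply, Fin.sum_univ_two, Fin.sum_univ_two]
    simp [h01]

theorem exists_trace_ne {n : ℕ} {M : Mat n} (h : M ≠ 0) : ∃ E : Mat n, (M * E).trace ≠ 0 := by
  by_contra! hc
  apply h
  ext i j
  have := hc (Matrix.single j i 1)
  rw [Matrix.trace_mul_single] at this
  simpa using this

theorem exists_trace_ne2 {n : ℕ} {M N : Mat n} (hM : M ≠ 0) (hN : N ≠ 0) :
    ∃ E : Mat n, (M * E).trace ≠ 0 ∧ (N * E).trace ≠ 0 := by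
  obtain ⟨E, hE⟩ := exists_trace_ne hM
  obtain ⟨F, hF⟩ := exists_trace_ne hN
  by_cases h1 : (N * E).trace = 0
  · by_cases h2 : (M * F).trace = 0
    · refine ⟨E + F, ?_, ?_⟩
      · rwa [Matrix.mul_add, Matrix.trace_add, h2, add_zero]
      · rwa [Matrix.mul_add, Matrix.trace_add, h1, zero_add]
    · exact ⟨F, h2, hF⟩
  · exact ⟨E, hE, h1⟩

def tailT {α : Type*} {k : ℕ} (A : Fin (k + 1) × Bool → α) : Fin k × Bool → α := fun x => A (x.1.succ, x.2)

def consT {α : Type*} {k : ℕ} (a b : α) (H : Fin k × Bool → α) : Fin (k + 1) × Bool → α :=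
  fun x => Fin.cases (if x.2 then b else a) (fun i => H (i, x.2)) x.1

theorem consT_eta {α : Type*} {k : ℕ} (A : Fin (k + 1) × Bool → α) :
    consT (A (0, false)) (A (0, true)) (tailT A) = A := by
  ext ⟨i, b⟩
  induction i using Fin.cases with
  | zero => cases b <;> rfl
  | succ i => rfl

theorem tailT_consT {α : Type*} {k : ℕ} (a b : α) (H : Fin k × Bool → α) : tailT (consT a b H) = H := rfl

theorem K_ne_one {n : ℕ} {K A B : Mat n} (h : K * A * B = B * A) (hn : A * B ≠ B * A) : K - 1 ≠ 0 := by
  intro e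
  rw [sub_eq_zero.1 e, one_mul] at h
  exact hn h

theorem trace_K {K A B : Mat 2} (h : K * A * B = B * A) (hB : B.det = 1) : ((K - 1) * A).trace = 0 := by
  have hu : IsUnit B.det := by rw [hB]; exact isUnit_one
  have : K * A = B * A * B⁻¹ := by rw [← h, Matrix.mul_nonsing_inv_cancel_right _ _ hu]
  rw [Matrix.sub_mul, Matrix.trace_sub, this, one_mul, Matrix.trace_mul_comm, ← mul_assoc,
    Matrix.nonsing_inv_mul _ hu, one_mul, sub_self]

theorem exists_path {k : ℕ} {A A' : Fin (k + 1) × Bool → Mat 2} (hA : ∀ x, (A x).det = 1)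
    (hA' : ∀ x, (A' x).det = 1)
    (hK : Ka (tailT A) * A (0, false) * A (0, true) = A (0, true) * A (0, false))
    (hK' : Ka (tailT A') * A' (0, false) * A' (0, true) = A' (0, true) * A' (0, false))
    (hc : A (0, false) * A (0, true) ≠ A (0, true) * A (0, false))
    (hc' : A' (0, false) * A' (0, true) ≠ A' (0, true) * A' (0, false)) :
    ∃ p : ℂ → Fin (k + 1) × Bool → Mat 2, (∀ x, MPF PC (fun t => p t x)) ∧ p 0 = A ∧ p 1 = A' ∧
      ∀ t, Ka (tailT (p t)) * p t (0, false) * p t (0, true) =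
        Da (tailT (p t)) • (p t (0, true) * p t (0, false)) := by
  have nsc : ∀ {X Y : Mat 2}, X * Y ≠ Y * X → ∀ c : ℂ, X ≠ c • 1 := by
    rintro X Y h c rfl
    apply h; rw [Matrix.smul_mul, Matrix.mul_smul, one_mul, mul_one]
  obtain ⟨X, hX0, hX1⟩ := exists_traceless (nsc hc)
  obtain ⟨X', hX0', hX1'⟩ := exists_traceless (nsc hc')
  obtain ⟨E, hE, hE'⟩ := exists_trace_ne2 (K_ne_one hK hc) (K_ne_one hK' hc')
  let H : ℂ → Fin k × Bool → Mat 2 := fun t x => (1 - t) • tailT A x + t • tailT A' x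
  have hH : ∀ x, MPF PC (fun t => H t x) := fun x => PC_mline _ _
  have hH0 : H 0 = tailT A := by ext1 x; simp [H]
  have hH1 : H 1 = tailT A' := by ext1 x; simp [H]
  have hD0 : Da (tailT A) = 1 := Da_one fun x => hA _
  have hD1 : Da (tailT A') = 1 := Da_one fun x => hA' _
  let KD : ℂ → Mat 2 := fun t => Ka (H t) - Da (H t) • 1
  have hKD : MPF PC KD := (MPF.Ka hH).sub (MPF.smul (MPF.Da hH) (MPF.const 1))
  have hKD0 : KD 0 = Ka (tailT A) - 1 := by simp only [KD, hH0, hD0, one_smul]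
  have hKD1 : KD 1 = Ka (tailT A') - 1 := by simp only [KD, hH1, hD1, one_smul]
  let Z : ℂ → Mat 2 := fun t => (1 - t) • A (0, false) + t • A' (0, false)
  have hZ : MPF PC Z := PC_mline _ _
  let den : ℂ → ℂ := fun t => (KD t * E).trace
  let num : ℂ → ℂ := fun t => (KD t * Z t).trace
  have hden : den ∈ PC := (hKD.mul (MPF.const E)).trace
  have hnum : num ∈ PC := (hKD.mul hZ).trace
  let c : ℂ → ℂ := fun t => (1 - t) * (den 0)⁻¹ + t * (den 1)⁻¹
  have hcc : c ∈ PC := PC_line _ _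
  let a : ℂ → Mat 2 := fun t => c t • (den t • Z t - num t • E)
  have ha : MPF PC a := MPF.smul hcc ((MPF.smul hden hZ).sub (MPF.smul hnum (MPF.const E)))
  let C : ℂ → Mat 2 := fun t => (1 - t) • (A (0, true) * X) + t • (A' (0, true) * X')
  have hC : MPF PC C := PC_mline _ _
  let b : ℂ → Mat 2 := fun t => Ka (H t) * a t * C t + Da (H t) • (C t * a t - (a t).trace • C t)
  have hb : MPF PC b := (((MPF.Ka hH).mul ha).mul hC).add
    (MPF.smul (MPF.Da hH) ((hC.mul ha).sub (MPF.smul ha.trace hC)))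
  have htr : ∀ t, (Ka (H t) * a t).trace = Da (H t) * (a t).trace := by
    intro t
    have h1 : (KD t * a t).trace = 0 := by
      simp only [a]
      rw [Matrix.mul_smul, Matrix.mul_sub, Matrix.mul_smul, Matrix.mul_smul, Matrix.trace_smul, Matrix.trace_sub,
        Matrix.trace_smul, Matrix.trace_smul]
      change c t • (den t • num t - num t • den t) = 0
      simp only [smul_eq_mul]; ring
    simp only [KD, Matrix.sub_mul, Matrix.smul_mul, one_mul, Matrix.trace_sub, Matrix.trace_smul, smul_eq_mul] at h1
    linear_combination h1
  have end0 : ∀ (K A B X : Mat 2), K * A * B = B * A → X.trace = 0 → (A * X).trace = 1 →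
      K * A * (B * X) + (1 : ℂ) • (B * X * A - A.trace • (B * X)) = B := by
    intro K A B X h1 h2 h3
    rw [← mul_assoc, h1, one_smul, mul_assoc B A X, mul_assoc B X A, ← Matrix.mul_smul, ← Matrix.mul_sub,
      ← Matrix.mul_add, ← add_sub_assoc, anti2 A X h2, h3, one_smul, add_sub_cancel_left, mul_one]
  have ha0 : a 0 = A (0, false) := by
    have h1 : num 0 = 0 := by
      simp only [num, hKD0]
      have : Z 0 = A (0, false) := by simp [Z]
      rw [this]; exact trace_K hK (hA _)
    have h2 : den 0 ≠ 0 := by simp only [den, hKD0]; exact hE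
    have h3 : Z 0 = A (0, false) := by simp [Z]
    have h4 : c 0 = (den 0)⁻¹ := by simp [c]
    simp only [a]
    rw [h1, h3, h4, zero_smul, sub_zero, smul_smul, inv_mul_cancel₀ h2, one_smul]
  have ha1 : a 1 = A' (0, false) := by
    have h1 : num 1 = 0 := by
      simp only [num, hKD1]
      have : Z 1 = A' (0, false) := by simp [Z]
      rw [this]; exact trace_K hK' (hA' _)
    have h2 : den 1 ≠ 0 := by simp only [den, hKD1]; exact hE'
    have h3 : Z 1 = A' (0, false) := by simp [Z]
    have h4 : c 1 = (den 1)⁻¹ := by simp [c]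
    simp only [a]
    rw [h1, h3, h4, zero_smul, sub_zero, smul_smul, inv_mul_cancel₀ h2, one_smul]
  have hb0 : b 0 = A (0, true) := by
    have h1 : C 0 = A (0, true) * X := by simp [C]
    simp only [b]
    rw [ha0, hH0, hD0, h1]
    exact end0 _ _ _ _ hK hX0 hX1
  have hb1 : b 1 = A' (0, true) := by
    have h1 : C 1 = A' (0, true) * X' := by simp [C]
    simp only [b]
    rw [ha1, hH1, hD1, h1]
    exact end0 _ _ _ _ hK' hX0' hX1'
  refine ⟨fun t => consT (a t) (b t) (H t), ?_, ?_, ?_, ?_⟩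
  · rintro ⟨i, s⟩
    induction i using Fin.cases with
    | zero => cases s <;> assumption
    | succ i => exact hH (i, s)
  · simp only [ha0, hb0, hH0]; exact consT_eta A
  · simp only [ha1, hb1, hH1]; exact consT_eta A'
  · intro t
    exact handle_solve (Ka (H t)) (a t) (C t) (Da (H t)) (Ka_det _) (htr t)

attribute [local instance] Matrix.normedAddCommGroup Matrix.normedSpace

/-! ### A local retraction -/

open scoped Topology in
theorem exists_retract {E F : Type*} [NormedAddCommGroup E] [NormedSpace ℂ E] [CompleteSpace E]
    [NormedAddCommGroup F] [NormedSpace ℂ F] [CompleteSpace F] {F1 F2 : E → F} {a0 : E}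
    (h1 : ContDiffAt ℂ 1 F1 a0) (h2 : ContDiffAt ℂ 1 F2 a0) (h0 : F1 a0 = 0)
    (s : F →L[ℂ] E) (τ : F →L[ℂ] ℂ) (hs : ∀ z, fderiv ℂ F1 a0 (s z) + τ z • F2 a0 = z)
    (hτ : ∀ᶠ p in 𝓝 (a0, (0 : ℂ)), F1 p.1 + p.2 • F2 p.1 = 0 → p.2 = 0) :
    ∃ g : E → E, g a0 = a0 ∧ ContDiffAt ℂ 1 g a0 ∧ (∀ᶠ A in 𝓝 a0, F1 (g A) = 0) ∧
      (∀ᶠ A in 𝓝 a0, F1 A = 0 → g A = A) ∧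
      ∀ (cE : E → E) (cF : F → F), Continuous cE → Continuous cF → cE a0 = a0 → cF 0 = 0 →
        (∀ A B, cE (A + B) = cE A + cE B) → (∀ A, F1 (cE A) = cF (F1 A)) → (∀ A, F2 (cE A) = cF (F2 A)) →
        (∀ x y, cF (x + y) = cF x + cF y) → (∀ (c : ℂ) x, cF (c • x) = (starRingEnd ℂ) c • cF x) →
        (∀ z, s (cF z) = cE (s z)) → (∀ z, τ (cF z) = (starRingEnd ℂ) (τ z)) →
        ∀ᶠ A in 𝓝 a0, g (cE A) = cE (g A) := by
  let u : E × F := (a0, 0)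
  let f : E × F → F := fun p => F1 (p.1 + s p.2) + τ p.2 • F2 (p.1 + s p.2)
  have hu : a0 = u.1 + s u.2 := by simp [u]
  have hl : HasFDerivAt (fun p : E × F => p.1 + s p.2)
      (ContinuousLinearMap.fst ℂ E F + s ∘L ContinuousLinearMap.snd ℂ E F) u :=
    hasFDerivAt_fst.add (s.hasFDerivAt.comp u hasFDerivAt_snd)
  have hlc : ContDiff ℂ 1 (fun p : E × F => p.1 + s p.2) := by fun_prop
  have hfc : ContDiffAt ℂ 1 f u := by
    have e1 : ContDiffAt ℂ 1 (fun p : E × F => F1 (p.1 + s p.2)) u :=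
      ContDiffAt.comp u (by rw [← hu]; exact h1) hlc.contDiffAt
    have e2 : ContDiffAt ℂ 1 (fun p : E × F => F2 (p.1 + s p.2)) u :=
      ContDiffAt.comp u (by rw [← hu]; exact h2) hlc.contDiffAt
    have e3 : ContDiffAt ℂ 1 (fun p : E × F => τ p.2) u := by fun_prop
    exact e1.add (e3.smul e2)
  have hf0 : f u = 0 := by simp [f, u, h0]
  have hfd : ∀ z, fderiv ℂ f u (0, z) = z := by
    intro z
    have e1 : HasFDerivAt (fun p : E × F => F1 (p.1 + s p.2)) _ u :=
      HasFDerivAt.comp u (g' := fderiv ℂ F1 a0)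
        (by rw [← hu]; exact (h1.differentiableAt one_ne_zero).hasFDerivAt) hl
    have e2 : HasFDerivAt (fun p : E × F => F2 (p.1 + s p.2)) _ u :=
      HasFDerivAt.comp u (g' := fderiv ℂ F2 a0)
        (by rw [← hu]; exact (h2.differentiableAt one_ne_zero).hasFDerivAt) hl
    have e3 : HasFDerivAt (fun p : E × F => τ p.2) _ u := τ.hasFDerivAt.comp u hasFDerivAt_snd
    have e4 := e1.add (e3.smul e2)
    have e5 : HasFDerivAt f _ u := e4
    rw [e5.fderiv]
    have := hs z
    simpa [u] using this
  have hinv : (fderiv ℂ f u ∘L .inr ℂ E F).IsInvertible := by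
    refine ⟨ContinuousLinearEquiv.refl ℂ F, ?_⟩
    ext z
    exact (hfd z).symm
  set ψ := hfc.implicitFunction one_ne_zero hinv with hψ
  have p1 : ψ a0 = 0 := hfc.implicitFunction_apply_self one_ne_zero hinv
  have p2 : ∀ᶠ x in 𝓝 a0, f (x, ψ x) = 0 := by
    rw [← hf0]; exact hfc.eventually_apply_implicitFunction one_ne_zero hinv
  have p3 : ∀ᶠ v in 𝓝 u, f v = 0 ↔ ψ v.1 = v.2 := by
    rw [← hf0]; exact hfc.eventually_apply_eq_iff_implicitFunction one_ne_zero hinv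
  have p4 : ContDiffAt ℂ 1 ψ a0 := hfc.contDiffAt_implicitFunction one_ne_zero hinv
  have hg0 : a0 + s (ψ a0) = a0 := by rw [p1, map_zero, add_zero]
  have hgc : ContDiffAt ℂ 1 (fun A => A + s (ψ A)) a0 :=
    contDiffAt_id.add (s.contDiff.contDiffAt.comp a0 p4)
  refine ⟨fun A => A + s (ψ A), hg0, hgc, ?_, ?_, ?_⟩
  · have hc : Filter.Tendsto (fun A => (A + s (ψ A), τ (ψ A))) (𝓝 a0) (𝓝 (a0, 0)) := by
      have : ContinuousAt (fun A => (A + s (ψ A), τ (ψ A))) a0 :=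
        hgc.continuousAt.prodMk (τ.continuous.continuousAt.comp p4.continuousAt)
      have h := this.tendsto
      simp only [p1, map_zero, add_zero] at h
      exact h
    filter_upwards [p2, hc.eventually hτ] with A hA hB
    have : τ (ψ A) = 0 := hB hA
    have hA' : F1 (A + s (ψ A)) + τ (ψ A) • F2 (A + s (ψ A)) = 0 := hA
    rwa [this, zero_smul, add_zero] at hA'
  · have hc : Filter.Tendsto (fun A : E => ((A, 0) : E × F)) (𝓝 a0) (𝓝 u) := by
      have : Continuous (fun A : E => ((A, 0) : E × F)) := by fun_prop
      exact this.tendsto a0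
    filter_upwards [hc.eventually p3] with A hA hF
    have : ψ A = 0 := hA.1 (by simp [f, hF])
    simp only [this, map_zero, add_zero]
  · intro cE cF hcE hcF ha hcF0 hadd hF1 hF2 hFadd hFs hss hτs
    have hc : Filter.Tendsto (fun A : E => ((cE A, cF (ψ A)) : E × F)) (𝓝 a0) (𝓝 u) := by
      have : ContinuousAt (fun A : E => ((cE A, cF (ψ A)) : E × F)) a0 :=
        hcE.continuousAt.prodMk (hcF.continuousAt.comp p4.continuousAt)
      have h := this.tendsto
      simp only [p1, ha, hcF0] at h
      exact h
    filter_upwards [p2, hc.eventually p3] with A hA hB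
    have h3 : f (cE A, cF (ψ A)) = cF (f (A, ψ A)) := by
      simp only [f]
      rw [hss, hτs, ← hadd, hF1, hF2, ← hFs, ← hFadd]
    have h4 : ψ (cE A) = cF (ψ A) := hB.1 (by rw [h3, hA, hcF0])
    change cE A + s (ψ (cE A)) = cE (A + s (ψ A))
    rw [h4, hss, hadd]

attribute [local instance] Matrix.normedAddCommGroup Matrix.normedSpace

/-! ### The representation variety: equations and derivatives -/

noncomputable def KK {k n : ℕ} (H : Fin k × Bool → Mat n) : Mat n :=
  (List.ofFn fun i : Fin k => H (i, false) * H (i, true) * (H (i, false))⁻¹ * (H (i, true))⁻¹).prod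

noncomputable def EqF {k n : ℕ} (A : Tup (Fin (k + 1) × Bool) n) : Mat n :=
  KK (tailT A) * A (0, false) * A (0, true) - A (0, true) * A (0, false)

def HC (k n : ℕ) : Set (Tup (Fin (k + 1) × Bool) n) := {A | A ∈ InvT _ n ∧ EqF A = 0}

section cd
variable {E : Type*} [NormedAddCommGroup E] [NormedSpace ℂ E] {x0 : E}

theorem cd_mat {a b : Type} [Fintype a] [Fintype b] {f : E → Matrix a b ℂ} :
    ContDiffAt ℂ 1 f x0 ↔ ∀ i j, ContDiffAt ℂ 1 (fun x => f x i j) x0 := by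
  constructor
  · intro h i j
    exact (contDiffAt_pi.1 ((contDiffAt_pi (F' := fun _ => b → ℂ)).1 h i)) j
  · intro h
    exact (contDiffAt_pi (F' := fun _ => b → ℂ)).2 fun i => contDiffAt_pi.2 (h i)

theorem cd_mul {a b c : Type} [Fintype a] [Fintype b] [Fintype c]
    {f : E → Matrix a b ℂ} {g : E → Matrix b c ℂ} (hf : ContDiffAt ℂ 1 f x0)
    (hg : ContDiffAt ℂ 1 g x0) : ContDiffAt ℂ 1 (fun x => f x * g x) x0 := by
  rw [cd_mat] at *
  intro i j
  simp only [Matrix.mul_apply]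
  exact ContDiffAt.sum fun k _ => (hf i k).mul (hg k j)

theorem cd_det {a : Type} [Fintype a] [DecidableEq a] {f : E → Matrix a a ℂ}
    (hf : ContDiffAt ℂ 1 f x0) : ContDiffAt ℂ 1 (fun x => (f x).det) x0 := by
  rw [cd_mat] at hf
  simp only [Matrix.det_apply']
  refine ContDiffAt.sum fun σ _ => contDiffAt_const.mul ?_
  exact contDiffAt_prod fun i _ => hf _ _

theorem cd_adj {a : Type} [Fintype a] [DecidableEq a] {f : E → Matrix a a ℂ}
    (hf : ContDiffAt ℂ 1 f x0) : ContDiffAt ℂ 1 (fun x => (f x).adjugate) x0 := by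
  rw [cd_mat]
  intro i j
  simp only [Matrix.adjugate_apply]
  apply cd_det
  rw [cd_mat] at *
  intro k l
  by_cases h : k = j
  · subst h; simp only [Matrix.updateRow_self]; exact contDiffAt_const
  · simp only [Matrix.updateRow_ne h]; exact hf k l

theorem cd_inv {a : Type} [Fintype a] [DecidableEq a] {f : E → Matrix a a ℂ}
    (hf : ContDiffAt ℂ 1 f x0) (h : (f x0).det ≠ 0) : ContDiffAt ℂ 1 (fun x => (f x)⁻¹) x0 := by
  simp only [Matrix.inv_def, Ring.inverse_eq_inv']
  rw [cd_mat]
  intro i j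
  exact ((cd_det hf).inv h).mul (cd_mat.1 (cd_adj hf) i j)

theorem cd_listprod {a β : Type} [Fintype a] [DecidableEq a] (l : List β) {f : β → E → Matrix a a ℂ}
    (hf : ∀ b, ContDiffAt ℂ 1 (f b) x0) : ContDiffAt ℂ 1 (fun x => (l.map fun b => f b x).prod) x0 := by
  induction l with
  | nil => simpa using contDiffAt_const
  | cons b l ih => simp only [List.map_cons, List.prod_cons]; exact cd_mul (hf b) ih

end cd

theorem cd_KK {k n : ℕ} {A : Tup (Fin (k + 1) × Bool) n} (hA : A ∈ InvT _ n) :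
    ContDiffAt ℂ 1 (fun A : Tup (Fin (k + 1) × Bool) n => KK (tailT A)) A := by
  simp only [KK, List.ofFn_eq_map]
  have hx : ∀ x, ContDiffAt ℂ 1 (fun A : Tup (Fin (k + 1) × Bool) n => tailT A x) A :=
    fun x => contDiffAt_pi.1 contDiffAt_id _
  exact cd_listprod _ fun i => cd_mul (cd_mul (cd_mul (hx _) (hx _)) (cd_inv (hx _) (hA _))) (cd_inv (hx _) (hA _))

theorem cd_EqF {k n : ℕ} {A : Tup (Fin (k + 1) × Bool) n} (hA : A ∈ InvT _ n) :
    ContDiffAt ℂ 1 (EqF (k := k) (n := n)) A := by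
  have hx : ∀ x, ContDiffAt ℂ 1 (fun A : Tup (Fin (k + 1) × Bool) n => A x) A :=
    fun x => contDiffAt_pi.1 contDiffAt_id _
  exact (cd_mul (cd_mul (cd_KK hA) (hx _)) (hx _)).sub (cd_mul (hx _) (hx _))

/-- derivative of a quadratic curve -/
theorem quad_deriv {F : Type*} [NormedAddCommGroup F] [NormedSpace ℂ F] (a b c : F) :
    HasDerivAt (fun t : ℂ => a + t • b + (t * t) • c) b 0 := by
  have h1 : HasDerivAt (fun t : ℂ => t • b) ((1 : ℂ) • b) 0 := (hasDerivAt_id 0).smul_const b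
  have h2 : HasDerivAt (fun t : ℂ => (t * t) • c) ((1 * 0 + 0 * 1 : ℂ) • c) 0 :=
    ((hasDerivAt_id (0 : ℂ)).mul (hasDerivAt_id 0)).smul_const c
  have h3 : HasDerivAt (fun t : ℂ => a + t • b + (t * t) • c) (0 + (1 : ℂ) • b + (1 * 0 + 0 * 1 : ℂ) • c) 0 :=
    ((hasDerivAt_const (0 : ℂ) a).add h1).add h2
  rw [one_smul, zero_add, mul_zero, zero_mul, add_zero, zero_smul, add_zero] at h3
  exact h3

theorem EqF_fderiv {k n : ℕ} {A : Tup (Fin (k + 1) × Bool) n} (hA : A ∈ InvT _ n) (X Y : Mat n) :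
    fderiv ℂ (EqF (k := k) (n := n)) A (consT X Y 0) =
      KK (tailT A) * (X * A (0, true) + A (0, false) * Y) - Y * A (0, false) - A (0, true) * X := by
  have h1 := ((cd_EqF hA).differentiableAt one_ne_zero).hasFDerivAt
  have h2 : HasDerivAt (fun t : ℂ => A + t • (consT X Y 0 : Tup (Fin (k + 1) × Bool) n)) (consT X Y 0) 0 := by
    have := quad_deriv A (consT X Y 0 : Tup (Fin (k + 1) × Bool) n) 0
    simp only [smul_zero, add_zero] at this
    exact this
  have h3 : HasDerivAt (fun t : ℂ => EqF (A + t • (consT X Y 0 : Tup (Fin (k + 1) × Bool) n)))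
      (fderiv ℂ (EqF (k := k) (n := n)) A (consT X Y 0)) 0 :=
    HasFDerivAt.comp_hasDerivAt (0 : ℂ) (l := EqF (k := k) (n := n)) (l' := fderiv ℂ (EqF (k := k) (n := n)) A) (f := fun t : ℂ => A + t • (consT X Y 0 : Tup (Fin (k + 1) × Bool) n))
      (by simpa using h1) h2
  have h4 : (fun t : ℂ => EqF (A + t • (consT X Y 0 : Tup (Fin (k + 1) × Bool) n))) = fun t : ℂ =>
      EqF A + t • (KK (tailT A) * (X * A (0, true) + A (0, false) * Y) - Y * A (0, false) - A (0, true) * X) +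
        (t * t) • (KK (tailT A) * X * Y - Y * X) := by
    funext t
    have e1 : tailT (A + t • (consT X Y 0 : Tup (Fin (k + 1) × Bool) n)) = tailT A := by
      funext x; simp [tailT, consT]
    have e2 : (A + t • (consT X Y 0 : Tup (Fin (k + 1) × Bool) n)) (0, false) = A (0, false) + t • X := by
      simp [consT]
    have e3 : (A + t • (consT X Y 0 : Tup (Fin (k + 1) × Bool) n)) (0, true) = A (0, true) + t • Y := by
      simp [consT]
    simp only [EqF, e1, e2, e3]
    simp only [Matrix.mul_add, Matrix.add_mul, Matrix.smul_mul, Matrix.mul_smul, smul_sub, smul_add, smul_smul,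
      Matrix.mul_assoc]
    abel
  rw [h4] at h3
  exact h3.unique (quad_deriv _ _ _)

attribute [local instance] Matrix.normedAddCommGroup Matrix.normedSpace

/-! ### Surjectivity of the derivative -/

theorem dual_trace {n : ℕ} (φ : Mat n →ₗ[ℂ] ℂ) : ∃ V : Mat n, ∀ w, φ w = (V * w).trace := by
  refine ⟨Matrix.of fun i j => φ (Matrix.single j i 1), fun w => ?_⟩
  have h1 : ∀ i j, Matrix.single i j (w i j) = w i j • Matrix.single i j (1 : ℂ) := by
    intro i j; rw [Matrix.smul_single, smul_eq_mul, mul_one]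
  conv_lhs => rw [Matrix.matrix_eq_sum_single w]
  simp only [map_sum, h1, map_smul, smul_eq_mul, Matrix.trace, Matrix.diag, Matrix.mul_apply, Matrix.of_apply]
  rw [Finset.sum_comm]
  exact Finset.sum_congr rfl fun i _ => Finset.sum_congr rfl fun j _ => mul_comm _ _

theorem eq_of_trace {n : ℕ} {M N : Mat n} (h : ∀ X, (M * X).trace = (N * X).trace) : M = N := by
  by_contra hc
  obtain ⟨E, hE⟩ := exists_trace_ne (sub_ne_zero.2 hc)
  apply hE
  rw [Matrix.sub_mul, Matrix.trace_sub, h, sub_self]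

noncomputable def ell {n : ℕ} (K A B : Mat n) : Mat n × Mat n →ₗ[ℂ] Mat n where
  toFun p := K * (p.1 * B + A * p.2) - p.2 * A - B * p.1
  map_add' p q := by
    simp only [Prod.fst_add, Prod.snd_add, Matrix.mul_add, Matrix.add_mul]; abel
  map_smul' c p := by
    simp only [Prod.smul_fst, Prod.smul_snd, Matrix.smul_mul, Matrix.mul_smul, Matrix.mul_add, smul_sub,
      smul_add, RingHom.id_apply]

theorem ell_apply {n : ℕ} (K A B X Y : Mat n) : ell K A B (X, Y) = K * (X * B + A * Y) - Y * A - B * X := rfl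

theorem ell_range {n : ℕ} {K A B : Mat n} (hA : A.det ≠ 0) (hB : B.det ≠ 0) (h : K * A * B = B * A)
    (habs : AbsP A B) {z : Mat n} (hz : ((B * A)⁻¹ * z).trace = 0) : z ∈ LinearMap.range (ell K A B) := by
  by_contra hc
  obtain ⟨φ, hφ, hker⟩ := Submodule.exists_le_ker_of_notMem hc
  obtain ⟨V, hV⟩ := dual_trace φ
  have hk : ∀ X Y, (V * (K * (X * B + A * Y) - Y * A - B * X)).trace = 0 := by
    intro X Y
    rw [← hV, ← ell_apply]
    exact hker ⟨_, rfl⟩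
  have e1 : B * V * K = V * B := by
    apply eq_of_trace
    intro X
    have := hk X 0
    rw [Matrix.mul_zero, add_zero, Matrix.zero_mul, sub_zero, Matrix.mul_sub, Matrix.trace_sub, sub_eq_zero] at this
    rw [mul_assoc V B X, ← this, mul_assoc, mul_assoc, Matrix.trace_mul_comm]
    simp only [mul_assoc]
  have e2 : V * K * A = A * V := by
    apply eq_of_trace
    intro Y
    have := hk 0 Y
    rw [Matrix.mul_zero, Matrix.zero_mul, zero_add, sub_zero, Matrix.mul_sub, Matrix.trace_sub, sub_eq_zero] at this
    rw [mul_assoc A V Y, Matrix.trace_mul_comm A, mul_assoc V Y A, ← this]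
    simp only [mul_assoc]
  have c1 : (A * V * B) * A = A * (A * V * B) := by
    calc (A * V * B) * A = A * V * (B * A) := by simp only [mul_assoc]
      _ = A * (V * K * A) * B := by rw [← h]; simp only [mul_assoc]
      _ = _ := by rw [e2]; simp only [mul_assoc]
  have c2 : (A * V * B) * B = B * (A * V * B) := by
    calc (A * V * B) * B = (V * K * A) * B * B := by rw [e2]
      _ = V * (K * A * B) * B := by simp only [mul_assoc]
      _ = (V * B) * (A * B) := by rw [h]; simp only [mul_assoc]
      _ = B * (V * K * A) * B := by rw [← e1]; simp only [mul_assoc]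
      _ = _ := by rw [e2]; simp only [mul_assoc]
  obtain ⟨σ, hσ⟩ := habs _ c1 c2
  have hAu : IsUnit A.det := isUnit_iff_ne_zero.2 hA
  have hBu : IsUnit B.det := isUnit_iff_ne_zero.2 hB
  have hVe : V = σ • (B * A)⁻¹ := by
    have : V = A⁻¹ * (A * V * B) * B⁻¹ := by
      rw [mul_assoc A V B, Matrix.nonsing_inv_mul_cancel_left _ _ hAu, Matrix.mul_nonsing_inv_cancel_right _ _ hBu]
    rw [this, hσ, Matrix.mul_smul, Matrix.smul_mul, mul_one, Matrix.mul_inv_rev]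
  apply hφ
  rw [hV, hVe, Matrix.smul_mul, Matrix.trace_smul, hz, smul_zero]

theorem exists_section {n : ℕ} (hn : n ≠ 0) {K A B : Mat n} (hA : A.det ≠ 0) (hB : B.det ≠ 0) (h : K * A * B = B * A)
    (habs : AbsP A B) : ∃ s : Mat n →ₗ[ℂ] Mat n × Mat n,
      ∀ z, ell K A B (s z) + (((B * A)⁻¹ * z).trace / n) • (B * A) = z := by
  let π : Mat n →ₗ[ℂ] Mat n :=
    { toFun := fun z => z - (((B * A)⁻¹ * z).trace / n) • (B * A)
      map_add' := fun z w => by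
        rw [Matrix.mul_add, Matrix.trace_add, add_div, add_smul]; abel
      map_smul' := fun c z => by
        rw [Matrix.mul_smul, Matrix.trace_smul, smul_eq_mul, mul_div_assoc, mul_smul, RingHom.id_apply, smul_sub] }
  have hπ : ∀ z, π z ∈ LinearMap.range (ell K A B) := by
    intro z
    apply ell_range hA hB h habs
    change ((B * A)⁻¹ * (z - (((B * A)⁻¹ * z).trace / n) • (B * A))).trace = 0
    have hu : IsUnit (B * A).det := by
      rw [Matrix.det_mul]; exact isUnit_iff_ne_zero.2 (mul_ne_zero hB hA)
    have hn' : (n : ℂ) ≠ 0 := Nat.cast_ne_zero.2 hn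
    rw [Matrix.mul_sub, Matrix.trace_sub, Matrix.mul_smul, Matrix.trace_smul, Matrix.nonsing_inv_mul _ hu,
      Matrix.trace_one, Fintype.card_fin, smul_eq_mul, div_mul_cancel₀ _ hn', sub_self]
  obtain ⟨r, hr⟩ := LinearMap.exists_rightInverse_of_surjective (ell K A B).rangeRestrict
    (LinearMap.range_rangeRestrict _)
  refine ⟨r ∘ₗ π.codRestrict _ hπ, fun z => ?_⟩
  have h1 := LinearMap.congr_fun hr (π.codRestrict _ hπ z)
  have h2 : ell K A B ((r ∘ₗ π.codRestrict _ hπ) z) = π z := congrArg Subtype.val h1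
  rw [h2]
  exact sub_add_cancel _ _

/-! ### complex conjugation -/

noncomputable def cjM {n : ℕ} (A : Mat n) : Mat n := A.map (starRingEnd ℂ)
noncomputable def cjT {ι : Type} {n : ℕ} (A : Tup ι n) : Tup ι n := fun x => cjM (A x)

theorem cjM_mul {n : ℕ} (A B : Mat n) : cjM (A * B) = cjM A * cjM B := Matrix.map_mul
theorem cjM_add {n : ℕ} (A B : Mat n) : cjM (A + B) = cjM A + cjM B := by ext; simp [cjM]
theorem cjM_sub {n : ℕ} (A B : Mat n) : cjM (A - B) = cjM A - cjM B := by ext; simp [cjM]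
theorem cjM_smul {n : ℕ} (c : ℂ) (A : Mat n) : cjM (c • A) = (starRingEnd ℂ) c • cjM A := by ext; simp [cjM]
theorem cjM_zero {n : ℕ} : cjM (0 : Mat n) = 0 := by ext; simp [cjM]
theorem cjM_one {n : ℕ} : cjM (1 : Mat n) = 1 := by simp [cjM]
theorem cjM_cjM {n : ℕ} (A : Mat n) : cjM (cjM A) = A := by ext; simp [cjM]
theorem cjM_inv {n : ℕ} (A : Mat n) : cjM A⁻¹ = (cjM A)⁻¹ := by
  rw [Matrix.inv_def, Matrix.inv_def, cjM_smul, Ring.inverse_eq_inv', map_inv₀]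
  congr 2
  · exact RingHom.map_det (starRingEnd ℂ) A
  · exact RingHom.map_adjugate (starRingEnd ℂ) A
theorem cjM_trace {n : ℕ} (A : Mat n) : (cjM A).trace = (starRingEnd ℂ) A.trace := by
  simp [cjM, Matrix.trace]
theorem cjM_list {n : ℕ} (l : List (Mat n)) : cjM l.prod = (l.map cjM).prod := by
  induction l with
  | nil => simp [cjM_one]
  | cons a l ih => simp [cjM_mul, ih]
theorem cjM_cont {n : ℕ} : Continuous (cjM (n := n)) := by
  refine continuous_matrix fun i j => ?_
  exact Complex.continuous_conj.comp (continuous_id.matrix_elem i j)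
theorem cjT_cont {ι : Type} {n : ℕ} : Continuous (cjT (ι := ι) (n := n)) :=
  continuous_pi fun x => cjM_cont.comp (continuous_apply x)

theorem EqF_cj {k n : ℕ} (A : Tup (Fin (k + 1) × Bool) n) : EqF (cjT A) = cjM (EqF A) := by
  simp only [EqF, cjM_sub, cjM_mul, KK, cjM_list, List.map_ofFn, Function.comp_def, cjM_inv]
  rfl

theorem exists_section_cj {n : ℕ} (hn : n ≠ 0) {K A B : Mat n} (hA : A.det ≠ 0) (hB : B.det ≠ 0)
    (h : K * A * B = B * A) (habs : AbsP A B) : ∃ s : Mat n →ₗ[ℂ] Mat n × Mat n,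
      (∀ z, ell K A B (s z) + (((B * A)⁻¹ * z).trace / n) • (B * A) = z) ∧
      (cjM K = K → cjM A = A → cjM B = B → ∀ z, s (cjM z) = (cjM (s z).1, cjM (s z).2)) := by
  obtain ⟨s, hs⟩ := exists_section hn hA hB h habs
  by_cases hr : cjM K = K ∧ cjM A = A ∧ cjM B = B
  · obtain ⟨rK, rA, rB⟩ := hr
    let s2 : Mat n →ₗ[ℂ] Mat n × Mat n :=
      { toFun := fun z => (cjM (s (cjM z)).1, cjM (s (cjM z)).2)
        map_add' := fun z w => by simp [cjM_add]
        map_smul' := fun c z => by simp [cjM_smul] }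
    have hell : ∀ X Y, ell K A B (cjM X, cjM Y) = cjM (ell K A B (X, Y)) := by
      intro X Y
      simp only [ell_apply, cjM_sub, cjM_mul, cjM_add, rK, rA, rB]
    have hs2 : ∀ z, ell K A B (s2 z) + (((B * A)⁻¹ * z).trace / n) • (B * A) = z := by
      intro z
      have h1 : ell K A B (s2 z) = cjM (ell K A B (s (cjM z))) := hell _ _
      have h2 : (((B * A)⁻¹ * z).trace / n) • (B * A) =
          cjM ((((B * A)⁻¹ * cjM z).trace / n) • (B * A)) := by
        rw [cjM_smul, map_div₀, ← cjM_trace, cjM_mul, cjM_inv, cjM_mul, rB, rA, cjM_cjM, map_natCast]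
      rw [h1, h2, ← cjM_add, hs, cjM_cjM]
    refine ⟨(1 / 2 : ℂ) • (s + s2), fun z => ?_, fun _ _ _ z => ?_⟩
    · have e : ell K A B (((1 / 2 : ℂ) • (s + s2)) z) = (1 / 2 : ℂ) • (ell K A B (s z) + ell K A B (s2 z)) := by
        simp
      have e1 := eq_sub_of_add_eq (hs z)
      have e2 := eq_sub_of_add_eq (hs2 z)
      rw [e, e1, e2, ← two_smul ℂ, smul_smul]
      norm_num
    · have e1 : s2 (cjM z) = (cjM (s z).1, cjM (s z).2) := by simp [s2, cjM_cjM]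
      have e2 : s (cjM z) = (cjM (s2 z).1, cjM (s2 z).2) := by simp [s2, cjM_cjM]
      have e3 : (starRingEnd ℂ) (1 / 2 : ℂ) = 1 / 2 := by rw [map_div₀, map_one, map_ofNat]
      simp only [LinearMap.smul_apply, LinearMap.add_apply, Prod.smul_fst, Prod.smul_snd, Prod.fst_add, Prod.snd_add,
        cjM_smul, cjM_add, e1, e2, e3]
      ext1 <;> simp [add_comm]
  · exact ⟨s, hs, fun h1 h2 h3 => absurd ⟨h1, h2, h3⟩ hr⟩

/-! ### Good points -/

open scoped Topology in
def Good {k n : ℕ} (a : Tup (Fin (k + 1) × Bool) n) : Prop :=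
  ∃ g : Tup (Fin (k + 1) × Bool) n → Tup (Fin (k + 1) × Bool) n, g a = a ∧ ContDiffAt ℂ 1 g a ∧
    (∀ᶠ A in 𝓝 a, g A ∈ HC k n) ∧ (∀ᶠ A in 𝓝 a, A ∈ HC k n → g A = A) ∧
    (cjT a = a → ∀ᶠ A in 𝓝 a, g (cjT A) = cjT (g A))

theorem KK_det {k n : ℕ} {H : Fin k × Bool → Mat n} (hH : ∀ x, (H x).det ≠ 0) : (KK H).det = 1 := by
  have : ∀ l : List (Fin k), ((l.map fun i => H (i, false) * H (i, true) * (H (i, false))⁻¹ *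
      (H (i, true))⁻¹).prod).det = 1 := by
    intro l
    induction l with
    | nil => simp
    | cons i l ih =>
      simp only [List.map_cons, List.prod_cons, Matrix.det_mul, ih, Matrix.det_nonsing_inv, Ring.inverse_eq_inv']
      field_simp [hH (i, false), hH (i, true)]
  rw [KK, List.ofFn_eq_map]
  exact this _

open scoped Topology in
theorem good_of_abs {k n : ℕ} (hn : n ≠ 0) {a : Tup (Fin (k + 1) × Bool) n} (ha : a ∈ HC k n)
    (habs : AbsP (a (0, false)) (a (0, true))) : Good a := by
  obtain ⟨hI, hE⟩ := ha
  have hrel : KK (tailT a) * a (0, false) * a (0, true) = a (0, true) * a (0, false) := sub_eq_zero.1 hE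
  obtain ⟨s, hs, hsc⟩ := exists_section_cj hn (hI _) (hI _) hrel habs
  let s1 : Mat n →ₗ[ℂ] Tup (Fin (k + 1) × Bool) n :=
    { toFun := fun z => consT (s z).1 (s z).2 0
      map_add' := fun z w => by
        funext ⟨i, b⟩
        induction i using Fin.cases with
        | zero => cases b <;> simp [consT]
        | succ i => simp [consT]
      map_smul' := fun c z => by
        funext ⟨i, b⟩
        induction i using Fin.cases with
        | zero => cases b <;> simp [consT]
        | succ i => simp [consT] }
  let t1 : Mat n →ₗ[ℂ] ℂ :=
    { toFun := fun z => ((a (0, true) * a (0, false))⁻¹ * z).trace / n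
      map_add' := fun z w => by rw [Matrix.mul_add, Matrix.trace_add, add_div]
      map_smul' := fun c z => by
        rw [Matrix.mul_smul, Matrix.trace_smul, smul_eq_mul, mul_div_assoc, RingHom.id_apply, smul_eq_mul] }
  have hx : ∀ x, ContDiffAt ℂ 1 (fun A : Tup (Fin (k + 1) × Bool) n => A x) a :=
    fun x => contDiffAt_pi.1 contDiffAt_id _
  have hInv : ∀ᶠ A in 𝓝 a, A ∈ InvT (Fin (k + 1) × Bool) n := isOpen_InvT.mem_nhds hI
  obtain ⟨g, g1, g2, g3, g4, g5⟩ := exists_retract (F1 := EqF (k := k) (n := n))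
    (F2 := fun A => A (0, true) * A (0, false)) (a0 := a) (cd_EqF hI) (cd_mul (hx _) (hx _)) hE
    (LinearMap.toContinuousLinearMap s1) (LinearMap.toContinuousLinearMap t1)
    (by
      intro z
      change fderiv ℂ EqF a (consT (s z).1 (s z).2 0) + _ = z
      rw [EqF_fderiv hI]
      exact hs z)
    (by
      have h1 : ∀ᶠ p : Tup (Fin (k + 1) × Bool) n × ℂ in 𝓝 (a, 0), p.1 ∈ InvT (Fin (k + 1) × Bool) n :=
        (continuous_fst.tendsto (a, (0 : ℂ))).eventually hInv
      have h2 : ∀ᶠ p : Tup (Fin (k + 1) × Bool) n × ℂ in 𝓝 (a, 0), ∑ i ∈ Finset.range n, (1 - p.2) ^ i ≠ 0 := by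
        have hc : Continuous fun p : Tup (Fin (k + 1) × Bool) n × ℂ => ∑ i ∈ Finset.range n, (1 - p.2) ^ i := by
          fun_prop
        refine (hc.tendsto (a, 0)).eventually_ne ?_
        simpa using hn
      filter_upwards [h1, h2] with p hp1 hp2 hp
      have e1 : KK (tailT p.1) * p.1 (0, false) * p.1 (0, true) =
          (1 - p.2) • (p.1 (0, true) * p.1 (0, false)) := by
        have : KK (tailT p.1) * p.1 (0, false) * p.1 (0, true) - p.1 (0, true) * p.1 (0, false) +
          p.2 • (p.1 (0, true) * p.1 (0, false)) = 0 := hp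
        rw [sub_smul, one_smul]
        rw [sub_add, sub_eq_zero] at this
        exact this
      have e2 := congrArg Matrix.det e1
      rw [Matrix.det_mul, Matrix.det_mul, KK_det (H := tailT p.1) (fun x => hp1 _), Matrix.det_smul, Matrix.det_mul, Fintype.card_fin,
        one_mul] at e2
      have e3 : (1 - p.2) ^ n = 1 := by
        have h3 := mul_ne_zero (hp1 (0, true)) (hp1 (0, false))
        apply mul_right_cancel₀ h3
        rw [← e2]; ring
      have e4 := geom_sum_mul (1 - p.2) n
      rw [e3, sub_self] at e4
      rcases mul_eq_zero.1 e4 with h | h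
      · exact absurd h hp2
      · linear_combination -h)
  refine ⟨g, g1, g2, ?_, ?_, ?_⟩
  · have h1 : ∀ᶠ A in 𝓝 a, g A ∈ InvT (Fin (k + 1) × Bool) n := by
      have := g2.continuousAt.tendsto
      rw [g1] at this
      exact this.eventually hInv
    filter_upwards [g3, h1] with A hA hB using ⟨hB, hA⟩
  · filter_upwards [g4] with A hA hB using hA hB.2
  · intro hr
    have hrx : ∀ x, cjM (a x) = a x := fun x => congrFun hr x
    have hKr : cjM (KK (tailT a)) = KK (tailT a) := by
      simp only [KK, cjM_list, List.map_ofFn, Function.comp_def, cjM_inv, cjM_mul, tailT, hrx]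
    refine g5 cjT cjM cjT_cont cjM_cont hr cjM_zero ?_ EqF_cj ?_ cjM_add cjM_smul ?_ ?_
    · intro A B; funext x; exact cjM_add _ _
    · intro A; exact (cjM_mul _ _).symm
    · intro z
      change consT (s (cjM z)).1 (s (cjM z)).2 0 = cjT (consT (s z).1 (s z).2 0)
      rw [hsc hKr (hrx _) (hrx _)]
      funext ⟨i, b⟩
      induction i using Fin.cases with
      | zero => cases b <;> rfl
      | succ i => exact cjM_zero.symm
    · intro z
      change ((a (0, true) * a (0, false))⁻¹ * cjM z).trace / n =
        (starRingEnd ℂ) (((a (0, true) * a (0, false))⁻¹ * z).trace / n)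
      rw [map_div₀, ← cjM_trace, cjM_mul, cjM_inv, cjM_mul, hrx, hrx, map_natCast]

attribute [local instance] Matrix.normedAddCommGroup Matrix.normedSpace

/-! ### From paths in SL2 to paths in the representation variety -/

theorem Jm_mul_adj {m : ℕ} {P P' : Mat (m + 1)} (hP : P * P' = 1) (g : Mat 2) :
    Jm P P' g * Jm P P' g.adjugate = g.det ^ m • 1 := by
  rw [← Jm_mul hP, Matrix.mul_adjugate, Jm_scalar hP]

theorem Jm_det_ne {m : ℕ} {P P' : Mat (m + 1)} (hP : P * P' = 1) {g : Mat 2} (hg : g.det ≠ 0) :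
    (Jm P P' g).det ≠ 0 := by
  intro h
  have := congrArg Matrix.det (Jm_mul_adj hP g)
  rw [Matrix.det_mul, h, zero_mul, Matrix.det_smul, Matrix.det_one, mul_one] at this
  exact pow_ne_zero _ (pow_ne_zero _ hg) this.symm

theorem Jm_adj {m : ℕ} {P P' : Mat (m + 1)} (hP : P * P' = 1) {g : Mat 2} (hg : g.det ≠ 0) :
    Jm P P' g.adjugate = g.det ^ m • (Jm P P' g)⁻¹ := by
  have hu : IsUnit (Jm P P' g).det := isUnit_iff_ne_zero.2 (Jm_det_ne hP hg)
  rw [← Matrix.nonsing_inv_mul_cancel_left _ (Jm P P' g.adjugate) hu, Jm_mul_adj hP, Matrix.mul_smul, mul_one]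

theorem Jm_Ka {m k : ℕ} {P P' : Mat (m + 1)} (hP : P * P' = 1) {H : Fin k × Bool → Mat 2}
    (hH : ∀ x, (H x).det ≠ 0) : Jm P P' (Ka H) = Da H ^ m • KK (fun x => Jm P P' (H x)) := by
  have : ∀ l : List (Fin k), Jm P P' ((l.map fun i => H (i, false) * H (i, true) * (H (i, false)).adjugate *
      (H (i, true)).adjugate).prod) = ((l.map fun i => (H (i, false)).det * (H (i, true)).det).prod) ^ m •
      ((l.map fun i => Jm P P' (H (i, false)) * Jm P P' (H (i, true)) * (Jm P P' (H (i, false)))⁻¹ *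
        (Jm P P' (H (i, true)))⁻¹).prod) := by
    intro l
    induction l with
    | nil => simp [Jm_one hP]
    | cons i l ih =>
      simp only [List.map_cons, List.prod_cons]
      rw [Jm_mul hP, ih, Jm_mul hP, Jm_mul hP, Jm_mul hP, Jm_adj hP (hH _), Jm_adj hP (hH _)]
      simp only [Matrix.mul_smul, Matrix.smul_mul, smul_smul]
      congr 1
      ring
  rw [Ka, Da, KK, List.ofFn_eq_map, List.ofFn_eq_map, List.ofFn_eq_map]
  exact this _

theorem Da_ne {k : ℕ} {H : Fin k × Bool → Mat 2} (h : ∀ x, (H x).det ≠ 0) : Da H ≠ 0 := by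
  rw [Da, List.prod_ofFn]
  exact Finset.prod_ne_zero_iff.2 fun i _ => mul_ne_zero (h _) (h _)

theorem Jm_HC {m k : ℕ} {P P' : Mat (m + 1)} (hP : P * P' = 1) {p : Fin (k + 1) × Bool → Mat 2}
    (hp : ∀ x, (p x).det ≠ 0)
    (h : Ka (tailT p) * p (0, false) * p (0, true) = Da (tailT p) • (p (0, true) * p (0, false))) :
    (fun x => Jm P P' (p x)) ∈ HC k (m + 1) := by
  refine ⟨fun x => Jm_det_ne hP (hp x), ?_⟩
  have hD : Da (tailT p) ≠ 0 := Da_ne fun x => hp _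
  have e := congrArg (Jm P P') h
  rw [← one_mul (p (0, true) * p (0, false)), ← Matrix.smul_mul, Jm_mul hP, Jm_mul hP, Jm_mul hP, Jm_mul hP,
    Jm_Ka hP (H := tailT p) (fun x => hp _), Jm_scalar hP, Matrix.smul_mul, Matrix.smul_mul, Matrix.smul_mul, one_mul] at e
  have e2 := smul_right_injective _ (pow_ne_zero m hD) e
  exact sub_eq_zero.2 e2

theorem MPF.cont {ι κ : Type} {M : ℂ → Matrix ι κ ℂ} (h : MPF PC M) : Continuous M := by
  refine continuous_matrix fun i j => ?_
  obtain ⟨q, hq⟩ := PC_poly (h i j)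
  have : (fun t => M t i j) = fun t => q.eval t := funext hq
  rw [this]; exact q.continuous

/-! ### Vanishing near a point of the representation variety -/

open scoped Topology in
def VV {k n : ℕ} (f : Tup (Fin (k + 1) × Bool) n → ℂ) (A : Tup (Fin (k + 1) × Bool) n) : Prop :=
  ∀ᶠ A' in 𝓝 A, A' ∈ HC k n → f A' = 0

theorem ball_zero {ι : Type} [Fintype ι] {n : ℕ} {F : Tup ι n → ℂ} {a : Tup ι n} {ε : ℝ}
    (hF : DifferentiableOn ℂ F (Metric.ball a ε)) {A : Tup ι n} (hA : A ∈ Metric.ball a ε)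
    (hz : ∀ᶠ B in nhds A, F B = 0) {B : Tup ι n} (hB : B ∈ Metric.ball a ε) : F B = 0 := by
  have hc := (lineT_diff' A B).continuous
  have h1 : IsOpen {t | lineT A B t ∈ Metric.ball a ε} := Metric.isOpen_ball.preimage hc
  have h2 : Convex ℝ {t | lineT A B t ∈ Metric.ball a ε} := by
    intro t ht s hs x y hx hy hxy
    have : lineT A B (x • t + y • s) = x • lineT A B t + y • lineT A B s := by
      funext z
      have hxy' : (x : ℂ) + y = 1 := by exact_mod_cast hxy
      ext i j
      simp only [lineT, Pi.add_apply, Pi.smul_apply, Matrix.add_apply, Matrix.smul_apply, Matrix.sub_apply,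
        smul_eq_mul, Complex.real_smul]
      linear_combination (A z i j) * (1 - hxy')
    have h3 := convex_ball a ε ht hs hx hy hxy
    rw [← this] at h3
    exact h3
  have h3 := ident_zero h1 h2.isPreconnected (f := fun t => F (lineT A B t))
    (hF.comp (lineT_diff' A B).differentiableOn fun _ h => h) (t₀ := 0)
    (by simpa [lineT_zero] using hA)
    (by
      have := hc.tendsto 0
      rw [lineT_zero] at this
      exact this.eventually hz) (t := 1) (by simpa [lineT_one] using hB)
  simpa [lineT_one] using h3

theorem good_ball {k n : ℕ} {a : Tup (Fin (k + 1) × Bool) n}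
    {g : Tup (Fin (k + 1) × Bool) n → Tup (Fin (k + 1) × Bool) n} (g2 : ContDiffAt ℂ 1 g a)
    (g3 : ∀ᶠ A in nhds a, g A ∈ HC k n) (g4 : ∀ᶠ A in nhds a, A ∈ HC k n → g A = A) :
    ∃ ε > 0, (∀ A ∈ Metric.ball a ε, g A ∈ HC k n ∧ (A ∈ HC k n → g A = A) ∧ DifferentiableAt ℂ g A) := by
  have h1 : ∀ᶠ A in nhds a, DifferentiableAt ℂ g A := by
    have := g2.eventually (by simp)
    filter_upwards [this] with A hA using hA.differentiableAt (by simp)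
  obtain ⟨ε, hε, h⟩ := Metric.eventually_nhds_iff_ball.1 (g3.and (g4.and h1))
  exact ⟨ε, hε, h⟩

theorem comp_diff {k n : ℕ} {f : Tup (Fin (k + 1) × Bool) n → ℂ} (hf : HolT f)
    {a : Tup (Fin (k + 1) × Bool) n} {ε : ℝ}
    {g : Tup (Fin (k + 1) × Bool) n → Tup (Fin (k + 1) × Bool) n}
    (h : ∀ A ∈ Metric.ball a ε, g A ∈ HC k n ∧ (A ∈ HC k n → g A = A) ∧ DifferentiableAt ℂ g A) :
    DifferentiableOn ℂ (fun A => f (g A)) (Metric.ball a ε) := by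
  intro A hA
  obtain ⟨h1, -, h3⟩ := h A hA
  have : DifferentiableAt ℂ f (g A) := (hf _ h1.1).differentiableAt (isOpen_InvT.mem_nhds h1.1)
  exact (this.comp A h3).differentiableWithinAt

theorem VV_close {k n : ℕ} {f : Tup (Fin (k + 1) × Bool) n → ℂ} (hf : HolT f)
    {a : Tup (Fin (k + 1) × Bool) n} (ha : Good a) (h : ∃ᶠ A in nhds a, A ∈ HC k n ∧ VV f A) : VV f a := by
  obtain ⟨g, g1, g2, g3, g4, -⟩ := ha
  obtain ⟨ε, hε, hb⟩ := good_ball g2 g3 g4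
  obtain ⟨A, ⟨hA1, hA2⟩, hA3⟩ := (h.and_eventually (Metric.ball_mem_nhds a hε)).exists
  have hz : ∀ᶠ B in nhds A, f (g B) = 0 := by
    have hc := (hb A hA3).2.2.continuousAt.tendsto
    rw [(hb A hA3).2.1 hA1] at hc
    filter_upwards [hc.eventually hA2, Metric.isOpen_ball.mem_nhds hA3] with B h1 h2 using h1 (hb B h2).1
  filter_upwards [Metric.ball_mem_nhds a hε] with B hB hBH
  have := ball_zero (comp_diff hf hb) hA3 hz hB
  rwa [(hb B hB).2.1 hBH] at this

theorem VV_path {k n : ℕ} {f : Tup (Fin (k + 1) × Bool) n → ℂ} (hf : HolT f) {S : Set ℂ} (hS : IsPreconnected S)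
    {A : ℂ → Tup (Fin (k + 1) × Bool) n} (hA : Continuous A) (hH : ∀ t ∈ S, A t ∈ HC k n)
    (hG : ∀ t ∈ S, Good (A t)) {t s : ℂ} (ht : t ∈ S) (hs : s ∈ S) (h : VV f (A t)) : VV f (A s) := by
  have key : VV f (A t) ↔ VV f (A s) := by
    refine hS.induction₂ (fun x y => VV f (A x) ↔ VV f (A y)) ?_ ?_ ?_ ht hs
    · intro x hx
      have hc : Filter.Tendsto A (nhdsWithin x S) (nhds (A x)) := (hA.tendsto x).mono_left nhdsWithin_le_nhds
      by_cases hv : VV f (A x)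
      · have h1 : ∀ᶠ B in nhds (A x), VV f B := eventually_eventually_nhds.2 hv
        filter_upwards [hc.eventually h1] with y hy
        exact ⟨fun _ => hy, fun _ => hv⟩
      · have h1 : ∀ᶠ B in nhds (A x), ¬ (B ∈ HC k n ∧ VV f B) := by
          by_contra hcon
          exact hv (VV_close hf (hG x hx) hcon)
        filter_upwards [hc.eventually h1, self_mem_nhdsWithin] with y hy hyS
        exact ⟨fun h => absurd h hv, fun h => absurd ⟨hH y hyS, h⟩ hy⟩
    · exact fun x y z _ _ _ h1 h2 => h1.trans h2
    · exact fun x y _ _ h1 => h1.symm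
  exact key.1 h

attribute [local instance] Matrix.normedAddCommGroup Matrix.normedSpace

/-! ### Transfer of vanishing between representations coming from SL2 -/

def tp {k : ℕ} (r : SurfaceGroup (k + 1) →* SL 2 ℂ) (x : Fin (k + 1) × Bool) : Mat 2 := (r (sgen x.1 x.2)).1

theorem tp_det {k : ℕ} (r : SurfaceGroup (k + 1) →* SL 2 ℂ) (x) : (tp r x).det = 1 := (r _).2

theorem tp_rel {k : ℕ} (r : SurfaceGroup (k + 1) →* SL 2 ℂ) :
    Ka (tailT (tp r)) * tp r (0, false) * tp r (0, true) = tp r (0, true) * tp r (0, false) := by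
  have h := congrArg r (sg_rel (k + 1))
  rw [List.ofFn_succ, List.prod_cons, map_mul, map_one, map_list_prod, List.map_ofFn] at h
  set K := (List.ofFn (r ∘ fun i : Fin k => ⁅sgen i.succ false, sgen i.succ true⁆)).prod with hK
  have h1 : K * r (sgen 0 false) * r (sgen 0 true) = r (sgen 0 true) * r (sgen 0 false) := by
    have h2 : K = (r ⁅sgen 0 false, sgen 0 true⁆)⁻¹ := (inv_eq_of_mul_eq_one_right h).symm
    rw [h2, commutatorElement_def]
    simp only [map_mul, map_inv]
    group
  have hKa : Ka (tailT (tp r)) = K.1 := by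
    have : ∀ l : List (Fin k), ((l.map fun i => tailT (tp r) (i, false) * tailT (tp r) (i, true) *
        (tailT (tp r) (i, false)).adjugate * (tailT (tp r) (i, true)).adjugate).prod) =
        ((l.map (r ∘ fun i : Fin k => ⁅sgen i.succ false, sgen i.succ true⁆)).prod).1 := by
      intro l
      induction l with
      | nil => simp
      | cons i l ih =>
        simp only [List.map_cons, List.prod_cons]
        rw [ih, Matrix.SpecialLinearGroup.coe_mul]
        congr 1
        simp [tailT, tp, commutatorElement_def, Matrix.SpecialLinearGroup.coe_inv]
    rw [Ka, hK, List.ofFn_eq_map, List.ofFn_eq_map]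
    exact this _
  rw [hKa]
  exact congrArg Subtype.val h1

noncomputable def JT {k m : ℕ} (P P' : Mat (m + 1)) (r : SurfaceGroup (k + 1) →* SL 2 ℂ) :
    Tup (Fin (k + 1) × Bool) (m + 1) := fun x => Jm P P' (tp r x)

theorem JT_HC {k m : ℕ} {P P' : Mat (m + 1)} (hP : P * P' = 1) (r : SurfaceGroup (k + 1) →* SL 2 ℂ) :
    JT P P' r ∈ HC k (m + 1) := by
  refine Jm_HC hP (fun x => by rw [tp_det]; exact one_ne_zero) ?_
  rw [tp_rel, Da_one (H := tailT (tp r)) (fun x => tp_det r _), one_smul]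

theorem words_of {k m : ℕ} {P P' : Mat (m + 1)} {r : SurfaceGroup (k + 1) →* SL 2 ℂ}
    {u v : SurfaceGroup (k + 1)} (hu : u ∈ Subgroup.closure {sgen 0 false, sgen 0 true})
    (hv : v ∈ Subgroup.closure {sgen 0 false, sgen 0 true})
    (h : ff (Jm P P' (r u).1) (Jm P P' (r v).1) ≠ 0) : ∃ l1 l2,
    ff (Jm P P' (wadj l1 fun b => tp r (0, b))) (Jm P P' (wadj l2 fun b => tp r (0, b))) ≠ 0 := by
  have key : ∀ w ∈ Subgroup.closure {sgen (g := k + 1) 0 false, sgen 0 true},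
      ∃ l, (r w).1 = wadj l fun b => tp r (0, b) := by
    intro w hw
    have h1 : r w ∈ Subgroup.closure {r (sgen 0 false), r (sgen 0 true)} := by
      have := Subgroup.mem_map_of_mem r hw
      rwa [MonoidHom.map_closure, Set.image_pair] at this
    obtain ⟨l, hl⟩ := closure_pair_wadj h1
    refine ⟨l, hl.trans ?_⟩
    congr 1; funext b; cases b <;> rfl
  obtain ⟨l1, h1⟩ := key u hu
  obtain ⟨l2, h2⟩ := key v hv
  exact ⟨l1, l2, by rw [← h1, ← h2]; exact h⟩

theorem JT_good {k m : ℕ} {P P' : Mat (m + 1)} (hP : P * P' = 1) {r : SurfaceGroup (k + 1) →* SL 2 ℂ}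
    {u v : SurfaceGroup (k + 1)} (hu : u ∈ Subgroup.closure {sgen 0 false, sgen 0 true})
    (hv : v ∈ Subgroup.closure {sgen 0 false, sgen 0 true})
    (h : ff (Jm P P' (r u).1) (Jm P P' (r v).1) ≠ 0) : Good (JT P P' r) := by
  obtain ⟨l1, l2, hl⟩ := words_of hu hv h
  exact good_of_abs (Nat.succ_ne_zero m) (JT_HC hP r)
    (abs_of_wadj hP (p := fun b => tp r (0, b)) (fun b => by rw [tp_det]; exact one_ne_zero) hl)

theorem VV_transfer {k m : ℕ} {P P' : Mat (m + 1)} (hP : P * P' = 1) {r r' : SurfaceGroup (k + 1) →* SL 2 ℂ}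
    {u v : SurfaceGroup (k + 1)} (hu : u ∈ Subgroup.closure {sgen 0 false, sgen 0 true})
    (hv : v ∈ Subgroup.closure {sgen 0 false, sgen 0 true})
    (h : ff (Jm P P' (r u).1) (Jm P P' (r v).1) ≠ 0)
    (hc : r (sgen 0 false) * r (sgen 0 true) ≠ r (sgen 0 true) * r (sgen 0 false))
    (hc' : r' (sgen 0 false) * r' (sgen 0 true) ≠ r' (sgen 0 true) * r' (sgen 0 false))
    (hG : Good (JT P P' r')) {f : Tup (Fin (k + 1) × Bool) (m + 1) → ℂ} (hf : HolT f)
    (hV : VV f (JT P P' r')) : VV f (JT P P' r) := by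
  obtain ⟨l1, l2, hl⟩ := words_of hu hv h
  obtain ⟨p, hp, p0, p1, hpe⟩ := exists_path (tp_det r) (tp_det r') (tp_rel r) (tp_rel r')
    (fun e => hc (Subtype.ext e)) (fun e => hc' (Subtype.ext e))
  have hq : (fun t => (∏ x, (p t x).det) * ff (Jm P P' (wadj l1 fun b => p t (0, b)))
      (Jm P P' (wadj l2 fun b => p t (0, b)))) ∈ PC :=
    pf_mul (pf_prod _ fun x _ => (hp x).det) (MPF.ff ((MPF.wadj l1 (p := fun t b => p t (0, b)) fun b => hp _).Jm P P')
      ((MPF.wadj l2 (p := fun t b => p t (0, b)) fun b => hp _).Jm P P'))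
  obtain ⟨q, hq⟩ := PC_poly hq
  have hq0 : q.eval 0 ≠ 0 := by
    rw [← hq]
    refine mul_ne_zero ?_ ?_
    · rw [p0]; simp [tp_det]
    · rw [p0]; exact hl
  have hqne : q ≠ 0 := by rintro rfl; simp at hq0
  have hdense : Dense {t : ℂ | q.eval t ≠ 0} := by
    have hcn : {t : ℂ | q.eval t = 0}.Countable := by
      have : {t : ℂ | q.eval t = 0} ⊆ (q.roots.toFinset : Set ℂ) := by
        intro t ht
        simpa [hqne] using ht
      exact (q.roots.toFinset.countable_toSet).mono this
    exact hcn.dense_compl ℝ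
  have hS : IsPreconnected ({t : ℂ | q.eval t ≠ 0} ∪ {1}) :=
    (isPreconnected_poly_ne hqne).subset_closure Set.subset_union_left (by rw [hdense.closure_eq]; exact Set.subset_univ _)
  have hA : Continuous fun t => (fun x => Jm P P' (p t x) : Tup (Fin (k + 1) × Bool) (m + 1)) :=
    continuous_pi fun x => ((hp x).Jm P P').cont
  have hH : ∀ t, q.eval t ≠ 0 → (∀ x, (p t x).det ≠ 0) ∧ AbsP (Jm P P' (p t (0, false))) (Jm P P' (p t (0, true))) := by
    intro t ht
    rw [← hq] at ht
    have hd : ∀ x, (p t x).det ≠ 0 := fun x => Finset.prod_ne_zero_iff.1 (left_ne_zero_of_mul ht) x (Finset.mem_univ _)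
    exact ⟨hd, abs_of_wadj hP (p := fun b => p t (0, b)) (fun b => hd _) (right_ne_zero_of_mul ht)⟩
  have h1 : (fun x => Jm P P' (p 1 x)) = JT P P' r' := by rw [p1]; rfl
  have h0 : (fun x => Jm P P' (p 0 x)) = JT P P' r := by rw [p0]; rfl
  have hHC : ∀ t ∈ {t : ℂ | q.eval t ≠ 0} ∪ {1}, (fun x => Jm P P' (p t x)) ∈ HC k (m + 1) := by
    rintro t (ht | ht)
    · exact Jm_HC hP (hH t ht).1 (hpe t)
    · rw [Set.mem_singleton_iff.1 ht, h1]; exact JT_HC hP r'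
  have := VV_path hf hS hA hHC (by
    rintro t (ht | ht)
    · exact good_of_abs (Nat.succ_ne_zero m) (hHC t (Or.inl ht)) (hH t ht).2
    · rw [Set.mem_singleton_iff.1 ht, h1]; exact hG) (t := 1) (s := 0) (Or.inr rfl) (Or.inl hq0)
    (by rw [h1]; exact hV)
  rwa [h0] at this

attribute [local instance] Matrix.normedAddCommGroup Matrix.normedSpace

/-! ### Non-vanishing -/

theorem handle_ne (k : ℕ) (hk : 1 ≤ k) :
    sgen (g := k + 1) 0 false * sgen 0 true ≠ sgen 0 true * sgen 0 false := by
  obtain ⟨k, rfl⟩ : ∃ l, k = l + 1 := ⟨k - 1, by omega⟩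
  let f : Fin (k + 1 + 1) → Bool → FreeGroup Bool :=
    Fin.cons FreeGroup.of (Fin.cons (fun b => FreeGroup.of (!b)) fun _ _ => 1)
  have hf : (List.ofFn fun i => ⁅f i false, f i true⁆).prod = 1 := by
    rw [List.ofFn_succ, List.ofFn_succ]
    simp [f, commutatorElement_def, List.ofFn_const]
    group
  intro h
  have := congrArg (sgLift f hf) h
  rw [map_mul, map_mul, sgLift_gen, sgLift_gen] at this
  simp only [f, Fin.cons_zero] at this
  exact absurd this (by decide)

noncomputable def stdC : FreeGroup Bool →* SL 2 ℂ :=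
  (Matrix.SpecialLinearGroup.map (Int.castRingHom ℂ)).comp std

theorem stdC_inj : Function.Injective stdC := by
  intro x y h
  apply std_injective
  ext i j
  have := congrArg (fun A : SL 2 ℂ => A.1 i j) h
  simpa [stdC] using this

noncomputable def JGL {m : ℕ} {P P' : Mat (m + 1)} (hP : P * P' = 1) : SL 2 ℂ →* GL (Fin (m + 1)) ℂ :=
  MonoidHom.toHomUnits
    { toFun := fun g => Jm P P' g.1
      map_one' := by rw [Matrix.SpecialLinearGroup.coe_one]; exact Jm_one hP
      map_mul' := fun g h => by rw [Matrix.SpecialLinearGroup.coe_mul]; exact Jm_mul hP _ _ }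

theorem JGL_val {m : ℕ} {P P' : Mat (m + 1)} (hP : P * P' = 1) (g : SL 2 ℂ) :
    (JGL hP g : Mat (m + 1)) = Jm P P' g.1 := rfl

theorem rep_HC {k n : ℕ} (R : SurfaceGroup (k + 1) →* GL (Fin n) ℂ) :
    (fun x : Fin (k + 1) × Bool => (R (sgen x.1 x.2) : Mat n)) ∈ HC k n := by
  refine ⟨fun x => gl_det_ne _, ?_⟩
  have h := congrArg R (sg_rel (k + 1))
  rw [List.ofFn_succ, List.prod_cons, map_mul, map_one, map_list_prod, List.map_ofFn] at h
  set K := (List.ofFn (R ∘ fun i : Fin k => ⁅sgen i.succ false, sgen i.succ true⁆)).prod with hK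
  have h1 : K * R (sgen 0 false) * R (sgen 0 true) = R (sgen 0 true) * R (sgen 0 false) := by
    have h2 : K = (R ⁅sgen 0 false, sgen 0 true⁆)⁻¹ := (inv_eq_of_mul_eq_one_right h).symm
    rw [h2, commutatorElement_def]
    simp only [map_mul, map_inv]
    group
  have hKa : KK (tailT fun x : Fin (k + 1) × Bool => (R (sgen x.1 x.2) : Mat n)) = K.1 := by
    have : ∀ l : List (Fin k), ((l.map fun i => (R (sgen i.succ false) : Mat n) * (R (sgen i.succ true) : Mat n) *
        (R (sgen i.succ false) : Mat n)⁻¹ * (R (sgen i.succ true) : Mat n)⁻¹).prod) =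
        ((l.map (R ∘ fun i : Fin k => ⁅sgen i.succ false, sgen i.succ true⁆)).prod : GL (Fin n) ℂ).1 := by
      intro l
      induction l with
      | nil => simp
      | cons i l ih =>
        simp only [List.map_cons, List.prod_cons]
        rw [ih, Units.val_mul]
        congr 1
        simp [commutatorElement_def, Matrix.coe_units_inv]
    rw [KK, hK, List.ofFn_eq_map, List.ofFn_eq_map]
    exact this _
  rw [EqF, hKa, sub_eq_zero]
  exact congrArg Units.val h1

noncomputable def PsiT {k n : ℕ} (φ : SurfaceGroup (k + 1) →* FreeGroup Bool) (h : Tup Bool n) :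
    Tup (Fin (k + 1) × Bool) n := fun x => wev (φ (sgen x.1 x.2)) h

noncomputable def wglH {ι : Type} {n : ℕ} (h : Tup ι n) : FreeGroup ι →* GL (Fin n) ℂ :=
  FreeGroup.lift fun x => glOf (h x)

theorem PsiT_HC {k n : ℕ} (φ : SurfaceGroup (k + 1) →* FreeGroup Bool) (h : Tup Bool n) :
    PsiT φ h ∈ HC k n := rep_HC ((wglH h).comp φ)

abbrev gmk {g : ℕ} (w : FreeGroup (Fin g × Bool)) : SurfaceGroup g :=
  PresentedGroup.mk ({surfaceRelator g} : Set (FreeGroup (Fin g × Bool))) w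

theorem wev_rep {g n : ℕ} (R : SurfaceGroup g →* GL (Fin n) ℂ) (w : FreeGroup (Fin g × Bool)) :
    wev w (fun x : Fin g × Bool => (R (sgen x.1 x.2) : Mat n)) = R (gmk w) := by
  have h1 := wgl_coe w (fun x : Fin g × Bool => R (sgen x.1 x.2))
  have h2 : FreeGroup.lift (fun x : Fin g × Bool => R (sgen x.1 x.2)) =
      R.comp (PresentedGroup.mk ({surfaceRelator g} : Set (FreeGroup (Fin g × Bool)))) := by
    ext1 x; simp; rfl
  rw [wev, h1, h2]; rfl

theorem wev_PsiT {k n : ℕ} (φ : SurfaceGroup (k + 1) →* FreeGroup Bool) (h : Tup Bool n)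
    (w : FreeGroup (Fin (k + 1) × Bool)) : wev w (PsiT φ h) = wev (φ (gmk w)) h :=
  wev_rep ((wglH h).comp φ) w

theorem wev_std {m : ℕ} {P P' : Mat (m + 1)} (hP : P * P' = 1) (w : FreeGroup Bool) :
    wev w (fun b => Jm P P' (stdC (FreeGroup.of b)).1) = Jm P P' (stdC w).1 := by
  have h1 := wgl_coe w (fun b => JGL hP (stdC (FreeGroup.of b)))
  have h2 : FreeGroup.lift (fun b => JGL hP (stdC (FreeGroup.of b))) = (JGL hP).comp stdC := by
    ext1 x; simp
  rw [h2] at h1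
  exact congrArg Units.val h1

theorem VV_all {k m : ℕ} {P P' : Mat (m + 1)} (hP : P * P' = 1) {r' : SurfaceGroup (k + 1) →* SL 2 ℂ}
    (hr' : Function.Injective r') (hk : 1 ≤ k) (φ : SurfaceGroup (k + 1) →* FreeGroup Bool)
    (hφ : φ ⁅(sgen 0 false : SurfaceGroup (k + 1)), sgen 0 true⁆ ≠ 1) {f : Tup (Fin (k + 1) × Bool) (m + 1) → ℂ} (hf : HolT f)
    (hV : VV f (JT P P' r')) {h : Tup Bool (m + 1)} (hh : h ∈ InvT Bool (m + 1)) : f (PsiT φ h) = 0 := by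
  have hne := handle_ne k hk
  have hc' : r' (sgen 0 false) * r' (sgen 0 true) ≠ r' (sgen 0 true) * r' (sgen 0 false) := by
    rw [← map_mul, ← map_mul]; exact fun e => hne (hr' e)
  have hφc : φ (sgen 0 false) * φ (sgen 0 true) ≠ φ (sgen 0 true) * φ (sgen 0 false) := by
    rw [map_commutatorElement] at hφ
    exact fun e => hφ (commutatorElement_eq_one_iff_mul_comm.2 e)
  obtain ⟨u', hu', v', hv', hw'⟩ := dens2 r' hr' (surf_tf (by omega)) _ (surf_nonmet (by omega) hne) hP
  have hG : Good (JT P P' r') := JT_good hP hu' hv' hw'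
  obtain ⟨u, hu, v, hv, hw⟩ := dens2 stdC stdC_inj free_tf _ (free_nonmet hφc) hP
  have hmap : Subgroup.closure {φ (sgen 0 false), φ (sgen 0 true)} =
      (Subgroup.closure {sgen 0 false, sgen 0 true}).map φ := by
    rw [MonoidHom.map_closure, Set.image_pair]
  rw [hmap] at hu hv
  obtain ⟨u, hu, rfl⟩ := hu
  obtain ⟨v, hv, rfl⟩ := hv
  have hV2 := VV_transfer hP (r := stdC.comp φ) hu hv hw (by
    simp only [MonoidHom.comp_apply, ← map_mul]
    rw [← map_mul, ← map_mul] at hφc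
    exact fun e => hφc (stdC_inj e)) hc' hG hf hV
  set h0 : Tup Bool (m + 1) := fun b => Jm P P' (stdC (FreeGroup.of b)).1 with hh0
  have h0I : h0 ∈ InvT Bool (m + 1) := fun b => Jm_det_ne hP (by rw [(stdC _).2]; exact one_ne_zero)
  have e0 : PsiT φ h0 = JT P P' (stdC.comp φ) := by
    funext x; exact wev_std hP _
  have hΨ : DifferentiableOn ℂ (PsiT (n := m + 1) φ) (InvT Bool (m + 1)) :=
    differentiableOn_pi.2 fun x => HolT.wev _
  have hHol : HolT (fun h : Tup Bool (m + 1) => f (PsiT φ h)) :=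
    DifferentiableOn.comp hf hΨ fun h _ => (PsiT_HC φ h).1
  refine hHol.zero h0I ?_ hh
  have hc : ContinuousAt (PsiT (n := m + 1) φ) h0 :=
    (hΨ.continuousOn).continuousAt (isOpen_InvT.mem_nhds h0I)
  rw [← e0] at hV2
  filter_upwards [hc.tendsto.eventually hV2] with B hB using hB (PsiT_HC φ B)

theorem ff_hol {n : ℕ} {E : Type*} [NormedAddCommGroup E] [NormedSpace ℂ E]
    {S : Set E} {f g : E → Mat n} (hf : DifferentiableOn ℂ f S) (hg : DifferentiableOn ℂ g S) :
    DifferentiableOn ℂ (fun e => ff (f e) (g e)) S := by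
  have hpow : ∀ k : ℕ, DifferentiableOn ℂ (fun e => f e ^ k) S := by
    intro k
    induction k with
    | zero => simp
    | succ k ih => simp only [pow_succ]; exact diffOn_mul ih hf
  refine diffOn_det (diffOn_mat.2 fun p q => ?_)
  simp only [ffM, Matrix.of_apply]
  exact diffOn_mat.1 (diffOn_mul (diffOn_mul (hpow _) hg) (hpow _)) _ _

theorem wev_comm_det {ι : Type} {n : ℕ} (p q : FreeGroup ι) (A : Tup ι n) : (wev ⁅p, q⁆ A).det = 1 := by
  rw [commutatorElement_def, wev_mul, wev_mul, wev_mul, wev_inv, wev_inv, Matrix.det_mul, Matrix.det_mul,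
    Matrix.det_mul, Matrix.det_nonsing_inv, Matrix.det_nonsing_inv, Ring.inverse_eq_inv']
  have := wev_det_ne p A
  have := wev_det_ne q A
  field_simp

theorem not_VV {k m : ℕ} {P P' : Mat (m + 1)} (hP : P * P' = 1) (hm : 1 ≤ m) {r' : SurfaceGroup (k + 1) →* SL 2 ℂ}
    (hr' : Function.Injective r') (hk : 1 ≤ k) {a b : SurfaceGroup (k + 1)} (hab : a * b ≠ b * a) :
    ∃ p q u v : FreeGroup (Fin (k + 1) × Bool), gmk ⁅p, q⁆ ∈ Subgroup.closure {a, b} ∧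
      gmk ⁅u, v⁆ ∈ Subgroup.closure {a, b} ∧
      (∀ l : Fin (m + 1) → ℕ, (¬ ∀ i j, l i = l j) → ¬ VV (fun A => resD l (wev ⁅p, q⁆ A)) (JT P P' r')) ∧
      ¬ VV (fun A => ff (wev ⁅p, q⁆ A) (wev ⁅u, v⁆ A)) (JT P P' r') ∧
      ¬ VV (fun A => ff (wev ⁅p, q⁆ A) (wev ⁅u, v⁆⁻¹ A)) (JT P P' r') := by
  obtain ⟨φs, hφs⟩ := resfree (k + 1) (by omega)
  obtain ⟨s, hs1, hs2⟩ := ((hφs ⁅a, b⁆ fun e => hab (commutatorElement_eq_one_iff_mul_comm.1 e)).and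
    (hφs ⁅sgen 0 false, sgen 0 true⁆ fun e => handle_ne k hk (commutatorElement_eq_one_iff_mul_comm.1 e))).exists
  set φ := φs s
  have hφc : φ a * φ b ≠ φ b * φ a := by
    rw [map_commutatorElement] at hs1
    exact fun e => hs1 (commutatorElement_eq_one_iff_mul_comm.2 e)
  have hmap : Subgroup.closure {φ a, φ b} = (Subgroup.closure {a, b}).map φ := by
    rw [MonoidHom.map_closure, Set.image_pair]
  obtain ⟨p, hp, q, hq, u, hu, v, hv, h1, h2⟩ := dens4 stdC stdC_inj free_tf _ (free_nonmet hφc) hP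
  rw [hmap] at hp hq hu hv
  have lift : ∀ x ∈ (Subgroup.closure {a, b}).map φ, ∃ w : FreeGroup (Fin (k + 1) × Bool),
      gmk w ∈ Subgroup.closure {a, b} ∧ φ (gmk w) = x := by
    rintro x ⟨y, hy, rfl⟩
    obtain ⟨w, rfl⟩ := PresentedGroup.mk_surjective _ y
    exact ⟨w, hy, rfl⟩
  obtain ⟨p, hp', rfl⟩ := lift p hp
  obtain ⟨q, hq', rfl⟩ := lift q hq
  obtain ⟨u, hu', rfl⟩ := lift u hu
  obtain ⟨v, hv', rfl⟩ := lift v hv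
  have hcm : ∀ x y : FreeGroup (Fin (k + 1) × Bool), φ (gmk ⁅x, y⁆) = ⁅φ (gmk x), φ (gmk y)⁆ := by
    intro x y
    rw [gmk, map_commutatorElement, map_commutatorElement]
  have hmem : ∀ x y : FreeGroup (Fin (k + 1) × Bool), gmk x ∈ Subgroup.closure {a, b} →
      gmk y ∈ Subgroup.closure {a, b} → gmk ⁅x, y⁆ ∈ Subgroup.closure {a, b} := by
    intro x y hx hy
    rw [gmk, map_commutatorElement, commutatorElement_def]
    exact mul_mem (mul_mem (mul_mem hx hy) (inv_mem hx)) (inv_mem hy)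
  rw [← hcm, ← hcm] at h1 h2
  set h0 : Tup Bool (m + 1) := fun b => Jm P P' (stdC (FreeGroup.of b)).1 with hh0
  have h0I : h0 ∈ InvT Bool (m + 1) := fun b => Jm_det_ne hP (by rw [(stdC _).2]; exact one_ne_zero)
  refine ⟨p, q, u, v, hmem _ _ hp' hq', hmem _ _ hu' hv', ?_, ?_, ?_⟩
  · intro l hl hV
    have hw : φ (gmk ⁅p, q⁆) ≠ 1 := by
      intro e
      apply h1
      rw [e, map_one, Matrix.SpecialLinearGroup.coe_one, Jm_one hP, ff_one (by omega)]
    obtain ⟨A, hA, hA2⟩ := resD_exists hw (fun n A => by rw [hcm]; exact wev_comm_det _ _ _) (m + 1) l hl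
    apply hA2
    have := VV_all hP hr' hk φ hs2 (resD_hol l (HolT.wev _)) hV hA
    rwa [wev_PsiT] at this
  · intro hV
    have := VV_all hP hr' hk φ hs2 (ff_hol (HolT.wev _) (HolT.wev _)) hV h0I
    rw [wev_PsiT, wev_PsiT, wev_std hP, wev_std hP] at this
    exact h1 this
  · intro hV
    have := VV_all hP hr' hk φ hs2 (ff_hol (HolT.wev _) (HolT.wev _)) hV h0I
    rw [wev_PsiT, wev_PsiT, wev_std hP, wev_std hP] at this
    have e : φ (gmk ⁅u, v⁆⁻¹) = (φ (gmk ⁅u, v⁆))⁻¹ := by rw [gmk, map_inv, map_inv]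
    rw [e] at this
    exact h2 this

attribute [local instance] Matrix.normedAddCommGroup Matrix.normedSpace

/-! ### Real points -/

abbrev RTup (ι : Type) (n : ℕ) := ι → Matrix (Fin n) (Fin n) ℝ

noncomputable def cxT {ι : Type} {n : ℕ} (A : RTup ι n) : Tup ι n := fun x => cx (A x)
noncomputable def reT {ι : Type} {n : ℕ} (A : Tup ι n) : RTup ι n := fun x => (A x).map Complex.re
noncomputable def imT {ι : Type} {n : ℕ} (A : Tup ι n) : RTup ι n := fun x => (A x).map Complex.im

theorem cxT_cont {ι : Type} {n : ℕ} : Continuous (cxT (ι := ι) (n := n)) :=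
  continuous_pi fun x => continuous_matrix fun i j =>
    Complex.continuous_ofReal.comp ((continuous_apply x).matrix_elem i j)

theorem reT_cont {ι : Type} {n : ℕ} : Continuous (reT (ι := ι) (n := n)) :=
  continuous_pi fun x => continuous_matrix fun i j =>
    Complex.continuous_re.comp ((continuous_apply x).matrix_elem i j)

theorem reT_cxT {ι : Type} {n : ℕ} (A : RTup ι n) : reT (cxT A) = A := by
  funext x; ext i j; simp [reT, cxT, cx]

theorem cjT_cxT {ι : Type} {n : ℕ} (A : RTup ι n) : cjT (cxT A) = cxT A := by
  funext x; ext i j; simp [cjT, cjM, cxT, cx]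

theorem cxT_reT {ι : Type} {n : ℕ} {A : Tup ι n} (h : cjT A = A) : cxT (reT A) = A := by
  funext x; ext i j
  have := congrFun (congrFun (congrFun h x) i) j
  simp only [cjT, cjM, Matrix.map_apply] at this
  simpa [reT, cxT, cx] using Complex.conj_eq_iff_re.1 this

/-- a holomorphic function on a ball vanishing on an open set of real points vanishes -/
theorem real_zero {ι : Type} [Fintype ι] {n : ℕ} {F : Tup ι n → ℂ} {a : Tup ι n} {ε : ℝ}
    (hF : DifferentiableOn ℂ F (Metric.ball a ε)) {O : Set (RTup ι n)} (hO : IsOpen O)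
    {y : RTup ι n} (hy : y ∈ O) (hya : cxT y ∈ Metric.ball a ε)
    (hz : ∀ x ∈ O, cxT x ∈ Metric.ball a ε → F (cxT x) = 0) {B : Tup ι n} (hB : B ∈ Metric.ball a ε) : F B = 0 := by
  refine ball_zero hF hya ?_ hB
  have h1 : ∀ᶠ z : Tup ι n in nhds (cxT y), reT z ∈ O := by
    have := reT_cont.tendsto (cxT y)
    rw [reT_cxT] at this
    exact this.eventually (hO.mem_nhds hy)
  have h2 : ∀ᶠ z : Tup ι n in nhds (cxT y), cxT (reT z) ∈ Metric.ball a ε := by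
    have := (cxT_cont.comp reT_cont).tendsto (cxT y)
    simp only [Function.comp, reT_cxT] at this
    exact this.eventually (Metric.isOpen_ball.mem_nhds hya)
  filter_upwards [h1, h2, Metric.isOpen_ball.mem_nhds hya] with z hz1 hz2 hz3
  let L : ℂ → Tup ι n := lineT (cxT (reT z)) (cxT (reT z) + cxT (imT z))
  have hLd : Differentiable ℂ L := lineT_diff' _ _
  have hLI : L Complex.I = z := by
    funext x; ext i j
    simp only [L, lineT, Pi.add_apply, add_sub_cancel_left, Matrix.add_apply, Matrix.smul_apply, smul_eq_mul]
    simp only [cxT, cx, reT, imT, Matrix.map_apply, Complex.ofRealHom_eq_coe]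
    rw [mul_comm]; exact Complex.re_add_im _
  have hLr : ∀ t : ℝ, L t = cxT (fun x => reT z x + t • imT z x) := by
    intro t
    funext x; ext i j
    simp [L, lineT, cxT, cx]
  have h3 : IsOpen {t | L t ∈ Metric.ball a ε} := Metric.isOpen_ball.preimage hLd.continuous
  have h4 : Convex ℝ {t | L t ∈ Metric.ball a ε} := by
    intro t ht s hs p q hp hq hpq
    have : L (p • t + q • s) = p • L t + q • L s := by
      funext x
      have hpq' : (p : ℂ) + q = 1 := by exact_mod_cast hpq
      ext i j
      simp only [L, lineT, Pi.add_apply, Pi.smul_apply, Matrix.add_apply, Matrix.smul_apply, Matrix.sub_apply,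
        smul_eq_mul, Complex.real_smul]
      linear_combination (cxT (reT z) x i j) * (1 - hpq')
    have h3 := convex_ball a ε ht hs hp hq hpq
    rw [← this] at h3
    exact h3
  have h0 : L 0 = cxT (reT z) := lineT_zero _ _
  have hfr : ∃ᶠ t in nhdsWithin (0 : ℂ) {0}ᶜ, F (L t) = 0 := by
    have hev : ∀ᶠ t : ℝ in nhds 0, F (L t) = 0 := by
      have hc : Continuous fun t : ℝ => (fun x => reT z x + t • imT z x : RTup ι n) := by fun_prop
      have hc0 := hc.tendsto 0
      simp only [zero_smul, add_zero] at hc0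
      have hc1 : Filter.Tendsto (fun t : ℝ => L t) (nhds 0) (nhds (L 0)) := by
        have := (hLd.continuous.comp Complex.continuous_ofReal).tendsto 0
        simp only [Function.comp_apply, Complex.ofReal_zero] at this
        exact this
      rw [h0] at hc1
      filter_upwards [hc0.eventually (hO.mem_nhds hz1), hc1.eventually (Metric.isOpen_ball.mem_nhds hz2)] with t ht1 ht2
      simp only [hLr] at ht2 ⊢
      exact hz _ ht1 ht2
    have htd : Filter.Tendsto (fun t : ℝ => (t : ℂ)) (nhdsWithin 0 {0}ᶜ) (nhdsWithin 0 {0}ᶜ) := by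
      refine tendsto_nhdsWithin_iff.2 ⟨?_, ?_⟩
      · have := Complex.continuous_ofReal.tendsto 0
        rw [Complex.ofReal_zero] at this
        exact this.mono_left nhdsWithin_le_nhds
      · filter_upwards [self_mem_nhdsWithin] with t ht
        simpa using ht
    exact htd.frequently (hev.filter_mono nhdsWithin_le_nhds).frequently
  have hd : DifferentiableOn ℂ (fun t => F (L t)) {t | L t ∈ Metric.ball a ε} :=
    hF.comp hLd.differentiableOn fun _ h => h
  have := (hd.analyticOnNhd h3).eqOn_zero_of_preconnected_of_frequently_eq_zero h4.isPreconnected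
    (z₀ := 0) (by rw [Set.mem_setOf_eq, h0]; exact hz2) hfr (x := Complex.I) (by rw [Set.mem_setOf_eq, hLI]; exact hz3)
  simpa [hLI] using this

theorem baire_RTup (ι : Type) [Fintype ι] (n : ℕ) : BaireSpace (RTup ι n) :=
  inferInstanceAs (BaireSpace (ι → Fin n → Fin n → ℝ))

theorem baire_abs {X κ : Type} [TopologicalSpace X] [BaireSpace X] [Countable κ] {V : Set X} (hV : IsOpen V)
    (hVn : V.Nonempty) {f : κ → X → ℂ} (hf : ∀ i, ContinuousOn (f i) V)
    (hne : ∀ i O, IsOpen O → (O ∩ V).Nonempty → ∃ x ∈ O, x ∈ V ∧ f i x ≠ 0) : ∃ y ∈ V, ∀ i, f i y ≠ 0 := by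
  have hU : ∀ i, IsOpen (V ∩ f i ⁻¹' {0}ᶜ) := fun i => (hf i).isOpen_inter_preimage hV isOpen_compl_singleton
  have hD : ∀ i, Dense ((V ∩ f i ⁻¹' {0}ᶜ) ∪ (closure V)ᶜ) := by
    intro i
    rw [dense_iff_inter_open]
    intro O hO hOn
    by_cases hOV : (O ∩ V).Nonempty
    · obtain ⟨x, h1, h2, h3⟩ := hne i O hO hOV
      exact ⟨x, h1, Or.inl ⟨h2, h3⟩⟩
    · obtain ⟨y, hy⟩ := hOn
      refine ⟨y, hy, Or.inr fun hyc => ?_⟩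
      exact hOV (mem_closure_iff.1 hyc O hO hy)
  have hDD := dense_iInter_of_isOpen (fun i => (hU i).union isClosed_closure.isOpen_compl) hD
  obtain ⟨y, hy1, hy2⟩ := hDD.inter_open_nonempty V hV hVn
  refine ⟨y, hy1, fun i => ?_⟩
  rcases Set.mem_iInter.1 hy2 i with h | h
  · exact h.2
  · exact absurd (subset_closure hy1) h

theorem baire_real {ι κ : Type} [Fintype ι] [Countable κ] {n : ℕ} {F : κ → Tup ι n → ℂ} {T : RTup ι n} {ε : ℝ}
    (hε : 0 < ε) (hF : ∀ i, DifferentiableOn ℂ (F i) (Metric.ball (cxT T) ε))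
    (hne : ∀ i, ∃ B ∈ Metric.ball (cxT T) ε, F i B ≠ 0) :
    ∃ y : RTup ι n, cxT y ∈ Metric.ball (cxT T) ε ∧ ∀ i, F i (cxT y) ≠ 0 := by
  haveI := baire_RTup ι n
  have hV : IsOpen (cxT ⁻¹' Metric.ball (cxT T) ε) := Metric.isOpen_ball.preimage cxT_cont
  have hVn : (cxT ⁻¹' Metric.ball (cxT T) ε).Nonempty := by
    refine ⟨T, ?_⟩
    rw [Set.mem_preimage]
    exact Metric.mem_ball_self hε
  have hf : ∀ i, ContinuousOn (fun y => F i (cxT y)) (cxT ⁻¹' Metric.ball (cxT T) ε) :=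
    fun i => (hF i).continuousOn.comp cxT_cont.continuousOn fun _ h => h
  refine baire_abs hV hVn hf ?_
  rintro i O hO ⟨y, hy1, hy2⟩
  by_contra hcon
  obtain ⟨B, hB, hBn⟩ := hne i
  refine hBn (real_zero (hF i) hO hy1 hy2 (fun x hx1 hx2 => ?_) hB)
  by_contra hx3
  exact hcon ⟨x, hx1, hx2, hx3⟩

attribute [local instance] Matrix.normedAddCommGroup Matrix.normedSpace

/-! ### Normalising determinants -/

def scT {ι : Type} {n : ℕ} (c : ι → ℂ) (A : Tup ι n) : Tup ι n := fun x => c x • A x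

theorem smul_inv_mat {n : ℕ} {c : ℂ} (hc : c ≠ 0) {M : Mat n} (hM : M.det ≠ 0) : (c • M)⁻¹ = c⁻¹ • M⁻¹ := by
  apply Matrix.inv_eq_right_inv
  rw [Matrix.smul_mul, Matrix.mul_smul, smul_smul, mul_inv_cancel₀ hc, one_smul,
    Matrix.mul_nonsing_inv _ (isUnit_iff_ne_zero.2 hM)]

theorem scT_Inv {ι : Type} {n : ℕ} {c : ι → ℂ} (hc : ∀ x, c x ≠ 0) {A : Tup ι n} (hA : A ∈ InvT ι n) :
    scT c A ∈ InvT ι n := by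
  intro x
  rw [scT, Matrix.det_smul]
  exact mul_ne_zero (pow_ne_zero _ (hc x)) (hA x)

theorem wev_scT {ι : Type} {n : ℕ} {c : ι → ℂ} (hc : ∀ x, c x ≠ 0) {A : Tup ι n} (hA : A ∈ InvT ι n)
    (w : FreeGroup ι) : ∃ s : ℂ, s ≠ 0 ∧ wev w (scT c A) = s • wev w A := by
  have hof : ∀ x, wev (FreeGroup.of x) (scT c A) = c x • wev (FreeGroup.of x) A := by
    intro x
    rw [wev_of (scT_Inv hc hA), wev_of hA, scT]
  induction w using FreeGroup.induction_on with
  | C1 => exact ⟨1, one_ne_zero, by rw [wev_one, wev_one, one_smul]⟩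
  | of x => exact ⟨c x, hc x, hof x⟩
  | inv_of x _ =>
    refine ⟨(c x)⁻¹, inv_ne_zero (hc x), ?_⟩
    rw [wev_inv, wev_inv, hof, smul_inv_mat (hc x) (wev_det_ne _ _)]
  | mul u v hu hv =>
    obtain ⟨s, hs, e⟩ := hu
    obtain ⟨t, ht, f⟩ := hv
    refine ⟨s * t, mul_ne_zero hs ht, ?_⟩
    rw [wev_mul, wev_mul, e, f, Matrix.smul_mul, Matrix.mul_smul, smul_smul]

theorem wev_scT_comm {ι : Type} {n : ℕ} {c : ι → ℂ} (hc : ∀ x, c x ≠ 0) {A : Tup ι n} (hA : A ∈ InvT ι n)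
    (p q : FreeGroup ι) : wev ⁅p, q⁆ (scT c A) = wev ⁅p, q⁆ A := by
  obtain ⟨s, hs, e⟩ := wev_scT hc hA p
  obtain ⟨t, ht, f⟩ := wev_scT hc hA q
  simp only [commutatorElement_def, wev_mul, wev_inv]
  rw [e, f, smul_inv_mat hs (wev_det_ne _ _), smul_inv_mat ht (wev_det_ne _ _)]
  simp only [Matrix.smul_mul, Matrix.mul_smul, smul_smul]
  rw [show t⁻¹ * (s⁻¹ * (t * s)) = 1 by field_simp, one_smul]

theorem scT_HC {k n : ℕ} {c : Fin (k + 1) × Bool → ℂ} (hc : ∀ x, c x ≠ 0) {A : Tup (Fin (k + 1) × Bool) n}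
    (hA : A ∈ HC k n) : scT c A ∈ HC k n := by
  refine ⟨scT_Inv hc hA.1, ?_⟩
  have hK : KK (tailT (scT c A)) = KK (tailT A) := by
    unfold KK
    congr 2
    funext i
    simp only [tailT, scT]
    rw [smul_inv_mat (hc _) (hA.1 _), smul_inv_mat (hc _) (hA.1 _)]
    simp only [Matrix.smul_mul, Matrix.mul_smul, smul_smul]
    have h1 := hc (i.succ, false)
    have h2 := hc (i.succ, true)
    rw [show (c (i.succ, true))⁻¹ * ((c (i.succ, false))⁻¹ * (c (i.succ, true) * c (i.succ, false))) = 1 by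
      field_simp, one_smul]
  have h := hA.2
  unfold EqF at h ⊢
  rw [hK]
  simp only [scT, Matrix.smul_mul, Matrix.mul_smul, smul_smul]
  rw [mul_comm (c (0, true)), ← smul_sub, h, smul_zero]

theorem cx_inv {n : ℕ} {M : Matrix (Fin n) (Fin n) ℝ} (h : M.det ≠ 0) : cx M⁻¹ = (cx M)⁻¹ := by
  symm
  apply Matrix.inv_eq_right_inv
  rw [← cx_mul, Matrix.mul_nonsing_inv _ (isUnit_iff_ne_zero.2 h), cx_one]

theorem cx_list {n : ℕ} (l : List (Matrix (Fin n) (Fin n) ℝ)) : cx l.prod = (l.map cx).prod := by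
  induction l with
  | nil => exact cx_one
  | cons a l ih => rw [List.prod_cons, cx_mul, ih, List.map_cons, List.prod_cons]

theorem rep_of_HC {k n : ℕ} {A : RTup (Fin (k + 1) × Bool) n} (hA : cxT A ∈ HC k n) (hd : ∀ x, (A x).det = 1) :
    A ∈ RepVariety (k + 1) n ℝ := by
  refine ⟨hd, ?_⟩
  have hne : ∀ x, (A x).det ≠ 0 := fun x => by rw [hd]; exact one_ne_zero
  apply cx_inj
  rw [cx_list, List.map_ofFn, List.ofFn_succ, List.prod_cons, cx_one]
  have hK : (List.ofFn fun i : Fin k => (cx ∘ fun i : Fin (k + 1) =>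
      A (i, false) * A (i, true) * (A (i, false))⁻¹ * (A (i, true))⁻¹) i.succ).prod = KK (tailT (cxT A)) := by
    unfold KK
    congr 2
    funext i
    simp only [Function.comp, tailT, cxT, cx_mul, cx_inv (hne _)]
  rw [hK]
  have h := sub_eq_zero.1 hA.2
  have h0 : IsUnit (cxT A (0, false)).det := isUnit_iff_ne_zero.2 (hA.1 _)
  have h1 : IsUnit (cxT A (0, true)).det := isUnit_iff_ne_zero.2 (hA.1 _)
  have e : (cx ∘ fun i : Fin (k + 1) =>
      A (i, false) * A (i, true) * (A (i, false))⁻¹ * (A (i, true))⁻¹) 0 =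
      cxT A (0, false) * cxT A (0, true) * (cxT A (0, true) * cxT A (0, false))⁻¹ := by
    simp only [Function.comp, cxT, cx_mul, cx_inv (hne _), Matrix.mul_inv_rev, mul_assoc]
  rw [e, ← h, Matrix.mul_inv_rev, Matrix.mul_inv_rev]
  generalize cxT A (0, false) = X at *
  generalize cxT A (0, true) = Y at *
  have hKu : IsUnit (KK (tailT (cxT A))).det := by
    rw [KK_det (H := tailT (cxT A)) (fun x => hA.1 _)]; exact isUnit_one
  generalize KK (tailT (cxT A)) = K at *
  have : X * Y * (Y⁻¹ * (X⁻¹ * K⁻¹)) * K = X * (Y * Y⁻¹) * X⁻¹ * (K⁻¹ * K) := by simp only [mul_assoc]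
  rw [this, Matrix.mul_nonsing_inv _ h1, mul_one, Matrix.mul_nonsing_inv _ h0, one_mul, Matrix.nonsing_inv_mul _ hKu]

noncomputable def nrm {ι : Type} {n : ℕ} (A : RTup ι n) : RTup ι n :=
  fun x => ((A x).det ^ (-((n : ℝ)⁻¹)) : ℝ) • A x

theorem nrm_det {ι : Type} {n : ℕ} (hn : n ≠ 0) {A : RTup ι n} {x : ι} (h : 0 < (A x).det) : (nrm A x).det = 1 := by
  have hn' : (n : ℝ) ≠ 0 := Nat.cast_ne_zero.2 hn
  rw [nrm, Matrix.det_smul, Fintype.card_fin, ← Real.rpow_natCast, ← Real.rpow_mul h.le, neg_mul,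
    inv_mul_cancel₀ hn', Real.rpow_neg_one, inv_mul_cancel₀ h.ne']

theorem nrm_cx {ι : Type} {n : ℕ} (A : RTup ι n) :
    cxT (nrm A) = scT (fun x => (((A x).det ^ (-((n : ℝ)⁻¹)) : ℝ) : ℂ)) (cxT A) := by
  funext x; ext i j
  simp [cxT, nrm, scT, cx]

theorem nrm_one {ι : Type} {n : ℕ} {A : RTup ι n} (h : ∀ x, (A x).det = 1) : nrm A = A := by
  funext x
  rw [nrm, h, Real.one_rpow, one_smul]

theorem nrm_contOn {ι : Type} {n : ℕ} : ContinuousOn (nrm (ι := ι) (n := n)) {A | ∀ x, 0 < (A x).det} := by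
  have h0 : ∀ x, Continuous fun A : RTup ι n => A x := fun x => continuous_apply x
  have h1 : ∀ x, Continuous fun A : RTup ι n => (A x).det := fun x => (h0 x).matrix_det
  refine continuousOn_pi.2 fun x => ?_
  refine ContinuousOn.smul (ContinuousOn.rpow_const (h1 x).continuousOn fun A hA => Or.inl (hA x).ne') (h0 x).continuousOn

attribute [local instance] Matrix.normedAddCommGroup Matrix.normedSpace

theorem hit_of {k n : ℕ} (hn : n ≠ 0) {T y : RTup (Fin (k + 1) × Bool) n} (hTd : ∀ x, (T x).det = 1) {ε : ℝ}
    {g : Tup (Fin (k + 1) × Bool) n → Tup (Fin (k + 1) × Bool) n} (hε : 0 < ε) (hy : cxT y ∈ Metric.ball (cxT T) ε)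
    (h1 : ∀ A ∈ Metric.ball (cxT T) ε, g A ∈ HC k n) (h2 : ∀ A ∈ Metric.ball (cxT T) ε, ContinuousAt g A)
    (h3 : ∀ A ∈ Metric.ball (cxT T) ε, ∀ x, 0 < (g A x).det.re)
    (h4 : ∀ A ∈ Metric.ball (cxT T) ε, g (cjT A) = cjT (g A)) (h5 : g (cxT T) = cxT T) :
    nrm (reT (g (cxT y))) ∈ HIT (k + 1) n T ∧ nrm (reT (g (cxT y))) ∈ RepVariety (k + 1) n ℝ ∧
      (∀ x, 0 < (reT (g (cxT y)) x).det) ∧ cxT (reT (g (cxT y))) = g (cxT y) := by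
  let S : Set (RTup (Fin (k + 1) × Bool) n) := cxT ⁻¹' Metric.ball (cxT T) ε
  have hre : ∀ A ∈ S, cxT (reT (g (cxT A))) = g (cxT A) := by
    intro A hA
    apply cxT_reT
    rw [← h4 _ hA, cjT_cxT]
  have hdp : ∀ A ∈ S, ∀ x, 0 < (reT (g (cxT A)) x).det := by
    intro A hA x
    have := h3 _ hA x
    rw [← hre A hA, cxT, cx_det, Complex.ofReal_re] at this
    exact this
  have hrep : ∀ A ∈ S, nrm (reT (g (cxT A))) ∈ RepVariety (k + 1) n ℝ := by
    intro A hA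
    refine rep_of_HC ?_ fun x => nrm_det hn (hdp A hA x)
    rw [nrm_cx, hre A hA]
    refine scT_HC (fun x => ?_) (h1 _ hA)
    exact Complex.ofReal_ne_zero.2 (Real.rpow_pos_of_pos (hdp A hA x) _).ne'
  have hcont : ContinuousOn (fun A => nrm (reT (g (cxT A)))) S := by
    refine nrm_contOn.comp ?_ hdp
    intro A hA
    have := (h2 _ hA).comp (f := cxT) cxT_cont.continuousAt
    exact (reT_cont.continuousAt.comp this).continuousWithinAt
  have hconv : IsPreconnected S := by
    have : Convex ℝ S := by
      intro t ht s hs p q hp hq hpq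
      have e : cxT (p • t + q • s) = p • cxT t + q • cxT s := by
        funext x; ext i j
        simp [cxT, cx]
      have h3 := convex_ball (cxT T) ε ht hs hp hq hpq
      rw [← e] at h3
      exact h3
    exact this.isPreconnected
  have hTS : T ∈ S := by
    rw [Set.mem_preimage]; exact Metric.mem_ball_self hε
  have hT' : nrm (reT (g (cxT T))) = T := by
    rw [h5, reT_cxT, nrm_one hTd]
  refine ⟨?_, hrep y hy, hdp y hy, hre y hy⟩
  have hsub := (hconv.image _ hcont).subset_connectedComponentIn (x := T) (F := RepVariety (k + 1) n ℝ)
    ((Set.mem_image _ _ _).2 ⟨T, hTS, hT'⟩) (Set.image_subset_iff.2 hrep)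
  exact hsub (Set.mem_image_of_mem _ hy)

theorem real_gen {k n : ℕ} (hn : n ≠ 0) {T : RTup (Fin (k + 1) × Bool) n} (hG : Good (cxT T))
    (hTd : ∀ x, (T x).det = 1) {κ : Type} [Countable κ] {f : κ → Tup (Fin (k + 1) × Bool) n → ℂ}
    (hf : ∀ i, HolT (f i)) (hV : ∀ i, ¬ VV (f i) (cxT T)) :
    ∃ B ∈ HIT (k + 1) n T, B ∈ RepVariety (k + 1) n ℝ ∧ ∃ C ∈ HC k n, ∃ c : Fin (k + 1) × Bool → ℂ,
      (∀ x, c x ≠ 0) ∧ cxT B = scT c C ∧ ∀ i, f i C ≠ 0 := by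
  obtain ⟨g, g1, g2, g3, g4, g5⟩ := hG
  have hd : ∀ᶠ A in nhds (cxT T), ∀ x, 0 < (g A x).det.re := by
    refine Filter.eventually_all.2 fun x => ?_
    have hc : Continuous fun A : Tup (Fin (k + 1) × Bool) n => (A x).det.re :=
      Complex.continuous_re.comp (Continuous.matrix_det (continuous_apply x))
    have h0 : 0 < (g (cxT T) x).det.re := by
      rw [g1, cxT, cx_det, hTd, Complex.ofReal_one, Complex.one_re]; exact one_pos
    have hca : ContinuousAt (fun A => (g A x).det.re) (cxT T) := hc.continuousAt.comp g2.continuousAt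
    exact hca.eventually (isOpen_Ioi.mem_nhds h0)
  obtain ⟨ε₁, hε₁, hb⟩ := good_ball g2 g3 g4
  obtain ⟨ε₂, hε₂, hb2⟩ := Metric.eventually_nhds_iff_ball.1 (hd.and (g5 (cjT_cxT T)))
  have hb' : ∀ A ∈ Metric.ball (cxT T) (min ε₁ ε₂), g A ∈ HC k n ∧ (A ∈ HC k n → g A = A) ∧ DifferentiableAt ℂ g A :=
    fun A hA => hb A (Metric.ball_subset_ball (min_le_left _ _) hA)
  have hb2' : ∀ A ∈ Metric.ball (cxT T) (min ε₁ ε₂), (∀ x, 0 < (g A x).det.re) ∧ g (cjT A) = cjT (g A) :=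
    fun A hA => hb2 A (Metric.ball_subset_ball (min_le_right _ _) hA)
  have hε : 0 < min ε₁ ε₂ := lt_min hε₁ hε₂
  obtain ⟨y, hy, hyf⟩ := baire_real (F := fun i A => f i (g A)) hε (fun i => comp_diff (hf i) hb') (by
    intro i
    by_contra hcon
    push Not at hcon
    refine hV i ?_
    filter_upwards [Metric.ball_mem_nhds (cxT T) hε] with A hA hAH
    have := hcon A hA
    rwa [(hb' A hA).2.1 hAH] at this)
  obtain ⟨hB1, hB2, hB3, hB4⟩ := hit_of hn hTd hε hy (fun A hA => (hb' A hA).1)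
    (fun A hA => (hb' A hA).2.2.continuousAt) (fun A hA => (hb2' A hA).1) (fun A hA => (hb2' A hA).2) g1
  refine ⟨_, hB1, hB2, g (cxT y), (hb' _ hy).1,
    fun x => (((reT (g (cxT y)) x).det ^ (-((n : ℝ)⁻¹)) : ℝ) : ℂ), ?_, ?_, hyf⟩
  · exact fun x => Complex.ofReal_ne_zero.2 (Real.rpow_pos_of_pos (hB3 x) _).ne'
  · rw [nrm_cx, hB4]

noncomputable def slGL (n : ℕ) : SL n ℝ →* GL (Fin n) ℂ :=
  MonoidHom.toHomUnits
    { toFun := fun g => cx g.1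
      map_one' := cx_one
      map_mul' := fun g h => cx_mul g.1 h.1 }

theorem rep_exists {g n : ℕ} {B : RTup (Fin g × Bool) n} (hB : B ∈ RepVariety g n ℝ) :
    ∃ ρ : SurfaceGroup g →* SL n ℝ, repTuple ρ = B ∧ ∀ w, cx (ρ (gmk w)).1 = wev w (cxT B) := by
  let b' : Fin g → Bool → SL n ℝ := fun i b => ⟨B (i, b), hB.1 _⟩
  have hb' : ∀ i b, (b' i b).1 = B (i, b) := fun _ _ => rfl
  have hrel : (List.ofFn fun i : Fin g => ⁅b' i false, b' i true⁆).prod = 1 := by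
    apply Subtype.ext
    have hl : ∀ l : List (SL n ℝ), (l.prod).1 = (l.map fun h => h.1).prod := by
      intro l
      induction l with
      | nil => rfl
      | cons a l ih => rw [List.prod_cons, Matrix.SpecialLinearGroup.coe_mul, ih, List.map_cons, List.prod_cons]
    rw [hl, List.map_ofFn, Matrix.SpecialLinearGroup.coe_one, ← hB.2]
    congr 2
    funext i
    have hinv : ∀ x, (B x)⁻¹ = (B x).adjugate := by
      intro x
      rw [Matrix.inv_def, hB.1, Ring.inverse_one, one_smul]
    simp only [Function.comp, commutatorElement_def, Matrix.SpecialLinearGroup.coe_mul,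
      Matrix.SpecialLinearGroup.coe_inv, hinv, hb']
  let ρ : SurfaceGroup g →* SL n ℝ := sgLift b' hrel
  have hρ : ∀ x : Fin g × Bool, (ρ (sgen x.1 x.2)).1 = B x := by
    intro x
    rw [show ρ (sgen x.1 x.2) = b' x.1 x.2 from sgLift_gen b' hrel _ _]
  refine ⟨ρ, funext hρ, fun w => ?_⟩
  have h := wev_rep ((slGL n).comp ρ) w
  have e : (fun x : Fin g × Bool => (((slGL n).comp ρ) (sgen x.1 x.2) : Mat n)) = cxT B := by
    funext x
    exact congrArg cx (hρ x)
  rw [e] at h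
  exact h.symm

theorem main_aux {k m : ℕ} (hk : 1 ≤ k) (hm : 1 ≤ m) {T : RTup (Fin (k + 1) × Bool) (m + 1)}
    {ρ₀ : SurfaceGroup (k + 1) →* SL 2 ℝ} {j : SL 2 ℝ →* SL (m + 1) ℝ} (hinj : Function.Injective ρ₀)
    (hTe : T = repTuple (j.comp ρ₀)) {P P' : Matrix (Fin (m + 1)) (Fin (m + 1)) ℝ} (hP : P * P' = 1)
    (hj : ∀ h : SL 2 ℝ, (j h).1 = P * symP m h.1 * P') {a b : SurfaceGroup (k + 1)} (hab : a * b ≠ b * a) :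
    ∃ ρ : SurfaceGroup (k + 1) →* SL (m + 1) ℝ, repTuple ρ ∈ HIT (k + 1) (m + 1) T ∧
      IsZariskiDense (m + 1) (Subgroup.closure {ρ a, ρ b}) := by
  have hPc : cx P * cx P' = 1 := by rw [← cx_mul, hP, cx_one]
  let r' : SurfaceGroup (k + 1) →* SL 2 ℂ := (Matrix.SpecialLinearGroup.map Complex.ofRealHom).comp ρ₀
  have hr' : Function.Injective r' := by
    intro x y h
    apply hinj
    apply Subtype.ext
    apply cx_inj
    exact congrArg Subtype.val h
  have hJT : JT (cx P) (cx P') r' = cxT T := by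
    funext x
    have h1 : T x = P * symP m (ρ₀ (sgen x.1 x.2)).1 * P' := by
      rw [hTe, ← hj]; rfl
    rw [cxT, h1, cx_mul, cx_mul, cx, cx, cx, ← symP_cx]
    rfl
  have hTd : ∀ x, (T x).det = 1 := by
    intro x; rw [hTe]; exact ((j.comp ρ₀) _).2
  have hne := handle_ne k hk
  obtain ⟨u, hu, v, hv, huv⟩ := dens2 r' hr' (surf_tf (by omega)) _ (surf_nonmet (by omega) hne) hPc
  have hG := JT_good hPc hu hv huv
  obtain ⟨p, q, s, t, hpq, hst, hV1, hV2, hV3⟩ := not_VV hPc hm hr' hk hab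
  rw [hJT] at hG hV2 hV3
  simp only [hJT] at hV1
  let f : {l : Fin (m + 1) → ℕ // ¬ ∀ i j, l i = l j} ⊕ Bool → Tup (Fin (k + 1) × Bool) (m + 1) → ℂ := fun i A =>
    Sum.elim (fun l => resD l.1 (wev ⁅p, q⁆ A)) (fun c => if c then ff (wev ⁅p, q⁆ A) (wev ⁅s, t⁆ A)
      else ff (wev ⁅p, q⁆ A) (wev ⁅s, t⁆⁻¹ A)) i
  obtain ⟨B, hB, hBR, C, hC, c, hc, hBC, hfC⟩ := real_gen (Nat.succ_ne_zero m) hG hTd (f := f) (by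
    rintro (l | c)
    · exact resD_hol l.1 (HolT.wev _)
    · cases c
      · exact ff_hol (HolT.wev _) (HolT.wev _)
      · exact ff_hol (HolT.wev _) (HolT.wev _)) (by
    rintro (l | c)
    · exact hV1 l.1 l.2
    · cases c
      · exact hV3
      · exact hV2)
  obtain ⟨ρ, hρB, hρw⟩ := rep_exists hBR
  refine ⟨ρ, by rw [hρB]; exact hB, ?_⟩
  have hcl : ∀ x ∈ Subgroup.closure {a, b}, ρ x ∈ Subgroup.closure {ρ a, ρ b} := by
    intro x hx
    have := Subgroup.mem_map_of_mem ρ hx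
    rwa [MonoidHom.map_closure, Set.image_pair] at this
  have e1 : cx (ρ (gmk ⁅p, q⁆)).1 = wev ⁅p, q⁆ C := by
    rw [hρw, hBC, wev_scT_comm hc hC.1]
  have e2 : cx (ρ (gmk ⁅s, t⁆)).1 = wev ⁅s, t⁆ C := by
    rw [hρw, hBC, wev_scT_comm hc hC.1]
  have e3 : cx ((ρ (gmk ⁅s, t⁆))⁻¹).1 = wev ⁅s, t⁆⁻¹ C := by
    rw [← map_inv, ← map_inv, hρw, hBC, wev_inv, wev_inv, wev_scT_comm hc hC.1]
  refine zdense_of_fun _ (ρ (gmk ⁅p, q⁆)) (ρ (gmk ⁅s, t⁆)) (hcl _ hpq) (hcl _ hst) ?_ ?_ ?_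
  · intro l hl
    rw [e1]
    exact hfC (Sum.inl ⟨l, hl⟩)
  · rw [e1, e2]
    exact hfC (Sum.inr true)
  · rw [e1, e3]
    exact hfC (Sum.inr false)

/-- If `a, b ∈ Γ_g` do not commute, there is a Hitchin representation `ρ ∈ HIT_n` such
that `ρ(a)` and `ρ(b)` generate a Zariski-dense subgroup of `SL_n(ℝ)`. -/
theorem exists_Hitchin_rep_with_zariski_dense_pair (g n : ℕ) (hg : 2 ≤ g) (hn : 3 ≤ n)
    (T : (Fin g × Bool) → Matrix (Fin n) (Fin n) ℝ) (hT : IsTeichmuller g n T)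
    (a b : SurfaceGroup g) (hab : a * b ≠ b * a) :
    ∃ ρ : SurfaceGroup g →* SL n ℝ, repTuple ρ ∈ HIT g n T ∧
      IsZariskiDense n (Subgroup.closure {ρ a, ρ b}) := by
  obtain ⟨ρ₀, j, hdf, hj, hTe⟩ := hT
  obtain ⟨m, rfl, P, P', hP, -, hjP⟩ := irr_form (by omega) j hj
  obtain ⟨k, rfl⟩ : ∃ k, g = k + 1 := ⟨g - 1, by omega⟩
  exact main_aux (by omega) (by omega) hdf.1 hTe hP hjP hab
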